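/- Let N ≥ 3 and let F : ℝ → ℝ be continuously differentiable with F(0) = 0 and F'(0) = -m for some m > 0. Let I ⊆ (0,∞) be an open interval and suppose that for every α ∈ I the problem -V''(t) - (k(α)/t)V'(t) = F(V(t)) on (0,∞) with lim_{t→0⁺} V'(t) = 0 and lim_{t→∞} V(t) = 0 has a positive solution V_α ∈ C²((0,∞)) that is nondegenerate and has Morse index one; let u_α(x) = V_α((2/(2+α))|x|^{(2+α)/2}). Let i be a positive integer with α_i := 2i ∈ I. Then (α_i, u_{α_i}) is a nonradial bifurcation point in the class of O(N-1)-invariant functions: for every ε > 0 there exist α ∈ I with |α - α_i| < ε and a function v : ℝ^N → ℝ such that v is positive, continuous on ℝ^N, twice continuously differentiable on ℝ^N∖{0}, satisfies -Δv(x) = |x|^α F(v(x)) for all x ≠ 0 and v(x) → 0 as |x| → ∞; v is O(N-1)-invariant; v is nonradial; and max( ‖∇v - ∇u_{α_i}‖_{L²(ℝ^N)} , sup_{x∈ℝ^N} e^{|x|}|v(x) - u_{α_i}(x)| ) < ε. -/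

import Mathlib

open MeasureTheory Filter Set Topology

/-- The Euclidean Laplacian: sum of second partial derivatives. -/
noncomputable def lap {N : ℕ} (u : EuclideanSpace ℝ (Fin N) → ℝ)
    (x : EuclideanSpace ℝ (Fin N)) : ℝ :=
  ∑ i : Fin N, fderiv ℝ (fun y => fderiv ℝ u y (EuclideanSpace.single i 1)) x
    (EuclideanSpace.single i 1)

/-- k(α) = (2N-2+α)/(2+α). -/
noncomputable def kk (N : ℕ) (α : ℝ) : ℝ := (2 * (N : ℝ) - 2 + α) / (2 + α)

/-- Membership in the space `E`: a `C¹` function on `(0,∞)` with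
`∫₀^∞ t^k ((w')² + w²) dt < ∞`. -/
def memE (k : ℝ) (w : ℝ → ℝ) : Prop :=
  ContDiffOn ℝ 1 w (Ioi 0) ∧
  IntegrableOn (fun t => t ^ k * ((deriv w t) ^ 2 + (w t) ^ 2)) (Ioi 0)

/-- The Rayleigh quotient
`R(w) = (∫₀^∞ t^k ((w')² − A·w²) dt) / (∫₀^∞ t^k w² dt)`. -/
noncomputable def Ray (k : ℝ) (A : ℝ → ℝ) (w : ℝ → ℝ) : ℝ :=
  (∫ t in Ioi (0:ℝ), t ^ k * ((deriv w t) ^ 2 - A t * (w t) ^ 2)) /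
    ∫ t in Ioi (0:ℝ), t ^ k * (w t) ^ 2

/-- Morse index one: the infimum of the Rayleigh quotient over nonzero elements of `E`
is negative, while on every two-dimensional subspace of `E` the maximum of the
Rayleigh quotient over nonzero elements is nonnegative. -/
def MorseIndexOne (k : ℝ) (A : ℝ → ℝ) : Prop :=
  (∃ w, memE k w ∧ (∃ t ∈ Ioi (0:ℝ), w t ≠ 0) ∧ Ray k A w < 0) ∧
  ∀ w₁ w₂ : ℝ → ℝ, memE k w₁ → memE k w₂ →
    (∀ c₁ c₂ : ℝ, (∀ t ∈ Ioi (0:ℝ), c₁ * w₁ t + c₂ * w₂ t = 0) → c₁ = 0 ∧ c₂ = 0) →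
    ∃ c₁ c₂ : ℝ, ¬(c₁ = 0 ∧ c₂ = 0) ∧
      0 ≤ Ray k A (fun t => c₁ * w₁ t + c₂ * w₂ t)

/-- Nondegeneracy: the linearized ODE `-w'' - (k/t) w' = A w` has no nontrivial
solution in `E`. -/
def RadNondeg (k : ℝ) (A : ℝ → ℝ) : Prop :=
  ∀ w : ℝ → ℝ, ContDiffOn ℝ 2 w (Ioi 0) → memE k w →
    (∀ t > (0:ℝ), -(deriv (deriv w) t) - k / t * deriv w t = A t * w t) →
    ∀ t > (0:ℝ), w t = 0

open scoped ContDiff Convolution ZeroAtInfty BoundedContinuousFunction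

namespace Henon

open EuclideanSpace (single)
open Finset (mul_sum sum_add_distrib sum_congr)
open Metric (ball closedBall closedBall_subset_closedBall mem_ball mem_closedBall
  mem_closedBall_self sphere)
open Real (add_one_le_exp contDiff_exp continuousAt_const_rpow continuousAt_rpow_const
  continuous_rpow_const exp exp_add exp_le_exp exp_le_one_iff exp_pos exp_zero
  hasDerivAt_rpow_const hasDerivAt_sqrt le_sqrt_of_sq_le norm_eq_abs norm_of_nonneg one_le_exp
  one_rpow rpow_add rpow_def_of_pos rpow_le_one rpow_le_one_of_one_le_of_nonpos rpow_le_rpow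
  rpow_le_rpow_of_exponent_le rpow_natCast rpow_neg rpow_nonneg rpow_one rpow_pos_of_pos
  rpow_sub rpow_two smoothTransition sq_sqrt sqrt_nonneg sqrt_pos sqrt_sq zero_rpow)

variable {N : ℕ}

local notation "𝔼" => EuclideanSpace ℝ (Fin N)

/-- Partial derivative in the `i`-th coordinate direction. -/
noncomputable def pd (u : 𝔼 → ℝ) (i : Fin N)
    (x : 𝔼) : ℝ := fderiv ℝ u x (single i 1)

lemma lap_eq_pd (u : 𝔼 → ℝ) (x : 𝔼) : lap u x = ∑ i, pd (pd u i) i x := rfl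

lemma pd_contDiffAt {u : 𝔼 → ℝ} {x : 𝔼} {n m : WithTop ℕ∞} (h : ContDiffAt ℝ n u x)
    (hm : m + 1 ≤ n) (i : Fin N) : ContDiffAt ℝ m (pd u i) x :=
  (h.fderiv_right hm).clm_apply contDiffAt_const

lemma pd_contDiff {u : 𝔼 → ℝ} {n m : WithTop ℕ∞} (h : ContDiff ℝ n u)
    (hm : m + 1 ≤ n) (i : Fin N) : ContDiff ℝ m (pd u i) :=
  (h.fderiv_right hm).clm_apply contDiff_const

lemma pd_congr {u v : 𝔼 → ℝ} {x : 𝔼} (h : u =ᶠ[𝓝 x] v) (i : Fin N) :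
    pd u i =ᶠ[𝓝 x] pd v i := by
  filter_upwards [h.fderiv (𝕜 := ℝ)] with y hy
  simp [pd, hy]

lemma lap_congr {u v : 𝔼 → ℝ} {x : 𝔼} (h : u =ᶠ[𝓝 x] v) : lap u x = lap v x := by
  simp only [lap_eq_pd]
  exact sum_congr rfl fun i _ => (pd_congr (pd_congr h i) i).self_of_nhds

lemma pd_mul {f g : 𝔼 → ℝ} {x : 𝔼} (hf : DifferentiableAt ℝ f x) (hg : DifferentiableAt ℝ g x)
    (i : Fin N) : pd (fun y => f y * g y) i x = f x * pd g i x + g x * pd f i x := by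
  simp [pd, fderiv_fun_mul hf hg]

lemma pd_add {f g : 𝔼 → ℝ} {x : 𝔼} (hf : DifferentiableAt ℝ f x) (hg : DifferentiableAt ℝ g x)
    (i : Fin N) : pd (fun y => f y + g y) i x = pd f i x + pd g i x := by
  simp [pd, fderiv_fun_add hf hg]

lemma pd_comp {g : ℝ → ℝ} {p : 𝔼 → ℝ} {x : 𝔼} (hg : DifferentiableAt ℝ g (p x))
    (hp : DifferentiableAt ℝ p x) (i : Fin N) :
    pd (fun y => g (p y)) i x = deriv g (p x) * pd p i x := by
  have := (hg.hasDerivAt.comp_hasFDerivAt x hp.hasFDerivAt).fderiv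
  simp only [pd]
  change fderiv ℝ (g ∘ p) x _ = _
  rw [this]; simp

lemma _root_.ContDiffAt.evDiff {F : Type*} [NormedAddCommGroup F] [NormedSpace ℝ F]
    {G : Type*} [NormedAddCommGroup G] [NormedSpace ℝ G] {f : F → G} {x : F}
    (h : ContDiffAt ℝ 2 f x) : ∀ᶠ y in 𝓝 x, DifferentiableAt ℝ f y := by
  filter_upwards [h.eventually (by simp)] with y hy
  exact hy.differentiableAt (by simp)

lemma lap_mul {f g : 𝔼 → ℝ} {x : 𝔼} (hf : ContDiffAt ℝ 2 f x) (hg : ContDiffAt ℝ 2 g x) :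
    lap (fun y => f y * g y) x = f x * lap g x + 2 * ∑ i, pd f i x * pd g i x + g x * lap f x := by
  simp only [lap_eq_pd, mul_sum, ← sum_add_distrib]
  refine sum_congr rfl fun i _ => ?_
  have h1 : pd (fun y => f y * g y) i =ᶠ[𝓝 x] fun y => f y * pd g i y + g y * pd f i y := by
    filter_upwards [hf.evDiff, hg.evDiff] with y h1 h2 using pd_mul h1 h2 i
  have df := hf.differentiableAt (by simp)
  have dg := hg.differentiableAt (by simp)
  have dpf := (pd_contDiffAt (m := 1) hf (by norm_num) i).differentiableAt (by simp)
  have dpg := (pd_contDiffAt (m := 1) hg (by norm_num) i).differentiableAt (by simp)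
  rw [(pd_congr h1 i).self_of_nhds, pd_add (f := fun y => f y * pd g i y)
    (g := fun y => g y * pd f i y) (df.mul dpg) (dg.mul dpf), pd_mul df dpg, pd_mul dg dpf]
  ring

lemma lap_add {f g : 𝔼 → ℝ} {x : 𝔼} (hf : ContDiffAt ℝ 2 f x) (hg : ContDiffAt ℝ 2 g x) :
    lap (fun y => f y + g y) x = lap f x + lap g x := by
  simp only [lap_eq_pd, ← sum_add_distrib]
  refine sum_congr rfl fun i _ => ?_
  have h1 : pd (fun y => f y + g y) i =ᶠ[𝓝 x] fun y => pd f i y + pd g i y := by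
    filter_upwards [hf.evDiff, hg.evDiff] with y h1 h2 using pd_add h1 h2 i
  have dpf := (pd_contDiffAt (m := 1) hf (by norm_num) i).differentiableAt (by simp)
  have dpg := (pd_contDiffAt (m := 1) hg (by norm_num) i).differentiableAt (by simp)
  rw [(pd_congr h1 i).self_of_nhds, pd_add dpf dpg]

lemma pd_const (c : ℝ) (i : Fin N) : pd (fun _ : 𝔼 => c) i = fun _ => 0 := by
  ext x; simp [pd]

lemma lap_const (c : ℝ) (x : 𝔼) : lap (fun _ : 𝔼 => c) x = 0 := by
  simp [lap_eq_pd, pd_const]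

lemma lap_const_mul {f : 𝔼 → ℝ} {x : 𝔼} (c : ℝ) (hf : ContDiffAt ℝ 2 f x) :
    lap (fun y => c * f y) x = c * lap f x := by
  rw [lap_mul contDiffAt_const hf]; simp [lap_const, pd_const]

lemma lap_sub {f g : 𝔼 → ℝ} {x : 𝔼} (hf : ContDiffAt ℝ 2 f x) (hg : ContDiffAt ℝ 2 g x) :
    lap (fun y => f y - g y) x = lap f x - lap g x := by
  have := lap_add hf (g := fun y => (-1) * g y) (contDiffAt_const.mul hg)
  rw [lap_const_mul _ hg] at this
  simpa [sub_eq_add_neg] using this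

lemma lap_comp {g : ℝ → ℝ} {p : 𝔼 → ℝ} {x : 𝔼} (hg : ContDiffAt ℝ 2 g (p x))
    (hp : ContDiffAt ℝ 2 p x) :
    lap (fun y => g (p y)) x =
      deriv (deriv g) (p x) * ∑ i, pd p i x ^ 2 + deriv g (p x) * lap p x := by
  simp only [lap_eq_pd, mul_sum, ← sum_add_distrib]
  refine sum_congr rfl fun i _ => ?_
  have h1 : pd (fun y => g (p y)) i =ᶠ[𝓝 x] fun y => deriv g (p y) * pd p i y := by
    filter_upwards [hp.continuousAt.eventually hg.evDiff, hp.evDiff] with y h1 h2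
      using pd_comp h1 h2 i
  have dp := hp.differentiableAt (by simp)
  have dg' : DifferentiableAt ℝ (deriv g) (p x) :=
    ((hg.derivWithin (m := 1) (by norm_num)).differentiableAt (by simp))
  have dpp := (pd_contDiffAt (m := 1) hp (by norm_num) i).differentiableAt (by simp)
  rw [(pd_congr h1 i).self_of_nhds, pd_mul (f := fun y => deriv g (p y)) (dg'.comp x dp) dpp, pd_comp dg' dp]
  ring

lemma pd_normSq (i : Fin N) (x : 𝔼) : pd (fun y : 𝔼 => ‖y‖ ^ 2) i x = 2 * x i := by
  have := (hasStrictFDerivAt_norm_sq x).hasFDerivAt.fderiv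
  simp only [pd, this]
  simp [EuclideanSpace.inner_single_right]

lemma pd_coord (i j : Fin N) (x : 𝔼) : pd (fun y : 𝔼 => y j) i x = if i = j then 1 else 0 := by
  have : HasFDerivAt (fun y : 𝔼 => y j) (EuclideanSpace.proj j : 𝔼 →L[ℝ] ℝ) x :=
    (EuclideanSpace.proj j : 𝔼 →L[ℝ] ℝ).hasFDerivAt
  simp [pd, this.fderiv, eq_comm]

lemma contDiff_normSq : ContDiff ℝ ⊤ (fun y : 𝔼 => ‖y‖ ^ 2) := contDiff_norm_sq ℝ

lemma contDiff_coord (j : Fin N) {n : WithTop ℕ∞} : ContDiff ℝ n (fun y : 𝔼 => y j) :=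
  (EuclideanSpace.proj j : 𝔼 →L[ℝ] ℝ).contDiff

lemma lap_normSq (x : 𝔼) : lap (fun y : 𝔼 => ‖y‖ ^ 2) x = 2 * N := by
  have : ∀ i, pd (pd (fun y : 𝔼 => ‖y‖ ^ 2) i) i x = 2 := by
    intro i
    have : pd (fun y : 𝔼 => ‖y‖ ^ 2) i = fun y => (fun _ => 2) y * y i := by
      ext y; exact pd_normSq i y
    rw [this, pd_mul (by fun_prop) ((contDiff_coord i (n := 1)).differentiable (by simp) x), pd_coord, pd_const]
    simp
  simp [lap_eq_pd, this, mul_comm]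

lemma lap_coord (j : Fin N) (x : 𝔼) : lap (fun y : 𝔼 => y j) x = 0 := by
  rw [lap_eq_pd]
  refine Finset.sum_eq_zero fun i _ => ?_
  have : pd (fun y : 𝔼 => y j) i = fun _ => if i = j then 1 else 0 := by
    ext y; exact pd_coord i j y
  rw [this, pd_const]

lemma lap_comp_normSq {g : ℝ → ℝ} {x : 𝔼} (hg : ContDiffAt ℝ 2 g (‖x‖ ^ 2)) :
    lap (fun y : 𝔼 => g (‖y‖ ^ 2)) x =
      4 * ‖x‖ ^ 2 * deriv (deriv g) (‖x‖ ^ 2) + 2 * N * deriv g (‖x‖ ^ 2) := by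
  rw [lap_comp (p := fun y : 𝔼 => ‖y‖ ^ 2) hg (contDiff_normSq.contDiffAt.of_le le_top), lap_normSq]
  have : ∑ i, x i ^ 2 = ‖x‖ ^ 2 := (EuclideanSpace.real_norm_sq_eq x).symm
  simp only [pd_normSq, mul_pow, ← mul_sum, this]
  ring

lemma lap_eq_trace {u : 𝔼 → ℝ} {x : 𝔼} (hu : ContDiffAt ℝ 2 u x) :
    lap u x = ∑ i, fderiv ℝ (fderiv ℝ u) x (single i 1)
      (single i 1) := by
  refine sum_congr rfl fun i _ => ?_
  have h : HasFDerivAt (fderiv ℝ u) _ x :=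
    ((hu.fderiv_right (m := 1) (by norm_num)).differentiableAt (by simp)).hasFDerivAt
  have := (h.clm_apply (hasFDerivAt_const (single i (1:ℝ)) x)).fderiv
  rw [this]; simp

lemma lap_eq_laplacian {u : 𝔼 → ℝ} {x : 𝔼} (hu : ContDiffAt ℝ 2 u x) :
    lap u x = Laplacian.laplacian u x := by
  rw [lap_eq_trace hu,
    InnerProductSpace.laplacian_eq_iteratedFDeriv_orthonormalBasis u (EuclideanSpace.basisFun (Fin N) ℝ)]
  simp [iteratedFDeriv_two_apply]

lemma lap_eq_basis {u : 𝔼 → ℝ} {x : 𝔼} (hu : ContDiffAt ℝ 2 u x)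
    (b : OrthonormalBasis (Fin N) ℝ 𝔼) :
    lap u x = ∑ i, fderiv ℝ (fderiv ℝ u) x (b i) (b i) := by
  rw [lap_eq_laplacian hu, InnerProductSpace.laplacian_eq_iteratedFDeriv_orthonormalBasis u b]
  simp [iteratedFDeriv_two_apply]

lemma lap_comp_isometry {u : 𝔼 → ℝ} (hu : ContDiff ℝ 2 u) (g : 𝔼 ≃ₗᵢ[ℝ] 𝔼) (x : 𝔼) :
    lap (fun y => u (g y)) x = lap u (g x) := by
  have hc : ContDiff ℝ 2 (fun y => u (g y)) := hu.comp g.toContinuousLinearEquiv.contDiff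
  rw [lap_eq_trace hc.contDiffAt, lap_eq_basis hu.contDiffAt ((EuclideanSpace.basisFun (Fin N) ℝ).map g)]
  refine sum_congr rfl fun i _ => ?_
  have h1 : fderiv ℝ (fun y => u (g y)) = fun y =>
      (fderiv ℝ u (g y)).comp (g.toContinuousLinearEquiv : 𝔼 →L[ℝ] 𝔼) := by
    ext1 y
    exact ((hu.differentiable (by simp) (g y)).hasFDerivAt.comp y
      g.toContinuousLinearEquiv.hasFDerivAt).fderiv
  have h2 : HasFDerivAt (fderiv ℝ u) (fderiv ℝ (fderiv ℝ u) (g x)) (g x) :=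
    ((hu.fderiv_right (m := 1) (by norm_num)).differentiable (by simp) _).hasFDerivAt
  have h3 := h2.comp x g.toContinuousLinearEquiv.hasFDerivAt
  rw [h1]
  have h4 := (h3.clm_comp (hasFDerivAt_const (g.toContinuousLinearEquiv : 𝔼 →L[ℝ] 𝔼) x)).fderiv
  have h5 : (fun y => (fderiv ℝ u (g y)).comp (g.toContinuousLinearEquiv : 𝔼 →L[ℝ] 𝔼)) =
      fun y => ((fderiv ℝ u ∘ g) y).comp (g.toContinuousLinearEquiv : 𝔼 →L[ℝ] 𝔼) := rfl
  rw [h5, h4]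
  simp

lemma continuous_lap {u : 𝔼 → ℝ} (hu : ContDiff ℝ 2 u) : Continuous (lap u) := by
  refine continuous_finsetSum _ fun i _ => ?_
  exact (pd_contDiff (m := 0) (pd_contDiff (m := 1) hu (by norm_num) i) (by norm_num) i).continuous

/-- Second derivative test: the Laplacian is nonpositive at a local maximum. -/
lemma lap_nonpos_of_isLocalMax {u : 𝔼 → ℝ} {x : 𝔼} (hu : ContDiffAt ℝ 2 u x)
    (hx : IsLocalMax u x) : lap u x ≤ 0 := by
  refine Finset.sum_nonpos fun i _ => ?_
  set e : 𝔼 := single i 1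
  have hl : ∀ t : ℝ, HasDerivAt (fun t : ℝ => x + t • e) e t := fun t => by
    simpa using ((hasDerivAt_id t).smul_const e).const_add x
  have hc : Tendsto (fun t : ℝ => x + t • e) (𝓝 0) (𝓝 x) := by
    simpa using (hl 0).continuousAt.tendsto
  set g : ℝ → ℝ := fun t => u (x + t • e)
  have hg1 : ∀ᶠ t in 𝓝 (0:ℝ), HasDerivAt g (pd u i (x + t • e)) t := by
    filter_upwards [hc.eventually hu.evDiff] with t ht
    exact ht.hasFDerivAt.comp_hasDerivAt t (hl t)
  have hg2 : HasDerivAt (deriv g) (fderiv ℝ (pd u i) x e) 0 := by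
    have h1 : deriv g =ᶠ[𝓝 0] fun t => pd u i (x + t • e) := by
      filter_upwards [hg1] with t ht using ht.deriv
    refine HasDerivAt.congr_of_eventuallyEq ?_ h1
    have := (pd_contDiffAt (m := 1) hu (by norm_num) i).differentiableAt (by simp)
    have h2 : HasFDerivAt (pd u i) (fderiv ℝ (pd u i) x) (x + (0:ℝ) • e) := by
      simpa using this.hasFDerivAt
    exact h2.comp_hasDerivAt (0:ℝ) (hl 0)
  have hmax : IsLocalMax g 0 := by
    have := hc.eventually hx
    simpa [IsLocalMax, IsMaxFilter, g] using this
  by_contra! hpos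
  change 0 < fderiv ℝ (pd u i) x e at hpos
  have hmin : IsLocalMin g 0 := by
    apply isLocalMin_of_deriv_deriv_pos
    · rw [hg2.deriv]; exact hpos
    · exact hmax.deriv_eq_zero
    · exact hg1.self_of_nhds.continuousAt
  have hconst : g =ᶠ[𝓝 0] fun _ => g 0 := by
    filter_upwards [hmin, hmax] with t h1 h2 using le_antisymm h2 h1
  have : deriv (deriv g) 0 = 0 := by
    have := hconst.deriv.deriv.self_of_nhds
    simpa using this
  rw [hg2.deriv] at this
  linarith

lemma lap_comp_const_add (u : 𝔼 → ℝ) (a y : 𝔼) : lap (fun z => u (a + z)) y = lap u (a + y) := by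
  simp only [lap, fderiv_comp_add_left]
  refine sum_congr rfl fun i _ => ?_
  rw [fderiv_comp_add_left (f := fun z => fderiv ℝ u z (single i 1))]

lemma pd_inner (e : 𝔼) (i : Fin N) (x : 𝔼) : pd (fun y : 𝔼 => inner ℝ e y) i x = e i := by
  have : HasFDerivAt (fun y : 𝔼 => inner ℝ e y) (innerSL ℝ e) x := (innerSL ℝ e).hasFDerivAt
  simp [pd, this.fderiv, EuclideanSpace.inner_single_right]

lemma lap_comp_inner {g : ℝ → ℝ} (e : 𝔼) (he : ‖e‖ = 1) (hg : ContDiff ℝ 2 g) (x : 𝔼) :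
    lap (fun y : 𝔼 => g (inner ℝ e y)) x = deriv (deriv g) (inner ℝ e x) := by
  rw [lap_comp (p := fun y : 𝔼 => inner ℝ e y) hg.contDiffAt (innerSL ℝ e).contDiff.contDiffAt]
  have h1 : lap (fun y : 𝔼 => inner ℝ e y) x = 0 := by
    rw [lap_eq_pd]
    refine Finset.sum_eq_zero fun i _ => ?_
    have : pd (fun y : 𝔼 => inner ℝ e y) i = fun _ => e i := by ext y; exact pd_inner e i y
    rw [this, pd_const]
  have h2 : ∑ i, e i ^ 2 = 1 := by rw [← EuclideanSpace.real_norm_sq_eq, he]; norm_num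
  simp only [pd_inner, h1, h2]; ring

/-- Interior gradient estimate, directional form. -/
lemma dir_grad_est {u : 𝔼 → ℝ} (hu : ContDiff ℝ 2 u) (x₀ : 𝔼) {M F : ℝ}
    (hM : ∀ y ∈ closedBall x₀ 1, |u y| ≤ M)
    (hF : ∀ y ∈ closedBall x₀ 1, |lap u y| ≤ F) (e : 𝔼) (he : ‖e‖ = 1) :
    fderiv ℝ u x₀ e ≤ N * M + F / 2 := by
  have hN : (1:ℝ) ≤ N := by
    rcases Nat.eq_zero_or_pos N with h | h
    · subst h; simp [Subsingleton.elim e 0] at he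
    · exact_mod_cast h
  have hM0 : 0 ≤ M := (abs_nonneg _).trans (hM x₀ (by simp))
  have hF0 : 0 ≤ F := (abs_nonneg _).trans (hF x₀ (by simp))
  refine le_of_forall_pos_le_add fun δ hδ => ?_
  set R : 𝔼 ≃ₗᵢ[ℝ] 𝔼 := (ℝ ∙ e)ᗮ.reflection
  have hRe : R e = -e := Submodule.reflection_mem_subspace_orthogonalComplement_eq_neg
    (by rw [Submodule.orthogonal_orthogonal]; exact Submodule.mem_span_singleton_self e)
  have hRs : ∀ y : 𝔼, inner ℝ e y = 0 → R y = y := fun y hy =>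
    Submodule.reflection_mem_subspace_eq_self (Submodule.mem_orthogonal_singleton_iff_inner_right.2 hy)
  set φ : 𝔼 → ℝ := fun y => (1/2) * (u (x₀ + y) - u (x₀ + R y))
  set g : ℝ → ℝ := fun s => M * (-N * s ^ 2 + N * s) + ((F + 2 * δ) / 2) * (s * (1 - s))
  have hg : ContDiff ℝ 2 g := by fun_prop
  have hg1 : deriv g = fun s => M * (-N * (2 * s) + N) + ((F + 2 * δ) / 2) * (1 - 2 * s) := by
    ext s
    have : HasDerivAt g (M * (-N * (2 * s ^ 1 * 1) + N * 1) + ((F + 2 * δ) / 2) * (1 * (1 - s) + s * (0 - 1))) s := by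
      have hi := hasDerivAt_id' s
      exact ((((hi.pow 2).const_mul _).add (hi.const_mul _)).const_mul _).add
        ((hi.mul ((hasDerivAt_const s 1).sub hi)).const_mul _)
    rw [this.deriv]; ring
  have hg2 : ∀ s, deriv (deriv g) s = -(2 * N * M) - (F + 2 * δ) := by
    intro s
    rw [hg1]
    have : HasDerivAt (fun s : ℝ => M * (-N * (2 * s) + N) + ((F + 2 * δ) / 2) * (1 - 2 * s))
      (M * (-N * (2 * 1)) + ((F + 2 * δ) / 2) * (-(2 * 1))) s := by
      have hi := hasDerivAt_id' s
      exact ((((hi.const_mul 2).const_mul _).add_const _).const_mul _).add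
        (((hi.const_mul 2).const_sub 1).const_mul _)
    rw [this.deriv]; ring
  set ψ : 𝔼 → ℝ := fun y => M * ‖y‖ ^ 2 + g (inner ℝ e y)
  have hφ1 : ContDiff ℝ 2 (fun y => u (x₀ + y)) := hu.comp (contDiff_const.add contDiff_id)
  have hφ2 : ContDiff ℝ 2 (fun y => u (x₀ + R y)) :=
    hφ1.comp R.toContinuousLinearEquiv.contDiff
  have hφ : ContDiff ℝ 2 φ := contDiff_const.mul (hφ1.sub hφ2)
  have hns : ContDiff ℝ 2 (fun y : 𝔼 => ‖y‖ ^ 2) := contDiff_normSq.of_le le_top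
  have hge : ContDiff ℝ 2 (fun y : 𝔼 => g (inner ℝ e y)) := hg.comp (innerSL ℝ e).contDiff
  have hψ : ContDiff ℝ 2 ψ := (contDiff_const.mul hns).add hge
  have hlφ : ∀ y, ‖y‖ ≤ 1 → |lap φ y| ≤ F := by
    intro y hy
    have : lap φ y = (1/2) * (lap u (x₀ + y) - lap u (x₀ + R y)) := by
      rw [lap_const_mul _ (hφ1.sub hφ2).contDiffAt, lap_sub hφ1.contDiffAt hφ2.contDiffAt,
        lap_comp_const_add, lap_comp_isometry hφ1 R y, lap_comp_const_add]
    have h1 := abs_le.1 (hF (x₀ + y) (by simpa [dist_eq_norm] using hy))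
    have h2 := abs_le.1 (hF (x₀ + R y) (by simpa [dist_eq_norm] using hy))
    rw [this, abs_le]; constructor <;> linarith
  have hlψ : ∀ y, lap ψ y = -(F + 2 * δ) := by
    intro y
    rw [lap_add (contDiff_const.mul hns).contDiffAt hge.contDiffAt, lap_const_mul _ hns.contDiffAt,
      lap_normSq, lap_comp_inner e he hg, hg2]
    ring
  have hφM : ∀ y, ‖y‖ ≤ 1 → φ y ≤ M := by
    intro y hy
    have h1 := abs_le.1 (hM (x₀ + y) (by simpa [dist_eq_norm] using hy))
    have h2 := abs_le.1 (hM (x₀ + R y) (by simpa [dist_eq_norm] using hy))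
    simp only [φ]; linarith
  set K : Set 𝔼 := closedBall 0 1 ∩ {y | 0 ≤ inner ℝ e y}
  have hK : IsCompact K := (isCompact_closedBall _ _).inter_right
    (isClosed_le continuous_const (by fun_prop))
  have hcont : Continuous (fun y => φ y - ψ y) := hφ.continuous.sub hψ.continuous
  obtain ⟨z, hzK, hz⟩ := hK.exists_isMaxOn ⟨0, by simp [K]⟩ hcont.continuousOn
  have hin : ∀ y : 𝔼, ‖y‖ ≤ 1 → inner ℝ e y ≤ 1 := fun y hy => by
    have := real_inner_le_norm e y
    rw [he, one_mul] at this; linarith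
  have hz0 : φ z - ψ z ≤ 0 := by
    have hz1 : ‖z‖ ≤ 1 := by simpa using hzK.1
    have hz2 : 0 ≤ inner ℝ e z := hzK.2
    have hz3 := hin z hz1
    set s : ℝ := inner ℝ e z
    have hss : 0 ≤ s * (1 - s) := mul_nonneg hz2 (by linarith)
    rcases eq_or_lt_of_le hz2 with h0 | h0
    · have : φ z = 0 := by simp [φ, hRs z h0.symm]
      have h3 : 0 ≤ ψ z := by
        have hs0 : inner ℝ e z = (0:ℝ) := h0.symm
        simp only [ψ, g, hs0]
        simp; positivity
      linarith
    rcases eq_or_lt_of_le hz1 with h1 | h1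
    · have h3 : M ≤ ψ z := by
        simp only [ψ, g, h1]
        have : 0 ≤ M * N * (s * (1 - s)) := by positivity
        have : 0 ≤ (F + 2 * δ) / 2 * (s * (1 - s)) := by positivity
        change M ≤ M * 1 ^ 2 + (M * (-N * s ^ 2 + N * s) + ((F + 2 * δ) / 2) * (s * (1 - s)))
        nlinarith
      linarith [hφM z hz1]
    · exfalso
      have hmem : K ∈ 𝓝 z := by
        refine inter_mem (Metric.closedBall_mem_nhds_of_mem (by simpa using h1)) ?_
        exact mem_of_superset ((isOpen_lt continuous_const
          (by fun_prop : Continuous fun y : 𝔼 => inner ℝ e y)).mem_nhds h0)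
          (fun y (hy : 0 < inner ℝ e y) => hy.le)
      have := lap_nonpos_of_isLocalMax (hφ.sub hψ).contDiffAt (hz.isLocalMax hmem)
      rw [lap_sub hφ.contDiffAt hψ.contDiffAt, hlψ] at this
      have := abs_le.1 (hlφ z hz1)
      linarith
  -- compare along the ray
  have hray : ∀ t ∈ Icc (0:ℝ) 1, φ (t • e) ≤ ψ (t • e) := by
    intro t ht
    have : t • e ∈ K := by
      constructor
      · simp [norm_smul, he, abs_of_nonneg ht.1, ht.2]
      · simp [inner_smul_right, he, ht.1]
    have := hz this
    simp only [mem_ofPred_eq] at this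
    linarith
  have hl : HasDerivAt (fun t : ℝ => t • e) e 0 := by
    simpa using (hasDerivAt_id (0:ℝ)).smul_const e
  have hd : HasDerivAt (fun t : ℝ => ψ (t • e) - φ (t • e)) (N * M + (F + 2 * δ) / 2 - fderiv ℝ u x₀ e) 0 := by
    have e1 : (fun t : ℝ => ψ (t • e)) = fun t => M * t ^ 2 + g t := by
      ext t; simp [ψ, norm_smul, he, inner_smul_right]
    have d1 : HasDerivAt (fun t : ℝ => ψ (t • e)) (N * M + (F + 2 * δ) / 2) 0 := by
      rw [e1]
      have hgd := (hg.differentiable (by simp) 0).hasDerivAt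
      rw [hg1] at hgd
      have := ((hasDerivAt_pow 2 (0:ℝ)).const_mul M).add hgd
      refine this.congr_deriv ?_
      simp; ring
    have d2 : HasDerivAt (fun t : ℝ => φ (t • e)) (fderiv ℝ u x₀ e) 0 := by
      have hd0 := (hu.differentiable (by simp) x₀).hasFDerivAt
      have a1 : HasDerivAt (fun t : ℝ => u (x₀ + t • e)) (fderiv ℝ u x₀ e) 0 := by
        have h := (hl.const_add x₀)
        have hd' : HasFDerivAt u (fderiv ℝ u x₀) (x₀ + (0:ℝ) • e) := by simpa using hd0
        exact hd'.comp_hasDerivAt (0:ℝ) h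
      have a2 : HasDerivAt (fun t : ℝ => u (x₀ + R (t • e))) (-fderiv ℝ u x₀ e) 0 := by
        have h := (hl.neg.const_add x₀)
        have hd' : HasFDerivAt u (fderiv ℝ u x₀) (x₀ + -((0:ℝ) • e)) := by simpa using hd0
        have h2 := hd'.comp_hasDerivAt (0:ℝ) h
        have e2 : (fun t : ℝ => u (x₀ + R (t • e))) = u ∘ fun t : ℝ => x₀ + -(t • e) := by
          ext t; simp [hRe]
        rw [e2]; simpa using h2
      refine ((a1.sub a2).const_mul (1/2)).congr_deriv ?_
      ring
    exact d1.sub d2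
  have hnn : 0 ≤ N * M + (F + 2 * δ) / 2 - fderiv ℝ u x₀ e := by
    have ht := (hasDerivAt_iff_tendsto_slope.1 hd).mono_left (nhdsWithin_mono (0:ℝ) (fun t (ht : t ∈ Ioi (0:ℝ)) => ne_of_gt ht))
    refine ge_of_tendsto ht ?_
    filter_upwards [Ioo_mem_nhdsGT (zero_lt_one)] with t ht
    rw [slope_def_field]
    have := hray t ⟨ht.1.le, ht.2.le⟩
    have h0 : ψ ((0:ℝ) • e) - φ ((0:ℝ) • e) = 0 := by simp [ψ, φ, g]
    rw [h0]
    exact div_nonneg (by linarith) (by linarith [ht.1])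
  linarith

lemma grad_est {u : 𝔼 → ℝ} (hu : ContDiff ℝ 2 u) (x₀ : 𝔼) {M F : ℝ}
    (hM : ∀ y ∈ closedBall x₀ 1, |u y| ≤ M)
    (hF : ∀ y ∈ closedBall x₀ 1, |lap u y| ≤ F) :
    ‖fderiv ℝ u x₀‖ ≤ N * M + F / 2 := by
  have hM0 : 0 ≤ M := (abs_nonneg _).trans (hM x₀ (by simp))
  have hF0 : 0 ≤ F := (abs_nonneg _).trans (hF x₀ (by simp))
  refine ContinuousLinearMap.opNorm_le_of_unit_norm (by positivity) fun e he => ?_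
  rw [norm_eq_abs, abs_le]
  have h1 := dir_grad_est hu x₀ hM hF e he
  have h2 := dir_grad_est hu x₀ hM hF (-e) (by simpa using he)
  simp only [map_neg] at h2
  constructor <;> linarith

/-- `LSol v h` is a generalised form of `-Δ v = h`: on every ball, `v` and `h` are simultaneously
uniform limits of `w` and `-Δ w` with `w` of class `C²`. -/
def LSol (v h : 𝔼 → ℝ) : Prop :=
  ∀ R > (0:ℝ), ∀ ε > (0:ℝ), ∃ w : 𝔼 → ℝ, ContDiff ℝ 2 w ∧
    ∀ x ∈ closedBall (0 : 𝔼) R,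
      |w x - v x| ≤ ε ∧ |lap w x + h x| ≤ ε

lemma LSol.of_contDiff {v : 𝔼 → ℝ} (hv : ContDiff ℝ 2 v) : LSol v (fun x => -lap v x) :=
  fun R _ ε hε => ⟨v, hv, fun x _ => by simp [hε.le]⟩

lemma LSol.of_lim {v h : 𝔼 → ℝ}
    (H : ∀ R > (0:ℝ), ∀ ε > (0:ℝ), ∃ v' h' : 𝔼 → ℝ, LSol v' h' ∧
      ∀ x ∈ closedBall (0 : 𝔼) R, |v' x - v x| ≤ ε ∧ |h' x - h x| ≤ ε) : LSol v h := by
  intro R hR ε hε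
  obtain ⟨v', h', hs, hc⟩ := H R hR (ε / 2) (by positivity)
  obtain ⟨w, hw, hwc⟩ := hs R hR (ε / 2) (by positivity)
  refine ⟨w, hw, fun x hx => ?_⟩
  obtain ⟨a1, a2⟩ := hc x hx
  obtain ⟨b1, b2⟩ := hwc x hx
  simp only [abs_le] at *
  constructor <;> constructor <;> linarith

lemma LSol.add {v h v' h' : 𝔼 → ℝ} (H : LSol v h) (H' : LSol v' h') :
    LSol (fun x => v x + v' x) (fun x => h x + h' x) := by
  intro R hR ε hε
  obtain ⟨w, hw, hwc⟩ := H R hR (ε / 2) (by positivity)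
  obtain ⟨w', hw', hwc'⟩ := H' R hR (ε / 2) (by positivity)
  refine ⟨fun x => w x + w' x, hw.add hw', fun x hx => ?_⟩
  obtain ⟨a1, a2⟩ := hwc x hx
  obtain ⟨b1, b2⟩ := hwc' x hx
  rw [lap_add hw.contDiffAt hw'.contDiffAt]
  simp only [abs_le] at *
  constructor <;> constructor <;> linarith

lemma LSol.const_mul {v h : 𝔼 → ℝ} (H : LSol v h) (c : ℝ) :
    LSol (fun x => c * v x) (fun x => c * h x) := by
  intro R hR ε hε
  obtain ⟨w, hw, hwc⟩ := H R hR (ε / (|c| + 1)) (by positivity)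
  refine ⟨fun x => c * w x, contDiff_const.mul hw, fun x hx => ?_⟩
  obtain ⟨a1, a2⟩ := hwc x hx
  rw [lap_const_mul _ hw.contDiffAt, ← mul_sub, ← mul_add, abs_mul, abs_mul]
  have : |c| * (ε / (|c| + 1)) ≤ ε := by
    rw [mul_div_assoc', div_le_iff₀ (by positivity)]
    nlinarith [abs_nonneg c]
  exact ⟨(mul_le_mul_of_nonneg_left a1 (abs_nonneg c)).trans this,
    (mul_le_mul_of_nonneg_left a2 (abs_nonneg c)).trans this⟩

lemma LSol.neg {v h : 𝔼 → ℝ} (H : LSol v h) : LSol (fun x => -v x) (fun x => -h x) := by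
  simpa using H.const_mul (-1)

lemma LSol.sub {v h v' h' : 𝔼 → ℝ} (H : LSol v h) (H' : LSol v' h') :
    LSol (fun x => v x - v' x) (fun x => h x - h' x) := by
  simpa [sub_eq_add_neg] using H.add H'.neg

lemma continuous_of_ball_approx {f : 𝔼 → ℝ}
    (H : ∀ R > (0:ℝ), ∀ ε > (0:ℝ), ∃ g : 𝔼 → ℝ, Continuous g ∧
      ∀ x ∈ closedBall (0 : 𝔼) R, |g x - f x| ≤ ε) : Continuous f := by
  refine continuous_of_locally_uniform_approx_of_continuousAt fun x u hu => ?_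
  obtain ⟨ε, hε, hu⟩ := Metric.mem_uniformity_dist.1 hu
  obtain ⟨g, hg, hc⟩ := H (‖x‖ + 1) (by positivity) (ε / 2) (by positivity)
  refine ⟨ball x 1, Metric.ball_mem_nhds _ one_pos, g, hg.continuousAt, fun y hy => hu ?_⟩
  have : y ∈ closedBall (0 : 𝔼) (‖x‖ + 1) := by
    rw [mem_closedBall_zero_iff]
    rw [mem_ball, dist_eq_norm] at hy
    have := norm_sub_norm_le y x
    linarith
  have h1 := hc y this
  rw [dist_comm, Real.dist_eq]
  linarith

lemma LSol.continuous {v h : 𝔼 → ℝ} (H : LSol v h) : Continuous v := by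
  refine continuous_of_ball_approx fun R hR ε hε => ?_
  obtain ⟨w, hw, hc⟩ := H R hR ε hε
  exact ⟨w, hw.continuous, fun x hx => (hc x hx).1⟩

lemma LSol.continuous_rhs {v h : 𝔼 → ℝ} (H : LSol v h) : Continuous h := by
  refine continuous_of_ball_approx fun R hR ε hε => ?_
  obtain ⟨w, hw, hc⟩ := H R hR ε hε
  refine ⟨fun x => -lap w x, (continuous_lap hw).neg, fun x hx => ?_⟩
  have := (hc x hx).2
  rwa [← abs_neg, neg_sub, sub_neg_eq_add, add_comm]

lemma LSol.comp_isometry {v h : 𝔼 → ℝ} (H : LSol v h) (g : 𝔼 ≃ₗᵢ[ℝ] 𝔼) :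
    LSol (fun x => v (g x)) (fun x => h (g x)) := by
  intro R hR ε hε
  obtain ⟨w, hw, hc⟩ := H R hR ε hε
  refine ⟨fun x => w (g x), hw.comp g.toContinuousLinearEquiv.contDiff, fun x hx => ?_⟩
  rw [lap_comp_isometry hw]
  exact hc (g x) (by simpa using hx)

/-- Viscosity inequality at a maximum of `v - ψ`. -/
lemma LSol.le_of_isMax {v h ψ : 𝔼 → ℝ} (H : LSol v h) (hψ : ContDiff ℝ 2 ψ) {x₀ : 𝔼}
    (hmax : ∀ᶠ x in 𝓝 x₀, v x - ψ x ≤ v x₀ - ψ x₀) : -lap ψ x₀ ≤ h x₀ := by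
  refine le_of_forall_pos_le_add fun δ' hδ' => ?_
  obtain ⟨δ, hδ, hδδ⟩ : ∃ δ > (0:ℝ), (2 * N + 3) * δ ≤ δ' :=
    ⟨δ' / (2 * N + 3), by positivity, by rw [mul_div_cancel₀]; positivity⟩
  have e1 : ∀ᶠ x in 𝓝 x₀, h x ≤ h x₀ + δ :=
    (H.continuous_rhs.continuousAt.eventually_lt_const (by linarith)).mono fun _ h => h.le
  have e2 : ∀ᶠ x in 𝓝 x₀, lap ψ x ≤ lap ψ x₀ + δ :=
    ((continuous_lap hψ).continuousAt.eventually_lt_const (by linarith)).mono fun _ h => h.le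
  obtain ⟨r, hr, hball⟩ := Metric.nhds_basis_closedBall.mem_iff.1 (hmax.and (e1.and e2))
  set ε := min (δ * r ^ 2 / 4) δ with hε
  have hεpos : 0 < ε := lt_min (by positivity) hδ
  obtain ⟨w, hw, hc⟩ := H (‖x₀‖ + r) (by positivity) ε hεpos
  have hin : ∀ x ∈ closedBall x₀ r, x ∈ closedBall (0:𝔼) (‖x₀‖ + r) := by
    intro x hx
    rw [mem_closedBall_zero_iff]
    rw [mem_closedBall, dist_eq_norm] at hx
    linarith [norm_sub_norm_le x x₀]
  set p : 𝔼 → ℝ := fun x => ‖x - x₀‖ ^ 2 with hp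
  have hpc : ContDiff ℝ 2 p :=
    (contDiff_normSq.of_le le_top).comp (contDiff_id.sub contDiff_const)
  have hplap : ∀ x, lap p x = 2 * N := by
    intro x
    have := lap_comp_const_add (fun y : 𝔼 => ‖y‖ ^ 2) (-x₀) x
    rw [lap_normSq] at this
    rw [← this]
    congr 1
    ext y
    simp only [hp, sub_eq_add_neg, add_comm]
  set G : 𝔼 → ℝ := fun x => w x - (ψ x + δ * p x) with hG
  have hGc : ContDiff ℝ 2 G := hw.sub (hψ.add (contDiff_const.mul hpc))
  obtain ⟨y, hy, hymax⟩ := (isCompact_closedBall x₀ r).exists_isMaxOn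
    (Metric.nonempty_closedBall.2 hr.le) hGc.continuous.continuousOn
  have hylt : ‖y - x₀‖ < r := by
    by_contra hcon
    push Not at hcon
    have h0 : G x₀ ≤ G y := hymax (mem_closedBall_self hr.le)
    have h1 := (hball hy).1
    have h2 := abs_le.1 (hc y (hin y hy)).1
    have h3 := abs_le.1 (hc x₀ (hin x₀ (mem_closedBall_self hr.le))).1
    have h4 : r ^ 2 ≤ p y := by simp only [hp]; gcongr
    have h5 : p x₀ = 0 := by simp [hp]
    have h6 : ε ≤ δ * r ^ 2 / 4 := min_le_left _ _
    have h7 : 0 < δ * r ^ 2 := by positivity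
    have h8 := mul_le_mul_of_nonneg_left h4 hδ.le
    simp only [hG, h5, mul_zero, add_zero] at h0
    linarith [h1, h2.1, h2.2, h3.1, h3.2]
  have hloc : IsLocalMax G y := by
    refine hymax.isLocalMax (mem_of_superset (Metric.isOpen_ball.mem_nhds ?_)
      Metric.ball_subset_closedBall)
    rwa [mem_ball, dist_eq_norm]
  have h1 := lap_nonpos_of_isLocalMax hGc.contDiffAt hloc
  rw [hG, lap_sub hw.contDiffAt (hψ.add (contDiff_const.mul hpc)).contDiffAt,
    lap_add hψ.contDiffAt (contDiff_const.mul hpc).contDiffAt,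
    lap_const_mul _ hpc.contDiffAt, hplap] at h1
  have h2 := abs_le.1 (hc y (hin y hy)).2
  have h3 := (hball hy).2
  have h4 : ε ≤ δ := min_le_right _ _
  have h5 := h3.1
  have h6 := h3.2
  nlinarith [h2.1, h2.2]

lemma LSol.ge_of_isMin {v h ψ : 𝔼 → ℝ} (H : LSol v h) (hψ : ContDiff ℝ 2 ψ) {x₀ : 𝔼}
    (hmin : ∀ᶠ x in 𝓝 x₀, v x₀ - ψ x₀ ≤ v x - ψ x) : h x₀ ≤ -lap ψ x₀ := by
  have := H.neg.le_of_isMax (ψ := fun x => (-1) * ψ x) (contDiff_const.mul hψ) (x₀ := x₀)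
    (hmin.mono fun x hx => by linarith)
  rw [lap_const_mul _ hψ.contDiffAt] at this
  linarith

lemma LSol.lap_eq {v h : 𝔼 → ℝ} (H : LSol v h) (hv : ContDiff ℝ 2 v) (x : 𝔼) :
    -lap v x = h x :=
  le_antisymm (H.le_of_isMax hv (by simp)) (H.ge_of_isMin hv (by simp))

lemma mem_big_ball {x y : 𝔼} {R r : ℝ} (hx : x ∈ closedBall (0:𝔼) R)
    (hy : y ∈ closedBall x r) : y ∈ closedBall (0:𝔼) (R + r) := by
  rw [mem_closedBall_zero_iff] at *
  rw [mem_closedBall, dist_eq_norm] at hy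
  linarith [norm_sub_norm_le y x]

lemma LSol.exists_grad {v h : 𝔼 → ℝ} (H : LSol v h) :
    ContDiff ℝ 1 v ∧ ∃ w : ℕ → 𝔼 → ℝ, (∀ n, ContDiff ℝ 2 (w n)) ∧
      (∀ n : ℕ, ∀ x ∈ closedBall (0 : 𝔼) (n + 1),
        |w n x - v x| ≤ 1 / (n + 1) ∧ |lap (w n) x + h x| ≤ 1 / (n + 1)) ∧
      ∀ x, Tendsto (fun n => fderiv ℝ (w n) x) atTop (𝓝 (fderiv ℝ v x)) := by
  choose w hw hc using fun n : ℕ => H (n + 1) (by positivity) (1 / (n + 1)) (by positivity)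
  have key : ∀ R > (0:ℝ), UniformCauchySeqOn (fun n => fderiv ℝ (w n)) atTop
      (closedBall (0:𝔼) R) := by
    intro R hR
    rw [Metric.uniformCauchySeqOn_iff]
    intro ε hε
    obtain ⟨n0, hn0⟩ := exists_nat_gt (max (R + 1) ((2 * N + 2) / ε))
    have hn1 : R + 1 < n0 := (le_max_left _ _).trans_lt hn0
    have hn2 : (2 * N + 2) / ε < n0 := (le_max_right _ _).trans_lt hn0
    have hpos : (0:ℝ) < n0 := by linarith
    refine ⟨n0, fun k hk l hl x hx => ?_⟩
    have hs : ∀ j : ℕ, n0 ≤ j → ∀ y ∈ closedBall x 1,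
        |w j y - v y| ≤ 1 / n0 ∧ |lap (w j) y + h y| ≤ 1 / n0 := by
      intro j hj y hy
      have hjc : (n0:ℝ) ≤ j := by exact_mod_cast hj
      have : y ∈ closedBall (0:𝔼) (j + 1) :=
        closedBall_subset_closedBall (by linarith) (mem_big_ball hx hy)
      have h1 : (1:ℝ) / (j + 1) ≤ 1 / n0 := one_div_le_one_div_of_le hpos (by linarith)
      exact ⟨(hc j y this).1.trans h1, (hc j y this).2.trans h1⟩
    have := grad_est ((hw k).sub (hw l)) x (M := 2 / n0) (F := 2 / n0)
      (fun y hy => by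
        have a := abs_le.1 (hs k hk y hy).1
        have b := abs_le.1 (hs l hl y hy).1
        have e : (2:ℝ) / n0 = 1 / n0 + 1 / n0 := by ring
        rw [abs_le, e]
        constructor <;> linarith [a.1, a.2, b.1, b.2])
      (fun y hy => by
        have a := abs_le.1 (hs k hk y hy).2
        have b := abs_le.1 (hs l hl y hy).2
        have e : (2:ℝ) / n0 = 1 / n0 + 1 / n0 := by ring
        rw [lap_sub (hw k).contDiffAt (hw l).contDiffAt, abs_le, e]
        constructor <;> linarith [a.1, a.2, b.1, b.2])
    rw [dist_eq_norm, ← fderiv_fun_sub ((hw k).differentiable (by norm_num) x)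
      ((hw l).differentiable (by norm_num) x)]
    refine this.trans_lt ?_
    rw [div_lt_iff₀ hε] at hn2
    have : (N:ℝ) * (2 / n0) + 2 / n0 / 2 = (2 * N + 1) / n0 := by field_simp
    rw [this, div_lt_iff₀ hpos]
    linarith
  have hlim : ∀ x, ∃ L, Tendsto (fun n => fderiv ℝ (w n) x) atTop (𝓝 L) := by
    intro x
    refine cauchySeq_tendsto_of_complete ?_
    exact (key (‖x‖ + 1) (by positivity)).cauchySeq (by simp)
  choose D hD using hlim
  have hvlim : ∀ x, Tendsto (fun n => w n x) atTop (𝓝 (v x)) := by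
    intro x
    rw [tendsto_iff_norm_sub_tendsto_zero]
    refine squeeze_zero' (Eventually.of_forall fun n => norm_nonneg _) ?_
      tendsto_one_div_add_atTop_nhds_zero_nat
    obtain ⟨n0, hn0⟩ := exists_nat_gt ‖x‖
    filter_upwards [eventually_ge_atTop n0] with n hn
    have : (n0:ℝ) ≤ n := by exact_mod_cast hn
    exact (hc n x (by rw [mem_closedBall_zero_iff]; linarith)).1
  have hloc : TendstoLocallyUniformlyOn (fun n => fderiv ℝ (w n)) D atTop univ := by
    refine tendstoLocallyUniformlyOn_of_forall_exists_nhds fun x _ => ?_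
    refine ⟨closedBall 0 (‖x‖ + 1), mem_nhdsWithin_of_mem_nhds ?_,
      (key _ (by positivity)).tendstoUniformlyOn_of_tendsto fun y _ => hD y⟩
    exact mem_of_superset (Metric.isOpen_ball.mem_nhds (by simp)) Metric.ball_subset_closedBall
  have hder : ∀ x, HasFDerivAt v (D x) x := fun x =>
    hasFDerivAt_of_tendstoLocallyUniformlyOn isOpen_univ hloc
      (fun n x _ => ((hw n).differentiable (by norm_num) x).hasFDerivAt)
      (fun x _ => hvlim x) (mem_univ x)
  refine ⟨contDiff_one_iff_hasFDerivAt.2 ⟨D, ?_, hder⟩, w, hw, hc, fun x => ?_⟩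
  · rw [← continuousOn_univ]
    exact hloc.continuousOn (Frequently.of_forall fun n =>
      ((hw n).continuous_fderiv (by norm_num)).continuousOn)
  · rw [(hder x).fderiv]; exact hD x

lemma LSol.contDiff_one {v h : 𝔼 → ℝ} (H : LSol v h) : ContDiff ℝ 1 v := H.exists_grad.1

lemma LSol.grad_est {v h : 𝔼 → ℝ} (H : LSol v h) (x₀ : 𝔼) {M F : ℝ}
    (hM : ∀ y ∈ closedBall x₀ 1, |v y| ≤ M)
    (hF : ∀ y ∈ closedBall x₀ 1, |h y| ≤ F) : ‖fderiv ℝ v x₀‖ ≤ N * M + F / 2 := by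
  obtain ⟨-, w, hw, hc, hl⟩ := H.exists_grad
  have hl2 : Tendsto (fun n : ℕ => (N:ℝ) * (M + 1 / (n + 1)) + (F + 1 / (n + 1)) / 2) atTop
      (𝓝 (N * (M + 0) + (F + 0) / 2)) :=
    ((tendsto_const_nhds.add tendsto_one_div_add_atTop_nhds_zero_nat).const_mul _).add
      ((tendsto_const_nhds.add tendsto_one_div_add_atTop_nhds_zero_nat).div_const 2)
  rw [add_zero, add_zero] at hl2
  refine le_of_tendsto_of_tendsto (hl x₀).norm hl2 ?_
  obtain ⟨n0, hn0⟩ := exists_nat_gt ‖x₀‖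
  filter_upwards [eventually_ge_atTop n0] with n hn
  have hn' : (n0:ℝ) ≤ n := by exact_mod_cast hn
  have hin : ∀ y ∈ closedBall x₀ 1, y ∈ closedBall (0:𝔼) (n + 1) := fun y hy =>
    mem_big_ball (by rw [mem_closedBall_zero_iff]; linarith) hy
  refine Henon.grad_est (hw n) x₀ (fun y hy => ?_) (fun y hy => ?_)
  · have a := (hc n y (hin y hy)).1
    have b := hM y hy
    simp only [abs_le] at *
    constructor <;> linarith
  · have a := (hc n y (hin y hy)).2
    have b := hF y hy
    simp only [abs_le] at *
    constructor <;> linarith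

lemma LSol.translate {v h : 𝔼 → ℝ} (H : LSol v h) (a : 𝔼) :
    LSol (fun x => v (a + x)) (fun x => h (a + x)) := by
  intro R hR ε hε
  obtain ⟨w, hw, hc⟩ := H (‖a‖ + R) (by positivity) ε hε
  refine ⟨fun x => w (a + x), hw.comp (contDiff_const.add contDiff_id), fun x hx => ?_⟩
  rw [lap_comp_const_add]
  refine hc (a + x) ?_
  rw [mem_closedBall_zero_iff] at *
  exact (norm_add_le _ _).trans (by linarith)

lemma diffQuot_close {f : 𝔼 → ℝ} (hf : ContDiff ℝ 1 f) {e : 𝔼} (he : ‖e‖ = 1) {R ε : ℝ}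
    (hε : 0 < ε) : ∃ δ > (0:ℝ), ∀ s : ℝ, 0 < s → s ≤ δ → ∀ x ∈ closedBall (0:𝔼) R,
      |s⁻¹ * (f (s • e + x) - f x) - fderiv ℝ f x e| ≤ ε := by
  have huc := (isCompact_closedBall (0:𝔼) (R + 1)).uniformContinuousOn_of_continuous
    ((hf.continuous_fderiv (by norm_num)).continuousOn)
  obtain ⟨δ, hδ, hδc⟩ := Metric.uniformContinuousOn_iff.1 huc ε hε
  refine ⟨min (δ / 2) 1, lt_min (by positivity) one_pos, fun s hs0 hs x hx => ?_⟩
  have hs1 : s ≤ δ / 2 := hs.trans (min_le_left _ _)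
  have hs2 : s ≤ 1 := hs.trans (min_le_right _ _)
  have hb := (convex_closedBall x s).norm_image_sub_le_of_norm_fderiv_le' (𝕜 := ℝ) (f := f)
    (φ := fderiv ℝ f x) (C := ε) (x := x) (y := s • e + x)
    (fun y _ => hf.differentiable (by norm_num) y)
    (fun y hy => by
      have hy1 : y ∈ closedBall (0:𝔼) (R + 1) :=
        mem_big_ball hx (closedBall_subset_closedBall hs2 hy)
      have hx1 : x ∈ closedBall (0:𝔼) (R + 1) :=
        closedBall_subset_closedBall (by linarith) hx
      rw [mem_closedBall] at hy
      have := hδc y hy1 x hx1 (by linarith)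
      rw [dist_eq_norm] at this
      exact this.le)
    (by simp [hs0.le]) (by simp [dist_eq_norm, norm_smul, he, abs_of_pos hs0])
  simp only [add_sub_cancel_right, map_smul, smul_eq_mul, norm_smul, he, norm_eq_abs,
    abs_of_pos hs0, mul_one] at hb
  have : s⁻¹ * (f (s • e + x) - f x) - fderiv ℝ f x e
      = s⁻¹ * (f (s • e + x) - f x - s * fderiv ℝ f x e) := by field_simp
  rw [this, abs_mul, abs_of_pos (inv_pos.2 hs0), inv_mul_le_iff₀ hs0]
  linarith

lemma LSol.pd {v h : 𝔼 → ℝ} (H : LSol v h) (hh : ContDiff ℝ 1 h) (i : Fin N) :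
    LSol (pd v i) (pd h i) := by
  refine LSol.of_lim fun R hR ε hε => ?_
  have he : ‖(single i (1:ℝ) : 𝔼)‖ = 1 := by simp
  obtain ⟨δ, hδ, h1⟩ := diffQuot_close H.contDiff_one he (R := R) hε
  obtain ⟨δ', hδ', h2⟩ := diffQuot_close hh he (R := R) hε
  have hs : 0 < min δ δ' := lt_min hδ hδ'
  exact ⟨_, _, ((H.translate (min δ δ' • single i 1)).sub H).const_mul (min δ δ')⁻¹,
    fun x hx => ⟨h1 _ hs (min_le_left _ _) x hx, h2 _ hs (min_le_right _ _) x hx⟩⟩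

lemma contDiff_of_pd {f : 𝔼 → ℝ} {n : ℕ} (hf : Differentiable ℝ f)
    (h : ∀ i, ContDiff ℝ n (Henon.pd f i)) : ContDiff ℝ (n + 1) f := by
  rw [contDiff_succ_iff_fderiv]
  refine ⟨hf, by simp, ?_⟩
  rw [contDiff_clm_apply_iff]
  intro y
  have : (fun x => fderiv ℝ f x y) = fun x => ∑ i, y i * Henon.pd f i x := by
    ext x
    conv_lhs => rw [← (EuclideanSpace.basisFun (Fin N) ℝ).sum_repr y]
    simp [Henon.pd]
  rw [this]
  exact ContDiff.sum fun i _ => contDiff_const.mul (h i)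

lemma LSol.contDiff_two {v h : 𝔼 → ℝ} (H : LSol v h) (hh : ContDiff ℝ 1 h) : ContDiff ℝ 2 v :=
  contDiff_of_pd (n := 1) (H.contDiff_one.differentiable (by norm_num))
    fun i => (H.pd hh i).contDiff_one

lemma LSol.le_super {v f q ψ : 𝔼 → ℝ} (H : LSol v (fun x => f x - q x * v x))
    (hq : ∀ x, 0 < q x) (hψ : ContDiff ℝ 2 ψ)
    (hlim : ∀ ε > (0:ℝ), ∀ᶠ x in cocompact 𝔼, v x - ψ x < ε)
    (hs : ∀ x, f x ≤ q x * ψ x - lap ψ x) (x : 𝔼) : v x ≤ ψ x := by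
  by_contra hcon
  push Not at hcon
  obtain ⟨y, hy⟩ := (H.continuous.sub hψ.continuous).exists_forall_ge' x
    ((hlim (v x - ψ x) (by linarith)).mono fun z hz => hz.le)
  have h1 := H.le_of_isMax hψ (x₀ := y) (Eventually.of_forall hy)
  have h2 := hs y
  have h3 : v x - ψ x ≤ v y - ψ y := hy x
  nlinarith [hq y]

lemma LSol.abs_le_super {v f q ψ : 𝔼 → ℝ} (H : LSol v (fun x => f x - q x * v x))
    (hq : ∀ x, 0 < q x) (hψ : ContDiff ℝ 2 ψ) (hψ0 : ∀ x, 0 ≤ ψ x)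
    (hv : Tendsto v (cocompact 𝔼) (𝓝 0))
    (hs : ∀ x, |f x| ≤ q x * ψ x - lap ψ x) (x : 𝔼) : |v x| ≤ ψ x := by
  have key : ∀ {v f : 𝔼 → ℝ}, LSol v (fun x => f x - q x * v x) →
      Tendsto v (cocompact 𝔼) (𝓝 0) → (∀ x, |f x| ≤ q x * ψ x - lap ψ x) → v x ≤ ψ x := by
    intro v f H hv hs
    refine H.le_super hq hψ (fun ε hε => ?_) (fun x => (le_abs_self _).trans (hs x)) x
    filter_upwards [hv.eventually_lt_const hε] with y hy
    linarith [hψ0 y]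
  refine abs_le.2 ⟨?_, key H hv hs⟩
  have h2 := key (v := fun x => -v x) (f := fun x => -f x) (by convert H.neg using 2; ring)
    (by simpa using hv.neg) (fun x => by simpa using hs x)
  linarith

lemma LSol.abs_le_const {v f q : 𝔼 → ℝ} (H : LSol v (fun x => f x - q x * v x))
    (hq : ∀ x, 0 < q x) {M : ℝ} (hM : 0 ≤ M)
    (hv : Tendsto v (cocompact 𝔼) (𝓝 0)) (hs : ∀ x, |f x| ≤ q x * M) (x : 𝔼) : |v x| ≤ M :=
  H.abs_le_super hq (ψ := fun _ => M) contDiff_const (fun _ => hM) hv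
    (fun x => by simpa [lap_const] using hs x) x

/-- The weight `exp (-c √(1+|x|²))`. -/
noncomputable def rho (c : ℝ) (x : 𝔼) : ℝ :=
  exp (-(c * √(1 + ‖x‖ ^ 2)))

lemma rho_pos (c : ℝ) (x : 𝔼) : 0 < rho c x := exp_pos _

lemma contDiff_rho (c : ℝ) {n : WithTop ℕ∞} : ContDiff ℝ n (rho c : 𝔼 → ℝ) := by
  refine contDiff_exp.comp (contDiff_const.mul (ContDiff.sqrt ?_ fun x => ?_)).neg
  · exact contDiff_const.add (contDiff_normSq.of_le le_top)
  · positivity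

lemma tendsto_rho {c : ℝ} (hc : 0 < c) : Tendsto (rho c : 𝔼 → ℝ) (cocompact 𝔼) (𝓝 0) := by
  refine Real.tendsto_exp_neg_atTop_nhds_zero.comp ?_
  refine Tendsto.const_mul_atTop hc (tendsto_atTop_mono (fun x => ?_) (tendsto_norm_cocompact_atTop (E := 𝔼)))
  exact le_sqrt_of_sq_le (by linarith)

lemma lap_rho_le (hN : 1 ≤ N) {c : ℝ} (hc : 0 ≤ c) (x : 𝔼) : lap (rho c) x ≤ c ^ 2 * rho c x := by
  set g : ℝ → ℝ := fun s => exp (-(c * √(1 + s))) with hg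
  have h1 : ∀ s : ℝ, -1 < s → HasDerivAt g (-(c / (2 * √(1 + s))) * g s) s := by
    intro s hs
    have : HasDerivAt (fun s : ℝ => √(1 + s)) (1 / (2 * √(1 + s))) s :=
      ((hasDerivAt_id s).const_add 1).sqrt (by simp; linarith)
    refine HasDerivAt.congr_deriv (f := g) (this.const_mul c).fun_neg.exp ?_
    simp only [hg]; ring
  have h2 : ∀ s : ℝ, -1 < s → HasDerivAt (deriv g)
      (c / (4 * √(1 + s) * (1 + s)) * g s + c ^ 2 / (4 * (1 + s)) * g s) s := by
    intro s hs
    have hpos : 0 < 1 + s := by linarith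
    have he : deriv g =ᶠ[𝓝 s] fun s => -(c / (2 * √(1 + s))) * g s := by
      filter_upwards [lt_mem_nhds hs] with y hy using (h1 y hy).deriv
    refine HasDerivAt.congr_of_eventuallyEq ?_ he
    have h3 : HasDerivAt (fun s : ℝ => √(1 + s)) (1 / (2 * √(1 + s))) s :=
      ((hasDerivAt_id s).const_add 1).sqrt (by simp; linarith)
    have hsq : 0 < √(1 + s) := sqrt_pos.2 hpos
    refine HasDerivAt.congr_deriv
      ((((hasDerivAt_const s c).fun_div (h3.const_mul 2) (by positivity)).fun_neg).fun_mul (h1 s hs)) ?_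
    have := sq_sqrt hpos.le
    generalize g s = G
    generalize √(1 + s) = r at *
    rw [← this]
    field_simp
    ring
  have hgc : ContDiffAt ℝ 2 g (‖x‖ ^ 2) := by
    refine (contDiff_exp.contDiffAt).comp _ (contDiffAt_const.mul (ContDiffAt.sqrt ?_ ?_)).neg
    · exact contDiffAt_const.add contDiffAt_id
    · positivity
  have hx : -1 < ‖x‖ ^ 2 := by nlinarith [sq_nonneg ‖x‖]
  have hl : lap (rho c) x = _ := lap_comp_normSq (g := g) (x := x) hgc
  rw [hl, (h2 _ hx).deriv, (h1 _ hx).deriv]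
  have hG : g (‖x‖ ^ 2) = rho c x := rfl
  rw [hG]
  have hGp := rho_pos c x
  generalize rho c x = G at *
  have hs0 : (0:ℝ) ≤ ‖x‖ ^ 2 := by positivity
  generalize ‖x‖ ^ 2 = s at *
  have hpos : 0 < 1 + s := by linarith
  have hsq : 0 < √(1 + s) := sqrt_pos.2 hpos
  have e : 4 * s * (c / (4 * √(1 + s) * (1 + s)) * G + c ^ 2 / (4 * (1 + s)) * G) +
      2 * N * (-(c / (2 * √(1 + s))) * G) =
      (c ^ 2 * (s / (1 + s)) + c / √(1 + s) * (s / (1 + s) - N)) * G := by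
    field_simp; ring
  rw [e]
  have h5 : s / (1 + s) ≤ 1 := by rw [div_le_one hpos]; linarith
  have h6 : (1:ℝ) ≤ N := by exact_mod_cast hN
  have h7 : c / √(1 + s) * (s / (1 + s) - N) ≤ 0 :=
    mul_nonpos_of_nonneg_of_nonpos (by positivity) (by linarith)
  have h8 : c ^ 2 * (s / (1 + s)) ≤ c ^ 2 := mul_le_of_le_one_right (by positivity) h5
  exact mul_le_mul_of_nonneg_right (by linarith) hGp.le

lemma LSol.abs_le_rho (hN : 1 ≤ N) {v f q : 𝔼 → ℝ} (H : LSol v (fun x => f x - q x * v x))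
    (hq : ∀ x, 0 < q x) {M c : ℝ} (hc : 0 ≤ c) (hM : 0 ≤ M)
    (hv : Tendsto v (cocompact 𝔼) (𝓝 0)) (hs : ∀ x, |f x| ≤ M * (q x - c ^ 2) * rho c x) (x : 𝔼) :
    |v x| ≤ M * rho c x := by
  refine H.abs_le_super hq (ψ := fun x => M * rho c x) (contDiff_const.mul (contDiff_rho c))
    (fun x => mul_nonneg hM (rho_pos c x).le) hv (fun x => (hs x).trans ?_) x
  rw [lap_const_mul _ (contDiff_rho c).contDiffAt]
  nlinarith [mul_le_mul_of_nonneg_left (lap_rho_le hN hc x) hM]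

lemma exists_resolvent_schwartz {f : 𝔼 → ℝ} (hf : ContDiff ℝ ∞ f) (hc : HasCompactSupport f)
    {l : ℝ} (hl : 0 < l) :
    ∃ v : 𝔼 → ℝ, LSol v (fun x => f x - l * v x) ∧ Tendsto v (cocompact 𝔼) (𝓝 0) := by
  have hfc : HasCompactSupport (fun x => (f x : ℂ)) := hc.comp_left (g := fun t : ℝ => (t:ℂ)) rfl
  set φ : SchwartzMap 𝔼 ℂ := hfc.toSchwartzMap (Complex.ofRealCLM.contDiff.comp hf) with hφ
  set c : ℝ := l / (2 * Real.pi) ^ 2 with hcdef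
  have hcp : 0 < c := by positivity
  have hcl : (2 * Real.pi) ^ 2 * c = l := by rw [hcdef]; field_simp
  set g : 𝔼 → ℝ := fun x => c⁻¹ * (1 + ‖(√c)⁻¹ • x‖ ^ 2) ^ (-1 : ℝ) with hg
  have hgt : g.HasTemperateGrowth := by
    have h1 := (Function.hasTemperateGrowth_one_add_norm_sq_rpow 𝔼 (-1)).comp
      (f := fun x : 𝔼 => (√c)⁻¹ • x) (by fun_prop)
    have h2 : (fun _ : 𝔼 => c⁻¹).HasTemperateGrowth := by fun_prop
    exact h2.mul h1
  have hgeq : ∀ x, (c + ‖x‖ ^ 2) * g x = 1 := by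
    intro x
    simp only [hg, norm_smul, norm_eq_abs, mul_pow, sq_abs, inv_pow, sq_sqrt hcp.le,
      Real.rpow_neg_one]
    have : 0 < c + ‖x‖ ^ 2 := by positivity
    field_simp
  have hsq : (fun x : 𝔼 => ‖x‖ ^ 2).HasTemperateGrowth := by fun_prop
  have hct : (fun _ : 𝔼 => c).HasTemperateGrowth := by fun_prop
  set ψ : SchwartzMap 𝔼 ℂ := SchwartzMap.fourierMultiplierCLM ℂ g φ with hψ
  have key : c • ψ + SchwartzMap.fourierMultiplierCLM ℂ (fun x : 𝔼 => ‖x‖ ^ 2) ψ = φ := by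
    have h1 : SchwartzMap.fourierMultiplierCLM ℂ (fun x : 𝔼 => c) ψ = c • ψ := by
      rw [SchwartzMap.fourierMultiplierCLM_const]; rfl
    rw [← h1, hψ, SchwartzMap.fourierMultiplierCLM_fourierMultiplierCLM_apply hct hgt,
      SchwartzMap.fourierMultiplierCLM_fourierMultiplierCLM_apply hsq hgt]
    have h2 : SchwartzMap.fourierMultiplierCLM ℂ (fun _ : 𝔼 => (1:ℝ)) φ = φ := by
      rw [SchwartzMap.fourierMultiplierCLM_const]; simp
    conv_rhs => rw [← h2]
    simp only [SchwartzMap.fourierMultiplierCLM_apply, ← FourierTransform.fourierInv_add]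
    congr 1
    rw [← add_apply, ← SchwartzMap.smulLeftCLM_add (hct.mul hgt) (hsq.mul hgt)]
    congr 2
    ext x
    simp only [Pi.add_apply, Pi.mul_apply, ← add_mul, hgeq]
  have hψc : ContDiff ℝ 2 ψ := ψ.smooth 2
  set v : 𝔼 → ℝ := fun x => ((2 * Real.pi) ^ 2)⁻¹ * (ψ x).re with hv
  have hre : ContDiff ℝ 2 (fun x => (ψ x).re) := Complex.reCLM.contDiff.comp hψc
  have hvc : ContDiff ℝ 2 v := contDiff_const.mul hre
  have hlap : ∀ x, -lap v x = f x - l * v x := by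
    intro x
    rw [hv, lap_const_mul _ hre.contDiffAt, lap_eq_laplacian hre.contDiffAt]
    have h1 : Laplacian.laplacian (fun x => (ψ x).re) x = (Laplacian.laplacian (ψ : 𝔼 → ℂ) x).re :=
      hψc.contDiffAt.laplacian_CLM_comp_left (l := Complex.reCLM)
    rw [h1, ← SchwartzMap.laplacian_apply, SchwartzMap.laplacian_eq_fourierMultiplierCLM]
    have h2 : (c • ψ + SchwartzMap.fourierMultiplierCLM ℂ (fun x : 𝔼 => ‖x‖ ^ 2) ψ) x = φ x := by
      rw [key]
    have h3 : (φ x).re = f x := rfl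
    rw [← h3, ← h2, ← hcl]
    simp only [add_apply, smul_apply, Complex.add_re, Complex.smul_re, smul_eq_mul]
    generalize (SchwartzMap.fourierMultiplierCLM ℂ (fun x : 𝔼 => ‖x‖ ^ 2) ψ) x = A
    field_simp
    ring
  refine ⟨v, ?_, ?_⟩
  · have := LSol.of_contDiff hvc
    simpa only [hlap] using this
  · have h1 : Tendsto (ψ : 𝔼 → ℂ) (cocompact 𝔼) (𝓝 0) := ψ.toZeroAtInfty.zero_at_infty'
    have h2 := (Complex.continuous_re.tendsto 0).comp h1
    simpa [hv] using h2.const_mul ((2 * Real.pi) ^ 2)⁻¹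

lemma exists_unif_lim {X : Type*} {v : ℕ → X → ℝ} {δ : ℕ → ℝ} (hδ : Tendsto δ atTop (𝓝 0))
    (h : ∀ n m x, |v n x - v m x| ≤ δ n + δ m) : ∃ w : X → ℝ, ∀ n x, |v n x - w x| ≤ δ n := by
  have hc : ∀ x, ∃ L, Tendsto (fun n => v n x) atTop (𝓝 L) := by
    intro x
    refine cauchySeq_tendsto_of_complete (Metric.cauchySeq_iff'.2 fun ε hε => ?_)
    obtain ⟨n0, hn0⟩ := eventually_atTop.1 (hδ.eventually_lt_const (half_pos hε))
    refine ⟨n0, fun n hn => ?_⟩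
    rw [Real.dist_eq]
    linarith [h n n0 x, hn0 n hn, hn0 n0 le_rfl]
  choose w hw using hc
  refine ⟨w, fun n x => ?_⟩
  have h1 : Tendsto (fun m => |v n x - v m x|) atTop (𝓝 |v n x - w x|) :=
    (tendsto_const_nhds.sub (hw x)).abs
  have h2 : Tendsto (fun m => δ n + δ m) atTop (𝓝 (δ n + 0)) := tendsto_const_nhds.add hδ
  rw [add_zero] at h2
  exact le_of_tendsto_of_tendsto' h1 h2 fun m => h n m x

lemma tendsto_zero_of_unif {X : Type*} {l : Filter X} {w : X → ℝ}
    (h : ∀ ε > (0:ℝ), ∃ v : X → ℝ, Tendsto v l (𝓝 0) ∧ ∀ x, |v x - w x| ≤ ε) :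
    Tendsto w l (𝓝 0) := by
  rw [Metric.tendsto_nhds]
  intro ε hε
  obtain ⟨v, hv, hc⟩ := h (ε / 2) (half_pos hε)
  filter_upwards [Metric.tendsto_nhds.1 hv (ε / 2) (half_pos hε)] with x hx
  rw [dist_zero_right, norm_eq_abs] at *
  have := hc x
  simp only [abs_le, abs_lt] at *
  constructor <;> linarith

lemma exists_bound_ball {q : 𝔼 → ℝ} (hq : Continuous q) (R : ℝ) :
    ∃ C > (0:ℝ), ∀ x ∈ closedBall (0:𝔼) R, |q x| ≤ C := by
  obtain ⟨C, hC⟩ := (isCompact_closedBall (0:𝔼) R).exists_bound_of_continuousOn hq.continuousOn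
  exact ⟨max C 1, by positivity, fun x hx => (hC x hx).trans (le_max_left _ _)⟩

/-- Passing to the limit in `-Δ vₙ + qₙ vₙ = fₙ`. -/
lemma LSol.of_seq {v f q : ℕ → 𝔼 → ℝ} {v' f' q' : 𝔼 → ℝ}
    (H : ∀ n, LSol (v n) (fun x => f n x - q n x * v n x)) (hq' : Continuous q')
    (hv : ∀ ε > (0:ℝ), ∀ᶠ n in atTop, ∀ x, |v n x - v' x| ≤ ε)
    (hf : ∀ R, ∀ ε > (0:ℝ), ∀ᶠ n in atTop, ∀ x ∈ closedBall (0:𝔼) R, |f n x - f' x| ≤ ε)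
    (hq : ∀ R, ∀ᶠ n in atTop, ∀ x ∈ closedBall (0:𝔼) R, q n x = q' x) :
    LSol v' (fun x => f' x - q' x * v' x) := by
  refine LSol.of_lim fun R hR ε hε => ?_
  obtain ⟨C, hC, hb⟩ := exists_bound_ball hq' R
  obtain ⟨n, h1, h2, h3⟩ := ((hv (min ε (ε / 2 / C)) (by positivity)).and
    ((hf R (ε / 2) (by positivity)).and (hq R))).exists
  refine ⟨_, _, H n, fun x hx => ⟨(h1 x).trans (min_le_left _ _), ?_⟩⟩
  have e : f n x - q n x * v n x - (f' x - q' x * v' x) =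
      (f n x - f' x) - q' x * (v n x - v' x) := by rw [h3 x hx]; ring
  rw [e]
  have h4 : |q' x * (v n x - v' x)| ≤ ε / 2 := by
    rw [abs_mul]
    calc |q' x| * |v n x - v' x| ≤ C * (ε / 2 / C) :=
          mul_le_mul (hb x hx) ((h1 x).trans (min_le_right _ _)) (abs_nonneg _) hC.le
      _ = ε / 2 := by field_simp
  have := abs_sub (f n x - f' x) (q' x * (v n x - v' x))
  linarith [h2 x hx]

lemma LSol.diff_le {v f v' f' q : 𝔼 → ℝ} (H : LSol v (fun x => f x - q x * v x))
    (H' : LSol v' (fun x => f' x - q x * v' x)) {c : ℝ} (hc : 0 < c) (hq : ∀ x, c ≤ q x)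
    (hv : Tendsto v (cocompact 𝔼) (𝓝 0)) (hv' : Tendsto v' (cocompact 𝔼) (𝓝 0)) {M : ℝ}
    (hM : ∀ x, |f x - f' x| ≤ M) (x : 𝔼) : |v x - v' x| ≤ M / c := by
  have hM0 : 0 ≤ M := (abs_nonneg _).trans (hM x)
  refine LSol.abs_le_const (v := fun x => v x - v' x) (f := fun x => f x - f' x) (q := q)
    (by convert H.sub H' using 2; ring) (fun x => hc.trans_le (hq x)) (by positivity)
    (by simpa using hv.sub hv') (fun x => (hM x).trans ?_) x
  calc M = c * (M / c) := by field_simp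
    _ ≤ q x * (M / c) := mul_le_mul_of_nonneg_right (hq x) (by positivity)

lemma exists_resolvent_of_approx {q f : 𝔼 → ℝ} (hqc : Continuous q) {c : ℝ} (hc : 0 < c)
    (hq : ∀ x, c ≤ q x)
    (H : ∀ ε > (0:ℝ), ∃ f' v' : 𝔼 → ℝ, LSol v' (fun x => f' x - q x * v' x) ∧
      Tendsto v' (cocompact 𝔼) (𝓝 0) ∧ ∀ x, |f' x - f x| ≤ ε) :
    ∃ v : 𝔼 → ℝ, LSol v (fun x => f x - q x * v x) ∧ Tendsto v (cocompact 𝔼) (𝓝 0) := by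
  choose f' v' h1 h2 h3 using fun n : ℕ => H (1 / (n + 1)) (by positivity)
  have h0 : Tendsto (fun n : ℕ => (1:ℝ) / (n + 1)) atTop (𝓝 0) := tendsto_one_div_add_atTop_nhds_zero_nat
  have h0' : Tendsto (fun n : ℕ => (1:ℝ) / (n + 1) / c) atTop (𝓝 0) := by simpa using h0.div_const c
  obtain ⟨v, hv⟩ := exists_unif_lim (v := v') h0' fun n m x => by
    rw [← add_div]
    refine (h1 n).diff_le (h1 m) hc hq (h2 n) (h2 m) (fun y => ?_) x
    have a := h3 n y
    have b := h3 m y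
    simp only [abs_le] at *
    constructor <;> linarith
  refine ⟨v, LSol.of_seq (q := fun _ => q) h1 hqc (fun ε hε => ?_) (fun R ε hε => ?_)
    (fun R => Eventually.of_forall fun n x _ => rfl), tendsto_zero_of_unif fun ε hε => ?_⟩
  · filter_upwards [h0'.eventually_lt_const hε] with n hn x using (hv n x).trans hn.le
  · filter_upwards [h0.eventually_lt_const hε] with n hn x _ using (h3 n x).trans hn.le
  · obtain ⟨n, hn⟩ := (h0'.eventually_lt_const hε).exists
    exact ⟨v' n, h2 n, fun x => (hv n x).trans hn.le⟩

/-- Smooth compactly supported approximation of functions vanishing at infinity. -/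
lemma exists_smooth_approx {f : 𝔼 → ℝ} (hf : Continuous f) (h0 : Tendsto f (cocompact 𝔼) (𝓝 0))
    {ε : ℝ} (hε : 0 < ε) : ∃ g : 𝔼 → ℝ, ContDiff ℝ ∞ g ∧ HasCompactSupport g ∧
      ∀ x, |g x - f x| ≤ ε := by
  set f' : 𝔼 → ℝ := fun x => f x - max (-(ε / 2)) (min (f x) (ε / 2)) with hf'
  have hf'c : Continuous f' := hf.sub (continuous_const.max (hf.min continuous_const))
  have hcl : ∀ x, |f' x - f x| ≤ ε / 2 := by
    intro x
    simp only [hf', sub_sub_cancel_left, abs_neg, abs_le]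
    exact ⟨le_max_left _ _, max_le (by linarith) (min_le_right _ _)⟩
  have hcs : HasCompactSupport f' := by
    rw [hasCompactSupport_iff_eventuallyEq, coclosedCompact_eq_cocompact]
    filter_upwards [h0.eventually_lt_const (half_pos hε),
      h0.eventually_const_lt (neg_lt_zero.2 (half_pos hε))] with x hx hx'
    simp [hf', min_eq_left hx.le, max_eq_right hx'.le]
  obtain ⟨g, hg, hgc, hgs⟩ := hf'c.exists_contDiff_approx (n := ⊤)
    (ε := fun _ => ε / 2) continuous_const (fun _ => half_pos hε)
  refine ⟨g, hg, hcs.mono hgs, fun x => ?_⟩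
  have a := hgc x
  have b := hcl x
  rw [Real.dist_eq] at a
  have := abs_sub_le (g x) (f' x) (f x)
  linarith

lemma exists_resolvent_const {f : 𝔼 → ℝ} (hf : Continuous f)
    (h0 : Tendsto f (cocompact 𝔼) (𝓝 0)) {l : ℝ} (hl : 0 < l) :
    ∃ v : 𝔼 → ℝ, LSol v (fun x => f x - l * v x) ∧ Tendsto v (cocompact 𝔼) (𝓝 0) := by
  refine exists_resolvent_of_approx (q := fun _ => l) continuous_const hl (fun _ => le_rfl)
    fun ε hε => ?_
  obtain ⟨g, hg, hgs, hgc⟩ := exists_smooth_approx hf h0 hε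
  obtain ⟨v, hv, hv0⟩ := exists_resolvent_schwartz hg hgs hl
  exact ⟨g, v, hv, hv0, hgc⟩

lemma exists_resolvent_bdd {q f : 𝔼 → ℝ} (hq : Continuous q) {c l : ℝ} (hc : 0 < c) (hcl : c ≤ l)
    (hqc : ∀ x, c ≤ q x) (hql : ∀ x, q x ≤ l) (hf : Continuous f)
    (h0 : Tendsto f (cocompact 𝔼) (𝓝 0)) :
    ∃ v : 𝔼 → ℝ, LSol v (fun x => f x - q x * v x) ∧ Tendsto v (cocompact 𝔼) (𝓝 0) := by
  have hl : 0 < l := hc.trans_le hcl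
  have hex : ∀ z : C₀(𝔼, ℝ), ∃ w : C₀(𝔼, ℝ),
      LSol w (fun x => (f x + (l - q x) * z x) - l * w x) := by
    intro z
    have hz0 : Tendsto z (cocompact 𝔼) (𝓝 0) := z.zero_at_infty'
    have h1 : Tendsto (fun x => f x + (l - q x) * z x) (cocompact 𝔼) (𝓝 0) := by
      have : Tendsto (fun x => (l - q x) * z x) (cocompact 𝔼) (𝓝 0) := by
        refine bdd_le_mul_tendsto_zero' (l - c) (Eventually.of_forall fun x => ?_) hz0
        rw [abs_of_nonneg (by linarith [hql x])]
        linarith [hqc x]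
      simpa using h0.add this
    obtain ⟨v, hv, hv0⟩ := exists_resolvent_const
      (hf.add ((continuous_const.sub hq).mul z.continuous)) h1 hl
    exact ⟨⟨⟨v, hv.continuous⟩, hv0⟩, hv⟩
  choose T hT using hex
  have hcontr : ContractingWith (Real.toNNReal ((l - c) / l)) T := by
    refine ⟨?_, LipschitzWith.of_dist_le_mul fun z z' => ?_⟩
    · rw [Real.toNNReal_lt_one, div_lt_one hl]; linarith
    · rw [Real.coe_toNNReal _ (div_nonneg (by linarith) hl.le), ← ZeroAtInftyContinuousMap.dist_toBCF_eq_dist, ← ZeroAtInftyContinuousMap.dist_toBCF_eq_dist,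
        BoundedContinuousFunction.dist_le (mul_nonneg (div_nonneg (by linarith) hl.le) dist_nonneg)]
      intro x
      rw [Real.dist_eq, div_mul_eq_mul_div]
      refine (hT z).diff_le (q := fun _ => l) (hT z') hl (fun _ => le_rfl) (T z).zero_at_infty'
        (T z').zero_at_infty' (fun y => ?_) x
      have h1 := BoundedContinuousFunction.dist_coe_le_dist (f := z.toBCF) (g := z'.toBCF) y
      rw [Real.dist_eq] at h1
      have h2 : f y + (l - q y) * z y - (f y + (l - q y) * z' y) = (l - q y) * (z y - z' y) := by ring
      rw [h2, abs_mul, abs_of_nonneg (by linarith [hql y])]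
      exact mul_le_mul (by linarith [hqc y]) h1 (abs_nonneg _) (by linarith)
  set w := ContractingWith.fixedPoint T hcontr
  have hw : T w = w := hcontr.fixedPoint_isFixedPt
  refine ⟨w, ?_, w.zero_at_infty'⟩
  have := hT w
  rw [hw] at this
  convert this using 2
  ring

/-- Solvability of `-Δv + q v = f` with unbounded `q ≥ 8` and `|f| ≤ M q ρ`. -/
lemma exists_resolvent (hN : 1 ≤ N) {q f : 𝔼 → ℝ} (hq : Continuous q) (hq8 : ∀ x, 8 ≤ q x) {K : ℝ}
    (hqK : ∀ x, q x ^ 2 * rho 1 x ≤ K) (hf : Continuous f) {M : ℝ} (hM : 0 ≤ M)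
    (hfM : ∀ x, |f x| ≤ M * (q x * rho 1 x)) :
    ∃ v : 𝔼 → ℝ, LSol v (fun x => f x - q x * v x) ∧ ∀ x, |v x| ≤ 2 * M * rho 1 x := by
  set p : ℕ → 𝔼 → ℝ := fun n x => min (q x) (n + 8) with hp
  have hp8 : ∀ n x, 8 ≤ p n x := fun n x => le_min (hq8 x) (by linarith [n.cast_nonneg (α := ℝ)])
  have hpq : ∀ n x, p n x ≤ q x := fun n x => min_le_left _ _
  have hpc : ∀ n, Continuous (p n) := fun n => hq.min continuous_const
  have hqpos : ∀ x, 0 < q x := fun x => by linarith [hq8 x]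
  set g : ℕ → 𝔼 → ℝ := fun n x => f x * (p n x / q x) with hg
  have hgc : ∀ n, Continuous (g n) := fun n => hf.mul ((hpc n).div hq fun x => (hqpos x).ne')
  have hgM : ∀ n x, |g n x| ≤ M * (p n x * rho 1 x) := by
    intro n x
    have h1 : 0 ≤ p n x / q x := div_nonneg (by linarith [hp8 n x]) (hqpos x).le
    rw [hg]
    simp only
    rw [abs_mul, abs_of_nonneg h1]
    refine (mul_le_mul_of_nonneg_right (hfM x) h1).trans (le_of_eq ?_)
    have := (hqpos x).ne'
    field_simp
  have hg0 : ∀ n, Tendsto (g n) (cocompact 𝔼) (𝓝 0) := by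
    intro n
    refine squeeze_zero_norm (a := fun x => M * (n + 8) * rho 1 x) (fun x => (hgM n x).trans ?_) ?_
    · rw [mul_assoc]
      exact mul_le_mul_of_nonneg_left
        (mul_le_mul_of_nonneg_right (min_le_right _ _) (rho_pos _ _).le) hM
    · simpa using (tendsto_rho (N := N) one_pos).const_mul (M * (n + 8))
  choose v hv hv0 using fun n : ℕ => exists_resolvent_bdd (c := 8) (l := n + 8) (hpc n)
    (by norm_num) (by linarith [n.cast_nonneg (α := ℝ)]) (hp8 n) (fun x => min_le_right _ _)
    (hgc n) (hg0 n)
  have hvb : ∀ n x, |v n x| ≤ 2 * M * rho 1 x := by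
    intro n x
    refine (hv n).abs_le_rho hN (fun x => by linarith [hp8 n x]) (c := 1) zero_le_one
      (by positivity) (hv0 n) (fun x => (hgM n x).trans ?_) x
    have h1 := hp8 n x
    have h2 := mul_nonneg hM (rho_pos 1 x).le
    nlinarith
  have hK : 0 ≤ K := (mul_nonneg (sq_nonneg _) (rho_pos 1 0).le).trans (hqK 0)
  have hδ : Tendsto (fun n : ℕ => M * K * (1 / (n + 1))) atTop (𝓝 0) := by
    simpa using tendsto_one_div_add_atTop_nhds_zero_nat.const_mul (M * K)
  have hlt : ∀ n m : ℕ, n ≤ m → ∀ x, |v n x - v m x| ≤ M * K * (1 / (n + 1)) := by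
    intro n m hnm x
    have hnm' : (n:ℝ) ≤ m := by exact_mod_cast hnm
    have hn0 : (0:ℝ) ≤ n := n.cast_nonneg
    refine LSol.abs_le_const (v := fun x => v n x - v m x) (q := p n)
      (f := fun x => g n x - g m x + (p m x - p n x) * v m x)
      (by convert (hv n).sub (hv m) using 2; ring) (fun x => by linarith [hp8 n x]) (by positivity)
      (by simpa using (hv0 n).sub (hv0 m)) (fun y => ?_) x
    by_cases hy : q y ≤ n + 8
    · have e1 : p n y = q y := min_eq_left hy
      have e2 : p m y = q y := min_eq_left (by linarith)
      have e3 : g n y = g m y := by simp only [hg, e1, e2]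
      rw [e3, e1, e2]
      simp only [sub_self, zero_mul, add_zero, abs_zero]
      exact mul_nonneg (hqpos y).le (by positivity)
    · push Not at hy
      have e1 : p n y = n + 8 := min_eq_right hy.le
      have h1 := hgM n y
      have h2 := hgM m y
      have h3 := hvb m y
      have h4 := hpq n y
      have h5 := hpq m y
      have h6 := rho_pos 1 y
      have h7 := hp8 n y
      have h8 := hp8 m y
      have h9 : M * (p n y * rho 1 y) ≤ M * (q y * rho 1 y) := by gcongr
      have h10 : M * (p m y * rho 1 y) ≤ M * (q y * rho 1 y) := by gcongr
      have h11 : |(p m y - p n y) * v m y| ≤ 2 * (M * (q y * rho 1 y)) := by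
        rw [abs_mul]
        have : |p m y - p n y| ≤ q y := by rw [abs_le]; constructor <;> linarith
        calc |p m y - p n y| * |v m y| ≤ q y * (2 * M * rho 1 y) :=
              mul_le_mul this h3 (abs_nonneg _) (hqpos y).le
          _ = _ := by ring
      have h12 : |g n y - g m y + (p m y - p n y) * v m y| ≤ 4 * (M * (q y * rho 1 y)) := by
        refine (abs_add_le _ _).trans ?_
        linarith [abs_sub (g n y) (g m y)]
      refine h12.trans ?_
      rw [e1]
      have h13 : (n + 8) * (q y * rho 1 y) ≤ K := by
        refine le_trans ?_ (hqK y)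
        rw [pow_two, mul_assoc]
        exact mul_le_mul_of_nonneg_right hy.le (mul_nonneg (hqpos y).le h6.le)
      have h14 : q y * rho 1 y ≤ K / (n + 8) := by
        rw [le_div_iff₀ (by positivity)]; linarith
      calc 4 * (M * (q y * rho 1 y)) ≤ 4 * (M * (K / (n + 8))) := by gcongr
        _ ≤ 8 * (M * (K / (n + 1))) := by
          have : K / (n + 8) ≤ K / (n + 1) := by gcongr; linarith
          have h15 : 0 ≤ M * (K / (n + 1)) := by positivity
          have := mul_le_mul_of_nonneg_left this hM
          linarith
        _ ≤ (n + 8) * (M * K * (1 / (n + 1))) := by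
          have h15 : 0 ≤ M * (K / (n + 1)) := by positivity
          have : M * K * (1 / ((n:ℝ) + 1)) = M * (K / (n + 1)) := by ring
          rw [this]
          nlinarith
  obtain ⟨w, hw⟩ := exists_unif_lim (v := v) hδ fun n m x => by
    have p1 : 0 ≤ M * K * (1 / ((n:ℝ) + 1)) := by positivity
    have p2 : 0 ≤ M * K * (1 / ((m:ℝ) + 1)) := by positivity
    rcases le_total n m with h | h
    · linarith [hlt n m h x]
    · rw [abs_sub_comm]; linarith [hlt m n h x]
  have hev : ∀ R : ℝ, ∀ᶠ n : ℕ in atTop, ∀ x ∈ closedBall (0:𝔼) R, p n x = q x := by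
    intro R
    obtain ⟨C, -, hC⟩ := exists_bound_ball hq R
    obtain ⟨n0, hn0⟩ := exists_nat_gt C
    filter_upwards [eventually_ge_atTop n0] with n hn x hx
    have : (n0:ℝ) ≤ n := by exact_mod_cast hn
    exact min_eq_left (by linarith [le_abs_self (q x), hC x hx])
  refine ⟨w, LSol.of_seq hv hq (fun ε hε => ?_) (fun R ε hε => ?_) hev, fun x => ?_⟩
  · filter_upwards [hδ.eventually_lt_const hε] with n hn x using (hw n x).trans hn.le
  · filter_upwards [hev R] with n hn x hx
    simp only [hg, hn x hx, div_self (hqpos x).ne', mul_one, sub_self, abs_zero, hε.le]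
  · have h1 : Tendsto (fun n => v n x) atTop (𝓝 (w x)) := by
      rw [tendsto_iff_norm_sub_tendsto_zero]
      exact squeeze_zero (fun n => norm_nonneg _) (fun n => hw n x) hδ
    exact le_of_tendsto' h1.abs fun n => hvb n x

lemma rpow_sub_rpow_le {r α β : ℝ} (hr : 0 < r) (hβ : 0 < β) (h : β ≤ α) :
    |r ^ α - r ^ β| ≤ (α - β) / β * (1 + r ^ α * r ^ β) := by
  have hα : 0 < r ^ α := rpow_pos_of_pos hr _
  have hb : 0 < r ^ β := rpow_pos_of_pos hr _
  have e1 : r ^ α = r ^ β * exp ((α - β) * Real.log r) := by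
    rw [rpow_def_of_pos hr, rpow_def_of_pos hr, ← exp_add]; ring_nf
  have e2 : r ^ β = r ^ α * exp (-((α - β) * Real.log r)) := by
    rw [rpow_def_of_pos hr, rpow_def_of_pos hr, ← exp_add]; ring_nf
  have h0 : 0 ≤ α - β := by linarith
  have h0' : 0 ≤ (α - β) / β := by positivity
  rw [abs_le]
  constructor
  · have h1 := add_one_le_exp ((α - β) * Real.log r)
    have h2 : r ^ β - r ^ α ≤ r ^ β * ((α - β) * -Real.log r) := by
      rw [e1]
      nlinarith [mul_le_mul_of_nonneg_left h1 hb.le]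
    have h3 : r ^ β * -Real.log r ≤ 1 / β := by
      have := add_one_le_exp (-(β * Real.log r))
      have e3 : r ^ β * exp (-(β * Real.log r)) = 1 := by
        rw [rpow_def_of_pos hr, ← exp_add]; ring_nf; simp
      rw [le_div_iff₀ hβ]
      nlinarith
    have h4 : r ^ β * ((α - β) * -Real.log r) ≤ (α - β) / β := by
      calc _ = (α - β) * (r ^ β * -Real.log r) := by ring
        _ ≤ (α - β) * (1 / β) := mul_le_mul_of_nonneg_left h3 h0
        _ = _ := by ring
    nlinarith [mul_nonneg h0' (mul_pos hα hb).le]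
  · have h1 := add_one_le_exp (-((α - β) * Real.log r))
    have h2 : r ^ α - r ^ β ≤ r ^ α * ((α - β) * Real.log r) := by
      rw [e2]
      nlinarith [mul_le_mul_of_nonneg_left h1 hα.le]
    have h3 : Real.log r ≤ r ^ β / β := Real.log_le_rpow_div hr.le hβ
    have h4 : r ^ α * ((α - β) * Real.log r) ≤ (α - β) / β * (r ^ α * r ^ β) := by
      calc _ ≤ r ^ α * ((α - β) * (r ^ β / β)) := by gcongr
        _ = _ := by ring
    nlinarith

lemma abs_rpow_sub_le {r α β a : ℝ} (hr : 0 ≤ r) (ha : 0 < a) (hα : a ≤ α) (hβ : a ≤ β) :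
    |r ^ α - r ^ β| ≤ |α - β| / a * (1 + r ^ α * r ^ β) := by
  rcases hr.eq_or_lt with rfl | hr
  · rw [zero_rpow (by linarith), zero_rpow (by linarith)]
    simp; positivity
  have hα' : 0 < r ^ α := rpow_pos_of_pos hr _
  have hb : 0 < r ^ β := rpow_pos_of_pos hr _
  wlog h : β ≤ α generalizing α β
  · rw [abs_sub_comm, abs_sub_comm α, mul_comm (r ^ α)]
    exact this hβ hα hb hα' (by linarith)
  refine (rpow_sub_rpow_le hr (ha.trans_le hβ) h).trans ?_
  rw [abs_of_nonneg (by linarith : 0 ≤ α - β)]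
  have : 0 ≤ α - β := by linarith
  gcongr

lemma rpow_le_exp {r s c : ℝ} (hr : 0 ≤ r) (hs : 0 < s) (hc : 0 < c) :
    r ^ s ≤ (s / c) ^ s * exp (c * r) := by
  have h1 : r ≤ s / c * exp (c * r / s) := by
    have := add_one_le_exp (c * r / s)
    calc r = s / c * (c * r / s) := by field_simp
      _ ≤ _ := by gcongr; linarith
  calc r ^ s ≤ (s / c * exp (c * r / s)) ^ s := rpow_le_rpow hr h1 hs.le
    _ = _ := by
      rw [Real.mul_rpow (by positivity) (by positivity), ← Real.exp_mul]
      congr 2; field_simp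

lemma rho_le_exp {c : ℝ} (hc : 0 ≤ c) (x : 𝔼) : rho c x ≤ exp (-(c * ‖x‖)) := by
  refine exp_le_exp.2 (neg_le_neg (mul_le_mul_of_nonneg_left ?_ hc))
  exact le_sqrt_of_sq_le (by linarith)

lemma rho_two (x : 𝔼) : rho 2 x = rho 1 x * rho 1 x := by
  rw [rho, rho, ← exp_add]; congr 1; ring

lemma rho_le_one {c : ℝ} (hc : 0 ≤ c) (x : 𝔼) : rho c x ≤ 1 :=
  exp_le_one_iff.2 (by have := sqrt_nonneg (1 + ‖x‖ ^ 2); nlinarith)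

lemma rpow_le_one_add {r α b : ℝ} (hr : 0 ≤ r) (h0 : 0 ≤ α) (hα : α ≤ b) : r ^ α ≤ 1 + r ^ b := by
  rcases le_total r 1 with h | h
  · linarith [rpow_le_one hr h h0, rpow_nonneg hr b]
  · linarith [rpow_le_rpow_of_exponent_le h hα]

/-- `(1+r^b)² ρ` is bounded. -/
lemma exists_rpow_mul_rho_bound {b : ℝ} (hb : 0 < b) :
    ∃ C > (0:ℝ), ∀ x : 𝔼, (1 + ‖x‖ ^ b) ^ 2 * rho 1 x ≤ C := by
  set K := (b / (1 / 2)) ^ b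
  have hK : 0 < K := rpow_pos_of_pos (by positivity) _
  refine ⟨(1 + K) ^ 2, by positivity, fun x => ?_⟩
  have h1 := rpow_le_exp (norm_nonneg x) hb (by norm_num : (0:ℝ) < 1 / 2)
  have h2 : 1 ≤ exp (1 / 2 * ‖x‖) := one_le_exp (by positivity)
  have h3 : 1 + ‖x‖ ^ b ≤ (1 + K) * exp (1 / 2 * ‖x‖) := by
    calc _ ≤ exp (1 / 2 * ‖x‖) + K * exp (1 / 2 * ‖x‖) := add_le_add h2 h1
      _ = _ := by ring
  have h4 : 0 ≤ ‖x‖ ^ b := rpow_nonneg (norm_nonneg x) _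
  calc _ ≤ ((1 + K) * exp (1 / 2 * ‖x‖)) ^ 2 * exp (-(1 * ‖x‖)) := by
        gcongr
        · exact (rho_pos 1 x).le
        · exact rho_le_exp zero_le_one x
    _ = (1 + K) ^ 2 * (exp (1 / 2 * ‖x‖) * exp (1 / 2 * ‖x‖) * exp (-(1 * ‖x‖))) := by ring
    _ = (1 + K) ^ 2 := by
      rw [← exp_add, ← exp_add]; ring_nf; simp; ring

/-- The potential `m |x|^α + 8`. -/
noncomputable def qq (m α : ℝ) (x : 𝔼) : ℝ := m * ‖x‖ ^ α + 8

lemma continuous_norm_rpow {α : ℝ} (hα : 0 ≤ α) : Continuous (fun x : 𝔼 => ‖x‖ ^ α) :=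
  continuous_norm.rpow_const fun _ => Or.inr hα

lemma continuous_qq (m : ℝ) {α : ℝ} (hα : 0 ≤ α) : Continuous (qq m α : 𝔼 → ℝ) :=
  (continuous_const.mul (continuous_norm_rpow hα)).add continuous_const

lemma qq_ge {m : ℝ} (hm : 0 < m) (α : ℝ) (x : 𝔼) : 8 ≤ qq m α x := by
  have := rpow_nonneg (norm_nonneg x) α
  unfold qq; nlinarith

lemma qq_sq_rho_le {m : ℝ} (hm : 0 < m) {b : ℝ} (hb : 0 < b) :
    ∃ K : ℝ, ∀ x : 𝔼, qq m b x ^ 2 * rho 1 x ≤ K := by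
  obtain ⟨C, hC, h⟩ := exists_rpow_mul_rho_bound (N := N) hb
  refine ⟨(m + 8) ^ 2 * C, fun x => ?_⟩
  have h4 : 0 ≤ ‖x‖ ^ b := rpow_nonneg (norm_nonneg x) _
  have h5 : qq m b x ≤ (m + 8) * (1 + ‖x‖ ^ b) := by unfold qq; nlinarith
  calc _ ≤ ((m + 8) * (1 + ‖x‖ ^ b)) ^ 2 * rho 1 x := by
        have := qq_ge hm b x
        have := rho_pos 1 x
        gcongr
    _ = (m + 8) ^ 2 * ((1 + ‖x‖ ^ b) ^ 2 * rho 1 x) := by ring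
    _ ≤ _ := by gcongr; exact h x

lemma LSol.unique {v v' f q : 𝔼 → ℝ} (H : LSol v (fun x => f x - q x * v x))
    (H' : LSol v' (fun x => f x - q x * v' x)) (hq : ∀ x, 0 < q x)
    (hv : Tendsto v (cocompact 𝔼) (𝓝 0)) (hv' : Tendsto v' (cocompact 𝔼) (𝓝 0)) : v = v' := by
  funext x
  have := LSol.abs_le_const (v := fun x => v x - v' x) (f := fun _ => 0) (q := q)
    (by convert H.sub H' using 2; ring) hq le_rfl (by simpa using hv.sub hv') (fun x => by simp) x
  exact sub_eq_zero.1 (abs_nonpos_iff.1 this)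

lemma tendsto_rho_mul (z : 𝔼 →ᵇ ℝ) : Tendsto (fun x => rho 1 x * z x) (cocompact 𝔼) (𝓝 0) := by
  have : Tendsto (fun x => z x * rho 1 x) (cocompact 𝔼) (𝓝 0) :=
    bdd_le_mul_tendsto_zero' ‖z‖ (Eventually.of_forall fun x => z.norm_coe_le_norm x)
      (tendsto_rho one_pos)
  simpa only [mul_comm] using this

/-- `K` is the solution operator of `-Δ(ρ w) + q ρ w = q ρ z`. -/
def IsResolvent (q : 𝔼 → ℝ)
    (K : (𝔼 →ᵇ ℝ) →L[ℝ] (𝔼 →ᵇ ℝ)) : Prop :=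
  ∀ z, LSol (fun x => rho 1 x * K z x)
    (fun x => q x * (rho 1 x * z x) - q x * (rho 1 x * K z x))

lemma exists_isResolvent (hN : 1 ≤ N) {q : 𝔼 → ℝ} (hq : Continuous q) (hq8 : ∀ x, 8 ≤ q x) {K : ℝ}
    (hqK : ∀ x, q x ^ 2 * rho 1 x ≤ K) :
    ∃ T : (𝔼 →ᵇ ℝ) →L[ℝ] (𝔼 →ᵇ ℝ), IsResolvent q T ∧ ‖T‖ ≤ 2 := by
  have hex : ∀ z : 𝔼 →ᵇ ℝ, ∃ w : 𝔼 →ᵇ ℝ, LSol (fun x => rho 1 x * w x)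
      (fun x => q x * (rho 1 x * z x) - q x * (rho 1 x * w x)) ∧ ‖w‖ ≤ 2 * ‖z‖ := by
    intro z
    obtain ⟨v, hv, hvb⟩ := exists_resolvent hN hq hq8 hqK (f := fun x => q x * (rho 1 x * z x))
      (hq.mul ((contDiff_rho 1 (n := 0)).continuous.mul z.continuous)) (norm_nonneg z) fun x => by
        have h1 := z.norm_coe_le_norm x
        have h2 := rho_pos 1 x
        have h3 := hq8 x
        rw [norm_eq_abs] at h1
        rw [abs_mul, abs_mul, abs_of_pos h2, abs_of_pos (by linarith : 0 < q x)]
        have := mul_le_mul_of_nonneg_left h1 (mul_nonneg (by linarith : 0 ≤ q x) h2.le)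
        linarith
    have hb : ∀ x, ‖v x / rho 1 x‖ ≤ 2 * ‖z‖ := fun x => by
      rw [norm_div, norm_eq_abs, norm_of_nonneg (rho_pos 1 x).le, div_le_iff₀ (rho_pos 1 x)]
      exact hvb x
    refine ⟨BoundedContinuousFunction.ofNormedAddCommGroup (fun x => v x / rho 1 x)
      (hv.continuous.div (contDiff_rho 1 (n := 0)).continuous fun x => (rho_pos 1 x).ne') _ hb, ?_, ?_⟩
    · have : ∀ x : 𝔼, rho 1 x * (v x / rho 1 x) = v x := fun x => mul_div_cancel₀ _ (rho_pos 1 x).ne'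
      simpa [this] using hv
    · exact BoundedContinuousFunction.norm_ofNormedAddCommGroup_le _ (by positivity) hb
  choose T hT hTb using hex
  have huniq : ∀ z w : 𝔼 →ᵇ ℝ, LSol (fun x => rho 1 x * w x)
      (fun x => q x * (rho 1 x * z x) - q x * (rho 1 x * w x)) → T z = w := by
    intro z w hw
    have := (hT z).unique hw (fun x => by linarith [hq8 x]) (tendsto_rho_mul _) (tendsto_rho_mul _)
    ext x
    exact mul_left_cancel₀ (rho_pos 1 x).ne' (congrFun this x)
  refine ⟨LinearMap.mkContinuous
    { toFun := T
      map_add' := fun z z' => huniq _ _ ?_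
      map_smul' := fun c z => huniq _ _ ?_ } 2 hTb, hT, LinearMap.mkContinuous_norm_le _ (by norm_num) _⟩
  · convert (hT z).add (hT z') using 2 <;> simp <;> ring
  · convert (hT z).const_mul c using 2 <;> simp <;> ring

lemma IsResolvent.eq {q : 𝔼 → ℝ} {K : (𝔼 →ᵇ ℝ) →L[ℝ] (𝔼 →ᵇ ℝ)} (H : IsResolvent q K)
    (hq : ∀ x, 0 < q x) {z w : 𝔼 →ᵇ ℝ} (hw : LSol (fun x => rho 1 x * w x)
      (fun x => q x * (rho 1 x * z x) - q x * (rho 1 x * w x))) : K z = w := by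
  have := (H z).unique hw hq (tendsto_rho_mul _) (tendsto_rho_mul _)
  ext x
  exact mul_left_cancel₀ (rho_pos 1 x).ne' (congrFun this x)

open Classical in
/-- The solution operator for the potential `m |x|^α + 8`. -/
noncomputable def KK (m α : ℝ) :
    (𝔼 →ᵇ ℝ) →L[ℝ] (𝔼 →ᵇ ℝ) :=
  if h : ∃ T : (𝔼 →ᵇ ℝ) →L[ℝ] (𝔼 →ᵇ ℝ),
    IsResolvent (qq m α) T ∧ ‖T‖ ≤ 2 then h.choose else 0

lemma KK_spec (hN : 1 ≤ N) {m α : ℝ} (hm : 0 < m) (hα : 0 < α) :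
    IsResolvent (N := N) (qq m α) (KK m α) ∧ ‖KK (N := N) m α‖ ≤ 2 := by
  obtain ⟨K, hK⟩ := qq_sq_rho_le (N := N) hm hα
  have h := exists_isResolvent hN (continuous_qq m hα.le) (qq_ge hm α) hK
  rw [KK, dif_pos h]
  exact h.choose_spec

lemma KK_eq (hN : 1 ≤ N) {m α : ℝ} (hm : 0 < m) (hα : 0 < α) {z w : 𝔼 →ᵇ ℝ}
    (hw : LSol (fun x => rho 1 x * w x)
      (fun x => qq m α x * (rho 1 x * z x) - qq m α x * (rho 1 x * w x))) : KK m α z = w :=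
  (KK_spec hN hm hα).1.eq (fun x => by linarith [qq_ge hm α x]) hw

lemma inv_qq_sub_le {m α β a : ℝ} (hm : 0 < m) (ha : 0 < a) (hα : a ≤ α) (hβ : a ≤ β) (x : 𝔼) :
    |(qq m α x)⁻¹ - (qq m β x)⁻¹| ≤ |α - β| / a * (m / 64 + 1 / m) := by
  have h1 := abs_rpow_sub_le (norm_nonneg x) ha hα hβ
  have h2 := qq_ge hm α x
  have h3 := qq_ge hm β x
  have h4 : 0 ≤ ‖x‖ ^ α := rpow_nonneg (norm_nonneg x) _
  have h5 : 0 ≤ ‖x‖ ^ β := rpow_nonneg (norm_nonneg x) _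
  have h6 : 0 < qq m α x := by linarith
  have h7 : 0 < qq m β x := by linarith
  have e : (qq m α x)⁻¹ - (qq m β x)⁻¹ = -(m * (‖x‖ ^ α - ‖x‖ ^ β)) / (qq m α x * qq m β x) := by
    field_simp; unfold qq; ring
  rw [e, abs_div, abs_neg, abs_mul, abs_of_pos hm, abs_of_pos (mul_pos h6 h7), div_le_iff₀ (mul_pos h6 h7)]
  have h8 : m * (1 + ‖x‖ ^ α * ‖x‖ ^ β) ≤ (m / 64 + 1 / m) * (qq m α x * qq m β x) := by
    have e1 : 64 ≤ qq m α x * qq m β x := by nlinarith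
    have e2 : m ^ 2 * (‖x‖ ^ α * ‖x‖ ^ β) ≤ qq m α x * qq m β x := by
      unfold qq; nlinarith [mul_nonneg hm.le h4, mul_nonneg hm.le h5]
    have e3 : m * (‖x‖ ^ α * ‖x‖ ^ β) ≤ 1 / m * (qq m α x * qq m β x) := by
      rw [div_mul_eq_mul_div, one_mul, le_div_iff₀ hm]; linarith
    have e4 : m ≤ m / 64 * (qq m α x * qq m β x) := by nlinarith
    linarith
  calc m * |‖x‖ ^ α - ‖x‖ ^ β| ≤ m * (|α - β| / a * (1 + ‖x‖ ^ α * ‖x‖ ^ β)) := by gcongr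
    _ = |α - β| / a * (m * (1 + ‖x‖ ^ α * ‖x‖ ^ β)) := by ring
    _ ≤ |α - β| / a * ((m / 64 + 1 / m) * (qq m α x * qq m β x)) := by gcongr
    _ = _ := by ring

open Classical in
/-- `1/(m |x|^α + 8)` as a bounded continuous function. -/
noncomputable def bq (m α : ℝ) : 𝔼 →ᵇ ℝ :=
  if h : 0 < m ∧ 0 < α then BoundedContinuousFunction.ofNormedAddCommGroup
    (fun x => (qq m α x)⁻¹) ((continuous_qq m h.2.le).inv₀ fun x => by linarith [qq_ge h.1 α x]) 1
    (fun x => by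
      have := qq_ge h.1 α x
      rw [norm_inv, norm_of_nonneg (by linarith)]
      exact inv_le_one_of_one_le₀ (by linarith))
  else 0

lemma bq_apply {m α : ℝ} (hm : 0 < m) (hα : 0 < α) (x : 𝔼) : bq m α x = (qq m α x)⁻¹ := by
  rw [bq, dif_pos ⟨hm, hα⟩]; rfl

lemma tendsto_norm_rpow {α : ℝ} (hα : 0 < α) :
    Tendsto (fun x : 𝔼 => ‖x‖ ^ α) (cocompact 𝔼) atTop :=
  (tendsto_rpow_atTop hα).comp (tendsto_norm_cocompact_atTop (E := 𝔼))

lemma tendsto_qq {m α : ℝ} (hm : 0 < m) (hα : 0 < α) : Tendsto (qq m α) (cocompact 𝔼) atTop :=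
  tendsto_atTop_add_const_right _ _ ((tendsto_norm_rpow hα).const_mul_atTop hm)

lemma tendsto_bq {m α : ℝ} (hm : 0 < m) (hα : 0 < α) :
    Tendsto (bq m α) (cocompact 𝔼) (𝓝 0) := by
  have : (bq m α : 𝔼 → ℝ) = fun x => (qq m α x)⁻¹ := funext (bq_apply hm hα)
  rw [this]
  exact (tendsto_qq hm hα).inv_tendsto_atTop

lemma continuousAt_bq {m α : ℝ} (hm : 0 < m) (hα : 0 < α) :
    ContinuousAt (fun β => (bq m β : 𝔼 →ᵇ ℝ)) α := by
  rw [ContinuousAt, tendsto_iff_norm_sub_tendsto_zero]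
  have h0 : Tendsto (fun β => |β - α| / (α / 2) * (m / 64 + 1 / m)) (𝓝 α) (𝓝 0) := by
    have : Continuous (fun β => |β - α| / (α / 2) * (m / 64 + 1 / m)) := by fun_prop
    simpa using this.tendsto α
  refine squeeze_zero' (Eventually.of_forall fun _ => norm_nonneg _) ?_ h0
  filter_upwards [lt_mem_nhds (show α / 2 < α by linarith)] with β hβ
  refine (BoundedContinuousFunction.norm_le (by positivity)).2 fun x => ?_
  rw [BoundedContinuousFunction.sub_apply, bq_apply hm (by linarith), bq_apply hm hα]
  exact inv_qq_sub_le hm (by linarith) hβ.le (by linarith) x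

lemma exists_split {γ : 𝔼 →ᵇ ℝ} (h0 : Tendsto γ (cocompact 𝔼) (𝓝 0)) {ε : ℝ} (hε : 0 < ε) :
    ∃ γ₁ γ₂ : 𝔼 →ᵇ ℝ, γ = γ₁ + γ₂ ∧ ‖γ₂‖ ≤ ε ∧ ∃ R : ℝ, ∀ x, R < ‖x‖ → γ₁ x = 0 := by
  have hc : Continuous fun x => max (-ε) (min (γ x) ε) :=
    continuous_const.max (γ.continuous.min continuous_const)
  have hb : ∀ x, ‖max (-ε) (min (γ x) ε)‖ ≤ ε := fun x => by
    rw [norm_eq_abs, abs_le]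
    exact ⟨le_max_left _ _, max_le (by linarith) (min_le_right _ _)⟩
  set γ₂ : 𝔼 →ᵇ ℝ := BoundedContinuousFunction.ofNormedAddCommGroup _ hc ε hb with hγ₂
  refine ⟨γ - γ₂, γ₂, by simp, BoundedContinuousFunction.norm_ofNormedAddCommGroup_le _ hε.le hb, ?_⟩
  have := Metric.tendsto_nhds.1 h0 ε hε
  rw [← Metric.cobounded_eq_cocompact, ← comap_norm_atTop] at this
  obtain ⟨R, hR⟩ := (eventually_comap.1 this).exists_forall_of_atTop
  refine ⟨R, fun x hx => ?_⟩
  have h1 := hR ‖x‖ hx.le x rfl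
  rw [dist_zero_right, norm_eq_abs, abs_lt] at h1
  have h2 : γ₂ x = max (-ε) (min (γ x) ε) := rfl
  rw [BoundedContinuousFunction.sub_apply, h2, min_eq_left h1.2.le, max_eq_right h1.1.le, sub_self]

lemma rho_one_le {R : ℝ} {y : 𝔼} (h : ‖y‖ ≤ R) : rho 1 y ≤ exp (√(1 + R ^ 2)) * rho 2 y := by
  rw [rho, rho, ← exp_add]
  have : √(1 + ‖y‖ ^ 2) ≤ √(1 + R ^ 2) := by gcongr
  exact exp_le_exp.2 (by linarith)

/-- Sources supported in a ball produce solutions decaying like `ρ²`. -/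
lemma IsResolvent.le_rho_two (hN : 1 ≤ N) {q : 𝔼 → ℝ} {K : (𝔼 →ᵇ ℝ) →L[ℝ] (𝔼 →ᵇ ℝ)}
    (H : IsResolvent q K) (hq8 : ∀ x, 8 ≤ q x) {z : 𝔼 →ᵇ ℝ} {R : ℝ}
    (hz : ∀ x, R < ‖x‖ → z x = 0) (x : 𝔼) :
    |rho 1 x * K z x| ≤ 2 * ‖z‖ * exp (√(1 + R ^ 2)) * rho 2 x := by
  refine (H z).abs_le_rho hN (fun x => by linarith [hq8 x]) (c := 2) (by norm_num) (by positivity)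
    (tendsto_rho_mul _) (fun y => ?_) x
  have h8 := hq8 y
  have hr1 := rho_pos 1 y
  rcases lt_or_ge R ‖y‖ with h | h
  · rw [hz y h]
    have := rho_pos 2 y
    simp only [mul_zero, abs_zero]
    have : 0 ≤ q y - 2 ^ 2 := by linarith
    positivity
  · have h1 := z.norm_coe_le_norm y
    rw [norm_eq_abs] at h1
    have h2 := rho_one_le h
    rw [abs_mul, abs_mul, abs_of_pos hr1, abs_of_pos (by linarith : 0 < q y)]
    calc q y * (rho 1 y * |z y|) ≤ (2 * (q y - 2 ^ 2)) * (exp (√(1 + R ^ 2)) * rho 2 y * ‖z‖) := by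
          exact mul_le_mul (by linarith) (mul_le_mul h2 h1 (abs_nonneg _) (hr1.le.trans h2))
            (mul_nonneg hr1.le (abs_nonneg _)) (by linarith)
      _ = _ := by ring

lemma exists_rho_bound_pair {a b : ℝ} (ha : 0 < a) (hab : a ≤ b) :
    ∃ C > (0:ℝ), ∀ α ∈ Icc a b, ∀ β ∈ Icc a b, ∀ x : 𝔼,
      |‖x‖ ^ α - ‖x‖ ^ β| * rho 1 x ≤ C * |α - β| := by
  obtain ⟨C, hC, h⟩ := exists_rpow_mul_rho_bound (N := N) (ha.trans_le hab)
  refine ⟨2 * C / a, by positivity, fun α hα β hβ x => ?_⟩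
  have h1 := abs_rpow_sub_le (norm_nonneg x) ha hα.1 hβ.1
  have h2 := rpow_le_one_add (norm_nonneg x) (ha.le.trans hα.1) hα.2
  have h3 := rpow_le_one_add (norm_nonneg x) (ha.le.trans hβ.1) hβ.2
  have h4 : 0 ≤ ‖x‖ ^ α := rpow_nonneg (norm_nonneg x) _
  have h5 : 0 ≤ ‖x‖ ^ β := rpow_nonneg (norm_nonneg x) _
  have h6 : 0 ≤ ‖x‖ ^ b := rpow_nonneg (norm_nonneg x) _
  have hr := rho_pos 1 x
  have h7 : 1 + ‖x‖ ^ α * ‖x‖ ^ β ≤ 2 * (1 + ‖x‖ ^ b) ^ 2 := by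
    have := mul_le_mul h2 h3 h5 (by linarith)
    nlinarith
  calc _ ≤ |α - β| / a * (1 + ‖x‖ ^ α * ‖x‖ ^ β) * rho 1 x := by gcongr
    _ ≤ |α - β| / a * (2 * (1 + ‖x‖ ^ b) ^ 2) * rho 1 x := by gcongr
    _ = |α - β| / a * 2 * ((1 + ‖x‖ ^ b) ^ 2 * rho 1 x) := by ring
    _ ≤ |α - β| / a * 2 * C := by gcongr; exact h x
    _ = _ := by ring

/-- Operator-norm continuity of `z ↦ K_α (γ z)` in `α`, for `γ` vanishing at infinity. -/
lemma tendsto_KK_mul (hN : 1 ≤ N) {m α : ℝ} (hm : 0 < m) (hα : 0 < α) {γ : 𝔼 →ᵇ ℝ}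
    (h0 : Tendsto γ (cocompact 𝔼) (𝓝 0)) {ε : ℝ} (hε : 0 < ε) :
    ∀ᶠ β in 𝓝 α, ∀ z : 𝔼 →ᵇ ℝ, ‖KK m β (γ * z) - KK m α (γ * z)‖ ≤ ε * ‖z‖ := by
  obtain ⟨γ₁, γ₂, hγ, hγ₂, R, hR⟩ := exists_split h0 (show 0 < ε / 8 by positivity)
  obtain ⟨C, hC, hCb⟩ := exists_rho_bound_pair (N := N) (show 0 < α / 2 by positivity)
    (show α / 2 ≤ 2 * α by linarith)
  set D : ℝ := ‖γ₁‖ + 2 * ‖γ₁‖ * exp (√(1 + R ^ 2)) + exp (√(1 + R ^ 2)) * ‖γ₁‖ with hD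
  have hD0 : 0 ≤ D := by positivity
  have hlim : Tendsto (fun β => m * C * |β - α| * D) (𝓝 α) (𝓝 0) := by
    have : Continuous (fun β => m * C * |β - α| * D) := by fun_prop
    simpa using this.tendsto α
  filter_upwards [lt_mem_nhds (show α / 2 < α by linarith), gt_mem_nhds (show α < 2 * α by linarith),
    hlim.eventually_lt_const (show 0 < ε / 2 by positivity)] with β hβ1 hβ2 hβ3 z
  have hβ : 0 < β := by linarith
  have spβ := KK_spec hN hm hβ
  have spα := KK_spec hN hm hα
  have hsup : ∀ x, R < ‖x‖ → (γ₁ * z) x = 0 := fun x hx => by simp [hR x hx]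
  have hE : 1 ≤ exp (√(1 + R ^ 2)) := one_le_exp (sqrt_nonneg _)
  have main : ‖KK m β (γ₁ * z) - KK m α (γ₁ * z)‖ ≤ ε / 2 * ‖z‖ := by
    refine (BoundedContinuousFunction.norm_le (by positivity)).2 fun x => ?_
    have hz1 : ‖γ₁ * z‖ ≤ ‖γ₁‖ * ‖z‖ := norm_mul_le _ _
    set f : 𝔼 → ℝ := fun x => (qq m β x - qq m α x) *
      (rho 1 x * (γ₁ * z) x - rho 1 x * KK m α (γ₁ * z) x) with hf
    have hL : LSol (fun x => rho 1 x * (KK m β (γ₁ * z) x - KK m α (γ₁ * z) x))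
        (fun x => f x - qq m β x * (rho 1 x * (KK m β (γ₁ * z) x - KK m α (γ₁ * z) x))) := by
      convert (spβ.1 (γ₁ * z)).sub (spα.1 (γ₁ * z)) using 2
      · ring
      · simp only [hf]; ring
    have := hL.abs_le_rho hN (fun x => by linarith [qq_ge hm β x]) (c := 1) zero_le_one
      (M := ε / 2 * ‖z‖) (by positivity) (by
        have := tendsto_rho_mul (KK m β (γ₁ * z) - KK m α (γ₁ * z))
        simpa using this) (fun y => ?_) x
    · rw [abs_mul, abs_of_pos (rho_pos 1 x), mul_comm] at this
      exact le_of_mul_le_mul_right this (rho_pos 1 x)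
    · have e1 : |rho 1 y * (γ₁ * z) y| ≤ exp (√(1 + R ^ 2)) * ‖γ₁‖ * ‖z‖ * rho 2 y := by
        rcases lt_or_ge R ‖y‖ with h | h
        · rw [hsup y h]
          have := rho_pos 2 y
          simp only [mul_zero, abs_zero]; positivity
        · have h1 := ((γ₁ * z).norm_coe_le_norm y).trans hz1
          rw [norm_eq_abs] at h1
          have h2 := rho_one_le h
          rw [abs_mul, abs_of_pos (rho_pos 1 y)]
          calc rho 1 y * |(γ₁ * z) y| ≤ (exp (√(1 + R ^ 2)) * rho 2 y) * (‖γ₁‖ * ‖z‖) := by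
                gcongr
                exact (rho_pos 1 y).le.trans h2
            _ = _ := by ring
      have e2 := spα.1.le_rho_two hN (qq_ge hm α) hsup y
      have e3 : |rho 1 y * (γ₁ * z) y - rho 1 y * KK m α (γ₁ * z) y| ≤ D * ‖z‖ * rho 2 y := by
        refine (abs_sub _ _).trans ((add_le_add e1 e2).trans ?_)
        have h2 := rho_pos 2 y
        calc _ ≤ exp (√(1 + R ^ 2)) * ‖γ₁‖ * ‖z‖ * rho 2 y +
              2 * (‖γ₁‖ * ‖z‖) * exp (√(1 + R ^ 2)) * rho 2 y := by gcongr
          _ ≤ _ := by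
            rw [hD]
            have : 0 ≤ ‖γ₁‖ * ‖z‖ * rho 2 y := by positivity
            linarith
      have e4 := hCb β ⟨hβ1.le, hβ2.le⟩ α ⟨by linarith, by linarith⟩ y
      have hr := rho_pos 1 y
      have e5 : |f y| ≤ m * C * |β - α| * D * ‖z‖ * rho 1 y := by
        rw [hf]
        simp only [abs_mul]
        have : qq m β y - qq m α y = m * (‖y‖ ^ β - ‖y‖ ^ α) := by unfold qq; ring
        rw [this, abs_mul, abs_of_pos hm]
        calc _ ≤ m * |‖y‖ ^ β - ‖y‖ ^ α| * (D * ‖z‖ * rho 2 y) := by gcongr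
          _ = m * (|‖y‖ ^ β - ‖y‖ ^ α| * rho 1 y) * (D * ‖z‖ * rho 1 y) := by rw [rho_two]; ring
          _ ≤ m * (C * |β - α|) * (D * ‖z‖ * rho 1 y) := by gcongr
          _ = _ := by ring
      refine e5.trans ?_
      have h8 := qq_ge hm β y
      have : m * C * |β - α| * D * ‖z‖ ≤ ε / 2 * ‖z‖ * (qq m β y - 1 ^ 2) := by
        calc _ ≤ ε / 2 * ‖z‖ := by gcongr
          _ ≤ _ := le_mul_of_one_le_right (by positivity) (by linarith)
      gcongr
  have small : ∀ T : (𝔼 →ᵇ ℝ) →L[ℝ] (𝔼 →ᵇ ℝ), ‖T‖ ≤ 2 → ‖T (γ₂ * z)‖ ≤ ε / 4 * ‖z‖ := by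
    intro T hT
    calc ‖T (γ₂ * z)‖ ≤ ‖T‖ * ‖γ₂ * z‖ := T.le_opNorm _
      _ ≤ 2 * (ε / 8 * ‖z‖) := by
        gcongr
        exact (norm_mul_le _ _).trans (by gcongr)
      _ = _ := by ring
  have s1 := small _ spβ.2
  have s2 := small _ spα.2
  have e : KK m β (γ * z) - KK m α (γ * z) = (KK m β (γ₁ * z) - KK m α (γ₁ * z)) +
      (KK m β (γ₂ * z) - KK m α (γ₂ * z)) := by
    rw [hγ, add_mul, map_add, map_add]; abel
  rw [e]
  refine (norm_add_le _ _).trans ((add_le_add main (norm_sub_le _ _)).trans ?_)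
  linarith

lemma totallyBounded_of_decay {A : Set (𝔼 →ᵇ ℝ)} {M : ℝ} (hM : ∀ f ∈ A, ∀ x, |f x| ≤ M)
    (hdec : ∀ ε > (0:ℝ), ∃ R : ℝ, ∀ f ∈ A, ∀ x, R ≤ ‖x‖ → |f x| ≤ ε)
    (heq : Equicontinuous (fun f : A => (f.1 : 𝔼 → ℝ))) : TotallyBounded A := by
  rw [Metric.totallyBounded_iff]
  intro ε hε
  obtain ⟨R₀, hR₀⟩ := hdec (ε / 8) (by positivity)
  set R := max R₀ 1 with hR
  have hR1 : 0 < R := by positivity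
  set B : Set 𝔼 := closedBall 0 R
  have : CompactSpace B := isCompact_iff_compactSpace.1 (isCompact_closedBall 0 R)
  let inc : C(B, 𝔼) := ⟨Subtype.val, continuous_subtype_val⟩
  have hmx : ∀ x : 𝔼, 0 < max R ‖x‖ := fun x => lt_max_of_lt_left hR1
  have hpm : ∀ x : 𝔼, (R / max R ‖x‖) • x ∈ B := fun x => by
    rw [mem_closedBall_zero_iff, norm_smul, norm_of_nonneg (div_nonneg hR1.le (hmx x).le),
      div_mul_eq_mul_div, div_le_iff₀ (hmx x)]
    exact mul_le_mul_of_nonneg_left (le_max_right _ _) hR1.le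
  have hpc : Continuous (fun x : 𝔼 => (R / max R ‖x‖) • x) :=
    (continuous_const.div (continuous_const.max continuous_norm)
      fun x => (hmx x).ne').smul continuous_id
  let proj : C(𝔼, B) := ⟨fun x => ⟨_, hpm x⟩, hpc.subtype_mk hpm⟩
  have hcomp : IsCompact (closure ((fun f : 𝔼 →ᵇ ℝ => f.compContinuous inc) '' A)) := by
    refine BoundedContinuousFunction.arzela_ascoli (closedBall 0 M) (isCompact_closedBall _ _) _
      ?_ ?_
    · rintro _ x ⟨f, hf, rfl⟩
      rw [mem_closedBall_zero_iff]
      exact hM f hf x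
    · intro x
      rw [Metric.equicontinuousAt_iff]
      intro δ hδ
      obtain ⟨η, hη, h⟩ := Metric.equicontinuousAt_iff.1 (heq x) δ hδ
      refine ⟨η, hη, fun y hy => ?_⟩
      rintro ⟨_, f, hf, rfl⟩
      exact h y hy ⟨f, hf⟩
  have htb : TotallyBounded ((fun g : B →ᵇ ℝ => g.compContinuous proj) ''
      ((fun f : 𝔼 →ᵇ ℝ => f.compContinuous inc) '' A)) :=
    (hcomp.totallyBounded.subset subset_closure).image
      (BoundedContinuousFunction.lipschitz_compContinuous proj).uniformContinuous
  obtain ⟨t, ht, hcov⟩ := Metric.totallyBounded_iff.1 htb (ε / 2) (by positivity)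
  refine ⟨t, ht, fun f hf => ?_⟩
  have h1 := hcov ⟨_, ⟨f, hf, rfl⟩, rfl⟩
  simp only [mem_iUnion, mem_ball, exists_prop] at h1 ⊢
  obtain ⟨y, hy, hd⟩ := h1
  refine ⟨y, hy, ?_⟩
  have h2 : dist f ((f.compContinuous inc).compContinuous proj) ≤ ε / 4 := by
    refine (BoundedContinuousFunction.dist_le (by positivity)).2 fun x => ?_
    rw [Real.dist_eq]
    change |f x - f ((R / max R ‖x‖) • x)| ≤ _
    rcases le_total ‖x‖ R with h | h
    · rw [max_eq_left h, div_self hR1.ne', one_smul, sub_self, abs_zero]; positivity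
    · have hx0 : 0 < ‖x‖ := hR1.trans_le h
      have e1 := hR₀ f hf x ((le_max_left _ _).trans h)
      have e2 := hR₀ f hf ((R / max R ‖x‖) • x) (by
        rw [max_eq_right h, norm_smul, norm_of_nonneg (by positivity), div_mul_cancel₀ _ hx0.ne']
        exact le_max_left _ _)
      exact (abs_sub _ _).trans (by linarith)
  calc dist f y ≤ _ := dist_triangle _ _ _
    _ < ε := by linarith

lemma IsResolvent.exists_lipschitz {q : 𝔼 → ℝ} (hq : Continuous q)
    {K : (𝔼 →ᵇ ℝ) →L[ℝ] (𝔼 →ᵇ ℝ)} (H : IsResolvent q K) (hK : ‖K‖ ≤ 2) (x₀ : 𝔼) :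
    ∃ L : ℝ, ∀ z : 𝔼 →ᵇ ℝ, ‖z‖ ≤ 1 → ∀ x ∈ ball x₀ 1,
      |rho 1 x₀ * K z x₀ - rho 1 x * K z x| ≤ L * ‖x₀ - x‖ := by
  obtain ⟨C, hC, hb⟩ := exists_bound_ball hq (‖x₀‖ + 2)
  refine ⟨N * 2 + 3 * C / 2, fun z hz x hx => ?_⟩
  have hKz : ‖K z‖ ≤ 2 := (K.le_opNorm z).trans (by nlinarith [norm_nonneg z, norm_nonneg K])
  have b1 : ∀ y, |rho 1 y * K z y| ≤ 2 := fun y => by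
    have h1 := (K z).norm_coe_le_norm y
    rw [norm_eq_abs] at h1
    rw [abs_mul, abs_of_pos (rho_pos 1 y)]
    nlinarith [rho_le_one zero_le_one y, rho_pos 1 y, abs_nonneg (K z y)]
  have b2 : ∀ y, |rho 1 y * z y| ≤ 1 := fun y => by
    have h1 := z.norm_coe_le_norm y
    rw [norm_eq_abs] at h1
    rw [abs_mul, abs_of_pos (rho_pos 1 y)]
    nlinarith [rho_le_one zero_le_one y, rho_pos 1 y, abs_nonneg (z y)]
  have hd := (H z).contDiff_one
  have key := (convex_ball x₀ 1).norm_image_sub_le_of_norm_fderiv_le (𝕜 := ℝ)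
    (f := fun x => rho 1 x * K z x) (C := N * 2 + 3 * C / 2)
    (fun y _ => hd.differentiable (by norm_num) y) (fun y hy => ?_)
    hx (Metric.mem_ball_self one_pos)
  · simpa [norm_eq_abs] using key
  · refine (H z).grad_est y (fun w _ => b1 w) fun w hw => ?_
    have hw' : w ∈ closedBall (0:𝔼) (‖x₀‖ + 2) := by
      rw [mem_closedBall_zero_iff]
      rw [mem_closedBall, dist_eq_norm] at hw
      rw [mem_ball, dist_eq_norm] at hy
      calc ‖w‖ = ‖(w - y) + (y - x₀) + x₀‖ := by congr 1; abel
        _ ≤ ‖w - y‖ + ‖y - x₀‖ + ‖x₀‖ := norm_add₃_le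
        _ ≤ _ := by linarith
    have h1 := hb w hw'
    refine (abs_sub _ _).trans ?_
    rw [abs_mul, abs_mul (q w)]
    nlinarith [b1 w, b2 w, abs_nonneg (q w), abs_nonneg (rho 1 w * z w), abs_nonneg (rho 1 w * K z w)]

lemma IsResolvent.isCompactOperator_mul (hN : 1 ≤ N) {q : 𝔼 → ℝ} (hq : Continuous q)
    (hq8 : ∀ x, 8 ≤ q x) {K : (𝔼 →ᵇ ℝ) →L[ℝ] (𝔼 →ᵇ ℝ)} (H : IsResolvent q K) (hK : ‖K‖ ≤ 2)
    {γ : 𝔼 →ᵇ ℝ} (h0 : Tendsto γ (cocompact 𝔼) (𝓝 0)) :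
    IsCompactOperator (K.comp (ContinuousLinearMap.mul ℝ (𝔼 →ᵇ ℝ) γ)) := by
  set T := K.comp (ContinuousLinearMap.mul ℝ (𝔼 →ᵇ ℝ) γ) with hT
  have hTa : ∀ z, T z = K (γ * z) := fun z => rfl
  refine (isCompactOperator_iff_isCompact_closure_image_closedBall (T : (𝔼 →ᵇ ℝ) →ₗ[ℝ] (𝔼 →ᵇ ℝ))
    one_pos).2 ?_
  refine (TotallyBounded.closure ?_).isCompact_of_isClosed isClosed_closure
  have hγz : ∀ {δ z : 𝔼 →ᵇ ℝ} {c : ℝ}, ‖δ‖ ≤ c → z ∈ closedBall 0 1 → ‖δ * z‖ ≤ c := by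
    intro δ z c hδ hz
    rw [mem_closedBall_zero_iff] at hz
    exact (norm_mul_le _ _).trans (by nlinarith [norm_nonneg δ, norm_nonneg z])
  have hKb : ∀ z, ‖K z‖ ≤ 2 * ‖z‖ := fun z => (K.le_opNorm z).trans (by gcongr)
  refine totallyBounded_of_decay (M := 2 * ‖γ‖) ?_ ?_ ?_
  · rintro _ ⟨z, hz, rfl⟩ x
    refine ((T z).norm_coe_le_norm x).trans ((hKb _).trans ?_)
    have := hγz (δ := γ) le_rfl hz
    change 2 * ‖γ * z‖ ≤ _
    linarith
  · intro ε hε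
    obtain ⟨γ₁, γ₂, hγ, hγ₂, R, hR⟩ := exists_split h0 (show 0 < ε / 4 by positivity)
    have hlim : Tendsto (fun x : 𝔼 => 2 * ‖γ₁‖ * exp (√(1 + R ^ 2)) * rho 1 x) (cocompact 𝔼) (𝓝 0) := by
      simpa using (tendsto_rho one_pos).const_mul (2 * ‖γ₁‖ * exp (√(1 + R ^ 2)))
    have := hlim.eventually_lt_const (show 0 < ε / 2 by positivity)
    rw [← Metric.cobounded_eq_cocompact, ← comap_norm_atTop] at this
    obtain ⟨R', hR'⟩ := (eventually_comap.1 this).exists_forall_of_atTop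
    refine ⟨R', ?_⟩
    rintro _ ⟨z, hz, rfl⟩ x hx
    have h1 := hR' ‖x‖ hx x rfl
    have h2 := H.le_rho_two (R := R) hN hq8 (z := γ₁ * z) (fun x hx => by simp [hR x hx]) x
    have h3 := hγz (δ := γ₁) le_rfl hz
    have h4 := (K (γ₂ * z)).norm_coe_le_norm x
    have h5 := hKb (γ₂ * z)
    have h6 := hγz hγ₂ hz
    rw [norm_eq_abs] at h4
    have hr := rho_pos 1 x
    have h7 : |K (γ₁ * z) x| ≤ ε / 2 := by
      rw [rho_two, abs_mul, abs_of_pos hr] at h2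
      have : |K (γ₁ * z) x| ≤ 2 * ‖γ₁ * z‖ * exp (√(1 + R ^ 2)) * rho 1 x :=
        le_of_mul_le_mul_left (h2.trans_eq (by ring)) hr
      refine this.trans (le_trans ?_ h1.le)
      gcongr
    have e : (T z) x = K (γ₁ * z) x + K (γ₂ * z) x := by
      rw [hTa, hγ, add_mul, map_add]; rfl
    change |(T z) x| ≤ _
    rw [e]
    exact (abs_add_le _ _).trans (by linarith)
  · intro x₀
    obtain ⟨L, hL⟩ := H.exists_lipschitz hq hK x₀
    have hr0 := rho_pos 1 x₀
    have hcr : Continuous (fun x : 𝔼 => (rho 1 x)⁻¹) :=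
      (contDiff_rho 1 (n := 0)).continuous.inv₀ fun x => (rho_pos 1 x).ne'
    set b : 𝔼 → ℝ := fun x => ‖γ‖ * (L * ‖x₀ - x‖) * (rho 1 x₀)⁻¹ +
      2 * ‖γ‖ * |(rho 1 x₀)⁻¹ - (rho 1 x)⁻¹| with hb
    refine Metric.equicontinuousAt_of_continuity_modulus b ?_ _ ?_
    · have : Continuous b := by fun_prop
      have := this.tendsto x₀
      simpa [hb] using this
    · filter_upwards [Metric.ball_mem_nhds x₀ one_pos] with x hx
      rintro ⟨_, z, hz, rfl⟩
      change dist ((T z) x₀) ((T z) x) ≤ _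
      rw [Real.dist_eq, hTa]
      have hz1 := hγz (δ := γ) le_rfl hz
      have hr := rho_pos 1 x
      have e : K (γ * z) x₀ - K (γ * z) x = (rho 1 x₀ * K (γ * z) x₀ - rho 1 x * K (γ * z) x) * (rho 1 x₀)⁻¹ +
          (rho 1 x * K (γ * z) x) * ((rho 1 x₀)⁻¹ - (rho 1 x)⁻¹) := by
        field_simp; ring
      have h4 : |rho 1 x * K (γ * z) x| ≤ 2 * ‖γ‖ := by
        have h4 := (K (γ * z)).norm_coe_le_norm x
        have h5 := hKb (γ * z)
        rw [norm_eq_abs] at h4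
        rw [abs_mul, abs_of_pos hr]
        calc rho 1 x * |K (γ * z) x| ≤ 1 * (2 * ‖γ‖) :=
              mul_le_mul (rho_le_one zero_le_one x) (by linarith) (abs_nonneg _) zero_le_one
          _ = _ := one_mul _
      have h5 : |rho 1 x₀ * K (γ * z) x₀ - rho 1 x * K (γ * z) x| ≤ ‖γ‖ * (L * ‖x₀ - x‖) := by
        rcases (norm_nonneg γ).eq_or_lt with h | h
        · rw [eq_comm, norm_eq_zero] at h
          simp [h]
        · have h6 := hL (‖γ‖⁻¹ • (γ * z)) (by
            rw [norm_smul, norm_inv, norm_norm, inv_mul_le_iff₀ h]; linarith) x hx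
          have e2 : rho 1 x₀ * K (‖γ‖⁻¹ • (γ * z)) x₀ - rho 1 x * K (‖γ‖⁻¹ • (γ * z)) x =
              ‖γ‖⁻¹ * (rho 1 x₀ * K (γ * z) x₀ - rho 1 x * K (γ * z) x) := by
            rw [map_smul]; simp; ring
          rw [e2, abs_mul, abs_inv, abs_norm, inv_mul_le_iff₀ h] at h6
          exact h6
      rw [e, hb]
      refine (abs_add_le _ _).trans ?_
      rw [abs_mul, abs_mul (rho 1 x * _), abs_inv, abs_of_pos hr0]
      exact add_le_add (mul_le_mul_of_nonneg_right h5 (by positivity)) (mul_le_mul_of_nonneg_right h4 (abs_nonneg _))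

lemma exists_bound_of_injOn {X : Type*} [NormedAddCommGroup X] [NormedSpace ℝ X] [CompleteSpace X]
    {T : X →L[ℝ] X} (hT : IsCompactOperator T) (Y : Submodule ℝ X) (hY : IsClosed (Y : Set X))
    (hTY : ∀ y ∈ Y, T y ∈ Y) (hinj : ∀ y ∈ Y, T y = y → y = 0) :
    (∃ C > (0:ℝ), ∀ y ∈ Y, ‖y‖ ≤ C * ‖y - T y‖) ∧ ∀ y ∈ Y, ∃ x ∈ Y, x - T x = y := by
  have : CompleteSpace Y := hY.completeSpace_coe
  let TY : Y →L[ℝ] Y := (T.comp Y.subtypeL).codRestrict Y fun y => hTY y y.2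
  have hTYc : IsCompactOperator TY := hT.restrict (V := Y) (f := (T : X →ₗ[ℝ] X)) hTY hY
  rcases IsCompactOperator.hasEigenvalue_or_mem_resolventSet hTYc (one_ne_zero (α := ℝ)) with h | h
  · obtain ⟨y, hy⟩ := h.exists_hasEigenvector
    refine absurd ?_ hy.2
    have h1 := hy.apply_eq_smul
    rw [one_smul] at h1
    exact Subtype.ext (hinj y y.2 (congrArg Subtype.val h1))
  · rw [spectrum.mem_resolventSet_iff, map_one] at h
    obtain ⟨u, hu⟩ := h
    set S : Y →L[ℝ] Y := ((u⁻¹ : (Y →L[ℝ] Y)ˣ) : Y →L[ℝ] Y)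
    have e1 : ∀ y, (u : Y →L[ℝ] Y) (S y) = y := fun y =>
      congrArg (fun f : Y →L[ℝ] Y => f y) u.mul_inv
    have e2 : ∀ y, S ((u : Y →L[ℝ] Y) y) = y := fun y =>
      congrArg (fun f : Y →L[ℝ] Y => f y) u.inv_mul
    have e3 : ∀ y : Y, ((u : Y →L[ℝ] Y) y : X) = y - T y := fun y => by
      rw [hu]; rfl
    refine ⟨⟨‖S‖ + 1, by positivity, fun y hy => ?_⟩, fun y hy => ⟨S ⟨y, hy⟩, (S ⟨y, hy⟩).2, ?_⟩⟩
    · have h1 := S.le_opNorm ((u : Y →L[ℝ] Y) ⟨y, hy⟩)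
      rw [e2, Submodule.coe_norm, Submodule.coe_norm, e3] at h1
      exact h1.trans (mul_le_mul_of_nonneg_right (by linarith) (norm_nonneg _))
    · rw [← e3, e1]

/-- Quantitative stability of fixed points of a map close to a linear one with bounded inverse. -/
lemma norm_sub_le_of_near {X : Type*} [NormedAddCommGroup X] [NormedSpace ℝ X]
    {T : X →L[ℝ] X} {P : X → X} {C : ℝ} (hC : 0 < C) {y y' : X}
    (hb : ‖y - y'‖ ≤ C * ‖(y - y') - T (y - y')‖)
    (hP : ‖P y - P y' - T (y - y')‖ ≤ 1 / (2 * C) * ‖y - y'‖) :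
    ‖y - y'‖ ≤ 2 * C * ‖(y - P y) - (y' - P y')‖ := by
  have h1 : ‖(y - y') - T (y - y')‖ ≤ ‖(y - P y) - (y' - P y')‖ + 1 / (2 * C) * ‖y - y'‖ := by
    refine le_trans (le_of_eq ?_) ((norm_add_le _ _).trans (add_le_add_right hP _))
    congr 1; abel
  have h2 : ‖y - y'‖ ≤ C * ‖(y - P y) - (y' - P y')‖ + 1 / 2 * ‖y - y'‖ := by
    refine hb.trans ((mul_le_mul_of_nonneg_left h1 hC.le).trans (le_of_eq ?_))
    field_simp
  linarith

lemma exists_fixed_of_near {X : Type*} [NormedAddCommGroup X] [NormedSpace ℝ X] [CompleteSpace X]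
    {T : X →L[ℝ] X} {Y : Submodule ℝ X} (hY : IsClosed (Y : Set X))
    {C : ℝ} (hC : 0 < C) (hb : ∀ y ∈ Y, ‖y‖ ≤ C * ‖y - T y‖) (hS : ∀ y ∈ Y, ∃ x ∈ Y, x - T x = y)
    {P : X → X} (hPY : ∀ y ∈ Y, P y ∈ Y) {y₀ : X} (hy₀ : y₀ ∈ Y) {r : ℝ} (hr : 0 < r)
    (hP : ∀ y ∈ closedBall y₀ r, ∀ y' ∈ closedBall y₀ r,
      ‖P y - P y' - T (y - y')‖ ≤ 1 / (2 * C) * ‖y - y'‖)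
    (h0 : ‖P y₀ - y₀‖ ≤ r / (2 * C)) :
    ∃ y ∈ Y, y ∈ closedBall y₀ r ∧ P y = y := by
  choose! S hSY hS using hS
  set Q : X → X := fun y => y + S (P y - y) with hQ
  have hQY : ∀ y ∈ Y, Q y ∈ Y := fun y hy => Y.add_mem hy (hSY _ (Y.sub_mem (hPY y hy) hy))
  have hd : ∀ y ∈ Y, ‖Q y - y‖ ≤ C * ‖P y - y‖ := fun y hy => by
    have hm := Y.sub_mem (hPY y hy) hy
    have := hb _ (hSY _ hm)
    rw [hS _ hm] at this
    simpa [hQ] using this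
  set s : Set X := Y ∩ closedBall y₀ r with hs
  have hcon : ∀ y ∈ s, ∀ y' ∈ s, ‖Q y - Q y'‖ ≤ 1 / 2 * ‖y - y'‖ := by
    intro y hy y' hy'
    have hm := Y.sub_mem (hPY y hy.1) hy.1
    have hm' := Y.sub_mem (hPY y' hy'.1) hy'.1
    have h1 := hb _ (Y.sub_mem (hQY y hy.1) (hQY y' hy'.1))
    have e : Q y - Q y' - T (Q y - Q y') = P y - P y' - T (y - y') := by
      have a1 := hS _ hm
      have a2 := hS _ hm'
      have : Q y - Q y' - T (Q y - Q y') = (y - y') - T (y - y') +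
          (S (P y - y) - T (S (P y - y))) - (S (P y' - y') - T (S (P y' - y'))) := by
        simp only [hQ, map_sub, map_add]; abel
      rw [this, a1, a2]; abel
    rw [e] at h1
    refine h1.trans ((mul_le_mul_of_nonneg_left (hP y hy.2 y' hy'.2) hC.le).trans (le_of_eq ?_))
    field_simp
  have hy₀s : y₀ ∈ s := ⟨hy₀, mem_closedBall_self hr.le⟩
  have hmaps : MapsTo Q s s := by
    intro y hy
    refine ⟨hQY y hy.1, ?_⟩
    rw [mem_closedBall_iff_norm]
    have h1 := hcon y hy y₀ hy₀s
    have h2 := hd y₀ hy₀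
    have h3 : C * ‖P y₀ - y₀‖ ≤ r / 2 :=
      (mul_le_mul_of_nonneg_left h0 hC.le).trans (le_of_eq (by field_simp))
    have h4 := mem_closedBall_iff_norm.1 hy.2
    calc ‖Q y - y₀‖ = ‖(Q y - Q y₀) + (Q y₀ - y₀)‖ := by congr 1; abel
      _ ≤ ‖Q y - Q y₀‖ + ‖Q y₀ - y₀‖ := norm_add_le _ _
      _ ≤ r := by linarith
  have hcw : ContractingWith (1 / 2) (hmaps.restrict Q s s) := by
    refine ⟨by norm_num, LipschitzWith.of_dist_le_mul fun y y' => ?_⟩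
    rw [Subtype.dist_eq, Subtype.dist_eq, dist_eq_norm, dist_eq_norm]
    simpa using hcon y y.2 y' y'.2
  obtain ⟨y, hy, hfix, -⟩ := hcw.exists_fixedPoint' ((hY.inter Metric.isClosed_closedBall).isComplete)
    hmaps hy₀s (edist_ne_top _ _)
  refine ⟨y, hy.1, hy.2, ?_⟩
  have hm := Y.sub_mem (hPY y hy.1) hy.1
  have h1 : S (P y - y) = 0 := by simpa [hQ, Function.IsFixedPt] using hfix
  have h2 := hS _ hm
  rw [h1, map_zero, sub_zero] at h2
  exact (sub_eq_zero.1 h2.symm)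

/-- Functions of the norm and of the inner products with the vectors of `S`. -/
def symm (S : Set 𝔼) : Submodule ℝ (𝔼 →ᵇ ℝ) where
  carrier := {z | ∀ x y, (∀ s ∈ S, inner ℝ s x = inner ℝ s y) → ‖x‖ = ‖y‖ → z x = z y}
  zero_mem' := fun _ _ _ _ => rfl
  add_mem' := fun {a b} ha hb x y h1 h2 => by
    change a x + b x = a y + b y
    rw [ha x y h1 h2, hb x y h1 h2]
  smul_mem' := fun c a ha x y h1 h2 => by
    change c • a x = c • a y
    rw [ha x y h1 h2]

lemma mem_symm {S : Set 𝔼} {z : 𝔼 →ᵇ ℝ} : z ∈ symm S ↔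
    ∀ x y, (∀ s ∈ S, inner ℝ s x = inner ℝ s y) → ‖x‖ = ‖y‖ → z x = z y := Iff.rfl

lemma symm_mono {S S' : Set 𝔼} (h : S ⊆ S') : symm S ≤ symm S' :=
  fun _ hz x y h1 h2 => hz x y (fun s hs => h1 s (h hs)) h2

lemma isClosed_symm (S : Set 𝔼) : IsClosed (symm S : Set (𝔼 →ᵇ ℝ)) := by
  have : (symm S : Set (𝔼 →ᵇ ℝ)) = ⋂ (x : 𝔼) (y : 𝔼) (_ : ∀ s ∈ S, inner ℝ s x = inner ℝ s y)
      (_ : ‖x‖ = ‖y‖), {z : 𝔼 →ᵇ ℝ | z x = z y} := by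
    ext z; simp [mem_symm]
  rw [this]
  refine isClosed_iInter fun x => isClosed_iInter fun y => isClosed_iInter fun _ =>
    isClosed_iInter fun _ => isClosed_eq ?_ ?_ <;> exact continuous_eval_const _

lemma mul_mem_symm {S : Set 𝔼} {a b : 𝔼 →ᵇ ℝ} (ha : a ∈ symm S) (hb : b ∈ symm S) : a * b ∈ symm S :=
  fun x y h1 h2 => by
    change a x * b x = a y * b y
    rw [ha x y h1 h2, hb x y h1 h2]

lemma IsResolvent.mem_symm {S : Set 𝔼} {q : 𝔼 → ℝ} {K : (𝔼 →ᵇ ℝ) →L[ℝ] (𝔼 →ᵇ ℝ)}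
    (H : IsResolvent q K) (hq : ∀ x, 0 < q x) (hqr : ∀ x y, ‖x‖ = ‖y‖ → q x = q y) {z : 𝔼 →ᵇ ℝ}
    (hz : z ∈ symm S) : K z ∈ symm S := by
  intro x y hxy hn
  set g := (ℝ ∙ (x - y))ᗮ.reflection with hg
  have hgx : g x = y := Submodule.reflection_sub hn
  have hgS : ∀ w, ∀ s ∈ S, inner ℝ s (g w) = inner ℝ s w := by
    intro w s hs
    have h0 : inner ℝ s (x - y) = 0 := by rw [inner_sub_right, hxy s hs, sub_self]
    have hmem : s ∈ (ℝ ∙ (x - y))ᗮ := by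
      rw [Submodule.mem_orthogonal_singleton_iff_inner_left]; exact h0
    conv_lhs => rw [← Submodule.reflection_mem_subspace_eq_self hmem]
    exact g.inner_map_map s w
  have hrg : ∀ w, rho 1 (g w) = rho 1 w := fun w => by simp [rho]
  have h1 := (H z).comp_isometry g
  let w : 𝔼 →ᵇ ℝ := (K z).compContinuous ⟨g, g.continuous⟩
  have hw : K z = w := by
    refine H.eq hq ?_
    convert h1 using 2 with p p
    · rw [hrg]; rfl
    · rw [hrg, hqr (g p) p (g.norm_map p), hz (g p) p (hgS p) (g.norm_map p)]; rfl
  rw [← hgx]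
  conv_lhs => rw [hw]
  rfl

/-- The bounded continuous function with the given values (zero when there is none). -/
noncomputable def mkB (f : 𝔼 → ℝ) : 𝔼 →ᵇ ℝ :=
  open Classical in
  if h : Continuous f ∧ ∃ C, ∀ x, ‖f x‖ ≤ C then
    BoundedContinuousFunction.ofNormedAddCommGroup f h.1 h.2.choose h.2.choose_spec else 0

lemma mkB_apply {f : 𝔼 → ℝ} (hf : Continuous f) {C : ℝ} (hC : ∀ x, |f x| ≤ C) (x : 𝔼) :
    mkB f x = f x := by
  rw [mkB, dif_pos ⟨hf, C, hC⟩]; rfl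

lemma exists_deriv_bound {G : ℝ → ℝ} (hG : ContDiff ℝ 1 G) (M : ℝ) :
    ∃ L > (0:ℝ), ∀ s, |s| ≤ M → |deriv G s| ≤ L := by
  obtain ⟨C, hC⟩ := (isCompact_Icc (a := -M) (b := M)).exists_bound_of_continuousOn
    (hG.continuous_deriv le_rfl).continuousOn
  exact ⟨max C 1, by positivity, fun s hs => (hC s (abs_le.1 hs)).trans (le_max_left _ _)⟩

lemma abs_sub_sub_le {G : ℝ → ℝ} (hG : ContDiff ℝ 1 G) {a b c L : ℝ}
    (hL : ∀ s ∈ uIcc a b, |deriv G s - c| ≤ L) : |G a - G b - c * (a - b)| ≤ L * |a - b| := by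
  have hd : Differentiable ℝ G := hG.differentiable (by norm_num)
  have h := (convex_uIcc a b).norm_image_sub_le_of_norm_hasDerivWithin_le
    (f := fun s => G s - c * s) (f' := fun s => deriv G s - c) (C := L) (x := b) (y := a)
    (fun s _ => (((hd s).hasDerivAt.sub ((hasDerivAt_id s).const_mul c)).congr_deriv
      (by simp)).hasDerivWithinAt) hL right_mem_uIcc left_mem_uIcc
  rw [norm_eq_abs, norm_eq_abs] at h
  convert h using 2; ring

lemma abs_le_mul_of_deriv_bound {G : ℝ → ℝ} (hG : ContDiff ℝ 1 G) (h0 : G 0 = 0) {L s : ℝ}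
    (hL : ∀ t, |t| ≤ |s| → |deriv G t| ≤ L) : |G s| ≤ L * |s| := by
  have := abs_sub_sub_le hG (a := s) (b := 0) (c := 0) (L := L) (fun t ht => by
    rw [sub_zero]
    refine hL t ?_
    rw [uIcc_comm, mem_uIcc] at ht
    rcases ht with ⟨h1, h2⟩ | ⟨h1, h2⟩
    · rw [abs_of_nonneg h1, abs_of_nonneg (h1.trans h2)]; exact h2
    · rw [abs_of_nonpos h2, abs_of_nonpos (h1.trans h2)]; linarith)
  simpa [h0] using this

/-- The superposition operator `z ↦ G(ρz)/ρ`. -/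
noncomputable def nl (G : ℝ → ℝ) (z : 𝔼 →ᵇ ℝ) : 𝔼 →ᵇ ℝ :=
  mkB fun x => G (rho 1 x * z x) / rho 1 x

/-- The multiplier `G'(ρz)`. -/
noncomputable def nld (G : ℝ → ℝ) (z : 𝔼 →ᵇ ℝ) : 𝔼 →ᵇ ℝ :=
  mkB fun x => deriv G (rho 1 x * z x)

lemma abs_rho_mul_le (z : 𝔼 →ᵇ ℝ) (x : 𝔼) : |rho 1 x * z x| ≤ ‖z‖ := by
  rw [abs_mul, abs_of_pos (rho_pos 1 x)]
  have := z.norm_coe_le_norm x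
  rw [norm_eq_abs] at this
  have h2 := rho_le_one zero_le_one x
  have h3 := rho_pos 1 x
  nlinarith [abs_nonneg (z x)]

lemma continuous_rho_mul (z : 𝔼 →ᵇ ℝ) : Continuous fun x => rho 1 x * z x :=
  ((contDiff_rho 1 (n := 0)).continuous).mul z.continuous

lemma nl_apply {G : ℝ → ℝ} (hG : ContDiff ℝ 1 G) (h0 : G 0 = 0) (z : 𝔼 →ᵇ ℝ) (x : 𝔼) :
    nl G z x = G (rho 1 x * z x) / rho 1 x := by
  obtain ⟨L, hL, h⟩ := exists_deriv_bound hG ‖z‖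
  refine mkB_apply (C := L * ‖z‖) ?_ (fun y => ?_) x
  · exact (hG.continuous.comp (continuous_rho_mul z)).div (contDiff_rho 1 (n := 0)).continuous
      fun x => (rho_pos 1 x).ne'
  · have hr := rho_pos 1 y
    have := abs_le_mul_of_deriv_bound hG h0 (s := rho 1 y * z y) (L := L)
      (fun t ht => h t (ht.trans (abs_rho_mul_le z y)))
    rw [abs_div, abs_of_pos hr, div_le_iff₀ hr]
    have h2 := z.norm_coe_le_norm y
    rw [norm_eq_abs] at h2
    rw [abs_mul, abs_of_pos hr] at this
    calc _ ≤ _ := this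
      _ = L * |z y| * rho 1 y := by ring
      _ ≤ _ := by gcongr

lemma rho_mul_nl {G : ℝ → ℝ} (hG : ContDiff ℝ 1 G) (h0 : G 0 = 0) (z : 𝔼 →ᵇ ℝ) (x : 𝔼) :
    rho 1 x * nl G z x = G (rho 1 x * z x) := by
  rw [nl_apply hG h0]; field_simp [(rho_pos 1 x).ne']

lemma nld_apply {G : ℝ → ℝ} (hG : ContDiff ℝ 1 G) (z : 𝔼 →ᵇ ℝ) (x : 𝔼) :
    nld G z x = deriv G (rho 1 x * z x) := by
  obtain ⟨L, hL, h⟩ := exists_deriv_bound hG ‖z‖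
  exact mkB_apply (C := L) ((hG.continuous_deriv le_rfl).comp (continuous_rho_mul z))
    (fun y => h _ (abs_rho_mul_le z y)) x

lemma rho_eq_of_norm_eq {c : ℝ} {x y : 𝔼} (h : ‖x‖ = ‖y‖) : rho c x = rho c y := by
  rw [rho, rho, h]

lemma nl_mem_symm {G : ℝ → ℝ} (hG : ContDiff ℝ 1 G) (h0 : G 0 = 0) {S : Set 𝔼} {z : 𝔼 →ᵇ ℝ}
    (hz : z ∈ symm S) : nl G z ∈ symm S := fun x y h1 h2 => by
  rw [nl_apply hG h0, nl_apply hG h0, hz x y h1 h2, rho_eq_of_norm_eq h2]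

lemma nld_mem_symm {G : ℝ → ℝ} (hG : ContDiff ℝ 1 G) {S : Set 𝔼} {z : 𝔼 →ᵇ ℝ}
    (hz : z ∈ symm S) : nld G z ∈ symm S := fun x y h1 h2 => by
  rw [nld_apply hG, nld_apply hG, hz x y h1 h2, rho_eq_of_norm_eq h2]

lemma tendsto_nld {G : ℝ → ℝ} (hG : ContDiff ℝ 1 G) (h1 : deriv G 0 = 0) (z : 𝔼 →ᵇ ℝ) :
    Tendsto (nld G z) (cocompact 𝔼) (𝓝 0) := by
  have : (nld G z : 𝔼 → ℝ) = fun x => deriv G (rho 1 x * z x) := funext (nld_apply hG z)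
  rw [this, ← h1]
  exact ((hG.continuous_deriv le_rfl).tendsto 0).comp (tendsto_rho_mul z)

lemma tendsto_nl {G : ℝ → ℝ} (hG : ContDiff ℝ 1 G) (h0 : G 0 = 0) (h1 : deriv G 0 = 0) (z : 𝔼 →ᵇ ℝ) :
    Tendsto (nl G z) (cocompact 𝔼) (𝓝 0) := by
  rw [Metric.tendsto_nhds]
  intro ε hε
  have hc := (hG.continuous_deriv le_rfl).tendsto 0
  rw [h1, Metric.tendsto_nhds_nhds] at hc
  obtain ⟨δ, hδ, h⟩ := hc (ε / (2 * (‖z‖ + 1))) (by positivity)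
  filter_upwards [(Metric.tendsto_nhds.1 (tendsto_rho_mul z)) δ hδ] with x hx
  have hr := rho_pos 1 x
  rw [Real.dist_eq, sub_zero] at hx ⊢
  have := abs_le_mul_of_deriv_bound hG h0 (s := rho 1 x * z x) (L := ε / (2 * (‖z‖ + 1))) (fun t ht => by
    have := h (x := t) (by rw [Real.dist_eq, sub_zero]; exact ht.trans_lt hx)
    rw [Real.dist_eq, sub_zero] at this
    exact this.le)
  rw [nl_apply hG h0, abs_div, abs_of_pos hr, div_lt_iff₀ hr]
  have h2 := z.norm_coe_le_norm x
  rw [norm_eq_abs] at h2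
  rw [abs_mul (rho 1 x), abs_of_pos hr] at this
  refine this.trans_lt ?_
  have h3 : ε / (2 * (‖z‖ + 1)) * (rho 1 x * |z x|) = (ε * rho 1 x) * (|z x| / (2 * (‖z‖ + 1))) := by
    ring
  rw [h3]
  have h4 : |z x| / (2 * (‖z‖ + 1)) < 1 := by
    rw [div_lt_one (by positivity)]; linarith [norm_nonneg z]
  nlinarith [mul_pos hε hr]

lemma exists_nl_near {G : ℝ → ℝ} (hG : ContDiff ℝ 1 G) (h0 : G 0 = 0) (z₀ : 𝔼 →ᵇ ℝ) {δ : ℝ}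
    (hδ : 0 < δ) : ∃ r > (0:ℝ), ∀ z ∈ closedBall z₀ r, ∀ z' ∈ closedBall z₀ r,
      ‖nl G z - nl G z' - nld G z₀ * (z - z')‖ ≤ δ * ‖z - z'‖ := by
  have huc := (isCompact_Icc (a := -(‖z₀‖ + 1)) (b := ‖z₀‖ + 1)).uniformContinuousOn_of_continuous
    (hG.continuous_deriv le_rfl).continuousOn
  obtain ⟨η, hη, h⟩ := Metric.uniformContinuousOn_iff.1 huc δ hδ
  refine ⟨min (η / 2) 1, by positivity, fun z hz z' hz' => ?_⟩
  refine (BoundedContinuousFunction.norm_le (by positivity)).2 fun x => ?_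
  have hr := rho_pos 1 x
  have hb : ∀ w ∈ closedBall z₀ (min (η / 2) 1), |rho 1 x * w x - rho 1 x * z₀ x| ≤ min (η / 2) 1 := by
    intro w hw
    rw [← mul_sub]
    exact (abs_rho_mul_le (w - z₀) x).trans (mem_closedBall_iff_norm.1 hw)
  have key := abs_sub_sub_le hG (a := rho 1 x * z x) (b := rho 1 x * z' x)
    (c := deriv G (rho 1 x * z₀ x)) (L := δ) (fun s hs => by
      have hs1 : |s - rho 1 x * z₀ x| ≤ min (η / 2) 1 := by
        have c1 := abs_le.1 (hb z hz)
        have c2 := abs_le.1 (hb z' hz')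
        rw [mem_uIcc] at hs
        rw [abs_le]
        rcases hs with hs | hs <;> constructor <;> linarith [hs.1, hs.2]
      have hz0 := abs_le.1 (abs_rho_mul_le z₀ x)
      have c3 := abs_le.1 (hs1.trans (min_le_right _ _))
      have := h s ⟨by linarith, by linarith⟩ (rho 1 x * z₀ x) ⟨by linarith, by linarith⟩ (by
        rw [Real.dist_eq]; exact (hs1.trans (min_le_left _ _)).trans_lt (by linarith))
      rw [Real.dist_eq] at this
      exact this.le)
  have e : (nl G z - nl G z' - nld G z₀ * (z - z')) x =
      (G (rho 1 x * z x) - G (rho 1 x * z' x) - deriv G (rho 1 x * z₀ x) * (rho 1 x * z x - rho 1 x * z' x)) /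
        rho 1 x := by
    change nl G z x - nl G z' x - nld G z₀ x * (z x - z' x) = _
    rw [nl_apply hG h0, nl_apply hG h0, nld_apply hG]
    field_simp
  rw [e, norm_eq_abs, abs_div, abs_of_pos hr, div_le_iff₀ hr]
  refine key.trans ?_
  rw [← mul_sub, abs_mul, abs_of_pos hr]
  have := (z - z').norm_coe_le_norm x
  rw [norm_eq_abs] at this
  change |z x - z' x| ≤ _ at this
  calc _ = δ * |z x - z' x| * rho 1 x := by ring
    _ ≤ _ := by gcongr

/-- The multiplier `‖x‖^α / qq m α`. -/
noncomputable def ff (m α : ℝ) : 𝔼 →ᵇ ℝ := m⁻¹ • (1 - (8:ℝ) • bq m α)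

/-- The right-hand side of the equation, divided by `qq m α * rho 1`. -/
noncomputable def hh (G : ℝ → ℝ) (m α : ℝ) (z : 𝔼 →ᵇ ℝ) :
    𝔼 →ᵇ ℝ :=
  (8:ℝ) • (bq m α * z) + ff m α * nl G z

/-- The derivative of `hh`, as a multiplier. -/
noncomputable def bet (G : ℝ → ℝ) (m α : ℝ) (z : 𝔼 →ᵇ ℝ) :
    𝔼 →ᵇ ℝ :=
  (8:ℝ) • bq m α + ff m α * nld G z

/-- The fixed-point map with parameters `α` and `s`. -/
noncomputable def PP (G : ℝ → ℝ) (m : ℝ) (ell : (𝔼 →ᵇ ℝ) →L[ℝ] ℝ)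
    (zf zu : 𝔼 →ᵇ ℝ) (α s : ℝ) (z : 𝔼 →ᵇ ℝ) :
    𝔼 →ᵇ ℝ :=
  KK m α (hh G m α z + (s - ell (z - zu)) • zf)

/-- The derivative of the fixed-point map at `zu`. -/
noncomputable def TT (G : ℝ → ℝ) (m : ℝ) (ell : (𝔼 →ᵇ ℝ) →L[ℝ] ℝ)
    (zf zu : 𝔼 →ᵇ ℝ) (α : ℝ) :
    (𝔼 →ᵇ ℝ) →L[ℝ] (𝔼 →ᵇ ℝ) :=
  (KK m α).comp (ContinuousLinearMap.mul ℝ (𝔼 →ᵇ ℝ) (bet G m α zu)) -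
    ell.smulRight (KK m α zf)

lemma norm_bq_le {m α : ℝ} (hm : 0 < m) (hα : 0 < α) : ‖(bq m α : 𝔼 →ᵇ ℝ)‖ ≤ 1 := by
  refine (BoundedContinuousFunction.norm_le zero_le_one).2 fun x => ?_
  have := qq_ge hm α x
  rw [bq_apply hm hα, norm_of_nonneg (by positivity)]
  exact inv_le_one_of_one_le₀ (by linarith)

lemma norm_ff_le {m α : ℝ} (hm : 0 < m) (hα : 0 < α) : ‖(ff m α : 𝔼 →ᵇ ℝ)‖ ≤ 9 / m := by
  have h1 : ‖(1 : 𝔼 →ᵇ ℝ) - (8:ℝ) • bq m α‖ ≤ 9 := by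
    refine (norm_sub_le _ _).trans ?_
    have h2 : ‖(1 : 𝔼 →ᵇ ℝ)‖ ≤ 1 := (BoundedContinuousFunction.norm_le zero_le_one).2 fun x => by simp
    have h3 : ‖(8:ℝ) • (bq m α : 𝔼 →ᵇ ℝ)‖ ≤ 8 := by
      rw [norm_smul]; have := norm_bq_le (N := N) hm hα; norm_num; linarith
    linarith
  rw [ff, norm_smul, norm_inv, norm_of_nonneg hm.le, div_eq_inv_mul]
  gcongr

lemma ff_apply {m α : ℝ} (hm : 0 < m) (hα : 0 < α) (x : 𝔼) :
    qq m α x * ff m α x = ‖x‖ ^ α := by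
  have h : ff m α x = m⁻¹ * (1 - 8 * bq m α x) := rfl
  have := qq_ge hm α x
  rw [h, bq_apply hm hα]
  field_simp
  unfold qq; ring

lemma bq_mem_symm {m α : ℝ} (hm : 0 < m) (hα : 0 < α) (S : Set 𝔼) : bq m α ∈ symm S :=
  fun x y _ h => by rw [bq_apply hm hα, bq_apply hm hα, qq, qq, h]

lemma ff_mem_symm {m α : ℝ} (hm : 0 < m) (hα : 0 < α) (S : Set 𝔼) : ff m α ∈ symm S :=
  Submodule.smul_mem _ _ (Submodule.sub_mem _ (fun _ _ _ _ => rfl)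
    (Submodule.smul_mem _ _ (bq_mem_symm hm hα S)))

lemma KK_mem_symm (hN : 1 ≤ N) {m α : ℝ} (hm : 0 < m) (hα : 0 < α) {S : Set 𝔼} {z : 𝔼 →ᵇ ℝ}
    (hz : z ∈ symm S) : KK m α z ∈ symm S :=
  (KK_spec hN hm hα).1.mem_symm (fun x => by linarith [qq_ge hm α x])
    (fun x y h => by rw [qq, qq, h]) hz

lemma norm_KK_le (hN : 1 ≤ N) {m α : ℝ} (hm : 0 < m) (hα : 0 < α) (z : 𝔼 →ᵇ ℝ) :
    ‖KK m α z‖ ≤ 2 * ‖z‖ :=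
  ((KK m α).le_opNorm z).trans (mul_le_mul_of_nonneg_right (KK_spec hN hm hα).2 (norm_nonneg _))

variable {G : ℝ → ℝ} {m α : ℝ} {ell : (EuclideanSpace ℝ (Fin N) →ᵇ ℝ) →L[ℝ] ℝ}
  {zf zu : EuclideanSpace ℝ (Fin N) →ᵇ ℝ}

lemma hh_mem_symm (hG : ContDiff ℝ 1 G) (h0 : G 0 = 0) (hm : 0 < m) (hα : 0 < α) {S : Set 𝔼}
    {z : 𝔼 →ᵇ ℝ} (hz : z ∈ symm S) : hh G m α z ∈ symm S :=
  Submodule.add_mem _ (Submodule.smul_mem _ _ (mul_mem_symm (bq_mem_symm hm hα S) hz))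
    (mul_mem_symm (ff_mem_symm hm hα S) (nl_mem_symm hG h0 hz))

lemma bet_mem_symm (hG : ContDiff ℝ 1 G) (hm : 0 < m) (hα : 0 < α) {S : Set 𝔼}
    {z : 𝔼 →ᵇ ℝ} (hz : z ∈ symm S) : bet G m α z ∈ symm S :=
  Submodule.add_mem _ (Submodule.smul_mem _ _ (bq_mem_symm hm hα S))
    (mul_mem_symm (ff_mem_symm hm hα S) (nld_mem_symm hG hz))

lemma tendsto_mul_zero {a b : 𝔼 →ᵇ ℝ} (hb : Tendsto b (cocompact 𝔼) (𝓝 0)) :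
    Tendsto (a * b : 𝔼 →ᵇ ℝ) (cocompact 𝔼) (𝓝 0) :=
  bdd_le_mul_tendsto_zero' ‖a‖ (Eventually.of_forall fun x => a.norm_coe_le_norm x) hb

lemma tendsto_hh (hG : ContDiff ℝ 1 G) (h0 : G 0 = 0) (h1 : deriv G 0 = 0) (hm : 0 < m) (hα : 0 < α)
    (z : 𝔼 →ᵇ ℝ) : Tendsto (hh G m α z) (cocompact 𝔼) (𝓝 0) := by
  have e1 := (tendsto_mul_zero (a := z) (tendsto_bq (N := N) hm hα)).const_mul 8
  have e2 := tendsto_mul_zero (a := ff m α) (tendsto_nl hG h0 h1 z)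
  have := e1.add e2
  rw [mul_zero, add_zero] at this
  refine this.congr fun x => ?_
  change 8 * (z x * bq m α x) + ff m α x * nl G z x = 8 * (bq m α x * z x) + ff m α x * nl G z x
  ring

lemma tendsto_bet (hG : ContDiff ℝ 1 G) (h1 : deriv G 0 = 0) (hm : 0 < m) (hα : 0 < α)
    (z : 𝔼 →ᵇ ℝ) : Tendsto (bet G m α z) (cocompact 𝔼) (𝓝 0) := by
  have e1 := (tendsto_bq (N := N) hm hα).const_mul 8
  have e2 := tendsto_mul_zero (a := ff m α) (tendsto_nld hG h1 z)
  have := e1.add e2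
  rw [mul_zero, add_zero] at this
  exact this

lemma hh_sub (z z' z₀ : 𝔼 →ᵇ ℝ) : hh G m α z - hh G m α z' - bet G m α z₀ * (z - z') =
    ff m α * (nl G z - nl G z' - nld G z₀ * (z - z')) := by
  ext x
  change (8 * (bq m α x * z x) + ff m α x * nl G z x) - (8 * (bq m α x * z' x) + ff m α x * nl G z' x) -
    (8 * bq m α x + ff m α x * nld G z₀ x) * (z x - z' x) =
    ff m α x * (nl G z x - nl G z' x - nld G z₀ x * (z x - z' x))
  ring

lemma continuousAt_ff (hm : 0 < m) (hα : 0 < α) :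
    ContinuousAt (fun β => (ff m β : 𝔼 →ᵇ ℝ)) α :=
  (continuousAt_const.sub ((continuousAt_bq hm hα).const_smul (8:ℝ))).const_smul m⁻¹

lemma continuousAt_hh (hm : 0 < m) (hα : 0 < α) (z : 𝔼 →ᵇ ℝ) :
    ContinuousAt (fun β => hh G m β z) α :=
  (((continuousAt_bq hm hα).mul continuousAt_const).const_smul (8:ℝ)).add
    ((continuousAt_ff hm hα).mul continuousAt_const)

lemma continuousAt_bet (hm : 0 < m) (hα : 0 < α) (z : 𝔼 →ᵇ ℝ) :
    ContinuousAt (fun β => bet G m β z) α :=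
  ((continuousAt_bq hm hα).const_smul (8:ℝ)).add
    ((continuousAt_ff hm hα).mul continuousAt_const)

lemma continuousAt_KK (hN : 1 ≤ N) (hm : 0 < m) (hα : 0 < α) {k : ℝ → 𝔼 →ᵇ ℝ}
    (hk : ContinuousAt k α) (h0 : Tendsto (k α) (cocompact 𝔼) (𝓝 0)) :
    ContinuousAt (fun β => KK m β (k β)) α := by
  rw [ContinuousAt, Metric.tendsto_nhds]
  intro ε hε
  filter_upwards [Metric.tendsto_nhds.1 hk (ε / 4) (by positivity),
    tendsto_KK_mul hN hm hα h0 (show 0 < ε / 4 by positivity), eventually_gt_nhds hα] with β h1 h2 h3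
  rw [dist_eq_norm] at h1 ⊢
  have e2 := h2 1
  rw [mul_one] at e2
  have e3 : ‖(1 : 𝔼 →ᵇ ℝ)‖ ≤ 1 := (BoundedContinuousFunction.norm_le zero_le_one).2 fun x => by simp
  have e1 := norm_KK_le hN hm h3 (k β - k α)
  rw [map_sub] at e1
  calc ‖KK m β (k β) - KK m α (k α)‖ = ‖(KK m β (k β) - KK m β (k α)) + (KK m β (k α) - KK m α (k α))‖ := by
        congr 1; abel
    _ ≤ ‖KK m β (k β) - KK m β (k α)‖ + ‖KK m β (k α) - KK m α (k α)‖ := norm_add_le _ _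
    _ < ε := by nlinarith

lemma continuousAt_PP (hN : 1 ≤ N) (hG : ContDiff ℝ 1 G) (h0 : G 0 = 0) (h1 : deriv G 0 = 0)
    (hm : 0 < m) (hα : 0 < α) (hzf : Tendsto zf (cocompact 𝔼) (𝓝 0)) (s : ℝ) (z : 𝔼 →ᵇ ℝ) :
    ContinuousAt (fun β => PP G m ell zf zu β s z) α := by
  refine continuousAt_KK hN hm hα ((continuousAt_hh hm hα z).add continuousAt_const) ?_
  have := (tendsto_hh hG h0 h1 hm hα z).add (hzf.const_mul (s - ell (z - zu)))
  rw [mul_zero, add_zero] at this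
  exact this

lemma PP_sub_PP (s s' : ℝ) (z : 𝔼 →ᵇ ℝ) :
    PP G m ell zf zu α s z - PP G m ell zf zu α s' z = (s - s') • KK m α zf := by
  rw [PP, PP, ← map_sub, ← map_smul]; congr 1; module

lemma PP_mem_symm (hN : 1 ≤ N) (hG : ContDiff ℝ 1 G) (h0 : G 0 = 0) (hm : 0 < m) (hα : 0 < α)
    {S : Set 𝔼} (s : ℝ) (hzf : zf ∈ symm S) {z : 𝔼 →ᵇ ℝ} (hz : z ∈ symm S) :
    PP G m ell zf zu α s z ∈ symm S :=
  KK_mem_symm hN hm hα (Submodule.add_mem _ (hh_mem_symm hG h0 hm hα hz) (Submodule.smul_mem _ _ hzf))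

lemma TT_mem_symm (hN : 1 ≤ N) (hG : ContDiff ℝ 1 G) (hm : 0 < m) (hα : 0 < α)
    {S : Set 𝔼} (hzf : zf ∈ symm S) (hzu : zu ∈ symm S) {z : 𝔼 →ᵇ ℝ} (hz : z ∈ symm S) :
    TT G m ell zf zu α z ∈ symm S :=
  Submodule.sub_mem _ (KK_mem_symm hN hm hα (mul_mem_symm (bet_mem_symm hG hm hα hzu) hz))
    (Submodule.smul_mem _ _ (KK_mem_symm hN hm hα hzf))

lemma TT_isCompactOperator (hN : 1 ≤ N) (hG : ContDiff ℝ 1 G) (h1 : deriv G 0 = 0) (hm : 0 < m)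
    (hα : 0 < α) : IsCompactOperator (TT G m ell zf zu α) := by
  refine IsCompactOperator.sub ?_ ?_
  · exact (KK_spec hN hm hα).1.isCompactOperator_mul hN (continuous_qq m hα.le) (qq_ge hm α)
      (KK_spec hN hm hα).2 (tendsto_bet hG h1 hm hα zu)
  · have h2 : IsCompactOperator (ell : (𝔼 →ᵇ ℝ) → ℝ) :=
      isCompactOperator_of_locallyCompactSpace_dom ell
    exact h2.clm_comp ((ContinuousLinearMap.id ℝ ℝ).smulRight (KK m α zf))

lemma PP_near (hN : 1 ≤ N) (hG : ContDiff ℝ 1 G) (h0 : G 0 = 0) (h1 : deriv G 0 = 0)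
    (hm : 0 < m) (hα : 0 < α) (hzf : Tendsto zf (cocompact 𝔼) (𝓝 0)) {δ : ℝ} (hδ : 0 < δ) :
    ∃ r₀ > (0:ℝ), ∃ a > (0:ℝ), ∀ β, |β - α| ≤ a → ∀ s : ℝ, ∀ z ∈ closedBall zu r₀,
      ∀ z' ∈ closedBall zu r₀,
      ‖PP G m ell zf zu β s z - PP G m ell zf zu β s z' - TT G m ell zf zu α (z - z')‖ ≤
        δ * ‖z - z'‖ := by
  set δ' := δ / (18 / m + 2 + 1 + ‖ell‖) with hδ'
  have hden : 0 < 18 / m + 2 + 1 + ‖ell‖ := by positivity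
  have hδ'0 : 0 < δ' := by positivity
  obtain ⟨r₀, hr₀, hnl⟩ := exists_nl_near hG h0 zu hδ'0
  have hev := (Metric.tendsto_nhds.1 (continuousAt_bet (G := G) (N := N) hm hα zu) δ' hδ'0).and
    ((tendsto_KK_mul hN hm hα (tendsto_bet hG h1 hm hα zu) hδ'0).and
    ((Metric.tendsto_nhds.1 (continuousAt_KK hN hm hα (k := fun _ => zf) continuousAt_const hzf) δ' hδ'0).and
    (eventually_gt_nhds hα)))
  obtain ⟨a, ha, hev⟩ := Metric.eventually_nhds_iff.1 hev
  refine ⟨r₀, hr₀, a / 2, by positivity, fun β hβ s z hz z' hz' => ?_⟩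
  obtain ⟨e1, e2, e3, e4⟩ := hev (y := β) (by rw [Real.dist_eq]; linarith)
  rw [dist_eq_norm] at e1 e3
  have k1 := hnl z hz z' hz'
  have hd := norm_nonneg (z - z')
  have e : PP G m ell zf zu β s z - PP G m ell zf zu β s z' - TT G m ell zf zu α (z - z') =
      KK m β (ff m β * (nl G z - nl G z' - nld G zu * (z - z'))) +
      KK m β ((bet G m β zu - bet G m α zu) * (z - z')) +
      (KK m β (bet G m α zu * (z - z')) - KK m α (bet G m α zu * (z - z'))) -
      ell (z - z') • (KK m β zf - KK m α zf) := by
    rw [← hh_sub, sub_mul]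
    change KK m β _ - KK m β _ - (KK m α (bet G m α zu * (z - z')) - ell (z - z') • KK m α zf) = _
    simp only [map_sub, map_add, map_smul]
    module
  rw [e]
  have b1 : ‖KK m β (ff m β * (nl G z - nl G z' - nld G zu * (z - z')))‖ ≤ 18 / m * δ' * ‖z - z'‖ := by
    refine (norm_KK_le hN hm e4 _).trans ?_
    have := (norm_mul_le (ff m β) (nl G z - nl G z' - nld G zu * (z - z'))).trans
      (mul_le_mul (norm_ff_le hm e4) k1 (norm_nonneg _) (by positivity))
    calc _ ≤ 2 * (9 / m * (δ' * ‖z - z'‖)) := by gcongr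
      _ = _ := by ring
  have b2 : ‖KK m β ((bet G m β zu - bet G m α zu) * (z - z'))‖ ≤ 2 * δ' * ‖z - z'‖ := by
    refine (norm_KK_le hN hm e4 _).trans ?_
    have := (norm_mul_le (bet G m β zu - bet G m α zu) (z - z')).trans
      (mul_le_mul_of_nonneg_right e1.le hd)
    linarith
  have b3 := e2 (z - z')
  have b4 : ‖ell (z - z') • (KK m β zf - KK m α zf)‖ ≤ ‖ell‖ * δ' * ‖z - z'‖ := by
    rw [norm_smul]
    calc _ ≤ (‖ell‖ * ‖z - z'‖) * δ' :=
          mul_le_mul (ell.le_opNorm _) e3.le (norm_nonneg _) (by positivity)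
      _ = _ := by ring
  have hfin : δ * ‖z - z'‖ = 18 / m * δ' * ‖z - z'‖ + 2 * δ' * ‖z - z'‖ + δ' * ‖z - z'‖ +
      ‖ell‖ * δ' * ‖z - z'‖ := by
    have : δ = δ' * (18 / m + 2 + 1 + ‖ell‖) := by rw [hδ']; field_simp
    conv_lhs => rw [this]
    ring
  rw [hfin]
  exact (norm_sub_le _ _).trans (add_le_add (norm_add₃_le.trans
    (add_le_add (add_le_add b1 b2) b3)) b4)

lemma qq_mul_hh (hG : ContDiff ℝ 1 G) (h0 : G 0 = 0) (hm : 0 < m) (hα : 0 < α) (z : 𝔼 →ᵇ ℝ) (x : 𝔼) :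
    qq m α x * (rho 1 x * hh G m α z x) = 8 * (rho 1 x * z x) + ‖x‖ ^ α * G (rho 1 x * z x) := by
  have e : hh G m α z x = 8 * (bq m α x * z x) + ff m α x * nl G z x := rfl
  have h8 := qq_ge hm α x
  rw [e, ← ff_apply hm hα x, ← rho_mul_nl hG h0, bq_apply hm hα]
  field_simp

lemma qq_mul_bet (hG : ContDiff ℝ 1 G) (hm : 0 < m) (hα : 0 < α) (z : 𝔼 →ᵇ ℝ) (x : 𝔼) :
    qq m α x * bet G m α z x = 8 + ‖x‖ ^ α * deriv G (rho 1 x * z x) := by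
  have e : bet G m α z x = 8 * bq m α x + ff m α x * nld G z x := rfl
  have h8 := qq_ge hm α x
  rw [e, ← ff_apply hm hα x, nld_apply hG, bq_apply hm hα]
  field_simp

lemma KK_hh_eq_iff (hN : 1 ≤ N) (hG : ContDiff ℝ 1 G) (h0 : G 0 = 0) (hm : 0 < m) (hα : 0 < α)
    (c : ℝ) (z : 𝔼 →ᵇ ℝ) : KK m α (hh G m α z + c • zf) = z ↔
    LSol (fun x => rho 1 x * z x) (fun x => ‖x‖ ^ α * (G (rho 1 x * z x) - m * (rho 1 x * z x)) +
      c * (qq m α x * (rho 1 x * zf x))) := by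
  have e : (fun x => ‖x‖ ^ α * (G (rho 1 x * z x) - m * (rho 1 x * z x)) +
      c * (qq m α x * (rho 1 x * zf x))) =
      fun x => qq m α x * (rho 1 x * (hh G m α z + c • zf) x) - qq m α x * (rho 1 x * z x) := by
    funext x
    have e1 : (hh G m α z + c • zf) x = hh G m α z x + c * zf x := rfl
    have e2 : qq m α x * (rho 1 x * (hh G m α z x + c * zf x)) =
      qq m α x * (rho 1 x * hh G m α z x) + c * (qq m α x * (rho 1 x * zf x)) := by ring
    rw [e1, e2, qq_mul_hh hG h0 hm hα, qq]
    ring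
  rw [e]
  constructor
  · intro h
    have := (KK_spec hN hm hα).1 (hh G m α z + c • zf)
    rwa [h] at this
  · exact KK_eq hN hm hα

lemma TT_eq_imp (hN : 1 ≤ N) (hG : ContDiff ℝ 1 G) (hm : 0 < m) (hα : 0 < α)
    {z : 𝔼 →ᵇ ℝ} (h : TT G m ell zf zu α z = z) :
    LSol (fun x => rho 1 x * z x) (fun x =>
      ‖x‖ ^ α * (deriv G (rho 1 x * zu x) - m) * (rho 1 x * z x) -
      ell z * (qq m α x * (rho 1 x * zf x))) := by
  have h' : KK m α (bet G m α zu * z - ell z • zf) = z := by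
    rw [map_sub, map_smul]; exact h
  have := (KK_spec hN hm hα).1 (bet G m α zu * z - ell z • zf)
  rw [h'] at this
  convert this using 2 with x
  have e1 : (bet G m α zu * z - ell z • zf) x = bet G m α zu x * z x - ell z * zf x := rfl
  have e2 : qq m α x * (rho 1 x * (bet G m α zu x * z x - ell z * zf x)) =
    qq m α x * bet G m α zu x * (rho 1 x * z x) - ell z * (qq m α x * (rho 1 x * zf x)) := by ring
  rw [e1, e2, qq_mul_bet hG hm hα, qq]
  ring

/-- The zonal solid harmonic of degree `j` about the axis `e`, with value one at the pole. -/
noncomputable def HH (e : Fin N) : ℕ → 𝔼 → ℝ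
  | 0 => fun _ => 1
  | 1 => fun x => x e
  | j + 2 => fun x => ((2 * j + N) * x e * HH e (j + 1) x - (j + 1) * ‖x‖ ^ 2 * HH e j x)
      / (j + N - 1)

lemma HH_zero (e : Fin N) (x : 𝔼) : HH e 0 x = 1 := by simp [HH]
lemma HH_one (e : Fin N) (x : 𝔼) : HH e 1 x = x e := by simp [HH]
lemma HH_succ (e : Fin N) (j : ℕ) (x : 𝔼) : HH e (j + 2) x =
    ((2 * j + N) * x e * HH e (j + 1) x - (j + 1) * ‖x‖ ^ 2 * HH e j x) / (j + N - 1) := by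
  rw [HH]

lemma HH_contDiff (e : Fin N) (j : ℕ) {n : WithTop ℕ∞} : ContDiff ℝ n (HH e j : 𝔼 → ℝ) := by
  suffices h : ContDiff ℝ ⊤ (HH e j : 𝔼 → ℝ) ∧ ContDiff ℝ ⊤ (HH e (j + 1) : 𝔼 → ℝ) from
    h.1.of_le le_top
  induction j with
  | zero =>
    refine ⟨?_, ?_⟩
    · rw [show (HH e 0 : 𝔼 → ℝ) = fun _ => 1 from funext fun x => HH_zero e x]
      exact contDiff_const
    · rw [show (HH e (0 + 1) : 𝔼 → ℝ) = fun x => x e from funext fun x => HH_one e x]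
      exact contDiff_coord e
  | succ j ih =>
    refine ⟨ih.2, ?_⟩
    have h1 : ContDiff ℝ ⊤ (fun x : 𝔼 => ((2 * j + N) * x e * HH e (j + 1) x
        - (j + 1) * ‖x‖ ^ 2 * HH e j x) / (j + N - 1)) :=
      ((((contDiff_const.mul (contDiff_coord e)).mul ih.2)).sub
        ((contDiff_const.mul contDiff_normSq).mul ih.1)).div_const _
    rwa [show (HH e (j + 1 + 1) : 𝔼 → ℝ) = _ from funext fun x => HH_succ e j x]

lemma HH_differentiable (e : Fin N) (j : ℕ) : Differentiable ℝ (HH e j : 𝔼 → ℝ) :=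
  (HH_contDiff e j (n := 1)).differentiable (by norm_num)

lemma HH_continuous (e : Fin N) (j : ℕ) : Continuous (HH e j : 𝔼 → ℝ) :=
  (HH_contDiff e j (n := 1)).continuous

lemma HH_smul (e : Fin N) (j : ℕ) (r : ℝ) (x : 𝔼) : HH e j (r • x) = r ^ j * HH e j x := by
  suffices h : HH e j (r • x) = r ^ j * HH e j x ∧
      HH e (j + 1) (r • x) = r ^ (j + 1) * HH e (j + 1) x from h.1
  induction j with
  | zero => simp [HH_zero, HH_one]
  | succ j ih =>
    refine ⟨ih.2, ?_⟩
    rw [HH_succ, HH_succ, ih.1, ih.2, norm_smul, mul_pow, norm_eq_abs, sq_abs,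
      PiLp.smul_apply, smul_eq_mul]
    ring

lemma HH_eq_of (e : Fin N) (j : ℕ) {x y : 𝔼} (h1 : x e = y e) (h2 : ‖x‖ = ‖y‖) :
    HH e j x = HH e j y := by
  suffices h : HH e j x = HH e j y ∧ HH e (j + 1) x = HH e (j + 1) y from h.1
  induction j with
  | zero => simp [HH_zero, HH_one, h1]
  | succ j ih => exact ⟨ih.2, by rw [HH_succ, HH_succ, ih.1, ih.2, h1, h2]⟩

lemma HH_pole (hN : 2 ≤ N) (e : Fin N) (j : ℕ) :
    HH e j (single e (1:ℝ)) = 1 := by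
  have hN' : (2:ℝ) ≤ N := by exact_mod_cast hN
  suffices h : HH e j (single e (1:ℝ)) = 1 ∧
      HH e (j + 1) (single e (1:ℝ)) = 1 from h.1
  induction j with
  | zero => simp [HH_zero, HH_one]
  | succ j ih =>
    refine ⟨ih.2, ?_⟩
    have : (j:ℝ) + N - 1 ≠ 0 := by
      have : (0:ℝ) ≤ j := Nat.cast_nonneg j
      linarith
    rw [HH_succ, ih.1, ih.2]
    simp
    field_simp
    ring

/-- The derivative of the recursion defining `HH`. -/
lemma pd_HH_succ (e : Fin N) (j : ℕ) (i : Fin N) (x : 𝔼) :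
    pd (HH e (j + 2)) i x = ((2 * j + N) * ((if i = e then 1 else 0) * HH e (j + 1) x
      + x e * pd (HH e (j + 1)) i x)
      - (j + 1) * (2 * x i * HH e j x + ‖x‖ ^ 2 * pd (HH e j) i x)) / (j + N - 1) := by
  have e1 : (HH e (j + 2) : 𝔼 → ℝ) = (fun y => ((2 * j + N) / (j + N - 1) : ℝ) *
      (y e * HH e (j + 1) y)) + fun y => (-(j + 1) / (j + N - 1) : ℝ) * (‖y‖ ^ 2 * HH e j y) := by
    funext y
    rw [HH_succ, Pi.add_apply]
    ring
  have d1 : DifferentiableAt ℝ (fun y : 𝔼 => y e) x :=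
    (contDiff_coord e (n := 1)).differentiable (by norm_num) x
  have d2 : DifferentiableAt ℝ (fun y : 𝔼 => ‖y‖ ^ 2) x :=
    contDiff_normSq.differentiable (by norm_num) x
  have d3 := HH_differentiable e (j + 1) x
  have d4 := HH_differentiable e j x
  have p1 : pd (fun y : 𝔼 => ((2 * j + N) / (j + N - 1) : ℝ) * (y e * HH e (j + 1) y)) i x =
      ((2 * j + N) / (j + N - 1) : ℝ) * pd (fun y : 𝔼 => y e * HH e (j + 1) y) i x := by
    have := pd_mul (f := fun _ : 𝔼 => ((2 * j + N) / (j + N - 1) : ℝ)) (differentiableAt_const _)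
      (d1.fun_mul d3) i
    rw [pd_const] at this
    simpa using this
  have p2 : pd (fun y : 𝔼 => (-(j + 1) / (j + N - 1) : ℝ) * (‖y‖ ^ 2 * HH e j y)) i x =
      (-(j + 1) / (j + N - 1) : ℝ) * pd (fun y : 𝔼 => ‖y‖ ^ 2 * HH e j y) i x := by
    have := pd_mul (f := fun _ : 𝔼 => (-(j + 1) / (j + N - 1) : ℝ)) (differentiableAt_const _)
      (d2.fun_mul d4) i
    rw [pd_const] at this
    simpa using this
  have p3 := pd_mul d1 d3 i
  have p4 := pd_mul d2 d4 i
  rw [pd_coord] at p3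
  rw [pd_normSq] at p4
  rw [e1]
  refine (pd_add (f := fun y : 𝔼 => ((2 * j + N) / (j + N - 1) : ℝ) * (y e * HH e (j + 1) y))
    (g := fun y : 𝔼 => (-(j + 1) / (j + N - 1) : ℝ) * (‖y‖ ^ 2 * HH e j y))
    (((d1.fun_mul d3)).const_mul _) ((d2.fun_mul d4).const_mul _) i).trans ?_
  rw [p1, p2]
  erw [p3, p4]
  ring

lemma pd_HH (hN : 2 ≤ N) (e : Fin N) (j : ℕ) (x : 𝔼) :
    pd (HH e (j + 1)) e x = (j + 1) * HH e j x := by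
  have hN' : (2:ℝ) ≤ N := by exact_mod_cast hN
  suffices h : pd (HH e (j + 1)) e x = (j + 1) * HH e j x ∧
      pd (HH e (j + 2)) e x = (j + 2) * HH e (j + 1) x from h.1
  have h1 : pd (HH e 1) e x = 1 := by
    have : (HH e 1 : 𝔼 → ℝ) = fun y => y e := funext fun y => HH_one e y
    rw [this, pd_coord]
    simp
  have h0 : pd (HH e 0) e x = 0 := by
    have : (HH e 0 : 𝔼 → ℝ) = fun y => 1 := funext fun y => HH_zero e y
    rw [this, pd_const]
  induction j with
  | zero =>
    have : (N:ℝ) - 1 ≠ 0 := by linarith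
    refine ⟨by rw [h1, HH_zero]; simp, ?_⟩
    rw [pd_HH_succ, h1, h0, HH_zero, HH_one]
    simp
    field_simp
    ring
  | succ j ih =>
    have : (0:ℝ) ≤ j := Nat.cast_nonneg j
    have n1 : (j:ℝ) + N - 1 ≠ 0 := by linarith
    have n2 : (j:ℝ) + 1 + N - 1 ≠ 0 := by linarith
    refine ⟨by rw [ih.2]; push_cast; ring, ?_⟩
    rw [pd_HH_succ, ih.1, ih.2]
    rw [HH_succ]
    push_cast
    simp only [if_true]
    field_simp
    ring

lemma euler_HH (hN : 2 ≤ N) (e : Fin N) (j : ℕ) (x : 𝔼) :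
    ∑ i, x i * pd (HH e j) i x = j * HH e j x := by
  have hN' : (2:ℝ) ≤ N := by exact_mod_cast hN
  suffices h : ∑ i, x i * pd (HH e j) i x = j * HH e j x ∧
      ∑ i, x i * pd (HH e (j + 1)) i x = (j + 1) * HH e (j + 1) x from h.1
  induction j with
  | zero =>
    constructor
    · have : (HH e 0 : 𝔼 → ℝ) = fun y => 1 := funext fun y => HH_zero e y
      rw [this]
      simp [pd_const]
    · have : (HH e 1 : 𝔼 → ℝ) = fun y => y e := funext fun y => HH_one e y
      simp [this, pd_coord]
  | succ j ih =>
    refine ⟨by rw [ih.2]; push_cast; ring, ?_⟩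
    have : (0:ℝ) ≤ j := Nat.cast_nonneg j
    have n1 : (j:ℝ) + N - 1 ≠ 0 := by linarith
    have hs : ∑ i, x i * x i = ‖x‖ ^ 2 := by
      rw [EuclideanSpace.real_norm_sq_eq]
      exact sum_congr rfl fun i _ => by ring
    have : ∑ i, x i * pd (HH e (j + 2)) i x =
        ((2 * j + N) * (x e * HH e (j + 1) x + x e * ∑ i, x i * pd (HH e (j + 1)) i x)
        - (j + 1) * (2 * (∑ i, x i * x i) * HH e j x
          + ‖x‖ ^ 2 * ∑ i, x i * pd (HH e j) i x)) / (j + N - 1) := by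
      have hx : x e * HH e (j + 1) x = ∑ i, x i * ((if i = e then 1 else 0) * HH e (j + 1) x) := by
        simp
      rw [hx]
      simp only [mul_sum, Finset.sum_mul, ← sum_add_distrib,
        ← Finset.sum_sub_distrib, Finset.sum_div]
      refine sum_congr rfl fun i _ => ?_
      rw [pd_HH_succ]
      ring
    rw [this, ih.1, ih.2, hs, HH_succ]
    push_cast
    field_simp
    ring

lemma lap_HH (hN : 2 ≤ N) (e : Fin N) (j : ℕ) (x : 𝔼) : lap (HH e j) x = 0 := by
  have hN' : (2:ℝ) ≤ N := by exact_mod_cast hN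
  suffices h : lap (HH e j) x = 0 ∧ lap (HH e (j + 1)) x = 0 from h.1
  induction j with
  | zero =>
    constructor
    · have : (HH e 0 : 𝔼 → ℝ) = fun y => 1 := funext fun y => HH_zero e y
      rw [this, lap_const]
    · have : (HH e 1 : 𝔼 → ℝ) = fun y => y e := funext fun y => HH_one e y
      rw [this, lap_coord]
  | succ j ih =>
    refine ⟨ih.2, ?_⟩
    have e1 : (HH e (j + 2) : 𝔼 → ℝ) = (fun y => ((2 * j + N) / (j + N - 1) : ℝ) *
        (y e * HH e (j + 1) y)) + fun y => (-(j + 1) / (j + N - 1) : ℝ) *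
          (‖y‖ ^ 2 * HH e j y) := by
      funext y
      rw [HH_succ, Pi.add_apply]
      ring
    have c1 := (contDiff_coord e (N := N) (n := 2)).contDiffAt (x := x)
    have c2 : ContDiffAt ℝ 2 (fun y : 𝔼 => ‖y‖ ^ 2) x :=
      (contDiff_normSq.of_le le_top).contDiffAt
    have c3 := (HH_contDiff e (j + 1) (n := 2)).contDiffAt (x := x)
    have c4 := (HH_contDiff e j (n := 2)).contDiffAt (x := x)
    rw [e1]
    have h1 : lap (fun y : 𝔼 => y e * HH e (j + 1) y) x = 2 * (j + 1) * HH e j x := by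
      have := lap_mul c1 c3
      simp only [pd_coord, ite_mul, one_mul, zero_mul, Finset.sum_ite_eq', Finset.mem_univ,
        if_true, lap_coord, mul_zero] at this
      refine Eq.trans this ?_
      rw [ih.2, pd_HH hN]
      ring
    have h2 : lap (fun y : 𝔼 => ‖y‖ ^ 2 * HH e j y) x = (2 * N + 4 * j) * HH e j x := by
      have := lap_mul c2 c4
      simp only [pd_normSq, lap_normSq] at this
      refine Eq.trans this ?_
      have h3 : ∑ i, 2 * x i * pd (HH e j) i x = 2 * (j * HH e j x) := by
        rw [← euler_HH hN e j x, mul_sum]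
        exact sum_congr rfl fun i _ => by ring
      rw [ih.1, h3]
      ring
    have := lap_add (f := fun y : 𝔼 => ((2 * j + N) / (j + N - 1) : ℝ) * (y e * HH e (j + 1) y))
      (g := fun y : 𝔼 => (-(j + 1) / (j + N - 1) : ℝ) * (‖y‖ ^ 2 * HH e j y)) (x := x)
      (contDiffAt_const.mul (c1.mul c3)) (contDiffAt_const.mul (c2.mul c4))
    refine Eq.trans this ?_
    rw [lap_const_mul _ (c1.mul c3), lap_const_mul _ (c2.mul c4), h1, h2]
    ring

/-- The Laplacian of a radial function times a zonal harmonic. -/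
lemma lap_radial_mul_HH (hN : 2 ≤ N) (e : Fin N) (j : ℕ) {f : ℝ → ℝ} {x : 𝔼} (hx : x ≠ 0)
    (hf : ContDiffAt ℝ 2 f ‖x‖) :
    lap (fun y => f ‖y‖ * HH e j y) x =
      (deriv (deriv f) ‖x‖ + (N - 1 + 2 * j) / ‖x‖ * deriv f ‖x‖) * HH e j x := by
  have hx0 : 0 < ‖x‖ := norm_pos_iff.2 hx
  have hp : (‖x‖ ^ 2) ≠ 0 := by positivity
  have hs : √(‖x‖ ^ 2) = ‖x‖ := sqrt_sq hx0.le
  set g : ℝ → ℝ := fun p => f √p with hg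
  have cg : ContDiffAt ℝ 2 g (‖x‖ ^ 2) := by
    refine ContDiffAt.comp (g := f) (‖x‖ ^ 2) (by rwa [hs]) (Real.contDiffAt_sqrt hp)
  have e1 : (fun y : 𝔼 => f ‖y‖ * HH e j y) = fun y => g (‖y‖ ^ 2) * HH e j y := by
    funext y
    simp [hg, sqrt_sq (norm_nonneg y)]
  have c2 : ContDiffAt ℝ 2 (fun y : 𝔼 => g (‖y‖ ^ 2)) x :=
    ContDiffAt.comp (g := g) x cg (contDiff_normSq.of_le le_top).contDiffAt
  have c4 := (HH_contDiff e j (n := 2)).contDiffAt (x := x)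
  have dg1 : ∀ᶠ p in 𝓝 (‖x‖ ^ 2), HasDerivAt g (deriv f √p / (2 * √p)) p := by
    have h1 : ∀ᶠ r in 𝓝 ‖x‖, DifferentiableAt ℝ f r :=
      hf.evDiff
    have h2 : Tendsto Real.sqrt (𝓝 (‖x‖ ^ 2)) (𝓝 ‖x‖) := by
      have := Real.continuous_sqrt.tendsto (‖x‖ ^ 2)
      rwa [hs] at this
    filter_upwards [h2.eventually h1, eventually_ne_nhds hp] with p h3 h4
    exact (HasDerivAt.comp p h3.hasDerivAt (hasDerivAt_sqrt h4)).congr_deriv (by ring)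
  have d1 : deriv g (‖x‖ ^ 2) = deriv f ‖x‖ / (2 * ‖x‖) := by
    rw [dg1.self_of_nhds.deriv, hs]
  have d2 : deriv (deriv g) (‖x‖ ^ 2) =
      deriv (deriv f) ‖x‖ / (4 * ‖x‖ ^ 2) - deriv f ‖x‖ / (4 * ‖x‖ ^ 3) := by
    have h1 : deriv g =ᶠ[𝓝 (‖x‖ ^ 2)] fun p => deriv f √p / (2 * √p) :=
      dg1.mono fun p hp => hp.deriv
    rw [h1.deriv_eq]
    have h2 : HasDerivAt (deriv f) (deriv (deriv f) ‖x‖) (√(‖x‖ ^ 2)) := by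
      rw [hs]
      exact ((ContDiffAt.derivWithin (m := 1) hf (by norm_num)).differentiableAt (by norm_num)).hasDerivAt
    have h3 := hasDerivAt_sqrt hp
    have h4 := (HasDerivAt.comp (‖x‖ ^ 2) h2 h3).fun_div (h3.const_mul 2) (by rw [hs]; positivity)
    refine (h4.congr_deriv ?_).deriv
    simp only [Function.comp, hs]
    field_simp
    ring
  have h5 : ∀ i, pd (fun y : 𝔼 => g (‖y‖ ^ 2)) i x = deriv g (‖x‖ ^ 2) * (2 * x i) := by
    intro i
    have := pd_comp (g := g) (p := fun y : 𝔼 => ‖y‖ ^ 2) (x := x)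
      (cg.differentiableAt (by norm_num)) (contDiff_normSq.differentiable (by norm_num) x) i
    rw [pd_normSq] at this
    exact this
  rw [e1]
  refine (lap_mul c2 c4).trans ?_
  have h3 : ∑ i, pd (fun y : 𝔼 => g (‖y‖ ^ 2)) i x * pd (HH e j) i x =
      deriv g (‖x‖ ^ 2) * 2 * (j * HH e j x) := by
    rw [← euler_HH hN e j x, mul_sum]
    exact sum_congr rfl fun i _ => by rw [h5]; ring
  rw [h3, lap_HH hN, lap_comp_normSq cg, d1, d2]
  field_simp
  ring

lemma hasCompactSupport_pd {η : 𝔼 → ℝ} (h : HasCompactSupport η) (i : Fin N) :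
    HasCompactSupport (pd η i) :=
  h.fderiv_apply (𝕜 := ℝ) _

lemma hasCompactSupport_lap {η : 𝔼 → ℝ} (h : HasCompactSupport η) :
    HasCompactSupport (lap η) := by
  refine HasCompactSupport.intro h fun x hx => ?_
  rw [lap_congr (v := fun _ => 0) (notMem_tsupport_iff_eventuallyEq.1 hx), lap_const]

lemma integral_pd_mul {f g : 𝔼 → ℝ} (hf : ContDiff ℝ 1 f) (hg : ContDiff ℝ 1 g)
    (hc : HasCompactSupport g) (i : Fin N) : ∫ x, f x * pd g i x = -∫ x, pd f i x * g x := by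
  have cf := (pd_contDiff (m := 0) hf (by norm_num) i).continuous
  have cg := (pd_contDiff (m := 0) hg (by norm_num) i).continuous
  exact integral_mul_fderiv_eq_neg_fderiv_mul_of_integrable
    ((cf.mul hg.continuous).integrable_of_hasCompactSupport (hc.mul_left))
    ((hf.continuous.mul cg).integrable_of_hasCompactSupport ((hasCompactSupport_pd hc i).mul_left))
    ((hf.continuous.mul hg.continuous).integrable_of_hasCompactSupport (hc.mul_left))
    (fun x _ => hf.differentiable (by norm_num) x) (fun x _ => hg.differentiable (by norm_num) x)

lemma integral_mul_lap {w η : 𝔼 → ℝ} (hw : ContDiff ℝ 2 w) (hη : ContDiff ℝ 2 η)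
    (hc : HasCompactSupport η) : ∫ x, w x * lap η x = ∫ x, lap w x * η x := by
  simp only [lap_eq_pd, mul_sum, Finset.sum_mul]
  have cw := fun i => pd_contDiff (m := 1) hw (by norm_num) i
  have cη := fun i => pd_contDiff (m := 1) hη (by norm_num) i
  have cw' := fun i => (pd_contDiff (m := 0) (cw i) (by norm_num) i).continuous
  have cη' := fun i => (pd_contDiff (m := 0) (cη i) (by norm_num) i).continuous
  rw [integral_finsetSum, integral_finsetSum]
  · refine sum_congr rfl fun i _ => ?_
    rw [integral_pd_mul (hw.of_le (by norm_num)) (cη i) (hasCompactSupport_pd hc i),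
      integral_pd_mul (cw i) (hη.of_le (by norm_num)) hc, neg_neg]
  · exact fun i _ => ((cw' i).mul hη.continuous).integrable_of_hasCompactSupport hc.mul_left
  · exact fun i _ => (hw.continuous.mul (cη' i)).integrable_of_hasCompactSupport
      (hasCompactSupport_pd (hasCompactSupport_pd hc i) i).mul_left

lemma LSol.integral_mul_lap {v h η : 𝔼 → ℝ} (H : LSol v h) (hη : ContDiff ℝ 2 η)
    (hc : HasCompactSupport η) : ∫ x, v x * lap η x = -∫ x, h x * η x := by
  have cl := continuous_lap hη
  have hcl := hasCompactSupport_lap hc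
  obtain ⟨R, hR⟩ := hc.isCompact.isBounded.subset_closedBall (0:𝔼)
  have hz : ∀ x ∉ closedBall (0:𝔼) (max R 1), η x = 0 ∧ lap η x = 0 := by
    intro x hx
    have hx' : x ∉ tsupport η := fun h =>
      hx (closedBall_subset_closedBall (le_max_left _ _) (hR h))
    have := notMem_tsupport_iff_eventuallyEq.1 hx'
    exact ⟨this.self_of_nhds, by rw [lap_congr (v := fun _ => 0) this, lap_const]⟩
  have i1 : Integrable (fun x => |lap η x|) := (cl.integrable_of_hasCompactSupport hcl).abs
  have i2 : Integrable (fun x => |η x|) :=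
    (hη.continuous.integrable_of_hasCompactSupport hc).abs
  have j1 : Integrable (fun x => v x * lap η x) :=
    (H.continuous.mul cl).integrable_of_hasCompactSupport hcl.mul_left
  have j2 : Integrable (fun x => h x * η x) :=
    (H.continuous_rhs.mul hη.continuous).integrable_of_hasCompactSupport hc.mul_left
  rw [← sub_eq_zero, sub_neg_eq_add, ← abs_eq_zero]
  refine le_antisymm (le_of_forall_pos_le_add fun ε hε => ?_) (abs_nonneg _)
  set S := (∫ x, |lap η x|) + ∫ x, |η x| with hS
  have hS0 : 0 ≤ S := add_nonneg (integral_nonneg fun _ => abs_nonneg _)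
    (integral_nonneg fun _ => abs_nonneg _)
  obtain ⟨w, hw, hwc⟩ := H (max R 1) (by positivity) (ε / (S + 1)) (by positivity)
  have j3 : Integrable (fun x => w x * lap η x) :=
    (hw.continuous.mul cl).integrable_of_hasCompactSupport hcl.mul_left
  have j4 : Integrable (fun x => lap w x * η x) :=
    ((continuous_lap hw).mul hη.continuous).integrable_of_hasCompactSupport hc.mul_left
  have key := Henon.integral_mul_lap hw hη hc
  have e1 : (∫ x, v x * lap η x) + ∫ x, h x * η x =
      ∫ x, ((v x * lap η x - w x * lap η x) + (lap w x * η x + h x * η x)) := by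
    have e2 : ∫ x, ((v x * lap η x - w x * lap η x) + (lap w x * η x + h x * η x)) =
        (∫ x, (v x * lap η x - w x * lap η x)) + ∫ x, (lap w x * η x + h x * η x) :=
      integral_add (j1.sub j3) (j4.add j2)
    rw [e2, integral_sub j1 j3, integral_add j4 j2, key]
    ring
  rw [e1, zero_add]
  have i3 : Integrable (fun x => ε / (S + 1) * (|lap η x| + |η x|)) := (i1.add i2).const_mul _
  refine (abs_integral_le_integral_abs).trans ((integral_mono_of_nonneg
    (Eventually.of_forall fun x => abs_nonneg _) i3 (Eventually.of_forall fun x => ?_)).trans ?_)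
  · by_cases hx : x ∈ closedBall (0:𝔼) (max R 1)
    · obtain ⟨a, b⟩ := hwc x hx
      have e3 : (v x * lap η x - w x * lap η x) + (lap w x * η x + h x * η x) =
        -((w x - v x) * lap η x) + (lap w x + h x) * η x := by ring
      simp only [e3]
      refine (abs_add_le _ _).trans ?_
      rw [abs_neg, abs_mul, abs_mul, mul_add]
      gcongr
    · obtain ⟨a, b⟩ := hz x hx
      simp [a, b]
  · rw [integral_const_mul, integral_add i1 i2, ← hS, div_mul_eq_mul_div]
    exact div_le_of_le_mul₀ (by positivity) hε.le (by nlinarith)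

/-- Integration in polar coordinates. -/
lemma integral_polar (hN : 2 ≤ N) {f : 𝔼 → ℝ} (hf : Integrable f) :
    IntegrableOn (fun r : ℝ => r ^ (N - 1) *
      ∫ θ : sphere (0:𝔼) 1, f (r • (θ : 𝔼)) ∂(volume : Measure 𝔼).toSphere) (Ioi 0) ∧
    ∫ x, f x = ∫ r in Ioi (0:ℝ), r ^ (N - 1) *
      ∫ θ : sphere (0:𝔼) 1, f (r • (θ : 𝔼)) ∂(volume : Measure 𝔼).toSphere := by
  have : NeZero N := ⟨by omega⟩
  have : Nonempty (Fin N) := ⟨0⟩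
  have : Nontrivial 𝔼 := inferInstance
  have hd : Module.finrank ℝ 𝔼 = N := by simp
  have mp := (volume : Measure 𝔼).measurePreserving_homeomorphUnitSphereProd
  rw [hd] at mp
  have me := (homeomorphUnitSphereProd 𝔼).measurableEmbedding
  set g : sphere (0:𝔼) 1 × Ioi (0:ℝ) → ℝ := fun p => f (p.2.1 • p.1.1) with hg
  have hgf : ∀ x : ({0}ᶜ : Set 𝔼), g (homeomorphUnitSphereProd 𝔼 x) = f x := by
    intro x
    have := congrArg Subtype.val ((homeomorphUnitSphereProd 𝔼).symm_apply_apply x)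
    rw [homeomorphUnitSphereProd_symm_apply_coe] at this
    exact congrArg f this
  have hI : Integrable (fun x : ({0}ᶜ : Set 𝔼) => f x) ((volume : Measure 𝔼).comap (↑)) :=
    (integrableOn_iff_comap_subtypeVal (by measurability)).1 hf.integrableOn
  have hgI : Integrable g ((volume : Measure 𝔼).toSphere.prod (Measure.volumeIoiPow (N - 1))) := by
    rw [← mp.integrable_comp_emb me]
    exact hI.congr (Eventually.of_forall fun x => (hgf x).symm)
  have e1 : ∫ x, f x = ∫ p, g p ∂((volume : Measure 𝔼).toSphere.prod
      (Measure.volumeIoiPow (N - 1))) := by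
    rw [← mp.integral_comp me]
    simp only [hgf]
    rw [integral_subtype_comap (measurableSet_singleton _).compl f,
      restrict_compl_singleton]
  have hI2 := hgI.integral_prod_right
  constructor
  · rw [integrableOn_iff_comap_subtypeVal measurableSet_Ioi]
    rw [Measure.volumeIoiPow, integrable_withDensity_iff_integrable_smul'
      (by fun_prop) (by simp)] at hI2
    refine hI2.congr (Eventually.of_forall fun r => ?_)
    have hr : (0:ℝ) < r := r.2
    simp [ENNReal.toReal_ofReal (pow_nonneg hr.le (N - 1)), hg]
  · rw [e1, integral_prod_symm _ hgI, Measure.volumeIoiPow,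
      integral_withDensity_eq_integral_toReal_smul (by fun_prop) (by simp),
      ← integral_subtype_comap measurableSet_Ioi]
    refine integral_congr_ae (Eventually.of_forall fun r => ?_)
    have hr : (0:ℝ) < r := r.2
    simp [ENNReal.toReal_ofReal (pow_nonneg hr.le (N - 1)), hg]

/-- The coefficient of `v` on the sphere of radius `r` along the zonal harmonic of degree `j`. -/
noncomputable def md (e : Fin N) (j : ℕ) (v : 𝔼 → ℝ) (r : ℝ) : ℝ :=
  ∫ θ : sphere (0 : 𝔼) 1, v (r • (θ : 𝔼))
    * HH e j θ ∂(volume : Measure 𝔼).toSphere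

/-- The radial derivative of `md`. -/
noncomputable def mdd (e : Fin N) (j : ℕ) (v : 𝔼 → ℝ) (r : ℝ) : ℝ :=
  ∫ θ : sphere (0 : 𝔼) 1,
    fderiv ℝ v (r • (θ : 𝔼)) θ
    * HH e j θ ∂(volume : Measure 𝔼).toSphere

lemma continuous_sphere_integral {f : ℝ → 𝔼 → ℝ} (hf : Continuous f.uncurry) :
    Continuous fun r => ∫ θ : sphere (0:𝔼) 1, f r θ ∂(volume : Measure 𝔼).toSphere := by
  have h : Continuous (fun (r : ℝ) (θ : sphere (0:𝔼) 1) => f r θ).uncurry :=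
    hf.comp (continuous_fst.prodMk (continuous_subtype_val.comp continuous_snd))
  simpa using continuous_parametric_integral_of_continuous
    (μ := (volume : Measure 𝔼).toSphere) h isCompact_univ

lemma integrable_sphere {f : 𝔼 → ℝ} (hf : Continuous f) :
    Integrable (fun θ : sphere (0:𝔼) 1 => f θ) (volume : Measure 𝔼).toSphere :=
  (hf.comp continuous_subtype_val).integrable_of_hasCompactSupport (HasCompactSupport.of_compactSpace _)

lemma continuous_md (e : Fin N) (j : ℕ) {v : 𝔼 → ℝ} (hv : Continuous v) :
    Continuous (md e j v) := by
  refine continuous_sphere_integral (f := fun r θ => v (r • θ) * HH e j θ) ?_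
  exact (hv.comp (continuous_fst.smul continuous_snd)).mul
    ((HH_continuous e j).comp continuous_snd)

lemma continuous_mdd (e : Fin N) (j : ℕ) {v : 𝔼 → ℝ} (hv : ContDiff ℝ 1 v) :
    Continuous (mdd e j v) := by
  refine continuous_sphere_integral (f := fun r θ => fderiv ℝ v (r • θ) θ * HH e j θ) ?_
  exact (((hv.continuous_fderiv (by norm_num)).comp (continuous_fst.smul continuous_snd)).clm_apply
    continuous_snd).mul ((HH_continuous e j).comp continuous_snd)

lemma exists_sphere_bound (e : Fin N) (j : ℕ) : ∃ A > 0, ∀ (f : sphere (0:𝔼) 1 → ℝ) (M : ℝ),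
    (∀ θ, |f θ| ≤ M) → |∫ θ, f θ * HH e j θ ∂(volume : Measure 𝔼).toSphere| ≤ A * M := by
  have hI := integrable_sphere (HH_continuous e j).abs
  set A := ∫ θ : sphere (0:𝔼) 1, |HH e j θ| ∂(volume : Measure 𝔼).toSphere
  have hA : 0 ≤ A := integral_nonneg fun _ => abs_nonneg _
  refine ⟨A + 1, by positivity, fun f M hM => ?_⟩
  have hM0 : 0 ≤ M := (abs_nonneg _).trans (hM ⟨single e 1, by simp⟩)
  have : |∫ θ, f θ * HH e j θ ∂(volume : Measure 𝔼).toSphere| ≤ M * A := by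
    rw [← integral_const_mul]
    refine abs_integral_le_integral_abs.trans (integral_mono_of_nonneg
      (Eventually.of_forall fun _ => abs_nonneg _) (hI.const_mul _)
      (Eventually.of_forall fun θ => ?_))
    simp only [abs_mul]
    gcongr
    exact hM θ
  linarith

lemma norm_smul_sphere_eq (r : ℝ) (θ : sphere (0:𝔼) 1) : ‖r • (θ:𝔼)‖ = |r| := by
  rw [norm_smul, norm_eq_of_mem_sphere, mul_one, norm_eq_abs]

lemma norm_smul_sphere {r : ℝ} (hr : 0 ≤ r) (θ : sphere (0:𝔼) 1) : ‖r • (θ:𝔼)‖ = r := by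
  rw [norm_smul_sphere_eq, abs_of_nonneg hr]

lemma exists_md_bound (e : Fin N) (j : ℕ) : ∃ A > 0, ∀ (v : 𝔼 → ℝ) (r M : ℝ),
    (∀ x : 𝔼, ‖x‖ = |r| → |v x| ≤ M) → |md e j v r| ≤ A * M := by
  obtain ⟨A, hA, h⟩ := exists_sphere_bound e j
  exact ⟨A, hA, fun v r M hM => h _ M fun θ => hM _ (norm_smul_sphere_eq r θ)⟩

lemma exists_mdd_bound (e : Fin N) (j : ℕ) : ∃ A > 0, ∀ (v : 𝔼 → ℝ) (r M : ℝ),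
    (∀ x : 𝔼, ‖x‖ = |r| → ‖fderiv ℝ v x‖ ≤ M) → |mdd e j v r| ≤ A * M := by
  obtain ⟨A, hA, h⟩ := exists_sphere_bound e j
  refine ⟨A, hA, fun v r M hM => h _ M fun θ => ?_⟩
  have h1 := (fderiv ℝ v (r • (θ:𝔼))).le_of_opNorm_le (hM _ (norm_smul_sphere_eq r θ)) θ
  rwa [norm_eq_of_mem_sphere, mul_one] at h1

lemma hasDerivAt_md (e : Fin N) (j : ℕ) {v : 𝔼 → ℝ} (hv : ContDiff ℝ 1 v) (r : ℝ) :
    HasDerivAt (md e j v) (mdd e j v r) r := by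
  have c1 : Continuous fun p : ℝ × sphere (0:𝔼) 1 =>
      fderiv ℝ v (p.1 • (p.2:𝔼)) p.2 * HH e j p.2 := by
    have c2 : Continuous fun p : ℝ × sphere (0:𝔼) 1 => (p.2:𝔼) :=
      continuous_subtype_val.comp continuous_snd
    exact (((hv.continuous_fderiv (by norm_num)).comp (continuous_fst.smul c2)).clm_apply
      c2).mul ((HH_continuous e j).comp c2)
  obtain ⟨C, hC⟩ := (((isCompact_Icc (a := r - 1) (b := r + 1)).prod
    (isCompact_univ (X := sphere (0:𝔼) 1))).bddAbove_image c1.norm.continuousOn)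
  have hC' : ∀ x ∈ Icc (r - 1) (r + 1), ∀ θ : sphere (0:𝔼) 1,
      ‖fderiv ℝ v (x • (θ:𝔼)) θ * HH e j θ‖ ≤ C := fun x hx θ =>
    hC ⟨(x, θ), ⟨hx, mem_univ _⟩, rfl⟩
  refine (hasDerivAt_integral_of_dominated_loc_of_deriv_le (bound := fun _ => C)
    (F := fun (r : ℝ) (θ : sphere (0:𝔼) 1) => v (r • (θ:𝔼)) * HH e j θ)
    (F' := fun (r : ℝ) (θ : sphere (0:𝔼) 1) => fderiv ℝ v (r • (θ:𝔼)) θ * HH e j θ)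
    (μ := (volume : Measure 𝔼).toSphere)
    (Icc_mem_nhds (show r - 1 < r by linarith) (show r < r + 1 by linarith))
    (Eventually.of_forall fun x => ?_) ?_ ?_ (Eventually.of_forall fun θ x hx => hC' x hx θ)
    (integrable_const _) (Eventually.of_forall fun θ x _ => ?_)).2
  · exact (integrable_sphere (f := fun θ => v (x • θ) * HH e j θ) ((hv.continuous.comp
      (continuous_const_smul x)).mul (HH_continuous e j))).aestronglyMeasurable
  · exact integrable_sphere (f := fun θ => v (r • θ) * HH e j θ) ((hv.continuous.comp
      (continuous_const_smul r)).mul (HH_continuous e j))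
  · exact (c1.comp (continuous_const.prodMk continuous_id)).aestronglyMeasurable
  · have h1 : HasDerivAt (fun x : ℝ => x • (θ:𝔼)) (θ:𝔼) x := by
      simpa using (hasDerivAt_id x).smul_const (θ:𝔼)
    exact (((hv.differentiable (by norm_num) _).hasFDerivAt.comp_hasDerivAt x h1)).mul_const _

lemma md_add (e : Fin N) (j : ℕ) {v w : 𝔼 → ℝ} (hv : Continuous v) (hw : Continuous w) (r : ℝ) :
    md e j (fun x => v x + w x) r = md e j v r + md e j w r := by
  simp only [md, add_mul]
  exact integral_add
    (integrable_sphere (f := fun θ => v (r • θ) * HH e j θ) ((hv.comp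
      (continuous_const_smul r)).mul (HH_continuous e j)))
    (integrable_sphere (f := fun θ => w (r • θ) * HH e j θ) ((hw.comp
      (continuous_const_smul r)).mul (HH_continuous e j)))

lemma md_const_mul (e : Fin N) (j : ℕ) (v : 𝔼 → ℝ) (c r : ℝ) :
    md e j (fun x => c * v x) r = c * md e j v r := by
  simp only [md, mul_assoc]
  exact integral_const_mul _ _

lemma md_radial_mul (e : Fin N) (j : ℕ) {v p : 𝔼 → ℝ} {r c : ℝ} (hr : 0 ≤ r)
    (hp : ∀ x : 𝔼, ‖x‖ = r → p x = c) :
    md e j (fun x => p x * v x) r = c * md e j v r := by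
  simp only [md]
  rw [← integral_const_mul]
  refine integral_congr_ae (Eventually.of_forall fun θ => ?_)
  simp only
  rw [hp _ (norm_smul_sphere hr _)]
  ring

/-- The lemma of du Bois-Reymond on the half-line. -/
lemma eq_of_integral_deriv_mul {g : ℝ → ℝ} (hg : Continuous g)
    (H : ∀ f : ℝ → ℝ, ContDiff ℝ 2 f → HasCompactSupport f → tsupport f ⊆ Ioi 0 →
      ∫ r, deriv f r * g r = 0) {a b : ℝ} (ha : 0 < a) (hab : a < b) : g a = g b := by
  set S := smoothTransition with hS
  have hSc : ContDiff ℝ 3 S := smoothTransition.contDiff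
  have hSd : ∀ x, HasDerivAt S (deriv S x) x := fun x =>
    (hSc.differentiable (by norm_num) x).hasDerivAt
  have hS'c : Continuous (deriv S) := hSc.continuous_deriv (by norm_num)
  have hS0 : ∀ s, s ∉ Icc (0:ℝ) 1 → deriv S s = 0 := by
    intro s hs
    rw [mem_Icc, not_and_or, not_le, not_le] at hs
    rcases hs with hs | hs
    · have : S =ᶠ[𝓝 s] fun _ => 0 := by
        filter_upwards [eventually_lt_nhds hs] with x hx
        exact smoothTransition.zero_of_nonpos hx.le
      rw [this.deriv_eq, deriv_const]
    · have : S =ᶠ[𝓝 s] fun _ => 1 := by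
        filter_upwards [eventually_gt_nhds hs] with x hx
        exact smoothTransition.one_of_one_le hx.le
      rw [this.deriv_eq, deriv_const]
  set D : ℝ → ℝ := fun δ => ∫ s in Icc (0:ℝ) 1, deriv S s * (g (a + δ * s) - g (b + δ * s)) with hD
  have hDc : Continuous D := by
    refine continuous_parametric_integral_of_continuous
      (f := fun δ s => deriv S s * (g (a + δ * s) - g (b + δ * s))) ?_ isCompact_Icc
    simp only [Function.uncurry_def]
    fun_prop
  have hI : ∀ c δ : ℝ, Integrable (fun s => deriv S s * g (c + δ * s)) := by
    intro c δ
    refine Continuous.integrable_of_hasCompactSupport (by fun_prop)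
      (HasCompactSupport.intro (isCompact_Icc (a := (0:ℝ)) (b := 1)) fun x hx => ?_)
    rw [hS0 x hx, zero_mul]
  have hDpos : ∀ δ, 0 < δ → D δ = 0 := by
    intro δ hδ
    have e0 : D δ = (∫ s, deriv S s * g (a + δ * s)) - ∫ s, deriv S s * g (b + δ * s) := by
      rw [← integral_sub (hI a δ) (hI b δ), hD]
      simp only
      rw [setIntegral_eq_integral_of_forall_compl_eq_zero]
      · exact integral_congr_ae (Eventually.of_forall fun s => by simp only; ring)
      · intro x hx
        rw [hS0 x hx, zero_mul]
    have e1 : ∀ c, ∫ r, deriv S ((r - c) / δ) * g r = δ * ∫ s, deriv S s * g (c + δ * s) := by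
      intro c
      have h1 := integral_add_left_eq_self (μ := volume) (fun r => deriv S ((r - c) / δ) * g r) c
      have h2 := Measure.integral_comp_mul_left
        (fun x => deriv S ((c + x - c) / δ) * g (c + x)) δ
      rw [← h1]
      have h3 : ∀ s, deriv S ((c + δ * s - c) / δ) * g (c + δ * s) =
          deriv S s * g (c + δ * s) := by
        intro s
        congr 2
        field_simp
        ring
      simp only [h3] at h2
      rw [h2, abs_of_pos (by positivity), smul_eq_mul]
      field_simp
    have hcI : ∀ c, Integrable (fun r => deriv S ((r - c) / δ) * g r) := by
      intro c
      refine Continuous.integrable_of_hasCompactSupport (by fun_prop)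
        (HasCompactSupport.intro (isCompact_Icc (a := c) (b := c + δ)) fun x hx => ?_)
      rw [hS0 _ (fun h => hx ?_), zero_mul]
      have h1 := h.1
      have h2 := h.2
      rw [le_div_iff₀ hδ] at h1
      rw [div_le_iff₀ hδ] at h2
      constructor <;> linarith
    set f : ℝ → ℝ := fun r => S ((r - a) / δ) - S ((r - b) / δ) with hf
    have hfs : tsupport f ⊆ Icc a (b + δ) := by
      refine closure_minimal (fun x hx => ?_) isClosed_Icc
      by_contra hx'
      apply hx
      rw [mem_Icc, not_and_or, not_le, not_le] at hx'
      simp only [hf]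
      rcases hx' with h | h
      · rw [hS, smoothTransition.zero_of_nonpos, smoothTransition.zero_of_nonpos, sub_self]
        · exact div_nonpos_of_nonpos_of_nonneg (by linarith) hδ.le
        · exact div_nonpos_of_nonpos_of_nonneg (by linarith) hδ.le
      · rw [hS, smoothTransition.one_of_one_le, smoothTransition.one_of_one_le, sub_self]
        · rw [le_div_iff₀ hδ]; linarith
        · rw [le_div_iff₀ hδ]; linarith
    have hfd : ∀ r, deriv f r = (deriv S ((r - a) / δ) - deriv S ((r - b) / δ)) / δ := by
      intro r
      have h1 : ∀ c, HasDerivAt (fun r => S ((r - c) / δ)) (deriv S ((r - c) / δ) * (1 / δ)) r :=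
        fun c => (hSd _).comp r (((hasDerivAt_id r).sub_const c).div_const δ)
      rw [((h1 a).fun_sub (h1 b)).deriv]
      ring
    have := H f ((hSc.of_le (by norm_num)).comp (by fun_prop) |>.sub
      ((hSc.of_le (by norm_num)).comp (by fun_prop)))
      (HasCompactSupport.of_support_subset_isCompact isCompact_Icc (subset_closure.trans hfs))
      (hfs.trans fun x hx => ha.trans_le hx.1)
    have e2 : ∫ r, deriv f r * g r = D δ := by
      have e3 : ∀ r, deriv f r * g r = δ⁻¹ * (deriv S ((r - a) / δ) * g r
          - deriv S ((r - b) / δ) * g r) := by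
        intro r
        rw [hfd]
        ring
      simp only [e3]
      rw [integral_const_mul, integral_sub (hcI a) (hcI b), e1, e1, e0]
      field_simp
    rw [← e2, this]
  have hD0 : D 0 = 0 := by
    have h1 : Tendsto D (𝓝[>] 0) (𝓝 (D 0)) := (hDc.tendsto 0).mono_left nhdsWithin_le_nhds
    have h2 : Tendsto D (𝓝[>] 0) (𝓝 0) := by
      refine tendsto_const_nhds.congr' ?_
      filter_upwards [self_mem_nhdsWithin] with δ hδ
      exact (hDpos δ hδ).symm
    exact tendsto_nhds_unique h1 h2
  have hD0' : D 0 = g a - g b := by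
    have h1 : ∫ s in (0:ℝ)..1, deriv S s = 1 := by
      rw [intervalIntegral.integral_deriv_eq_sub (fun x _ => (hSd x).differentiableAt)
        (hS'c.intervalIntegrable _ _), hS, smoothTransition.one, smoothTransition.zero]
      norm_num
    simp only [hD, zero_mul, add_zero]
    rw [integral_mul_const, integral_Icc_eq_integral_Ioc,
      ← intervalIntegral.integral_of_le zero_le_one, h1, one_mul]
  linarith

lemma eq_zero_of_notMem_tsupport {f : ℝ → ℝ} {r : ℝ} (h : r ∉ tsupport f) :
    f r = 0 ∧ deriv f r = 0 ∧ deriv (deriv f) r = 0 := by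
  have h2 : r ∉ tsupport (deriv f) := fun h' => h (tsupport_deriv_subset h')
  exact ⟨image_eq_zero_of_notMem_tsupport h, image_eq_zero_of_notMem_tsupport h2,
    image_eq_zero_of_notMem_tsupport fun h' => h2 (tsupport_deriv_subset h')⟩

lemma contDiff_radial_mul_HH (e : Fin N) (j : ℕ) {f : ℝ → ℝ} (hf : ContDiff ℝ 2 f)
    (hs : tsupport f ⊆ Ioi 0) : ContDiff ℝ 2 (fun x : 𝔼 => f ‖x‖ * HH e j x) := by
  rw [contDiff_iff_contDiffAt]
  intro x
  by_cases hx : x = 0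
  · have h0 : (0:ℝ) ∉ tsupport f := fun h => lt_irrefl (0:ℝ) (hs h)
    have h1 := notMem_tsupport_iff_eventuallyEq.1 h0
    have h2 : ∀ᶠ y : 𝔼 in 𝓝 x, f ‖y‖ = 0 := by
      have : Tendsto (fun y : 𝔼 => ‖y‖) (𝓝 x) (𝓝 0) := by
        simpa [hx] using (continuous_norm (E := 𝔼)).tendsto x
      exact this.eventually h1
    have h3 : (fun y : 𝔼 => f ‖y‖ * HH e j y) =ᶠ[𝓝 x] fun _ => 0 := by
      filter_upwards [h2] with y hy
      rw [hy, zero_mul]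
    exact contDiffAt_const.congr_of_eventuallyEq h3
  · exact (hf.contDiffAt.comp x (contDiffAt_norm ℝ hx)).mul (HH_contDiff e j).contDiffAt

lemma hasCompactSupport_radial_mul_HH (e : Fin N) (j : ℕ) {f : ℝ → ℝ}
    (hf : HasCompactSupport f) : HasCompactSupport (fun x : 𝔼 => f ‖x‖ * HH e j x) := by
  obtain ⟨R, hR⟩ := hf.isCompact.isBounded.subset_closedBall (0:ℝ)
  refine HasCompactSupport.intro (isCompact_closedBall (0:𝔼) R) fun x hx => ?_
  have : f ‖x‖ = 0 := by
    refine image_eq_zero_of_notMem_tsupport fun h => hx ?_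
    have := hR h
    simpa using this
  rw [this, zero_mul]

/-- The weak form of the equation satisfied by the coefficients. -/
lemma LSol.integral_md (hN : 2 ≤ N) {v h : 𝔼 → ℝ} (H : LSol v h) (e : Fin N) (j : ℕ) {f : ℝ → ℝ}
    (hf : ContDiff ℝ 2 f) (hc : HasCompactSupport f) (hs : tsupport f ⊆ Ioi 0) :
    ∫ r, (deriv (deriv f) r * r ^ (N - 1 + j) + (N - 1 + 2 * j) * deriv f r * r ^ (N - 2 + j))
      * md e j v r = -∫ r, r ^ (N - 1 + j) * f r * md e j h r := by
  have hη := contDiff_radial_mul_HH e j hf hs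
  have hηc := hasCompactSupport_radial_mul_HH e j hc
  have key := H.integral_mul_lap hη hηc
  have p1 := (integral_polar hN ((H.continuous.mul (continuous_lap hη)).integrable_of_hasCompactSupport
    (hasCompactSupport_lap hηc).mul_left)).2
  have p2 := (integral_polar hN ((H.continuous_rhs.mul hη.continuous).integrable_of_hasCompactSupport
    hηc.mul_left)).2
  have hz : ∀ r : ℝ, r ∉ Ioi (0:ℝ) → f r = 0 ∧ deriv f r = 0 ∧ deriv (deriv f) r = 0 :=
    fun r hr => eq_zero_of_notMem_tsupport fun h => hr (hs h)
  have hnorm : ∀ (r : ℝ), 0 < r → ∀ θ : sphere (0:𝔼) 1, ‖r • (θ:𝔼)‖ = r :=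
    fun r hr θ => norm_smul_sphere hr.le θ
  simp only [Pi.mul_apply] at p1 p2
  have f1 : ∫ r, r ^ (N - 1 + j) * f r * md e j h r =
      ∫ r in Ioi 0, r ^ (N - 1 + j) * f r * md e j h r := by
    refine (setIntegral_eq_integral_of_forall_compl_eq_zero fun r hr => ?_).symm
    rw [(hz r hr).1]
    ring
  rw [f1, ← setIntegral_eq_integral_of_forall_compl_eq_zero (s := Ioi 0) (fun r hr => by
    rw [(hz r hr).2.1, (hz r hr).2.2]; ring)]
  calc _ = ∫ x, v x * lap (fun x => f ‖x‖ * HH e j x) x := by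
        rw [p1]
        refine setIntegral_congr_fun measurableSet_Ioi fun r hr => ?_
        have hr0 : 0 < r := hr
        simp only [md]
        rw [← integral_const_mul, ← integral_const_mul]
        refine integral_congr_ae (Eventually.of_forall fun θ => ?_)
        simp only
        rw [lap_radial_mul_HH hN e j (by rw [← norm_pos_iff, hnorm r hr0]; exact hr0)
          hf.contDiffAt, hnorm r hr0, HH_smul]
        obtain ⟨n, rfl⟩ := Nat.exists_eq_add_of_le hN
        have e1 : 2 + n - 1 + j = n + j + 1 := by omega
        have e2 : 2 + n - 2 + j = n + j := by omega
        have e3 : 2 + n - 1 = n + 1 := by omega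
        rw [e1, e2, e3]
        field_simp
        ring
    _ = -∫ x, h x * (f ‖x‖ * HH e j x) := key
    _ = _ := by
        rw [p2]
        congr 1
        refine setIntegral_congr_fun measurableSet_Ioi fun r hr => ?_
        have hr0 : 0 < r := hr
        simp only [md]
        rw [← integral_const_mul, ← integral_const_mul]
        refine integral_congr_ae (Eventually.of_forall fun θ => ?_)
        simp only
        rw [hnorm r hr0, HH_smul, pow_add]
        ring

/-- The differential equation satisfied by the coefficients along zonal harmonics. -/
lemma LSol.hasDerivAt_mdd (hN : 2 ≤ N) {v h : 𝔼 → ℝ} (H : LSol v h) (e : Fin N) (j : ℕ) {r : ℝ}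
    (hr : 0 < r) : HasDerivAt (mdd e j v)
      (-((N - 1) / r * mdd e j v r) + j * (j + N - 2) / r ^ 2 * md e j v r - md e j h r) r := by
  have hv1 := H.contDiff_one
  have ca := continuous_md e j H.continuous
  have cd := continuous_mdd e j hv1
  have cb := continuous_md e j H.continuous_rhs
  have da := hasDerivAt_md e j hv1
  obtain ⟨k, rfl⟩ := Nat.exists_eq_add_of_le hN
  set n := k + j with hn
  have e1 : 2 + k - 1 + j = n + 1 := by omega
  have e2 : 2 + k - 2 + j = n := by omega
  set a := md e j v
  set d := mdd e j v
  set b := md e j h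
  set K : ℝ → ℝ := fun r => r ^ (n + 1) * b r with hK
  have cK : Continuous K := by fun_prop
  set K0 : ℝ → ℝ := fun r => ∫ s in (0:ℝ)..r, K s with hK0
  have dK0 : ∀ r, HasDerivAt K0 (K r) r := fun r =>
    intervalIntegral.integral_hasDerivAt_right (cK.intervalIntegrable _ _)
      (cK.stronglyMeasurableAtFilter _ _) cK.continuousAt
  have cK0 : Continuous K0 := continuous_iff_continuousAt.2 fun r => (dK0 r).continuousAt
  set P : ℝ → ℝ := fun r => r ^ (n + 1) * d r - j * r ^ n * a r with hP
  have cP : Continuous P := by fun_prop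
  have hconst : ∀ f : ℝ → ℝ, ContDiff ℝ 2 f → HasCompactSupport f → tsupport f ⊆ Ioi 0 →
      ∫ r, deriv f r * (P r + K0 r) = 0 := by
    intro f hf hc hs
    have key := H.integral_md hN e j hf hc hs
    rw [e1, e2] at key
    have cf := hf.continuous
    have cf' : Continuous (deriv f) := hf.continuous_deriv (by norm_num)
    have df : ∀ r, HasDerivAt f (deriv f r) r := fun r =>
      (hf.differentiable (by norm_num) r).hasDerivAt
    have hf1 : ContDiff ℝ 1 (deriv f) := ((contDiff_succ_iff_deriv (n := 1)).1 hf).2.2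
    have cf'' : Continuous (deriv (deriv f)) := hf1.continuous_deriv (by norm_num)
    have df' : ∀ r, HasDerivAt (deriv f) (deriv (deriv f) r) r := fun r =>
      (hf1.differentiable (by norm_num) r).hasDerivAt
    have hz := fun r => eq_zero_of_notMem_tsupport (f := f) (r := r)
    have hI : ∀ {q : ℝ → ℝ}, Continuous q → (∀ r ∉ tsupport f, q r = 0) → Integrable q :=
      fun hq h => hq.integrable_of_hasCompactSupport (HasCompactSupport.intro hc h)
    have i1 : ∫ r, ((deriv (deriv f) r * r ^ (n + 1) + deriv f r * ((n + 1) * r ^ n)) * a r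
        + deriv f r * r ^ (n + 1) * d r) = 0 := by
      refine integral_eq_zero_of_hasDerivAt_of_integrable
        (f := fun r => deriv f r * r ^ (n + 1) * a r) (fun r => ?_)
        (hI (by fun_prop) fun r hr => ?_) (hI (by fun_prop) fun r hr => ?_)
      · have h1 := ((df' r).fun_mul (hasDerivAt_pow (n + 1) r)).fun_mul (da r)
        exact h1.congr_deriv (by push_cast; simp [a, d])
      · rw [(hz r hr).2.1, (hz r hr).2.2]; ring
      · rw [(hz r hr).2.1]; ring
    have i2 : ∫ r, (deriv f r * K0 r + f r * K r) = 0 := by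
      refine integral_eq_zero_of_hasDerivAt_of_integrable
        (f := fun r => f r * K0 r) (fun r => (df r).fun_mul (dK0 r))
        (hI (by fun_prop) fun r hr => ?_) (hI (by fun_prop) fun r hr => ?_)
      · rw [(hz r hr).1, (hz r hr).2.1]; ring
      · rw [(hz r hr).1]; ring
    have I1 : Integrable fun r => ((deriv (deriv f) r * r ^ (n + 1) +
        deriv f r * ((n + 1) * r ^ n)) * a r + deriv f r * r ^ (n + 1) * d r) :=
      hI (by fun_prop) fun r hr => by rw [(hz r hr).2.1, (hz r hr).2.2]; ring
    have I2 : Integrable fun r => (deriv f r * K0 r + f r * K r) :=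
      hI (by fun_prop) fun r hr => by rw [(hz r hr).1, (hz r hr).2.1]; ring
    have I3 : Integrable fun r => (deriv (deriv f) r * r ^ (n + 1) +
        (((2 + k : ℕ) : ℝ) - 1 + 2 * j) * deriv f r * r ^ n) * a r :=
      hI (by fun_prop) fun r hr => by rw [(hz r hr).2.1, (hz r hr).2.2]; ring
    have I4 : Integrable fun r => r ^ (n + 1) * f r * b r :=
      hI (by fun_prop) fun r hr => by rw [(hz r hr).1]; ring
    have e3 : ∀ r, deriv f r * (P r + K0 r) =
        (((deriv (deriv f) r * r ^ (n + 1) + deriv f r * ((n + 1) * r ^ n)) * a r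
        + deriv f r * r ^ (n + 1) * d r) + (deriv f r * K0 r + f r * K r)) -
        ((deriv (deriv f) r * r ^ (n + 1) +
        (((2 + k : ℕ) : ℝ) - 1 + 2 * j) * deriv f r * r ^ n) * a r + r ^ (n + 1) * f r * b r) := by
      intro r
      simp only [hP, hK, hn]
      push_cast
      ring
    simp only [e3]
    have s1 := integral_sub (I1.add I2) (I3.add I4)
    have s2 := integral_add I1 I2
    have s3 := integral_add I3 I4
    simp only [Pi.add_apply] at s1
    rw [s1, s2, s3, i1, i2, key]
    ring
  have hcc : ∀ s, 0 < s → P s + K0 s = P r + K0 r := by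
    intro s hs
    rcases lt_trichotomy s r with h | h | h
    · exact eq_of_integral_deriv_mul (cP.add cK0) hconst hs h
    · rw [h]
    · exact (eq_of_integral_deriv_mul (cP.add cK0) hconst hr h).symm
  have hd : d =ᶠ[𝓝 r] fun s => (P r + K0 r - K0 s + j * s ^ n * a s) / s ^ (n + 1) := by
    filter_upwards [eventually_gt_nhds hr] with s hs
    rw [← hcc s hs]
    simp only [hP]
    field_simp
    ring
  refine HasDerivAt.congr_of_eventuallyEq ?_ hd
  have h1 := (((dK0 r).const_sub (P r + K0 r)).fun_add
    (((hasDerivAt_pow n r).const_mul (j:ℝ)).fun_mul (da r))).fun_div (hasDerivAt_pow (n + 1) r)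
    (by positivity)
  refine h1.congr_deriv ?_
  have e4 : md e j v r = a r := rfl
  have e6 : r * r ^ (n - 1) * n = n * r ^ n := by
    rcases Nat.eq_zero_or_pos n with h | h
    · simp [h]
    · obtain ⟨q, hq⟩ := Nat.exists_eq_add_of_le' h
      rw [hq]
      simp only [Nat.add_sub_cancel, pow_succ]
      ring
  simp only [hP, hK, Nat.add_sub_cancel]
  push_cast
  have e7 : (n:ℝ) = k + j := by rw [hn]; push_cast; ring
  have e8 : (n:ℝ) * r ^ (n - 1) = n * r ^ n / r := by
    field_simp
    linarith
  rw [e8, e7]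
  field_simp
  ring

lemma integral_HH_eq_zero (hN : 2 ≤ N) (e : Fin N) {j : ℕ} (hj : 1 ≤ j) :
    ∫ θ : sphere (0:𝔼) 1, HH e j θ ∂(volume : Measure 𝔼).toSphere = 0 := by
  have H : LSol (fun _ : 𝔼 => (1:ℝ)) (fun x => -lap (fun _ => (1:ℝ)) x) :=
    LSol.of_contDiff contDiff_const
  have h1 := H.hasDerivAt_mdd hN e j one_pos
  have h2 : mdd e j (fun _ : 𝔼 => (1:ℝ)) = fun _ => 0 := by
    funext r
    simp [mdd]
  have h3 : md e j (fun x : 𝔼 => -lap (fun _ => (1:ℝ)) x) 1 = 0 := by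
    simp [md, lap_const]
  have h4 : md e j (fun _ : 𝔼 => (1:ℝ)) 1 =
    ∫ θ : sphere (0:𝔼) 1, HH e j θ ∂(volume : Measure 𝔼).toSphere := by
    simp [md]
  rw [h2, h3, h4] at h1
  have h5 := h1.unique (hasDerivAt_const (1:ℝ) (0:ℝ))
  have hN' : (2:ℝ) ≤ N := by exact_mod_cast hN
  have hj' : (1:ℝ) ≤ j := by exact_mod_cast hj
  have h6 : (j:ℝ) * (j + N - 2) ≠ 0 := by
    have : (0:ℝ) < j * (j + N - 2) := by
      apply mul_pos <;> linarith
    exact this.ne'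
  simpa [h6] using h5

lemma md_radial (hN : 2 ≤ N) (e : Fin N) {j : ℕ} (hj : 1 ≤ j) {v : 𝔼 → ℝ} {r c : ℝ} (hr : 0 ≤ r)
    (hv : ∀ x : 𝔼, ‖x‖ = r → v x = c) : md e j v r = 0 := by
  have h := md_radial_mul e j (v := fun _ => 1) hr hv
  simp only [mul_one] at h
  rw [h]
  simp [md, integral_HH_eq_zero hN e hj]

/-- The squared norm on the sphere of the zonal harmonic. -/
noncomputable def sqH (e : Fin N) (j : ℕ) : ℝ :=
  ∫ θ : sphere (0 : 𝔼) 1, HH e j θ * HH e j θ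
    ∂(volume : Measure 𝔼).toSphere

lemma sqH_pos (hN : 2 ≤ N) (e : Fin N) (j : ℕ) : 0 < sqH e j := by
  have hc := (HH_continuous e j).comp
    (continuous_subtype_val (p := fun x => x ∈ sphere (0:𝔼) 1))
  refine Continuous.integral_pos_of_hasCompactSupport_nonneg_nonzero
    (x := ⟨single e 1, by simp⟩) (hc.mul hc)
    (HasCompactSupport.of_compactSpace _) (fun θ => mul_self_nonneg _) ?_
  simp [HH_pole hN]

lemma md_radial_mul_HH (e : Fin N) (j : ℕ) (f : ℝ → ℝ) {r : ℝ} (hr : 0 ≤ r) :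
    md e j (fun x => f ‖x‖ * HH e j x) r = f r * r ^ j * sqH e j := by
  simp only [md, sqH]
  rw [← integral_const_mul]
  refine integral_congr_ae (Eventually.of_forall fun θ => ?_)
  simp only
  rw [norm_smul_sphere hr, HH_smul]
  ring

/-- A zonal function all of whose coefficients vanish is zero. -/
lemma eq_zero_of_md_eq_zero (hN : 2 ≤ N) (e : Fin N) {v : 𝔼 → ℝ} (hv : Continuous v)
    (hz : ∀ x y : 𝔼, x e = y e → ‖x‖ = ‖y‖ → v x = v y) {r : ℝ} (hr : 0 ≤ r)
    (h : ∀ j, md e j v r = 0) (x : 𝔼) (hx : ‖x‖ = r) : v x = 0 := by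
  have hN' : (2:ℝ) ≤ N := by exact_mod_cast hN
  have cv : Continuous fun θ : 𝔼 => v (r • θ) := hv.comp (continuous_const_smul r)
  have ce : Continuous fun θ : 𝔼 => θ e := (contDiff_coord e (n := 0)).continuous
  have hI : ∀ (a j : ℕ), Integrable (fun θ : sphere (0:𝔼) 1 =>
      v (r • (θ:𝔼)) * (θ:𝔼) e ^ a * HH e j θ) (volume : Measure 𝔼).toSphere := fun a j =>
    integrable_sphere (f := fun θ => v (r • θ) * θ e ^ a * HH e j θ)
      ((cv.mul (ce.pow a)).mul (HH_continuous e j))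
  have key : ∀ a j : ℕ, ∫ θ : sphere (0:𝔼) 1,
      v (r • (θ:𝔼)) * (θ:𝔼) e ^ a * HH e j θ ∂(volume : Measure 𝔼).toSphere = 0 := by
    intro a
    induction a with
    | zero => intro j; simpa [md] using h j
    | succ a ih =>
      intro j
      cases j with
      | zero =>
        rw [← ih 1]
        refine integral_congr_ae (Eventually.of_forall fun θ => ?_)
        simp only [HH_zero, HH_one]
        ring
      | succ j =>
        have hj : (0:ℝ) ≤ j := Nat.cast_nonneg j
        have e1 : (j:ℝ) + N - 1 ≠ 0 := by linarith
        have e2 : 2 * (j:ℝ) + N ≠ 0 := by linarith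
        have e3 : ∀ θ : sphere (0:𝔼) 1,
            v (r • (θ:𝔼)) * (θ:𝔼) e ^ (a + 1) * HH e (j + 1) θ =
            (j + N - 1) / (2 * j + N) * (v (r • (θ:𝔼)) * (θ:𝔼) e ^ a * HH e (j + 2) θ) +
            (j + 1) / (2 * j + N) * (v (r • (θ:𝔼)) * (θ:𝔼) e ^ a * HH e j θ) := by
          intro θ
          rw [HH_succ, norm_eq_of_mem_sphere]
          field_simp
          ring
        simp only [e3]
        rw [integral_add ((hI _ _).const_mul _) ((hI _ _).const_mul _), integral_const_mul,
          integral_const_mul, ih, ih]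
        ring
  have keyP : ∀ p : Polynomial ℝ, ∫ θ : sphere (0:𝔼) 1,
      v (r • (θ:𝔼)) * p.eval ((θ:𝔼) e) ∂(volume : Measure 𝔼).toSphere = 0 := by
    intro p
    have cp : ∀ p : Polynomial ℝ, Integrable (fun θ : sphere (0:𝔼) 1 =>
      v (r • (θ:𝔼)) * p.eval ((θ:𝔼) e)) (volume : Measure 𝔼).toSphere := fun p =>
      integrable_sphere (f := fun θ => v (r • θ) * p.eval (θ e)) (cv.mul (p.continuous.comp ce))
    induction p using Polynomial.induction_on' with
    | add p q hp hq =>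
      simp only [Polynomial.eval_add, mul_add]
      rw [integral_add (cp p) (cp q), hp, hq, add_zero]
    | monomial n c =>
      have := key n 0
      simp only [HH_zero, mul_one] at this
      simp only [Polynomial.eval_monomial, mul_left_comm _ c]
      rw [integral_const_mul, this, mul_zero]
  have : Nontrivial (Fin N) := Fin.nontrivial_iff_two_le.2 hN
  obtain ⟨e', he⟩ := exists_ne e
  set g : ℝ → 𝔼 := fun s => s • single e (1:ℝ) +
    √(1 - s ^ 2) • single e' (1:ℝ) with hg
  have cg : Continuous g := by fun_prop
  have hge : ∀ s, g s e = s := fun s => by simp [hg, he.symm]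
  have hgn : ∀ s ∈ Icc (-1:ℝ) 1, ‖g s‖ = 1 := by
    intro s hs
    have h0 : 0 ≤ 1 - s ^ 2 := by nlinarith [hs.1, hs.2]
    have h1 : ‖g s‖ ^ 2 = 1 := by
      rw [hg]
      simp only
      rw [norm_add_sq_real]
      have h2 : inner ℝ (single e (1:ℝ)) (single e' (1:ℝ)) = 0 := by
        rw [EuclideanSpace.inner_single_left]
        simp [he.symm]
      simp [norm_smul, inner_smul_left, inner_smul_right, h2, sq_sqrt h0]
    have h2 := norm_nonneg (g s)
    nlinarith
  have hθ1 : ∀ θ : sphere (0:𝔼) 1, (θ:𝔼) e ∈ Icc (-1:ℝ) 1 := by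
    intro θ
    have := PiLp.norm_apply_le (θ:𝔼) e
    rw [norm_eq_of_mem_sphere, norm_eq_abs, abs_le] at this
    exact this
  have hθ : ∀ θ : sphere (0:𝔼) 1, v (r • g ((θ:𝔼) e)) = v (r • (θ:𝔼)) := by
    intro θ
    refine hz _ _ ?_ ?_
    · simp only [PiLp.smul_apply, hge]
    · rw [norm_smul, norm_smul, hgn _ (hθ1 θ), norm_eq_of_mem_sphere]
  set A := ∫ θ : sphere (0:𝔼) 1, |v (r • (θ:𝔼))| ∂(volume : Measure 𝔼).toSphere
  have hA : 0 ≤ A := integral_nonneg fun _ => abs_nonneg _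
  have IA := integrable_sphere cv.abs
  have I2 := integrable_sphere (f := fun θ => v (r • θ) * v (r • θ)) (cv.mul cv)
  have hsq : ∫ θ : sphere (0:𝔼) 1, v (r • (θ:𝔼)) * v (r • (θ:𝔼))
      ∂(volume : Measure 𝔼).toSphere ≤ 0 := by
    refine le_of_forall_pos_le_add fun ε hε => ?_
    obtain ⟨p, hp⟩ := exists_polynomial_near_of_continuousOn (-1) 1 (fun s => v (r • g s))
      (cv.comp cg).continuousOn (ε / (A + 1)) (by positivity)
    have I3 := integrable_sphere (f := fun θ => v (r • θ) * p.eval (θ e))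
      (cv.mul (p.continuous.comp ce))
    have h1 : ∫ θ : sphere (0:𝔼) 1, (v (r • (θ:𝔼)) * v (r • (θ:𝔼))
        - v (r • (θ:𝔼)) * p.eval ((θ:𝔼) e)) ∂(volume : Measure 𝔼).toSphere ≤
        ε / (A + 1) * A := by
      rw [← integral_const_mul]
      refine integral_mono (I2.sub I3) (IA.const_mul _) fun θ => ?_
      simp only
      have h2 := hp _ (hθ1 θ)
      rw [hθ, abs_sub_comm] at h2
      rw [← mul_sub]
      refine (le_abs_self _).trans ?_
      rw [abs_mul, mul_comm]
      gcongr
    rw [integral_sub I2 I3, keyP, sub_zero] at h1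
    refine h1.trans ?_
    rw [zero_add, div_mul_eq_mul_div, div_le_iff₀ (by positivity)]
    nlinarith
  obtain ⟨θ, hθx⟩ : ∃ θ : sphere (0:𝔼) 1, r • (θ:𝔼) = x := by
    rcases hr.eq_or_lt with h0 | h0
    · refine ⟨⟨single e 1, by simp⟩, ?_⟩
      rw [← h0] at hx ⊢
      rw [norm_eq_zero.1 hx, zero_smul]
    · refine ⟨⟨r⁻¹ • x, ?_⟩, ?_⟩
      · rw [mem_sphere_zero_iff_norm, norm_smul, hx, norm_inv, norm_of_nonneg hr,
          inv_mul_cancel₀ h0.ne']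
      · simp [smul_smul, h0.ne']
  by_contra hne
  refine absurd hsq (not_le.2 ?_)
  have cc := cv.comp (continuous_subtype_val (p := fun x => x ∈ sphere (0:𝔼) 1))
  refine Continuous.integral_pos_of_hasCompactSupport_nonneg_nonzero (x := θ) (cc.mul cc)
    (HasCompactSupport.of_compactSpace _) (fun θ => mul_self_nonneg _) ?_
  simp only [hθx]
  exact mul_ne_zero hne hne

/-- Boundedness on the half-line together with decay faster than any power. -/
def Dec (w : ℝ → ℝ) : Prop := ∀ n : ℕ, ∃ C, ∀ t > (0:ℝ), t ^ n * |w t| ≤ C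

lemma Dec.exists_bound {w : ℝ → ℝ} (h : Dec w) : ∃ C, ∀ t > (0:ℝ), |w t| ≤ C := by
  obtain ⟨C, hC⟩ := h 0
  exact ⟨C, fun t ht => by simpa using hC t ht⟩

lemma Dec.bdd_mul {w B : ℝ → ℝ} {M : ℝ} (h : Dec w) (hB : ∀ t > (0:ℝ), |B t| ≤ M) :
    Dec (fun t => B t * w t) := by
  intro n
  obtain ⟨C, hC⟩ := h n
  refine ⟨M * C, fun t ht => ?_⟩
  have hM : 0 ≤ M := (abs_nonneg _).trans (hB t ht)
  rw [abs_mul, mul_left_comm]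
  exact mul_le_mul (hB t ht) (hC t ht) (by positivity) hM

lemma Dec.mul {w z : ℝ → ℝ} (h : Dec w) (hz : Dec z) : Dec (fun t => w t * z t) := by
  obtain ⟨C, hC⟩ := h.exists_bound
  exact hz.bdd_mul hC

lemma Dec.add {w z : ℝ → ℝ} (h : Dec w) (hz : Dec z) : Dec (fun t => w t + z t) := by
  intro n
  obtain ⟨C, hC⟩ := h n
  obtain ⟨C', hC'⟩ := hz n
  refine ⟨C + C', fun t ht => ?_⟩
  have h1 := mul_le_mul_of_nonneg_left (abs_add_le (w t) (z t)) (pow_nonneg ht.le n)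
  linarith [hC t ht, hC' t ht]

lemma Dec.const_mul {w : ℝ → ℝ} (h : Dec w) (c : ℝ) : Dec (fun t => c * w t) :=
  h.bdd_mul (B := fun _ => c) (fun _ _ => le_refl |c|)

lemma Dec.congr {w z : ℝ → ℝ} (h : Dec w) (hz : ∀ t > (0:ℝ), z t = w t) : Dec z := by
  intro n
  obtain ⟨C, hC⟩ := h n
  exact ⟨C, fun t ht => by rw [hz t ht]; exact hC t ht⟩

lemma Dec.of_le {w z : ℝ → ℝ} (h : Dec w) {M : ℝ} (hz : ∀ t > (0:ℝ), |z t| ≤ M * |w t|) :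
    Dec z := by
  intro n
  obtain ⟨C, hC⟩ := h.const_mul M n
  refine ⟨C, fun t ht => (mul_le_mul_of_nonneg_left ((hz t ht).trans ?_) (by positivity)).trans
    (hC t ht)⟩
  rw [abs_mul]
  gcongr
  exact le_abs_self M

lemma Dec.rpow_mul {w : ℝ → ℝ} (h : Dec w) {b : ℝ} (hb : 0 ≤ b) :
    Dec (fun t => t ^ b * w t) := by
  intro n
  obtain ⟨C, hC⟩ := h n
  obtain ⟨C', hC'⟩ := h (n + ⌈b⌉₊)
  refine ⟨C + C', fun t ht => ?_⟩
  have h1 : t ^ b ≤ 1 + t ^ ⌈b⌉₊ := by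
    rcases le_total t 1 with h1 | h1
    · have := rpow_le_one ht.le h1 hb
      have := pow_nonneg ht.le ⌈b⌉₊
      linarith
    · have := rpow_le_rpow_of_exponent_le h1 (Nat.le_ceil b)
      rw [rpow_natCast] at this
      linarith
  rw [abs_mul, abs_of_nonneg (rpow_nonneg ht.le b)]
  have h2 := mul_le_mul_of_nonneg_right h1 (mul_nonneg (pow_nonneg ht.le n) (abs_nonneg (w t)))
  have h3 := hC t ht
  have h4 := hC' t ht
  rw [pow_add] at h4
  nlinarith

lemma Dec.tendsto_atTop {w : ℝ → ℝ} (h : Dec w) (b : ℝ) :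
    Tendsto (fun t => t ^ b * w t) atTop (𝓝 0) := by
  obtain ⟨C, hC⟩ := h.rpow_mul (b := |b|) (abs_nonneg b) 1
  have h1 : Tendsto (fun t : ℝ => C / t) atTop (𝓝 0) := tendsto_const_nhds.div_atTop tendsto_id
  refine squeeze_zero_norm' ?_ h1
  filter_upwards [eventually_ge_atTop 1] with t ht
  have ht0 : 0 < t := by linarith
  have h2 := hC t ht0
  have h3 := rpow_le_rpow_of_exponent_le ht (le_abs_self b)
  rw [norm_eq_abs, le_div_iff₀ ht0]
  rw [abs_mul, abs_of_nonneg (rpow_nonneg ht0.le _)] at h2 ⊢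
  have h4 := mul_le_mul_of_nonneg_right h3 (mul_nonneg (abs_nonneg (w t)) ht0.le)
  linarith

lemma Dec.tendsto_zero {w : ℝ → ℝ} (h : Dec w) {b : ℝ} (hb : 0 < b) :
    Tendsto (fun t => t ^ b * w t) (𝓝[>] 0) (𝓝 0) := by
  obtain ⟨C, hC⟩ := h.exists_bound
  have h1 : Tendsto (fun t : ℝ => t ^ b * C) (𝓝[>] 0) (𝓝 0) := by
    have := ((continuous_rpow_const hb.le).tendsto (0:ℝ)).mul_const C
    rw [zero_rpow hb.ne', zero_mul] at this
    exact this.mono_left nhdsWithin_le_nhds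
  refine squeeze_zero_norm' ?_ h1
  filter_upwards [self_mem_nhdsWithin] with t ht
  have ht0 : 0 < t := ht
  rw [norm_eq_abs, abs_mul, abs_of_nonneg (rpow_nonneg ht0.le _)]
  gcongr
  exact hC t ht0

lemma Dec.integrableOn {w : ℝ → ℝ} (h : Dec w) (hc : ContinuousOn w (Ioi 0)) {b : ℝ}
    (hb : -1 < b) : IntegrableOn (fun t => t ^ b * w t) (Ioi 0) := by
  have hcc : ContinuousOn (fun t => t ^ b * w t) (Ioi 0) := by
    refine ContinuousOn.mul (fun t ht => ?_) hc
    exact (continuousAt_rpow_const t b (Or.inl (ne_of_gt ht))).continuousWithinAt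
  rw [← Ioc_union_Ioi_eq_Ioi (zero_le_one (α := ℝ))]
  refine IntegrableOn.union ?_ ?_
  · obtain ⟨C, hC⟩ := h.exists_bound
    have h1 : IntegrableOn (fun t : ℝ => t ^ b * C) (Ioc 0 1) := by
      refine Integrable.mul_const ?_ C
      exact (intervalIntegrable_iff_integrableOn_Ioc_of_le zero_le_one).1
        (intervalIntegral.intervalIntegrable_rpow' hb)
    refine Integrable.mono' h1
      ((hcc.mono Ioc_subset_Ioi_self).aestronglyMeasurable measurableSet_Ioc) ?_
    refine (ae_restrict_iff' measurableSet_Ioc).2 (Eventually.of_forall fun t ht => ?_)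
    rw [norm_eq_abs, abs_mul, abs_of_nonneg (rpow_nonneg ht.1.le _)]
    gcongr
    · exact rpow_nonneg ht.1.le _
    · exact hC t ht.1
  · obtain ⟨C, hC⟩ := h.rpow_mul (b := |b|) (abs_nonneg b) 2
    have h1 : IntegrableOn (fun t : ℝ => t ^ (-2:ℝ) * C) (Ioi 1) :=
      (integrableOn_Ioi_rpow_of_lt (by norm_num) one_pos).mul_const C
    refine Integrable.mono' h1
      ((hcc.mono (Ioi_subset_Ioi zero_le_one)).aestronglyMeasurable measurableSet_Ioi) ?_
    refine (ae_restrict_iff' measurableSet_Ioi).2 (Eventually.of_forall fun t ht => ?_)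
    have ht1 : 1 < t := ht
    have ht0 : 0 < t := by linarith
    have h2 := hC t ht0
    have h3 := rpow_le_rpow_of_exponent_le ht1.le (le_abs_self b)
    rw [norm_eq_abs, rpow_neg ht0.le, rpow_two, inv_mul_eq_div,
      le_div_iff₀ (by positivity)]
    rw [abs_mul, abs_of_nonneg (rpow_nonneg ht0.le _)] at h2 ⊢
    have h4 := mul_le_mul_of_nonneg_right h3 (mul_nonneg (abs_nonneg (w t)) (sq_nonneg t))
    linarith

lemma setIntegral_rpow_mul_pos {f : ℝ → ℝ} {b t₀ : ℝ} (hc : ContinuousOn f (Ioi 0))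
    (h0 : ∀ t > (0:ℝ), 0 ≤ f t) (ht₀ : 0 < t₀) (hf : f t₀ ≠ 0)
    (hI : IntegrableOn (fun t => t ^ b * f t) (Ioi 0)) : 0 < ∫ t in Ioi 0, t ^ b * f t := by
  have hcc : ContinuousOn (fun t => t ^ b * f t) (Ioi 0) := by
    refine ContinuousOn.mul (fun t ht => ?_) hc
    exact (continuousAt_rpow_const t b (Or.inl (ne_of_gt ht))).continuousWithinAt
  rw [setIntegral_pos_iff_support_of_nonneg_ae]
  · have h1 : ∀ᶠ t in 𝓝 t₀, t ^ b * f t ≠ 0 :=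
      (hcc.continuousAt (Ioi_mem_nhds ht₀)).eventually_ne
        (mul_ne_zero (rpow_pos_of_pos ht₀ b).ne' hf)
    have h2 := h1.and (Ioi_mem_nhds ht₀)
    exact Measure.measure_pos_of_mem_nhds volume (x := t₀) (h2.mono fun t ht => ⟨ht.1, ht.2⟩)
  · refine (ae_restrict_iff' measurableSet_Ioi).2 (Eventually.of_forall fun t ht => ?_)
    exact mul_nonneg (rpow_nonneg (le_of_lt ht) b) (h0 t ht)
  · exact hI

lemma rpow_sub_two_mul {t : ℝ} (ht : 0 < t) (a x : ℝ) : t ^ (a - 2) * x = t ^ a * (x / t ^ 2) := by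
  rw [rpow_sub ht, rpow_two]
  ring

/-- Integration by parts for a radial operator. -/
lemma integral_green {a : ℝ} (ha : 1 < a) {y1 f Φ Φ1 : ℝ → ℝ}
    (hy1 : ∀ t > (0:ℝ), HasDerivAt y1 (-(a / t * y1 t) - f t) t)
    (hΦ : ∀ t > (0:ℝ), HasDerivAt Φ (Φ1 t) t) (cΦ1 : ContinuousOn Φ1 (Ioi 0))
    (dy1 : Dec fun t => t * y1 t) (dΦ : Dec Φ) (dΦ1 : Dec fun t => t * Φ1 t)
    (hI : IntegrableOn (fun t => t ^ a * (f t * Φ t)) (Ioi 0)) :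
    ∫ t in Ioi 0, t ^ a * (y1 t * Φ1 t) = ∫ t in Ioi 0, t ^ a * (f t * Φ t) := by
  have cy1 : ContinuousOn y1 (Ioi 0) := fun t ht => (hy1 t ht).continuousAt.continuousWithinAt
  have I1 : IntegrableOn (fun t => t ^ a * (y1 t * Φ1 t)) (Ioi 0) := by
    have h := (dy1.mul dΦ1).integrableOn
      ((continuousOn_id.mul cy1).mul (continuousOn_id.mul cΦ1)) (b := a - 2) (by linarith)
    refine h.congr_fun (fun t ht => ?_) measurableSet_Ioi
    have ht0 : 0 < t := ht
    simp only
    rw [rpow_sub_two_mul ht0]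
    field_simp
  set G : ℝ → ℝ := fun t => t ^ a * (y1 t * Φ t) with hG
  have hGd : ∀ t ∈ Ioi (0:ℝ), HasDerivAt G (t ^ a * (y1 t * Φ1 t) - t ^ a * (f t * Φ t)) t := by
    intro t ht
    have ht0 : 0 < t := ht
    have h1 := (hasDerivAt_rpow_const (x := t) (p := a) (Or.inl ht0.ne')).fun_mul
      ((hy1 t ht0).fun_mul (hΦ t ht0))
    refine h1.congr_deriv ?_
    rw [rpow_sub ht0, rpow_one]
    field_simp
    ring
  have e1 : ∀ t > (0:ℝ), G t = t ^ (a - 1) * (t * y1 t * Φ t) := by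
    intro t ht
    rw [rpow_sub ht, rpow_one]
    simp only [hG]
    field_simp
  have hG0 : G 0 = 0 := by simp [hG, zero_rpow (show a ≠ 0 by linarith)]
  have hd := dy1.mul dΦ
  have h1 : Tendsto G atTop (𝓝 0) := by
    refine (hd.tendsto_atTop (a - 1)).congr' ?_
    filter_upwards [eventually_gt_atTop 0] with t ht
    exact (e1 t ht).symm
  have h2 : ContinuousWithinAt G (Ici 0) 0 := by
    rw [← continuousWithinAt_Ioi_iff_Ici]
    unfold ContinuousWithinAt
    rw [hG0]
    refine (hd.tendsto_zero (b := a - 1) (by linarith)).congr' ?_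
    filter_upwards [self_mem_nhdsWithin] with t ht
    exact (e1 t ht).symm
  have h3 := integral_Ioi_of_hasDerivAt_of_tendsto h2 hGd (I1.sub hI) h1
  rw [hG0, sub_zero, integral_sub I1 hI] at h3
  linarith

/-- The Wronskian identity for a radial operator. -/
lemma integral_wronskian {a : ℝ} (ha : 1 < a) {y y1 f Φ Φ1 g : ℝ → ℝ}
    (hy : ∀ t > (0:ℝ), HasDerivAt y (y1 t) t)
    (hy1 : ∀ t > (0:ℝ), HasDerivAt y1 (-(a / t * y1 t) - f t) t)
    (hΦ : ∀ t > (0:ℝ), HasDerivAt Φ (Φ1 t) t)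
    (hΦ1 : ∀ t > (0:ℝ), HasDerivAt Φ1 (-(a / t * Φ1 t) - g t) t)
    (dy : Dec y) (dy1 : Dec fun t => t * y1 t) (dΦ : Dec Φ) (dΦ1 : Dec fun t => t * Φ1 t)
    (hI : IntegrableOn (fun t => t ^ a * (f t * Φ t)) (Ioi 0))
    (hI' : IntegrableOn (fun t => t ^ a * (g t * y t)) (Ioi 0)) :
    ∫ t in Ioi 0, t ^ a * (f t * Φ t) = ∫ t in Ioi 0, t ^ a * (g t * y t) := by
  rw [← integral_green ha hy1 hΦ (fun t ht => (hΦ1 t ht).continuousAt.continuousWithinAt)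
    dy1 dΦ dΦ1 hI, ← integral_green ha hΦ1 hy
    (fun t ht => (hy1 t ht).continuousAt.continuousWithinAt) dΦ1 dy dy1 hI']
  simp only [mul_comm]

lemma memE_of_dec {k : ℝ} (hk : 1 < k) {W W1 : ℝ → ℝ}
    (hW : ∀ t > (0:ℝ), HasDerivAt W (W1 t) t) (cW1 : ContinuousOn W1 (Ioi 0))
    (dW : Dec W) (dW1 : Dec fun t => t * W1 t) : memE k W := by
  have hd : ∀ t ∈ Ioi (0:ℝ), deriv W t = W1 t := fun t ht => (hW t ht).deriv
  have cW : ContinuousOn W (Ioi 0) := fun t ht => (hW t ht).continuousAt.continuousWithinAt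
  refine ⟨?_, ?_⟩
  · rw [show (1 : WithTop ℕ∞) = 0 + 1 from (zero_add 1).symm,
      contDiffOn_succ_iff_deriv_of_isOpen isOpen_Ioi]
    exact ⟨fun t ht => (hW t ht).differentiableAt.differentiableWithinAt, by simp,
      contDiffOn_zero.2 (cW1.congr hd)⟩
  · have h1 := (dW1.mul dW1).integrableOn
      ((continuousOn_id.mul cW1).mul (continuousOn_id.mul cW1)) (b := k - 2) (by linarith)
    have h2 := (dW.mul dW).integrableOn (cW.mul cW) (b := k) (by linarith)
    refine (h1.add h2).congr_fun (fun t ht => ?_) measurableSet_Ioi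
    have ht0 : 0 < t := ht
    simp only [Pi.add_apply]
    rw [rpow_sub_two_mul ht0, hd t ht]
    field_simp

/-- Nondegeneracy excludes nontrivial decaying solutions of the linearized equation. -/
lemma eq_zero_of_radNondeg {k : ℝ} (hk : 1 < k) {A W W1 : ℝ → ℝ} (hA : ContinuousOn A (Ioi 0))
    (H : RadNondeg k A) (hW : ∀ t > (0:ℝ), HasDerivAt W (W1 t) t)
    (hW1 : ∀ t > (0:ℝ), HasDerivAt W1 (-(k / t * W1 t) - A t * W t) t)
    (dW : Dec W) (dW1 : Dec fun t => t * W1 t) : ∀ t > (0:ℝ), W t = 0 := by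
  have cW : ContinuousOn W (Ioi 0) := fun t ht => (hW t ht).continuousAt.continuousWithinAt
  have cW1 : ContinuousOn W1 (Ioi 0) := fun t ht => (hW1 t ht).continuousAt.continuousWithinAt
  have hd : ∀ t ∈ Ioi (0:ℝ), deriv W t = W1 t := fun t ht => (hW t ht).deriv
  have hd2 : ∀ t ∈ Ioi (0:ℝ), deriv (deriv W) t = -(k / t * W1 t) - A t * W t := by
    intro t ht
    have : deriv W =ᶠ[𝓝 t] W1 := by
      filter_upwards [Ioi_mem_nhds ht] with s hs
      exact hd s hs
    rw [this.deriv_eq, (hW1 t ht).deriv]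
  refine H W ?_ (memE_of_dec hk hW cW1 dW dW1) fun t ht => ?_
  · rw [show (2 : WithTop ℕ∞) = 1 + 1 from (one_add_one_eq_two).symm,
      contDiffOn_succ_iff_deriv_of_isOpen isOpen_Ioi]
    refine ⟨fun t ht => (hW t ht).differentiableAt.differentiableWithinAt, by simp, ?_⟩
    refine ContDiffOn.congr ?_ hd
    rw [show (1 : WithTop ℕ∞) = 0 + 1 from (zero_add 1).symm,
      contDiffOn_succ_iff_deriv_of_isOpen isOpen_Ioi]
    refine ⟨fun t ht => (hW1 t ht).differentiableAt.differentiableWithinAt, by simp,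
      contDiffOn_zero.2 (ContinuousOn.congr ?_ fun t ht => (hW1 t ht).deriv)⟩
    refine ((ContinuousOn.mul (ContinuousOn.div continuousOn_const continuousOn_id
      fun t ht => ne_of_gt ht) cW1).neg).sub (hA.mul cW)
  · rw [hd2 t ht, hd t ht]
    ring

/-- Under Morse index one, two decaying solutions of the equations for positive angular
eigenvalues are linearly dependent. -/
lemma dependent_of_morseIndexOne {k : ℝ} (hk : 1 < k) {A W W1 P P1 : ℝ → ℝ} {ν κ M : ℝ}
    (hA : ContinuousOn A (Ioi 0)) (hAM : ∀ t > (0:ℝ), |A t| ≤ M)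
    (H : MorseIndexOne k A) (hν : 0 < ν) (hκ : 0 < κ)
    (hW : ∀ t > (0:ℝ), HasDerivAt W (W1 t) t)
    (hW1 : ∀ t > (0:ℝ), HasDerivAt W1 (-(k / t * W1 t) - (A t - ν / t ^ 2) * W t) t)
    (hP : ∀ t > (0:ℝ), HasDerivAt P (P1 t) t)
    (hP1 : ∀ t > (0:ℝ), HasDerivAt P1 (-(k / t * P1 t) - (A t - κ / t ^ 2) * P t) t)
    (dW : Dec W) (dW1 : Dec fun t => t * W1 t) (dP : Dec P) (dP1 : Dec fun t => t * P1 t) :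
    ∃ c₁ c₂ : ℝ, ¬(c₁ = 0 ∧ c₂ = 0) ∧ ∀ t > (0:ℝ), c₁ * W t + c₂ * P t = 0 := by
  by_contra hcon
  push Not at hcon
  have cW : ContinuousOn W (Ioi 0) := fun t ht => (hW t ht).continuousAt.continuousWithinAt
  have cW1 : ContinuousOn W1 (Ioi 0) := fun t ht => (hW1 t ht).continuousAt.continuousWithinAt
  have cP : ContinuousOn P (Ioi 0) := fun t ht => (hP t ht).continuousAt.continuousWithinAt
  have cP1 : ContinuousOn P1 (Ioi 0) := fun t ht => (hP1 t ht).continuousAt.continuousWithinAt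
  obtain ⟨c₁, c₂, hc, hR⟩ := H.2 W P (memE_of_dec hk hW cW1 dW dW1) (memE_of_dec hk hP cP1 dP dP1)
    (fun c₁ c₂ h => by
      by_contra h'
      obtain ⟨t, ht, h2⟩ := hcon c₁ c₂ (fun h3 h4 => h' ⟨h3, h4⟩)
      exact h2 (h t ht))
  obtain ⟨t₀, ht₀, hne⟩ := hcon c₁ c₂ (fun h3 h4 => hc ⟨h3, h4⟩)
  have hk2 : (-1:ℝ) < k - 2 := by linarith
  have hA2 : ∀ {z : ℝ → ℝ}, Dec z → ContinuousOn z (Ioi 0) →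
      IntegrableOn (fun t => t ^ k * (A t * z t)) (Ioi 0) := fun dz cz =>
    (dz.bdd_mul hAM).integrableOn (hA.mul cz) (by linarith)
  have split : ∀ {z q : ℝ → ℝ} {ν : ℝ}, Dec (fun t => z t * q t) →
      ContinuousOn (fun t => z t * q t) (Ioi 0) →
      IntegrableOn (fun t => t ^ k * ((A t - ν / t ^ 2) * z t * q t)) (Ioi 0) := by
    intro z q ν dz cz
    have h1 : IntegrableOn (fun t => t ^ k * (A t * (z t * q t)) -
        ν * (t ^ (k - 2) * (z t * q t))) (Ioi 0) :=
      (hA2 dz cz).sub ((dz.integrableOn cz hk2).const_mul ν)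
    refine h1.congr_fun (fun t ht => ?_) measurableSet_Ioi
    simp only
    rw [rpow_sub_two_mul ht]
    ring
  -- the cross term
  have hX : (ν - κ) * ∫ t in Ioi 0, t ^ (k - 2) * (W t * P t) = 0 := by
    have h1 := integral_wronskian hk hW hW1 hP hP1 dW dW1 dP dP1 (split (dW.mul dP) (cW.mul cP))
      (split (dP.mul dW) (cP.mul cW))
    have h2 := integral_sub (split (ν := ν) (dW.mul dP) (cW.mul cP))
      (split (ν := κ) (dP.mul dW) (cP.mul cW))
    have h3 : ∫ t in Ioi 0, (t ^ k * ((A t - ν / t ^ 2) * W t * P t) -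
        t ^ k * ((A t - κ / t ^ 2) * P t * W t)) =
        (-(ν - κ)) * ∫ t in Ioi 0, t ^ (k - 2) * (W t * P t) := by
      rw [← integral_const_mul]
      refine setIntegral_congr_fun measurableSet_Ioi fun t ht => ?_
      rw [rpow_sub_two_mul ht]
      ring
    rw [h1, sub_self, h3] at h2
    linarith
  set w : ℝ → ℝ := fun t => c₁ * W t + c₂ * P t with hw
  set w1 : ℝ → ℝ := fun t => c₁ * W1 t + c₂ * P1 t with hw1
  set g : ℝ → ℝ := fun t => c₁ * ν * W t + c₂ * κ * P t with hg
  have dw : Dec w := (dW.const_mul c₁).add (dP.const_mul c₂)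
  have dw1 : Dec fun t => t * w1 t :=
    ((dW1.const_mul c₁).add (dP1.const_mul c₂)).congr fun t _ => by simp only [hw1]; ring
  have dg : Dec g := (dW.const_mul _).add (dP.const_mul _)
  have cw : ContinuousOn w (Ioi 0) := (continuousOn_const.mul cW).add (continuousOn_const.mul cP)
  have cw1 : ContinuousOn w1 (Ioi 0) :=
    (continuousOn_const.mul cW1).add (continuousOn_const.mul cP1)
  have cg : ContinuousOn g (Ioi 0) := (continuousOn_const.mul cW).add (continuousOn_const.mul cP)
  have hwd : ∀ t > (0:ℝ), HasDerivAt w (w1 t) t := fun t ht =>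
    ((hW t ht).const_mul c₁).fun_add ((hP t ht).const_mul c₂)
  have hwd1 : ∀ t > (0:ℝ), HasDerivAt w1 (-(k / t * w1 t) - (A t * w t - g t / t ^ 2)) t := by
    intro t ht
    refine (((hW1 t ht).const_mul c₁).fun_add ((hP1 t ht).const_mul c₂)).congr_deriv ?_
    simp only [hw, hw1, hg]
    ring
  have J1 : IntegrableOn (fun t => t ^ k * (A t * (w t * w t))) (Ioi 0) :=
    hA2 (dw.mul dw) (cw.mul cw)
  have J2 : IntegrableOn (fun t => t ^ (k - 2) * (g t * w t)) (Ioi 0) :=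
    (dg.mul dw).integrableOn (cg.mul cw) hk2
  have J3 : IntegrableOn (fun t => t ^ k * ((A t * w t - g t / t ^ 2) * w t)) (Ioi 0) := by
    refine (J1.sub J2).congr_fun (fun t ht => ?_) measurableSet_Ioi
    simp only [Pi.sub_apply]
    rw [rpow_sub_two_mul ht]
    ring
  have J4 : IntegrableOn (fun t => t ^ k * (w1 t * w1 t)) (Ioi 0) := by
    refine ((dw1.mul dw1).integrableOn ((continuousOn_id.mul cw1).mul (continuousOn_id.mul cw1))
      hk2).congr_fun (fun t ht => ?_) measurableSet_Ioi
    have ht0 : 0 < t := ht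
    simp only
    rw [rpow_sub_two_mul ht0]
    field_simp
  have hgreen := integral_green hk hwd1 hwd cw1 dw1 dw dw1 J3
  have hnum : ∫ t in Ioi 0, t ^ k * (deriv w t ^ 2 - A t * w t ^ 2) =
      -∫ t in Ioi 0, t ^ (k - 2) * (g t * w t) := by
    have h1 : ∫ t in Ioi 0, t ^ k * (deriv w t ^ 2 - A t * w t ^ 2) =
        ∫ t in Ioi 0, (t ^ k * (w1 t * w1 t) - t ^ k * (A t * (w t * w t))) := by
      refine setIntegral_congr_fun measurableSet_Ioi fun t ht => ?_
      rw [(hwd t ht).deriv]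
      ring
    have h2 : ∫ t in Ioi 0, t ^ k * ((A t * w t - g t / t ^ 2) * w t) =
        ∫ t in Ioi 0, (t ^ k * (A t * (w t * w t)) - t ^ (k - 2) * (g t * w t)) := by
      refine setIntegral_congr_fun measurableSet_Ioi fun t ht => ?_
      rw [rpow_sub_two_mul ht]
      ring
    rw [h1, integral_sub J4 J1, hgreen, h2, integral_sub J1 J2]
    ring
  have hden : 0 < ∫ t in Ioi 0, t ^ k * w t ^ 2 := by
    refine setIntegral_rpow_mul_pos (cw.pow 2) (fun t _ => sq_nonneg _) ht₀ (pow_ne_zero 2 hne) ?_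
    refine ((dw.mul dw).integrableOn (cw.mul cw) (b := k) (by linarith)).congr_fun
      (fun t _ => ?_) measurableSet_Ioi
    simp only
    ring
  have hpos : 0 < ∫ t in Ioi 0, t ^ (k - 2) * (g t * w t) := by
    rcases eq_or_ne ν κ with h | h
    · have h1 : ∀ t, g t * w t = ν * (w t * w t) := fun t => by simp only [hg, hw, h]; ring
      simp only [h1, mul_left_comm _ ν]
      rw [integral_const_mul]
      exact mul_pos hν (setIntegral_rpow_mul_pos (cw.mul cw) (fun t _ => mul_self_nonneg _) ht₀
        (mul_ne_zero hne hne) ((dw.mul dw).integrableOn (cw.mul cw) hk2))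
    · have hX0 : ∫ t in Ioi 0, t ^ (k - 2) * (W t * P t) = 0 :=
        (mul_eq_zero.1 hX).resolve_left (sub_ne_zero.2 h)
      have IX := (dW.mul dP).integrableOn (cW.mul cP) hk2
      have IW := (dW.mul dW).integrableOn (cW.mul cW) hk2
      have IP := (dP.mul dP).integrableOn (cP.mul cP) hk2
      have J5 : IntegrableOn (fun t => t ^ (k - 2) * (ν * (c₁ * W t) ^ 2 + κ * (c₂ * P t) ^ 2))
          (Ioi 0) := by
        have h2 : IntegrableOn (fun t => ν * c₁ ^ 2 * (t ^ (k - 2) * (W t * W t)) +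
            κ * c₂ ^ 2 * (t ^ (k - 2) * (P t * P t))) (Ioi 0) :=
          (IW.const_mul (ν * c₁ ^ 2)).add (IP.const_mul (κ * c₂ ^ 2))
        refine h2.congr_fun (fun t _ => ?_) measurableSet_Ioi
        simp only
        ring
      have h1 : ∫ t in Ioi 0, t ^ (k - 2) * (g t * w t) =
          ∫ t in Ioi 0, t ^ (k - 2) * (ν * (c₁ * W t) ^ 2 + κ * (c₂ * P t) ^ 2) := by
        have h2 := integral_sub J2 J5
        have h3 : ∫ t in Ioi 0, (t ^ (k - 2) * (g t * w t) -
            t ^ (k - 2) * (ν * (c₁ * W t) ^ 2 + κ * (c₂ * P t) ^ 2)) =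
            (ν + κ) * c₁ * c₂ * ∫ t in Ioi 0, t ^ (k - 2) * (W t * P t) := by
          rw [← integral_const_mul]
          refine setIntegral_congr_fun measurableSet_Ioi fun t _ => ?_
          simp only [hg, hw]
          ring
        rw [hX0, mul_zero] at h3
        linarith
      rw [h1]
      refine setIntegral_rpow_mul_pos (t₀ := t₀) ?_ (fun t _ => by positivity) ht₀ ?_ J5
      · exact (continuousOn_const.mul ((continuousOn_const.mul cW).pow 2)).add
          (continuousOn_const.mul ((continuousOn_const.mul cP).pow 2))
      · rcases eq_or_ne (c₁ * W t₀) 0 with h2 | h2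
        · have h3 : c₂ * P t₀ ≠ 0 := fun h3 => hne (by rw [h2, h3, add_zero])
          positivity
        · positivity
  have hRay : Ray k A w < 0 := by
    unfold Ray
    rw [hnum]
    exact div_neg_of_neg_of_pos (by linarith) hden
  exact absurd hR (not_le.2 hRay)

/-- The inverse of the change of variables `r ↦ r ^ b / b`. -/
noncomputable def rt (b t : ℝ) : ℝ := (b * t) ^ (1 / b)

lemma rt_pos {b t : ℝ} (hb : 0 < b) (ht : 0 < t) : 0 < rt b t :=
  rpow_pos_of_pos (mul_pos hb ht) _

lemma rt_rpow {b t : ℝ} (hb : 0 < b) (ht : 0 < t) : rt b t ^ b = b * t := by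
  rw [rt, ← Real.rpow_mul (mul_pos hb ht).le, one_div_mul_cancel hb.ne', rpow_one]

lemma rt_apply_rpow {b r : ℝ} (hb : 0 < b) (hr : 0 < r) : rt b (r ^ b / b) = r := by
  rw [rt, mul_div_cancel₀ _ hb.ne', ← Real.rpow_mul hr.le, mul_one_div_cancel hb.ne',
    rpow_one]

lemma hasDerivAt_rt {b t : ℝ} (hb : 0 < b) (ht : 0 < t) :
    HasDerivAt (rt b) (rt b t / (b * t)) t := by
  have h := ((hasDerivAt_id t).const_mul b).rpow_const (p := 1 / b)
    (Or.inl (mul_pos hb ht).ne')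
  refine h.congr_deriv ?_
  simp only [id, rt]
  rw [rpow_sub (mul_pos hb ht), rpow_one]
  field_simp

lemma Dec.comp_rt {y : ℝ → ℝ} (hy : Dec y) {b : ℝ} (hb : 0 < b) : Dec fun t => y (rt b t) := by
  intro n
  obtain ⟨C, hC⟩ := hy.rpow_mul (b := b * n) (by positivity) 0
  refine ⟨(1 / b) ^ n * C, fun t ht => ?_⟩
  have h1 := hC _ (rt_pos hb ht)
  rw [abs_mul, abs_of_nonneg (rpow_nonneg (rt_pos hb ht).le _), Real.rpow_mul
    (rt_pos hb ht).le, rt_rpow hb ht, rpow_natCast, pow_zero, one_mul] at h1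
  have h2 : t ^ n = (1 / b) ^ n * (b * t) ^ n := by
    rw [← mul_pow]
    congr 1
    field_simp
  rw [h2, mul_assoc]
  gcongr

/-- The change of variables turning the weighted equation into one with a bounded potential. -/
lemma hasDerivAt_comp_rt {b a μ : ℝ} (hb : 0 < b) {y y1 A : ℝ → ℝ}
    (hy : ∀ r > (0:ℝ), HasDerivAt y (y1 r) r)
    (hy1 : ∀ r > (0:ℝ), HasDerivAt y1
      (-(a / r * y1 r) - (r ^ (2 * b - 2) * A (r ^ b / b) - μ / r ^ 2) * y r) r) {t : ℝ}
    (ht : 0 < t) :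
    HasDerivAt (fun t => y (rt b t)) (y1 (rt b t) * (rt b t / (b * t))) t ∧
    HasDerivAt (fun t => y1 (rt b t) * (rt b t / (b * t)))
      (-((a - 1 + b) / b / t * (y1 (rt b t) * (rt b t / (b * t))))
        - (A t - μ / b ^ 2 / t ^ 2) * y (rt b t)) t := by
  have hr := rt_pos hb ht
  have d := hasDerivAt_rt hb ht
  refine ⟨(hy _ hr).comp t d, ?_⟩
  have h1 := ((hy1 _ hr).comp t d).fun_mul (d.fun_div ((hasDerivAt_id t).const_mul b)
    (mul_pos hb ht).ne')
  refine h1.congr_deriv ?_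
  have h2 : rt b t ^ (2 * b - 2) = (b * t) ^ 2 / rt b t ^ 2 := by
    rw [rpow_sub hr, rpow_two, mul_comm 2 b, Real.rpow_mul hr.le, rt_rpow hb ht,
      rpow_two]
  have h3 : rt b t ^ b / b = t := by
    rw [rt_rpow hb ht]
    field_simp
  simp only [Function.comp, h2, h3, id]
  field_simp
  ring

lemma Dec.comp_rt_deriv {y1 : ℝ → ℝ} (hy : Dec fun r => r * y1 r) {b : ℝ} (hb : 0 < b) :
    Dec fun t => t * (y1 (rt b t) * (rt b t / (b * t))) :=
  ((hy.comp_rt hb).const_mul (1 / b)).congr fun t ht => by field_simp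

lemma dec_exp : Dec fun r => exp (-(r / 2)) := by
  intro n
  refine ⟨1 + ((n + 1) / (1 / 2)) ^ ((n:ℝ) + 1), fun r hr => ?_⟩
  have h1 := rpow_le_exp hr.le (show (0:ℝ) < n + 1 by positivity) (show (0:ℝ) < 1 / 2 by norm_num)
  · simp only
    rw [abs_of_pos (exp_pos _)]
    have h2 : r ^ n ≤ 1 + r ^ ((n:ℝ) + 1) := by
      rw [show (n:ℝ) + 1 = ((n + 1 : ℕ) : ℝ) by push_cast; ring, rpow_natCast]
      rcases le_total r 1 with h | h
      · have := pow_le_one₀ hr.le h (n := n)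
        have := pow_nonneg hr.le (n + 1)
        linarith
      · have := pow_le_pow_right₀ h (Nat.le_succ n)
        have h3 : n.succ = n + 1 := rfl
        rw [h3] at this
        linarith
    have h3 : exp (-(r / 2)) * exp (1 / 2 * r) = 1 := by
      rw [← exp_add]
      rw [show -(r / 2) + 1 / 2 * r = 0 by ring, exp_zero]
    have h4 : exp (-(r / 2)) ≤ 1 := by
      rw [exp_le_one_iff]
      linarith
    calc r ^ n * exp (-(r / 2))
        ≤ (1 + ((n + 1) / (1 / 2)) ^ ((n:ℝ) + 1) * exp (1 / 2 * r)) * exp (-(r / 2)) := by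
          gcongr
          linarith
      _ = exp (-(r / 2)) + ((n + 1) / (1 / 2)) ^ ((n:ℝ) + 1) *
          (exp (-(r / 2)) * exp (1 / 2 * r)) := by ring
      _ ≤ 1 + ((n + 1) / (1 / 2)) ^ ((n:ℝ) + 1) := by rw [h3]; linarith

lemma LSol.norm_fderiv_le_exp_mul {v h : 𝔼 → ℝ} (H : LSol v h) {C c : ℝ} (hc : 0 ≤ c)
    (hv : ∀ x, |v x| ≤ C * exp (-(c * ‖x‖))) (hh : ∀ x, |h x| ≤ C * exp (-(c * ‖x‖)))
    (x : 𝔼) : ‖fderiv ℝ v x‖ ≤ (N + 1) * exp c * C * exp (-(c * ‖x‖)) := by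
  have hC : 0 ≤ C := by
    have := (abs_nonneg _).trans (hv 0)
    simpa using this
  have hy : ∀ y ∈ closedBall x 1, C * exp (-(c * ‖y‖)) ≤
      exp c * C * exp (-(c * ‖x‖)) := by
    intro y hy
    have h1 : ‖x‖ ≤ ‖y‖ + 1 := by
      have := norm_le_norm_add_norm_sub' x y
      rw [mem_closedBall_iff_norm, norm_sub_rev] at hy
      linarith
    rw [mul_comm (exp c), mul_assoc, ← exp_add]
    refine mul_le_mul_of_nonneg_left (exp_le_exp.2 ?_) hC
    nlinarith
  refine (H.grad_est x (fun y hy' => (hv y).trans (hy y hy'))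
    (fun y hy' => (hh y).trans (hy y hy'))).trans ?_
  have := mul_nonneg (mul_nonneg (exp_pos c).le hC) (exp_pos (-(c * ‖x‖))).le
  nlinarith

lemma LSol.norm_fderiv_le_exp {v h : 𝔼 → ℝ} (H : LSol v h) {C : ℝ}
    (hv : ∀ x, |v x| ≤ C * exp (-(‖x‖ / 2))) (hh : ∀ x, |h x| ≤ C * exp (-(‖x‖ / 2)))
    (x : 𝔼) : ‖fderiv ℝ v x‖ ≤ (N + 1) * exp (1 / 2) * C * exp (-(‖x‖ / 2)) := by
  simp only [div_eq_inv_mul ‖_‖, ← one_div] at hv hh ⊢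
  exact H.norm_fderiv_le_exp_mul (by norm_num) hv hh x

lemma dec_md (e : Fin N) (j : ℕ) {v : 𝔼 → ℝ} {C : ℝ}
    (hv : ∀ x, |v x| ≤ C * exp (-(‖x‖ / 2))) : Dec (md e j v) := by
  obtain ⟨A, hA, hb⟩ := exists_md_bound e j
  refine dec_exp.of_le (M := A * C) fun r hr => ?_
  rw [abs_of_pos (exp_pos _), mul_assoc]
  refine hb v r _ fun x hx => ?_
  rw [abs_of_pos hr] at hx
  rw [← hx]
  exact hv x

lemma LSol.dec_mdd {v h : 𝔼 → ℝ} (H : LSol v h) (e : Fin N) (j : ℕ) {C : ℝ}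
    (hv : ∀ x, |v x| ≤ C * exp (-(‖x‖ / 2))) (hh : ∀ x, |h x| ≤ C * exp (-(‖x‖ / 2))) :
    Dec (fun r => r * mdd e j v r) := by
  obtain ⟨A, hA, hb⟩ := exists_mdd_bound e j
  have h1 : Dec (mdd e j v) := by
    refine dec_exp.of_le (M := A * ((N + 1) * exp (1 / 2) * C)) fun r hr => ?_
    rw [abs_of_pos (exp_pos _), mul_assoc]
    refine hb v r _ fun x hx => ?_
    rw [abs_of_pos hr] at hx
    rw [← hx]
    exact H.norm_fderiv_le_exp hv hh x
  exact (h1.rpow_mul zero_le_one).congr fun r hr => by rw [rpow_one]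

lemma md_zero_radial (e : Fin N) {v : 𝔼 → ℝ} {r c : ℝ} (hr : 0 ≤ r)
    (hv : ∀ x : 𝔼, ‖x‖ = r → v x = c) : md e 0 v r = c * sqH e 0 := by
  have h := md_radial_mul e 0 (v := fun _ => 1) hr hv
  have h1 := md_radial_mul_HH e 0 (fun _ => 1) hr
  simp only [HH_zero, mul_one, one_mul, pow_zero] at h h1
  rw [h, h1]

/-- Radial solutions of `-Δ U = |x|^α F(U)` with exponential decay. -/
structure RadSol (F : ℝ → ℝ) (α C : ℝ) (U : 𝔼 → ℝ) : Prop where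
  sol : LSol U (fun x => ‖x‖ ^ α * F (U x))
  rad : ∀ x y, ‖x‖ = ‖y‖ → U x = U y
  le : ∀ x, |U x| ≤ C * exp (-‖x‖)

/-- The profile of a radial function. -/
noncomputable def prof (e : Fin N) (U : 𝔼 → ℝ) (r : ℝ) : ℝ :=
  U (r • single e 1)

/-- The radial derivative divided by `r ^ (α / 2)`. -/
noncomputable def Phi (e : Fin N) (α : ℝ) (U : 𝔼 → ℝ) (r : ℝ) : ℝ :=
  r ^ (-(α / 2)) * (mdd e 0 U r / sqH e 0)

/-- The derivative of `Phi`. -/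
noncomputable def Phi1 (e : Fin N) (F : ℝ → ℝ) (α : ℝ) (U : 𝔼 → ℝ)
    (r : ℝ) : ℝ :=
  -((N - 1 + α / 2) / r * Phi e α U r) - r ^ (α / 2) * F (prof e U r)

variable {F V : ℝ → ℝ} {β b C C₀ L : ℝ} {U U₀ v : EuclideanSpace ℝ (Fin N) → ℝ} {e : Fin N} {i : ℕ}

lemma norm_smul_single {r : ℝ} (hr : 0 ≤ r) :
    ‖r • (single e 1 : 𝔼)‖ = r := by
  rw [norm_smul, PiLp.norm_single, norm_one, mul_one, norm_of_nonneg hr]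

namespace RadSol

lemma continuous (H : RadSol F α C U) : Continuous U := H.sol.continuous

lemma C_nonneg (H : RadSol F α C U) : 0 ≤ C := by
  have := (abs_nonneg _).trans (H.le 0)
  simpa using this

lemma prof_eq (H : RadSol F α C U) {r : ℝ} (hr : 0 ≤ r) {x : 𝔼} (hx : ‖x‖ = r) :
    U x = prof e U r :=
  H.rad _ _ (by rw [hx, norm_smul_single hr])

lemma continuous_prof (H : RadSol F α C U) : Continuous (prof e U) :=
  H.continuous.comp (by fun_prop : Continuous fun r : ℝ => r • (single e 1 : 𝔼))

lemma abs_prof_le (H : RadSol F α C U) {r : ℝ} (hr : 0 ≤ r) :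
    |prof e U r| ≤ C * exp (-r) := by
  have := H.le (r • (single e 1 : 𝔼))
  rwa [norm_smul_single hr] at this

lemma abs_prof_le' (H : RadSol F α C U) {r : ℝ} (hr : 0 ≤ r) : |prof e U r| ≤ C :=
  (H.abs_prof_le hr).trans (mul_le_of_le_one_right H.C_nonneg (by simpa))

lemma md_eq (H : RadSol F α C U) {r : ℝ} (hr : 0 ≤ r) : md e 0 U r = prof e U r * sqH e 0 :=
  md_zero_radial e hr fun _ hx => H.prof_eq hr hx

lemma md_rhs (H : RadSol F α C U) {r : ℝ} (hr : 0 ≤ r) :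
    md e 0 (fun x => ‖x‖ ^ α * F (U x)) r = r ^ α * F (prof e U r) * sqH e 0 :=
  md_zero_radial e hr fun x hx => by rw [H.prof_eq (e := e) hr hx, hx]

lemma contDiff (H : RadSol F α C U) : ContDiff ℝ 1 U := H.sol.contDiff_one

lemma hasDerivAt_mdd (H : RadSol F α C U) (hN : 2 ≤ N) {r : ℝ} (hr : 0 < r) :
    HasDerivAt (mdd e 0 U)
      (-((N - 1) / r * mdd e 0 U r) - r ^ α * F (prof e U r) * sqH e 0) r := by
  have h := H.sol.hasDerivAt_mdd hN e 0 hr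
  rw [H.md_rhs hr.le] at h
  refine h.congr_deriv ?_
  push_cast
  ring

lemma hasDerivAt_prof (H : RadSol F α C U) (hN : 2 ≤ N) {r : ℝ} (hr : 0 < r) :
    HasDerivAt (prof e U) (mdd e 0 U r / sqH e 0) r := by
  have h := (hasDerivAt_md e 0 H.contDiff r).div_const (sqH e 0)
  refine h.congr_of_eventuallyEq ?_
  filter_upwards [eventually_gt_nhds hr] with s hs
  rw [H.md_eq hs.le, mul_div_cancel_right₀ _ (sqH_pos hN e 0).ne']

lemma abs_F_le (H : RadSol F α C U) (hF : ContDiff ℝ 1 F) (hF0 : F 0 = 0)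
    (hL : ∀ s, |s| ≤ C → |deriv F s| ≤ L) {r : ℝ} (hr : 0 ≤ r) :
    |F (prof e U r)| ≤ L * |prof e U r| :=
  abs_le_mul_of_deriv_bound hF hF0 fun _ ht => hL _ (ht.trans (H.abs_prof_le' hr))

lemma mdd_eq_integral (H : RadSol F α C U) (hN : 2 ≤ N) (hF : ContDiff ℝ 1 F) (hα : 0 < α)
    {r : ℝ} (hr : 0 ≤ r) : r ^ (N - 1) * mdd e 0 U r =
      ∫ s in (0:ℝ)..r, -(s ^ (N - 1) * (s ^ α * F (prof e U s) * sqH e 0)) := by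
  have cF : Continuous fun s => F (prof e U s) := hF.continuous.comp H.continuous_prof
  have c : Continuous fun s : ℝ => -(s ^ (N - 1) * (s ^ α * F (prof e U s) * sqH e 0)) :=
    ((continuous_id.pow _).mul (((continuous_rpow_const hα.le).mul cF).mul
      continuous_const)).neg
  have h := intervalIntegral.integral_eq_sub_of_hasDerivAt_of_le hr
    (f := fun s => s ^ (N - 1) * mdd e 0 U s)
    (((continuous_id.pow _).mul (continuous_mdd e 0 H.contDiff)).continuousOn)
    (fun s hs => by
      refine ((hasDerivAt_pow (N - 1) s).fun_mul
        (H.hasDerivAt_mdd (e := e) hN hs.1)).congr_deriv ?_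
      obtain ⟨n, rfl⟩ : ∃ n, N = n + 2 := ⟨N - 2, by omega⟩
      have := hs.1.ne'
      simp only [show n + 2 - 1 = n + 1 by omega, add_tsub_cancel_right]
      push_cast
      field_simp
      ring) (c.intervalIntegrable _ _)
  rw [h, zero_pow (by omega)]
  ring

lemma abs_mdd_le (H : RadSol F α C U) (hN : 2 ≤ N) (hF : ContDiff ℝ 1 F) (hF0 : F 0 = 0)
    (hα : 0 < α) (hL : ∀ s, |s| ≤ C → |deriv F s| ≤ L) {r : ℝ} (hr : 0 < r) :
    |mdd e 0 U r / sqH e 0| ≤ L * C * r ^ (1 + α) := by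
  have hs := sqH_pos hN e 0
  have hL0 : 0 ≤ L := (abs_nonneg _).trans (hL 0 (by simpa using H.C_nonneg))
  have h := H.mdd_eq_integral (e := e) hN hF hα hr.le
  have h2 : |r ^ (N - 1) * mdd e 0 U r| ≤ r ^ (N - 1) * (r ^ α * (L * C) * sqH e 0) * |r - 0| := by
    rw [h, ← norm_eq_abs]
    refine intervalIntegral.norm_integral_le_of_norm_le_const fun s hs' => ?_
    rw [uIoc_of_le hr.le] at hs'
    have h0 := hs'.1.le
    rw [norm_neg, norm_eq_abs, abs_mul, abs_mul, abs_mul, abs_of_nonneg (pow_nonneg h0 _),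
      abs_of_nonneg (rpow_nonneg h0 _), abs_of_pos hs]
    have hF1 : |F (prof e U s)| ≤ L * C := (H.abs_F_le hF hF0 hL h0).trans (by
      gcongr
      exact H.abs_prof_le' h0)
    have hc := H.C_nonneg
    gcongr
    · exact hs'.2
    · exact hs'.2
  rw [abs_mul, abs_of_nonneg (pow_nonneg hr.le _), sub_zero, abs_of_pos hr, mul_assoc] at h2
  have h3 := le_of_mul_le_mul_left h2 (pow_pos hr _)
  rw [abs_div, abs_of_pos hs, div_le_iff₀ hs, rpow_add hr, rpow_one]
  linarith

lemma hasDerivAt_Phi (H : RadSol F α C U) (hN : 2 ≤ N) {r : ℝ} (hr : 0 < r) :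
    HasDerivAt (Phi e α U) (Phi1 e F α U r) r := by
  have hs := (sqH_pos hN e 0).ne'
  refine ((hasDerivAt_rpow_const (p := -(α / 2)) (Or.inl hr.ne')).fun_mul
    ((H.hasDerivAt_mdd hN hr).div_const (sqH e 0))).congr_deriv ?_
  have e1 : r ^ α = r ^ (α / 2) * r ^ (α / 2) := by rw [← rpow_add hr]; ring_nf
  have e2 : r ^ (-(α / 2)) = (r ^ (α / 2))⁻¹ := rpow_neg hr.le _
  have e3 : r ^ (-(α / 2) - 1) = (r ^ (α / 2))⁻¹ / r := by rw [rpow_sub hr, e2, rpow_one]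
  have := (rpow_pos_of_pos hr (α / 2)).ne'
  rw [Phi1, Phi, e1, e2, e3]
  field_simp
  ring

lemma hasDerivAt_Phi1 (H : RadSol F α C U) (hN : 2 ≤ N) (hF : ContDiff ℝ 1 F) {r : ℝ}
    (hr : 0 < r) : HasDerivAt (Phi1 e F α U) (-((N - 1) / r * Phi1 e F α U r) -
      (r ^ α * deriv F (prof e U r) - (N - 1 + α / 2) * (1 + α / 2) / r ^ 2) * Phi e α U r) r := by
  have hdF : HasDerivAt F (deriv F (prof e U r)) (prof e U r) :=
    (hF.differentiable (by norm_num)).differentiableAt.hasDerivAt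
  refine (((((hasDerivAt_const r ((N:ℝ) - 1 + α / 2)).fun_div (hasDerivAt_id' r) hr.ne').fun_mul
    (H.hasDerivAt_Phi (e := e) hN hr)).fun_neg).fun_sub
    ((hasDerivAt_rpow_const (p := α / 2) (Or.inl hr.ne')).fun_mul
      (hdF.comp r (H.hasDerivAt_prof hN hr)))).congr_deriv ?_
  have e1 : r ^ α = r ^ (α / 2) * r ^ (α / 2) := by rw [← rpow_add hr]; ring_nf
  have e2 : r ^ (-(α / 2)) = (r ^ (α / 2))⁻¹ := rpow_neg hr.le _
  have e3 : r ^ (α / 2 - 1) = r ^ (α / 2) / r := by rw [rpow_sub hr, rpow_one]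
  have := (rpow_pos_of_pos hr (α / 2)).ne'
  rw [Phi1, Phi, e1, e2, e3, Function.comp_apply]
  field_simp
  ring

lemma exp_bounds (H : RadSol F α C U) (hF : ContDiff ℝ 1 F) (hF0 : F 0 = 0) (hα : 0 < α)
    (hL : ∀ s, |s| ≤ C → |deriv F s| ≤ L) : ∃ C', (∀ x, |U x| ≤ C' * exp (-(‖x‖ / 2))) ∧
      ∀ x, |‖x‖ ^ α * F (U x)| ≤ C' * exp (-(‖x‖ / 2)) := by
  have hL0 : 0 ≤ L := (abs_nonneg _).trans (hL 0 (by simpa using H.C_nonneg))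
  have hC := H.C_nonneg
  set K := (α / (1 / 2)) ^ α
  have hK : 0 ≤ K := rpow_nonneg (by positivity) _
  have he : ∀ x : 𝔼, exp (-‖x‖) = exp (-(‖x‖ / 2)) * exp (-(‖x‖ / 2)) := fun x => by
    rw [← exp_add]; ring_nf
  refine ⟨C + K * (L * C), fun x => ?_, fun x => ?_⟩
  · refine (H.le x).trans ?_
    have h1 : exp (-‖x‖) ≤ exp (-(‖x‖ / 2)) :=
      exp_le_exp.2 (by linarith [norm_nonneg x])
    have h2 : 0 ≤ K * (L * C) := by positivity
    have := exp_pos (-(‖x‖ / 2))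
    nlinarith [mul_le_mul_of_nonneg_left h1 hC]
  · have h1 : |F (U x)| ≤ L * |U x| := abs_le_mul_of_deriv_bound hF hF0 fun s hs =>
      hL _ (hs.trans ((H.le x).trans (mul_le_of_le_one_right hC (by simp))))
    have h2 := rpow_le_exp (norm_nonneg x) hα (show (0:ℝ) < 1 / 2 by norm_num)
    have h3 : exp (1 / 2 * ‖x‖) * exp (-(‖x‖ / 2)) = 1 := by
      rw [← exp_add, show 1 / 2 * ‖x‖ + -(‖x‖ / 2) = 0 by ring, exp_zero]
    rw [abs_mul, abs_of_nonneg (rpow_nonneg (norm_nonneg x) _)]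
    calc ‖x‖ ^ α * |F (U x)| ≤ (K * exp (1 / 2 * ‖x‖)) * (L * (C * exp (-‖x‖))) := by
          gcongr
          exact h1.trans (by gcongr; exact H.le x)
      _ = K * (L * C) * (exp (1 / 2 * ‖x‖) * exp (-(‖x‖ / 2))) *
          exp (-(‖x‖ / 2)) := by rw [he]; ring
      _ ≤ _ := by
          rw [h3, mul_one]
          gcongr
          linarith

lemma dec_prof (H : RadSol F α C U) (hN : 2 ≤ N) (hF : ContDiff ℝ 1 F) (hF0 : F 0 = 0)
    (hα : 0 < α) (hL : ∀ s, |s| ≤ C → |deriv F s| ≤ L) : Dec (prof e U) := by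
  obtain ⟨C', h1, h2⟩ := H.exp_bounds hF hF0 hα hL
  refine ((dec_md e 0 h1).const_mul (sqH e 0)⁻¹).congr fun t ht => ?_
  rw [H.md_eq ht.le, mul_comm, mul_inv_cancel_right₀ (sqH_pos hN e 0).ne']

lemma abs_Phi_le (H : RadSol F α C U) (hN : 2 ≤ N) (hF : ContDiff ℝ 1 F) (hF0 : F 0 = 0)
    (hα : 0 < α) (hL : ∀ s, |s| ≤ C → |deriv F s| ≤ L) {r : ℝ} (hr : 0 < r) :
    |Phi e α U r| ≤ L * C * r ^ (1 + α / 2) := by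
  rw [Phi, abs_mul, abs_of_pos (rpow_pos_of_pos hr _),
    show (1 + α / 2) = -(α / 2) + (1 + α) by ring, rpow_add hr]
  have := H.abs_mdd_le (e := e) hN hF hF0 hα hL hr
  have h2 := rpow_pos_of_pos hr (-(α / 2))
  nlinarith

lemma dec_Phi (H : RadSol F α C U) (hN : 2 ≤ N) (hF : ContDiff ℝ 1 F) (hF0 : F 0 = 0)
    (hα : 0 < α) (hL : ∀ s, |s| ≤ C → |deriv F s| ≤ L) : Dec (Phi e α U) := by
  obtain ⟨C', h1, h2⟩ := H.exp_bounds hF hF0 hα hL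
  have hd := H.sol.dec_mdd e 0 h1 h2
  have hL0 : 0 ≤ L := (abs_nonneg _).trans (hL 0 (by simpa using H.C_nonneg))
  have hC := H.C_nonneg
  have hs := sqH_pos hN e 0
  intro n
  obtain ⟨B, hB⟩ := hd n
  refine ⟨max (L * C) (B / sqH e 0), fun r hr => ?_⟩
  rcases le_total r 1 with h | h
  · refine le_trans ?_ (le_max_left _ _)
    have h3 := H.abs_Phi_le (e := e) hN hF hF0 hα hL hr
    have h4 : r ^ (1 + α / 2) ≤ 1 := rpow_le_one hr.le h (by positivity)
    have h5 := pow_le_one₀ hr.le h (n := n)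
    calc r ^ n * |Phi e α U r| ≤ 1 * (L * C * 1) := by
          gcongr
          exact h3.trans (by gcongr)
      _ = _ := by ring
  · refine le_trans ?_ (le_max_right _ _)
    have h4 : r ^ (-(α / 2)) ≤ 1 := rpow_le_one_of_one_le_of_nonpos h (by linarith)
    rw [le_div_iff₀ hs, Phi, abs_mul, abs_div, abs_of_pos hs, abs_of_pos (rpow_pos_of_pos hr _)]
    refine le_trans ?_ (hB r hr)
    rw [abs_mul, abs_of_pos hr]
    calc r ^ n * (r ^ (-(α / 2)) * (|mdd e 0 U r| / sqH e 0)) * sqH e 0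
        = r ^ n * (r ^ (-(α / 2)) * |mdd e 0 U r|) := by field_simp
      _ ≤ r ^ n * (r * |mdd e 0 U r|) := by gcongr; linarith

lemma dec_Phi1 (H : RadSol F α C U) (hN : 2 ≤ N) (hF : ContDiff ℝ 1 F) (hF0 : F 0 = 0)
    (hα : 0 < α) (hL : ∀ s, |s| ≤ C → |deriv F s| ≤ L) :
    Dec fun r => r * Phi1 e F α U r := by
  have h1 := (H.dec_Phi (e := e) hN hF hF0 hα hL).const_mul (-(N - 1 + α / 2))
  have h2 : Dec fun r => F (prof e U r) := (H.dec_prof (e := e) hN hF hF0 hα hL).of_le fun r hr =>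
    H.abs_F_le hF hF0 hL hr.le
  have h3 := (h2.rpow_mul (b := α / 2 + 1) (by positivity)).const_mul (-1)
  refine (h1.add h3).congr fun r hr => ?_
  have := hr.ne'
  rw [Phi1, rpow_add hr, rpow_one]
  field_simp
  ring

lemma continuousOn_Phi (H : RadSol F α C U) (hN : 2 ≤ N) : ContinuousOn (Phi e α U) (Ioi 0) :=
  fun _ hr => (H.hasDerivAt_Phi hN hr).continuousAt.continuousWithinAt

lemma exists_Phi_ne_zero (H : RadSol F α C U) (hN : 2 ≤ N) (hF : ContDiff ℝ 1 F) (hF0 : F 0 = 0)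
    (hα : 0 < α) (hL : ∀ s, |s| ≤ C → |deriv F s| ≤ L) {x : 𝔼} (hx : x ≠ 0) (hU : U x ≠ 0) :
    ∃ r > 0, Phi e α U r ≠ 0 := by
  by_contra! h
  have hx0 := norm_pos_iff.2 hx
  have hd : ∀ r ∈ Ioi (0:ℝ), HasDerivAt (prof e U) 0 r := fun r hr => by
    have h1 := h r hr
    rw [Phi, mul_eq_zero] at h1
    have h2 := h1.resolve_left (rpow_pos_of_pos hr _).ne'
    have := H.hasDerivAt_prof (e := e) hN hr
    rwa [h2] at this
  have hc : ∀ r ∈ Ioi (0:ℝ), prof e U r = prof e U ‖x‖ := fun r hr =>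
    (isOpen_Ioi.is_const_of_deriv_eq_zero isPreconnected_Ioi
      (fun s hs => (hd s hs).differentiableAt.differentiableWithinAt)
      (fun s hs => (hd s hs).deriv) hr hx0)
  have ht := (H.dec_prof (e := e) hN hF hF0 hα hL).tendsto_atTop 0
  have ht2 : Tendsto (fun t => t ^ (0:ℝ) * prof e U t) atTop (𝓝 (prof e U ‖x‖)) := by
    refine tendsto_const_nhds.congr' ?_
    filter_upwards [eventually_gt_atTop 0] with r hr
    rw [Real.rpow_zero, one_mul, hc r hr]
  have := tendsto_nhds_unique ht2 ht
  rw [← H.prof_eq hx0.le rfl] at this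
  exact hU this

end RadSol

lemma rpow_le_one_add_of_le {r x k : ℝ} (hr : 0 < r) (hx : 0 ≤ x) (hk : x ≤ k) :
    r ^ x ≤ 1 + r ^ k := by
  have h0 := rpow_nonneg hr.le k
  rcases le_total r 1 with h | h
  · have := rpow_le_one hr.le h hx
    linarith
  · have := rpow_le_rpow_of_exponent_le h hk
    linarith

lemma tendsto_integral_dec {p : ℝ → ℝ → ℝ} {ψ : ℝ → ℝ} {α b k B : ℝ} (hb : -1 < b) (hk : 0 ≤ k)
    (dψ : Dec ψ) (cψ : ContinuousOn ψ (Ioi 0))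
    (hp : ∀ᶠ β in 𝓝 α, ContinuousOn (p β) (Ioi 0) ∧ ∀ r > 0, |p β r| ≤ B * (1 + r ^ k))
    (hlim : ∀ r > 0, Tendsto (fun β => p β r) (𝓝 α) (𝓝 (p α r))) :
    Tendsto (fun β => ∫ r in Ioi (0:ℝ), r ^ b * (ψ r * p β r)) (𝓝 α)
      (𝓝 (∫ r in Ioi (0:ℝ), r ^ b * (ψ r * p α r))) := by
  have d1 : Dec fun r => B * (|ψ r| + r ^ k * |ψ r|) := by
    have h1 : Dec fun r => |ψ r| := dψ.of_le (M := 1) fun t _ => by simp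
    exact (h1.add (h1.rpow_mul hk)).const_mul B
  have c1 : ContinuousOn (fun r => B * (|ψ r| + r ^ k * |ψ r|)) (Ioi 0) :=
    continuousOn_const.mul (cψ.abs.add ((continuous_rpow_const hk).continuousOn.mul cψ.abs))
  have cb : ContinuousOn (fun r : ℝ => r ^ b) (Ioi 0) := fun r hr =>
    (continuousAt_rpow_const r b (Or.inl (ne_of_gt hr))).continuousWithinAt
  refine tendsto_integral_filter_of_dominated_convergence _ ?_ ?_ (d1.integrableOn c1 hb) ?_
  · filter_upwards [hp] with β hβ
    exact (cb.mul (cψ.mul hβ.1)).aestronglyMeasurable measurableSet_Ioi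
  · filter_upwards [hp] with β hβ
    refine (ae_restrict_iff' measurableSet_Ioi).2 (Eventually.of_forall fun r hr => ?_)
    have h0 := rpow_nonneg (le_of_lt hr) b
    rw [norm_eq_abs, abs_mul, abs_mul, abs_of_nonneg h0]
    refine mul_le_mul_of_nonneg_left ?_ h0
    calc |ψ r| * |p β r| ≤ |ψ r| * (B * (1 + r ^ k)) := by
          gcongr
          exact hβ.2 r hr
      _ = _ := by ring
  · refine (ae_restrict_iff' measurableSet_Ioi).2 (Eventually.of_forall fun r hr => ?_)
    exact ((hlim r hr).const_mul _).const_mul _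

lemma tendsto_Phi (hN : 2 ≤ N) (hF : ContDiff ℝ 1 F) (hF0 : F 0 = 0) (hα : 0 < α)
    (hL : ∀ s, |s| ≤ C → |deriv F s| ≤ L) {U : ℝ → 𝔼 → ℝ}
    (H : ∀ᶠ β in 𝓝 α, RadSol F β C (U β))
    (hlim : ∀ x, Tendsto (fun β => U β x) (𝓝 α) (𝓝 (U α x))) {r : ℝ} (hr : 0 < r) :
    Tendsto (fun β => Phi e β (U β) r) (𝓝 α) (𝓝 (Phi e α (U α) r)) := by
  have hs := sqH_pos hN e 0
  have Hα := H.self_of_nhds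
  have hL0 : 0 ≤ L := (abs_nonneg _).trans (hL 0 (by simpa using Hα.C_nonneg))
  have hC := Hα.C_nonneg
  have hm : Tendsto (fun β => r ^ (N - 1) * mdd e 0 (U β) r) (𝓝 α)
      (𝓝 (r ^ (N - 1) * mdd e 0 (U α) r)) := by
    rw [Hα.mdd_eq_integral hN hF hα hr.le]
    have key : Tendsto (fun β => ∫ s in (0:ℝ)..r,
        -(s ^ (N - 1) * (s ^ β * F (prof e (U β) s) * sqH e 0))) (𝓝 α) (𝓝 (∫ s in (0:ℝ)..r,
        -(s ^ (N - 1) * (s ^ α * F (prof e (U α) s) * sqH e 0)))) := by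
      refine intervalIntegral.tendsto_integral_filter_of_dominated_convergence
        (fun _ => r ^ (N - 1) * ((1 + r ^ (α + 1)) * (L * C) * sqH e 0)) ?_ ?_ (by simp) ?_
      · filter_upwards [H, eventually_gt_nhds hα] with β hβ h0
        have cF : Continuous fun s => F (prof e (U β) s) := hF.continuous.comp hβ.continuous_prof
        have c : Continuous fun s : ℝ => -(s ^ (N - 1) * (s ^ β * F (prof e (U β) s) * sqH e 0)) :=
          ((continuous_id.pow _).mul (((continuous_rpow_const h0.le).mul cF).mul
            continuous_const)).neg
        exact c.aestronglyMeasurable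
      · filter_upwards [H, eventually_gt_nhds hα, eventually_lt_nhds (lt_add_one α)] with β hβ h0 h1
        refine Eventually.of_forall fun s hs' => ?_
        rw [uIoc_of_le hr.le] at hs'
        have hs0 := hs'.1.le
        rw [norm_neg, norm_eq_abs, abs_mul, abs_mul, abs_mul, abs_of_nonneg (pow_nonneg hs0 _),
          abs_of_nonneg (rpow_nonneg hs0 _), abs_of_pos hs]
        have hF1 : |F (prof e (U β) s)| ≤ L * C := (hβ.abs_F_le hF hF0 hL hs0).trans (by
          gcongr
          exact hβ.abs_prof_le' hs0)
        have h2 : s ^ β ≤ 1 + r ^ (α + 1) := (rpow_le_one_add_of_le hs'.1 h0.le h1.le).trans (by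
          gcongr
          exact hs'.2)
        have h3 := rpow_nonneg hs0 β
        have h4 := rpow_nonneg hr.le (α + 1)
        gcongr
        exact hs'.2
      · refine Eventually.of_forall fun s hs' => ?_
        rw [uIoc_of_le hr.le] at hs'
        have h1 : Tendsto (fun β => s ^ β) (𝓝 α) (𝓝 (s ^ α)) :=
          (continuousAt_const_rpow hs'.1.ne').tendsto
        have h2 := (hF.continuous.tendsto _).comp (hlim (s • single e 1))
        exact (((h1.mul h2).mul_const _).const_mul _).neg
    refine key.congr' ?_
    filter_upwards [H, eventually_gt_nhds hα] with β hβ h0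
    rw [hβ.mdd_eq_integral hN hF h0 hr.le]
  have hm2 : Tendsto (fun β => mdd e 0 (U β) r / sqH e 0) (𝓝 α) (𝓝 (mdd e 0 (U α) r / sqH e 0)) := by
    have h3 := (hm.const_mul (r ^ (N - 1))⁻¹).div_const (sqH e 0)
    have hp := (pow_pos hr (N - 1)).ne'
    simpa only [inv_mul_cancel_left₀ hp] using h3
  have h1 : Tendsto (fun β : ℝ => r ^ (-(β / 2))) (𝓝 α) (𝓝 (r ^ (-(α / 2)))) :=
    ((continuousAt_const_rpow hr.ne').tendsto).comp
      ((continuous_id.div_const 2).neg.tendsto α)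
  exact h1.mul hm2

lemma RadSol.wronskian (H : RadSol F α C U) (hN : 3 ≤ N) (hF : ContDiff ℝ 1 F) (hF0 : F 0 = 0)
    (hα : 0 < α) {w h : 𝔼 → ℝ} (Hw : LSol w h) {C' : ℝ}
    (hw : ∀ x, |w x| ≤ C' * exp (-(‖x‖ / 2))) (hh : ∀ x, |h x| ≤ C' * exp (-(‖x‖ / 2)))
    (j : ℕ) :
    ∫ r in Ioi (0:ℝ), r ^ ((N:ℝ) - 1) *
        ((md e j h r - r ^ α * deriv F (prof e U r) * md e j w r) * Phi e α U r) =
      (j * (j + N - 2) - (N - 1 + α / 2) * (1 + α / 2)) *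
        ∫ r in Ioi (0:ℝ), r ^ ((N:ℝ) - 1 - 2) * (md e j w r * Phi e α U r) := by
  have hN2 : 2 ≤ N := by omega
  have hNr : (3:ℝ) ≤ N := by exact_mod_cast hN
  obtain ⟨L, hL0, hL⟩ := exists_deriv_bound hF C
  have dΦ := H.dec_Phi (e := e) hN2 hF hF0 hα hL
  have cΦ := H.continuousOn_Phi (e := e) hN2
  have dy := dec_md e j hw
  have cy := (continuous_md e j Hw.continuous).continuousOn (s := Ioi 0)
  have dh := dec_md e j hh
  have ch := (continuous_md e j Hw.continuous_rhs).continuousOn (s := Ioi 0)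
  have cF' : ContinuousOn (fun r => deriv F (prof e U r)) (Ioi 0) :=
    ((hF.continuous_deriv le_rfl).comp H.continuous_prof).continuousOn
  set κ := ((N:ℝ) - 1 + α / 2) * (1 + α / 2)
  set μ := (j:ℝ) * (j + N - 2)
  have I0 : IntegrableOn (fun r => r ^ ((N:ℝ) - 1) * (md e j h r * Phi e α U r)) (Ioi 0) :=
    (dh.mul dΦ).integrableOn (ch.mul cΦ) (by linarith)
  have I1 : IntegrableOn (fun r => r ^ ((N:ℝ) - 1 - 2) * (md e j w r * Phi e α U r)) (Ioi 0) :=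
    (dy.mul dΦ).integrableOn (cy.mul cΦ) (by linarith)
  have d2 : Dec fun r => r ^ α * (deriv F (prof e U r) * (md e j w r * Phi e α U r)) :=
    ((dy.mul dΦ).bdd_mul fun t ht => hL _ (H.abs_prof_le' ht.le)).rpow_mul hα.le
  have I2 : IntegrableOn (fun r => r ^ ((N:ℝ) - 1) *
      (r ^ α * (deriv F (prof e U r) * (md e j w r * Phi e α U r)))) (Ioi 0) :=
    d2.integrableOn ((continuous_rpow_const hα.le).continuousOn.mul (cF'.mul (cy.mul cΦ)))
      (by linarith)
  have E1 : EqOn (fun r : ℝ => r ^ ((N:ℝ) - 1) * (md e j h r * Phi e α U r) -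
      μ * (r ^ ((N:ℝ) - 1 - 2) * (md e j w r * Phi e α U r)))
      (fun r => r ^ ((N:ℝ) - 1) * ((md e j h r - μ / r ^ 2 * md e j w r) * Phi e α U r)) (Ioi 0) :=
    fun r hr => by
      simp only
      rw [rpow_sub_two_mul hr]
      ring
  have E2 : EqOn (fun r : ℝ => r ^ ((N:ℝ) - 1) *
      (r ^ α * (deriv F (prof e U r) * (md e j w r * Phi e α U r))) -
      κ * (r ^ ((N:ℝ) - 1 - 2) * (md e j w r * Phi e α U r)))
      (fun r => r ^ ((N:ℝ) - 1) * ((r ^ α * deriv F (prof e U r) - κ / r ^ 2) * Phi e α U r *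
        md e j w r)) (Ioi 0) :=
    fun r hr => by
      simp only
      rw [rpow_sub_two_mul hr]
      ring
  have hy := hasDerivAt_md e j Hw.contDiff_one
  have key := integral_wronskian (a := (N:ℝ) - 1) (by linarith) (y := md e j w) (y1 := mdd e j w)
    (f := fun r => md e j h r - μ / r ^ 2 * md e j w r) (fun t _ => hy t)
    (fun t ht => (Hw.hasDerivAt_mdd hN2 e j ht).congr_deriv (by ring))
    (fun t ht => H.hasDerivAt_Phi hN2 ht) (fun t ht => H.hasDerivAt_Phi1 hN2 hF ht) dy
    (Hw.dec_mdd e j hw hh) dΦ (H.dec_Phi1 hN2 hF hF0 hα hL)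
    ((I0.sub (I1.const_mul μ)).congr_fun E1 measurableSet_Ioi)
    ((I2.sub (I1.const_mul κ)).congr_fun E2 measurableSet_Ioi)
  rw [← setIntegral_congr_fun measurableSet_Ioi E1, ← setIntegral_congr_fun measurableSet_Ioi E2,
    integral_sub I0 (I1.const_mul μ), integral_sub I2 (I1.const_mul κ), integral_const_mul,
    integral_const_mul] at key
  have E3 : ∀ r : ℝ, r ^ ((N:ℝ) - 1) *
      ((md e j h r - r ^ α * deriv F (prof e U r) * md e j w r) * Phi e α U r) =
      r ^ ((N:ℝ) - 1) * (md e j h r * Phi e α U r) - r ^ ((N:ℝ) - 1) *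
      (r ^ α * (deriv F (prof e U r) * (md e j w r * Phi e α U r))) := fun r => by ring
  simp only [E3]
  rw [integral_sub I0 I2]
  linarith

/-- The function `V` in the variable `σ = |x|²`. -/
noncomputable def sqProf (V : ℝ → ℝ) (b σ : ℝ) : ℝ := V (σ ^ (b / 2) / b)

lemma rpow_div_pos {σ : ℝ} (hb : 0 < b) (hσ : 0 < σ) : 0 < σ ^ (b / 2) / b :=
  div_pos (rpow_pos_of_pos hσ _) hb

lemma hasDerivAt_rpow_div {σ : ℝ} (hb : 0 < b) (hσ : 0 < σ) :
    HasDerivAt (fun σ : ℝ => σ ^ (b / 2) / b) (σ ^ (b / 2 - 1) / 2) σ := by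
  refine ((hasDerivAt_rpow_const (p := b / 2) (Or.inl hσ.ne')).div_const b).congr_deriv ?_
  field_simp

lemma hasDerivAt_sqProf (hb : 0 < b) (hV : ContDiffOn ℝ 2 V (Ioi 0)) {σ : ℝ} (hσ : 0 < σ) :
    HasDerivAt (sqProf V b) (deriv V (σ ^ (b / 2) / b) * (σ ^ (b / 2 - 1) / 2)) σ := by
  have h1 : HasDerivAt V (deriv V (σ ^ (b / 2) / b)) (σ ^ (b / 2) / b) :=
    ((hV.contDiffAt (Ioi_mem_nhds (rpow_div_pos hb hσ))).differentiableAt (by norm_num)).hasDerivAt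
  exact h1.comp σ (hasDerivAt_rpow_div hb hσ)

lemma hasDerivAt_deriv_sqProf (hb : 0 < b) (hV : ContDiffOn ℝ 2 V (Ioi 0))
    (hode : ∀ t > (0:ℝ), -(deriv (deriv V) t) - (N - 2 + b) / b / t * deriv V t = F (V t))
    {σ : ℝ} (hσ : 0 < σ) :
    HasDerivAt (fun σ : ℝ => deriv V (σ ^ (b / 2) / b) * (σ ^ (b / 2 - 1) / 2))
      (-(σ ^ (b - 2) * F (sqProf V b σ) / 4) -
        N * (deriv V (σ ^ (b / 2) / b) * σ ^ (b / 2 - 1)) / (4 * σ)) σ := by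
  have ht := rpow_div_pos hb hσ
  have h2 : HasDerivAt (deriv V) (deriv (deriv V) (σ ^ (b / 2) / b)) (σ ^ (b / 2) / b) :=
    (((hV.deriv_of_isOpen (m := 1) isOpen_Ioi (by norm_num)).contDiffAt
      (Ioi_mem_nhds ht)).differentiableAt (by norm_num)).hasDerivAt
  have h3 := (h2.comp σ (hasDerivAt_rpow_div hb hσ)).fun_mul
    ((hasDerivAt_rpow_const (p := b / 2 - 1) (Or.inl hσ.ne')).div_const 2)
  refine h3.congr_deriv ?_
  have e0 := hode _ ht
  have e1 : deriv (deriv V) (σ ^ (b / 2) / b) = -((N - 2 + b) / b / (σ ^ (b / 2) / b) *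
    deriv V (σ ^ (b / 2) / b)) - F (sqProf V b σ) := by rw [sqProf]; linarith
  have hp := rpow_pos_of_pos hσ (b / 2)
  have r1 : σ ^ (b / 2 - 1) = σ ^ (b / 2) / σ := by rw [rpow_sub hσ, rpow_one]
  have r2 : σ ^ (b / 2 - 1 - 1) = σ ^ (b / 2) / σ / σ := by
    rw [rpow_sub hσ, r1, rpow_one]
  have r3 : σ ^ (b - 2) = σ ^ (b / 2) * σ ^ (b / 2) / σ / σ := by
    rw [← rpow_add hσ, show b - 2 = b / 2 + b / 2 - 1 - 1 by ring, rpow_sub hσ,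
      rpow_sub hσ, rpow_one]
  rw [Function.comp_apply, e1, r1, r2, r3]
  field_simp
  ring

lemma contDiffAt_sqProf (hb : 0 < b) (hV : ContDiffOn ℝ 2 V (Ioi 0)) {σ : ℝ} (hσ : 0 < σ) :
    ContDiffAt ℝ 2 (sqProf V b) σ :=
  (hV.contDiffAt (Ioi_mem_nhds (rpow_div_pos hb hσ))).comp σ
    ((Real.contDiffAt_rpow_const_of_ne hσ.ne').div_const b)

lemma continuousOn_sqProf (hb : 0 < b) (hV : ContinuousOn V (Ici 0)) :
    ContinuousOn (sqProf V b) (Ici 0) :=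
  hV.comp ((continuous_rpow_const (by positivity)).div_const b).continuousOn
    fun _ hσ => div_nonneg (rpow_nonneg hσ _) hb.le

lemma lap_sqProf (hb : 0 < b) (hV : ContDiffOn ℝ 2 V (Ioi 0))
    (hode : ∀ t > (0:ℝ), -(deriv (deriv V) t) - (N - 2 + b) / b / t * deriv V t = F (V t))
    {d : ℝ} (hd : 0 < d) (x : 𝔼) :
    lap (fun y : 𝔼 => sqProf V b (d + ‖y‖ ^ 2)) x =
      -(‖x‖ ^ 2 * ((d + ‖x‖ ^ 2) ^ (b - 2) * F (sqProf V b (d + ‖x‖ ^ 2)))) +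
        N * (d * (deriv V ((d + ‖x‖ ^ 2) ^ (b / 2) / b) * (d + ‖x‖ ^ 2) ^ (b / 2 - 1)) /
          (d + ‖x‖ ^ 2)) := by
  have hσ : 0 < d + ‖x‖ ^ 2 := by positivity
  have hsh : ∀ y, HasDerivAt (fun y : ℝ => d + y) 1 y := fun y => (hasDerivAt_id y).const_add d
  have hev : ∀ᶠ y in 𝓝 (‖x‖ ^ 2), 0 < d + y :=
    ((continuous_const.add continuous_id).tendsto (‖x‖ ^ 2)).eventually (eventually_gt_nhds hσ)
  have hd1 : ∀ y, 0 < d + y → HasDerivAt (fun y => sqProf V b (d + y))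
      (deriv V ((d + y) ^ (b / 2) / b) * ((d + y) ^ (b / 2 - 1) / 2)) y := fun y hy => by
    have := (hasDerivAt_sqProf hb hV hy).comp y (hsh y)
    rwa [mul_one] at this
  have hd2 := (hasDerivAt_deriv_sqProf hb hV hode hσ).comp (‖x‖ ^ 2) (hsh _)
  rw [mul_one] at hd2
  have e2 : deriv (deriv fun y => sqProf V b (d + y)) (‖x‖ ^ 2) = _ :=
    (hd2.congr_of_eventuallyEq (hev.mono fun y hy => (hd1 y hy).deriv)).deriv
  rw [lap_comp_normSq (g := fun y => sqProf V b (d + y))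
    ((contDiffAt_sqProf hb hV hσ).comp _ (contDiffAt_const.add contDiffAt_id)), e2,
    (hd1 _ hσ).deriv]
  field_simp
  ring

lemma exists_le_add_mul {c : ℝ → ℝ} (hc : ContinuousOn c (Ioi 0)) (h0 : Tendsto c (𝓝[>] 0) (𝓝 0))
    (R : ℝ) {η : ℝ} (hη : 0 < η) : ∃ K ≥ 0, ∀ σ > 0, σ ≤ R → |c σ| ≤ η + K * σ := by
  obtain ⟨δ, hδ, h⟩ := Metric.mem_nhdsWithin_iff.1 (Metric.tendsto_nhds.1 h0 η hη)
  obtain ⟨B, hB⟩ := (isCompact_Icc (a := δ) (b := R)).exists_bound_of_continuousOn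
    (hc.mono fun σ hσ => lt_of_lt_of_le hδ hσ.1)
  refine ⟨max B 0 / δ, by positivity, fun σ hσ hR => ?_⟩
  rcases lt_or_ge σ δ with h1 | h1
  · have := h ⟨by simpa [abs_of_pos hσ] using h1, hσ⟩
    simp only [mem_ofPred_eq, Real.dist_eq, sub_zero] at this
    have : 0 ≤ max B 0 / δ * σ := by positivity
    linarith
  · have h2 := hB σ ⟨h1, hR⟩
    rw [norm_eq_abs] at h2
    have h3 : max B 0 ≤ max B 0 / δ * σ := by
      rw [div_mul_eq_mul_div, le_div_iff₀ hδ]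
      gcongr
    linarith [le_max_left B 0]

lemma lSol_sqProf (hb : 2 ≤ b) (hF : Continuous F) (hVc : ContinuousOn V (Ici 0))
    (hV : ContDiffOn ℝ 2 V (Ioi 0))
    (hode : ∀ t > (0:ℝ), -(deriv (deriv V) t) - (N - 2 + b) / b / t * deriv V t = F (V t))
    (hV0 : Tendsto (deriv V) (𝓝[>] 0) (𝓝 0)) :
    LSol (fun x : 𝔼 => sqProf V b (‖x‖ ^ 2))
      (fun x => ‖x‖ ^ 2 * ((‖x‖ ^ 2) ^ (b - 2) * F (sqProf V b (‖x‖ ^ 2)))) := by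
  have hb0 : 0 < b := by linarith
  refine LSol.of_lim fun R hR ε hε => ?_
  set c : ℝ → ℝ := fun σ => deriv V (σ ^ (b / 2) / b) * σ ^ (b / 2 - 1) with hcdef
  have cV' : ContinuousOn (deriv V) (Ioi 0) :=
    (hV.deriv_of_isOpen (m := 1) isOpen_Ioi (by norm_num)).continuousOn
  have ct : Continuous fun σ : ℝ => σ ^ (b / 2) / b :=
    (continuous_rpow_const (by positivity)).div_const b
  have cp : Continuous fun σ : ℝ => σ ^ (b / 2 - 1) := continuous_rpow_const (by linarith)
  have hc : ContinuousOn c (Ioi 0) :=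
    (cV'.comp ct.continuousOn fun σ hσ => rpow_div_pos hb0 hσ).mul cp.continuousOn
  have hc0 : Tendsto c (𝓝[>] 0) (𝓝 0) := by
    have h1 : Tendsto (fun σ : ℝ => σ ^ (b / 2) / b) (𝓝[>] 0) (𝓝[>] 0) := by
      refine tendsto_nhdsWithin_iff.2 ⟨?_, ?_⟩
      · have := (ct.tendsto 0).mono_left (nhdsWithin_le_nhds (s := Ioi 0))
        rwa [zero_rpow (by positivity), zero_div] at this
      · filter_upwards [self_mem_nhdsWithin] with σ hσ using rpow_div_pos hb0 hσ
    have := (hV0.comp h1).mul ((cp.tendsto 0).mono_left (nhdsWithin_le_nhds (s := Ioi 0)))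
    rwa [zero_mul] at this
  obtain ⟨K, hK, hcK⟩ := exists_le_add_mul hc hc0 (R ^ 2 + 1)
    (show 0 < ε / (4 * (N + 1)) by positivity)
  have c1 := continuousOn_sqProf (V := V) hb0 hVc
  have c2 : ContinuousOn (fun σ : ℝ => σ ^ (b - 2) * F (sqProf V b σ)) (Ici 0) :=
    (continuous_rpow_const (by linarith)).continuousOn.mul (hF.comp_continuousOn c1)
  have hsub : Icc 0 (R ^ 2 + 1) ⊆ Ici (0:ℝ) := fun _ h => h.1
  obtain ⟨δ₁, hδ₁, u1⟩ := Metric.uniformContinuousOn_iff_le.1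
    (isCompact_Icc.uniformContinuousOn_of_continuous (c1.mono hsub)) ε hε
  obtain ⟨δ₂, hδ₂, u2⟩ := Metric.uniformContinuousOn_iff_le.1
    (isCompact_Icc.uniformContinuousOn_of_continuous (c2.mono hsub)) (ε / (4 * (R ^ 2 + 1)))
    (by positivity)
  set d := min (min δ₁ δ₂) (min 1 (ε / (4 * (N + 1) * (K + 1)))) with hd
  have hd0 : 0 < d := by positivity
  have hd1 : d ≤ δ₁ := (min_le_left _ _).trans (min_le_left _ _)
  have hd2 : d ≤ δ₂ := (min_le_left _ _).trans (min_le_right _ _)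
  have hd3 : d ≤ 1 := (min_le_right _ _).trans (min_le_left _ _)
  have hd4 : d ≤ ε / (4 * (N + 1) * (K + 1)) := (min_le_right _ _).trans (min_le_right _ _)
  have hw : ContDiff ℝ 2 fun y : 𝔼 => sqProf V b (d + ‖y‖ ^ 2) :=
    contDiff_iff_contDiffAt.2 fun y => (contDiffAt_sqProf hb0 hV (by positivity)).comp y
      (contDiffAt_const.add (contDiff_normSq.contDiffAt.of_le le_top))
  refine ⟨_, _, LSol.of_contDiff hw, fun x hx => ?_⟩
  have hxR : ‖x‖ ≤ R := by simpa using hx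
  have hx2 : ‖x‖ ^ 2 ≤ R ^ 2 := pow_le_pow_left₀ (norm_nonneg x) hxR 2
  have hx0 : 0 ≤ ‖x‖ ^ 2 := by positivity
  have m1 : d + ‖x‖ ^ 2 ∈ Icc 0 (R ^ 2 + 1) := ⟨by positivity, by linarith⟩
  have m2 : ‖x‖ ^ 2 ∈ Icc 0 (R ^ 2 + 1) := ⟨by positivity, by linarith⟩
  have hdist : dist (d + ‖x‖ ^ 2) (‖x‖ ^ 2) = d := by
    rw [Real.dist_eq, add_sub_cancel_right, abs_of_pos hd0]
  refine ⟨u1 _ m1 _ m2 (by rw [hdist]; exact hd1), ?_⟩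
  have a2 := u2 _ m1 _ m2 (by rw [hdist]; exact hd2)
  rw [Real.dist_eq] at a2
  rw [lap_sqProf hb0 hV hode hd0]
  have hσ : 0 < d + ‖x‖ ^ 2 := by positivity
  have a3 := hcK _ hσ m1.2
  set σ := d + ‖x‖ ^ 2 with hσd
  have a4 : |d * c σ / σ| ≤ ε / (4 * (N + 1)) + K * d := by
    rw [abs_div, abs_mul, abs_of_pos hd0, abs_of_pos hσ, div_le_iff₀ hσ]
    have h5 : d ≤ σ := by linarith
    have h6 : 0 ≤ ε / (4 * (N + 1)) := by positivity
    nlinarith [mul_le_mul_of_nonneg_left a3 hd0.le, mul_le_mul_of_nonneg_left h5 h6]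
  have a5 : N * |d * c σ / σ| ≤ ε / 2 := by
    have h7 : K * d ≤ ε / (4 * (N + 1)) := by
      have : (K + 1) * d ≤ ε / (4 * (N + 1)) := by
        rw [le_div_iff₀ (by positivity)] at hd4 ⊢
        linarith
      linarith
    calc N * |d * c σ / σ| ≤ (N + 1) * (ε / (4 * (N + 1)) + ε / (4 * (N + 1))) := by
          gcongr
          · linarith
          · linarith
      _ = ε / 2 := by field_simp; ring
  have a6 : ‖x‖ ^ 2 * |σ ^ (b - 2) * F (sqProf V b σ) -
      (‖x‖ ^ 2) ^ (b - 2) * F (sqProf V b (‖x‖ ^ 2))| ≤ ε / 2 := by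
    calc _ ≤ (R ^ 2 + 1) * (ε / (4 * (R ^ 2 + 1))) := by
          gcongr
          linarith
      _ ≤ ε / 2 := by field_simp; linarith
  have e7 : -(-(‖x‖ ^ 2 * (σ ^ (b - 2) * F (sqProf V b σ))) + N * (d * c σ / σ)) -
      ‖x‖ ^ 2 * ((‖x‖ ^ 2) ^ (b - 2) * F (sqProf V b (‖x‖ ^ 2))) =
      ‖x‖ ^ 2 * (σ ^ (b - 2) * F (sqProf V b σ) -
      (‖x‖ ^ 2) ^ (b - 2) * F (sqProf V b (‖x‖ ^ 2))) - N * (d * c σ / σ) := by ring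
  refine (congrArg abs e7).trans_le ((abs_sub _ _).trans ?_)
  rw [abs_mul, abs_mul, abs_of_nonneg hx0, abs_of_nonneg (Nat.cast_nonneg (α := ℝ) N)]
  linarith

/-- Nonnegative solutions vanishing at infinity decay faster than every exponential. -/
lemma LSol.exists_abs_le_rho (hN : 1 ≤ N) {u : 𝔼 → ℝ} {F : ℝ → ℝ} {α m : ℝ} (hα : 0 < α)
    (hm : 0 < m) (hF : ContDiff ℝ 1 F) (hF0 : F 0 = 0) (hF1 : deriv F 0 = -m)
    (H : LSol u (fun x => ‖x‖ ^ α * F (u x))) (hpos : ∀ x, 0 ≤ u x)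
    (hu : Tendsto u (cocompact 𝔼) (𝓝 0)) {c : ℝ} (hc : 0 ≤ c) :
    ∃ C, 0 ≤ C ∧ ∀ x, |u x| ≤ C * rho c x := by
  set f : 𝔼 → ℝ := fun x => max 0 ((c ^ 2 + 1) * u x + ‖x‖ ^ α * F (u x)) with hf
  have hfc : Continuous f := continuous_const.max ((continuous_const.mul H.continuous).add
    H.continuous_rhs)
  have hd : HasDerivAt F (-m) 0 := by
    rw [← hF1]; exact (hF.differentiable (by norm_num)).differentiableAt.hasDerivAt
  have hs : ∀ᶠ s in 𝓝 (0:ℝ), |F s + m * s| ≤ m / 2 * |s| := by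
    have := hd.isLittleO.def (show (0:ℝ) < m / 2 by positivity)
    filter_upwards [this] with s hs
    simp only [hF0, sub_zero, smul_eq_mul, norm_eq_abs] at hs
    convert hs using 2
    ring
  have hcom : Tendsto (fun x : 𝔼 => ‖x‖ ^ α) (cocompact 𝔼) atTop :=
    (tendsto_rpow_atTop hα).comp tendsto_norm_cocompact_atTop
  have hz : ∀ᶠ x in cocompact 𝔼, f x = 0 := by
    filter_upwards [hu.eventually hs, hcom.eventually_ge_atTop (2 * (c ^ 2 + 1) / m)] with x h1 h2
    refine max_eq_left ?_
    have hx := hpos x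
    rw [abs_of_nonneg hx] at h1
    have h3 : F (u x) ≤ -(m / 2 * u x) := by linarith [(abs_le.1 h1).2]
    have h4 : c ^ 2 + 1 ≤ ‖x‖ ^ α * (m / 2) := by
      rw [div_le_iff₀ hm] at h2; linarith
    have h5 := mul_le_mul_of_nonneg_left h3 (rpow_nonneg (norm_nonneg x) α)
    nlinarith
  obtain ⟨K, hK, hKf⟩ := mem_cocompact.1 hz
  obtain ⟨B, hB⟩ := hK.exists_bound_of_continuousOn
    (hfc.div (contDiff_rho c (n := 0)).continuous fun x => (rho_pos c x).ne').continuousOn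
  refine ⟨max B 0, le_max_right _ _, ?_⟩
  have hq : ∀ x, ∃ q, c ^ 2 + 1 ≤ q ∧ f x - q * u x = ‖x‖ ^ α * F (u x) := fun x => by
    rcases (hpos x).eq_or_lt with h0 | h0
    · exact ⟨c ^ 2 + 1, le_rfl, by simp [hf, ← h0, hF0]⟩
    · refine ⟨(f x - ‖x‖ ^ α * F (u x)) / u x, ?_, ?_⟩
      · rw [le_div_iff₀ h0]
        have : (c ^ 2 + 1) * u x + ‖x‖ ^ α * F (u x) ≤ f x := le_max_right _ _
        linarith
      · rw [div_mul_cancel₀ _ h0.ne']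
        ring
  choose q hq1 hq2 using hq
  have H' : LSol u (fun x => f x - q x * u x) := by
    convert H using 2 with x
    exact hq2 x
  refine H'.abs_le_rho hN (fun x => (by positivity : (0:ℝ) < c ^ 2 + 1).trans_le (hq1 x)) hc
    (le_max_right _ _) hu fun x => ?_
  have h1 : |f x| ≤ max B 0 * rho c x := by
    by_cases hx : x ∈ K
    · have := hB x hx
      rw [norm_eq_abs, Pi.div_apply, abs_div, abs_of_pos (rho_pos c x),
        div_le_iff₀ (rho_pos c x)] at this
      exact this.trans (mul_le_mul_of_nonneg_right (le_max_left _ _) (rho_pos c x).le)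
    · have : f x = 0 := hKf hx
      rw [this, abs_zero]
      exact mul_nonneg (le_max_right _ _) (rho_pos c x).le
  have h2 : 0 ≤ max B 0 * rho c x := mul_nonneg (le_max_right _ _) (rho_pos c x).le
  nlinarith [hq1 x]

lemma exists_eq_rho_mul {u : 𝔼 → ℝ} (hc : Continuous u) {C : ℝ} (hu : ∀ x, |u x| ≤ C * rho 2 x) :
    (∀ x, u x = rho 1 x * mkB (fun y => u y / rho 1 y) x) ∧
      Tendsto (mkB fun y => u y / rho 1 y) (cocompact 𝔼) (𝓝 0) := by
  have hle : ∀ x, |u x / rho 1 x| ≤ C * rho 1 x := fun x => by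
    rw [abs_div, abs_of_pos (rho_pos 1 x), div_le_iff₀ (rho_pos 1 x), mul_assoc, ← rho_two]
    exact hu x
  have hC : 0 ≤ C := nonneg_of_mul_nonneg_left ((abs_nonneg _).trans (hle 0)) (rho_pos 1 0)
  have hap := mkB_apply (f := fun y => u y / rho 1 y)
    (hc.div (contDiff_rho 1 (n := 0)).continuous fun x => (rho_pos 1 x).ne') (C := C)
    fun x => (hle x).trans (mul_le_of_le_one_right hC (rho_le_one zero_le_one x))
  refine ⟨fun x => ?_, ?_⟩
  · rw [hap, mul_div_cancel₀ _ (rho_pos 1 x).ne']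
  · refine squeeze_zero_norm (fun x => ?_) (a := fun x => C * rho 1 x) ?_
    · rw [hap, norm_eq_abs]
      exact hle x
    · simpa using (tendsto_rho (N := N) one_pos).const_mul C

/-- A solution with decay rate `3` has `Phi` with decay rate `2`. -/
lemma RadSol.exists_abs_Phi_le_exp (H : RadSol F α C U) (hN : 2 ≤ N) (hF : ContDiff ℝ 1 F)
    (hF0 : F 0 = 0) (hα : 0 < α) (hL : ∀ s, |s| ≤ C → |deriv F s| ≤ L) {C₃ : ℝ}
    (h3 : ∀ x, |U x| ≤ C₃ * exp (-(3 * ‖x‖))) :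
    ∃ D ≥ 0, ∀ r > 0, |Phi e α U r| ≤ D * exp (-(2 * r)) := by
  have hL0 : 0 ≤ L := (abs_nonneg _).trans (hL 0 (by simpa using H.C_nonneg))
  have hC := H.C_nonneg
  have hC3 : 0 ≤ C₃ := by
    have := (abs_nonneg _).trans (h3 0)
    simpa using this
  set K := α ^ α with hKdef
  have hK : 0 ≤ K := rpow_nonneg (by positivity) _
  set C' := C₃ * (1 + L * K)
  have he : ∀ x : 𝔼, exp (-(3 * ‖x‖)) = exp (-(2 * ‖x‖)) * exp (-‖x‖) := fun x => by
    rw [← exp_add]; ring_nf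
  have hv : ∀ x, |U x| ≤ C' * exp (-(2 * ‖x‖)) := fun x => by
    have h1 : exp (-(3 * ‖x‖)) ≤ exp (-(2 * ‖x‖)) :=
      exp_le_exp.2 (by linarith [norm_nonneg x])
    have h2 : 0 ≤ C₃ * (L * K) * exp (-(2 * ‖x‖)) := by positivity
    have h4 := mul_le_mul_of_nonneg_left h1 hC3
    have h5 := h3 x
    simp only [C']
    linarith
  have hh : ∀ x, |‖x‖ ^ α * F (U x)| ≤ C' * exp (-(2 * ‖x‖)) := fun x => by
    have h1 : |F (U x)| ≤ L * |U x| := by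
      rw [H.prof_eq (e := e) (norm_nonneg x) rfl]
      exact H.abs_F_le hF hF0 hL (norm_nonneg x)
    have h2 : ‖x‖ ^ α ≤ K * exp ‖x‖ := by
      simpa [hKdef] using rpow_le_exp (norm_nonneg x) hα one_pos
    have h0 := rpow_nonneg (norm_nonneg x) α
    rw [abs_mul, abs_of_nonneg h0]
    calc ‖x‖ ^ α * |F (U x)| ≤ (K * exp ‖x‖) * (L * (C₃ * exp (-(3 * ‖x‖)))) := by
          gcongr
          exact h1.trans (mul_le_mul_of_nonneg_left (h3 x) hL0)
      _ = C₃ * (L * K) * exp (-(2 * ‖x‖)) := by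
          have : exp (-‖x‖) * exp ‖x‖ = 1 := by rw [← exp_add]; simp
          rw [he]
          linear_combination K * L * C₃ * exp (-(2 * ‖x‖)) * this
      _ ≤ C' * exp (-(2 * ‖x‖)) := by
          gcongr
          simp only [C']
          nlinarith
  obtain ⟨A, hA, hb⟩ := exists_mdd_bound e 0
  have hs := sqH_pos hN e 0
  set D₁ := A * ((N + 1) * exp 2 * C') / sqH e 0
  have hC' : 0 ≤ C' := by positivity
  have hD₁ : 0 ≤ D₁ := by positivity
  refine ⟨D₁ + L * C * exp 2, by positivity, fun r hr => ?_⟩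
  rcases le_total 1 r with h1 | h1
  · have h2 := hb U r ((N + 1) * exp 2 * C' * exp (-(2 * r))) fun x hx => by
      rw [abs_of_pos hr] at hx
      rw [← hx]
      exact H.sol.norm_fderiv_le_exp_mul (by norm_num) hv hh x
    have h4 : r ^ (-(α / 2)) ≤ 1 := rpow_le_one_of_one_le_of_nonpos h1 (by linarith)
    have h5 := rpow_pos_of_pos hr (-(α / 2))
    rw [Phi, abs_mul, abs_of_pos h5, abs_div, abs_of_pos hs]
    have h6 : |mdd e 0 U r| / sqH e 0 ≤ D₁ * exp (-(2 * r)) := by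
      rw [div_le_iff₀ hs]
      refine h2.trans_eq ?_
      simp only [D₁]
      field_simp
    have h7 : 0 ≤ |mdd e 0 U r| / sqH e 0 := by positivity
    have h8 : 0 ≤ L * C * exp 2 * exp (-(2 * r)) := by positivity
    nlinarith
  · have h2 := H.abs_Phi_le (e := e) hN hF hF0 hα hL hr
    have h4 : r ^ (1 + α / 2) ≤ 1 := rpow_le_one hr.le h1 (by positivity)
    have h5 : 1 ≤ exp 2 * exp (-(2 * r)) := by
      rw [← exp_add]
      exact one_le_exp (by linarith)
    have h6 : 0 ≤ L * C := by positivity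
    have h7 : 0 ≤ D₁ * exp (-(2 * r)) := by positivity
    nlinarith

/-- The function with radial factor `Phi` and angular factor `HH e j`. -/
noncomputable def phiH (e : Fin N) (j : ℕ) (α : ℝ) (U : 𝔼 → ℝ)
    (x : 𝔼) : ℝ := Phi e α U ‖x‖ / ‖x‖ ^ j * HH e j x

lemma exists_HH_bound (e : Fin N) (j : ℕ) : ∃ A ≥ 0, ∀ x : 𝔼, |HH e j x| ≤ A * ‖x‖ ^ j := by
  obtain ⟨A, hA⟩ := (isCompact_closedBall (0:𝔼) 1).exists_bound_of_continuousOn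
    (HH_continuous e j).continuousOn
  refine ⟨max A 0, le_max_right _ _, fun x => ?_⟩
  rcases eq_or_ne x 0 with rfl | hx
  · rcases Nat.eq_zero_or_pos j with rfl | hj
    · have := hA 0 (by simp)
      simpa using this.trans (le_max_left _ (0:ℝ))
    · have := HH_smul e j 0 (0:𝔼)
      rw [zero_smul, zero_pow hj.ne', zero_mul] at this
      rw [this, norm_zero, zero_pow hj.ne']
      simp
  · have hn := norm_pos_iff.2 hx
    have h1 := HH_smul e j ‖x‖ (‖x‖⁻¹ • x)
    rw [smul_smul, mul_inv_cancel₀ hn.ne', one_smul] at h1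
    have h2 := hA (‖x‖⁻¹ • x) (by
      rw [mem_closedBall_zero_iff, norm_smul, norm_inv, norm_norm, inv_mul_cancel₀ hn.ne'])
    rw [h1, abs_mul, abs_of_pos (pow_pos hn j), mul_comm]
    gcongr
    exact h2.trans (le_max_left _ _)

lemma abs_phiH_le {A : ℝ} {j : ℕ} (hA : 0 ≤ A) (h : ∀ x : 𝔼, |HH e j x| ≤ A * ‖x‖ ^ j) (x : 𝔼) :
    |phiH e j α U x| ≤ A * |Phi e α U ‖x‖| := by
  rw [phiH, abs_mul, abs_div, abs_of_nonneg (pow_nonneg (norm_nonneg x) j)]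
  rcases eq_or_ne (‖x‖ ^ j) 0 with h0 | h0
  · rw [h0]; simp; positivity
  · have h1 : 0 < ‖x‖ ^ j := lt_of_le_of_ne (pow_nonneg (norm_nonneg x) j) h0.symm
    calc |Phi e α U ‖x‖| / ‖x‖ ^ j * |HH e j x| ≤ |Phi e α U ‖x‖| / ‖x‖ ^ j * (A * ‖x‖ ^ j) := by
          gcongr
          exact h x
      _ = A * |Phi e α U ‖x‖| := by field_simp

lemma Phi_zero (hα : 0 < α) : Phi e α U 0 = 0 := by
  rw [Phi, zero_rpow (by linarith), zero_mul]

lemma md_phiH (e : Fin N) (j : ℕ) (α : ℝ) (U : 𝔼 → ℝ) {r : ℝ} (hr : 0 < r) :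
    md e j (phiH e j α U) r = Phi e α U r * sqH e j := by
  have := md_radial_mul_HH e j (fun r => Phi e α U r / r ^ j) hr.le
  refine this.trans ?_
  have := (pow_pos hr j).ne'
  field_simp

namespace RadSol

lemma continuous_phiH (H : RadSol F α C U) (hN : 2 ≤ N) (hF : ContDiff ℝ 1 F) (hF0 : F 0 = 0)
    (hα : 0 < α) (hL : ∀ s, |s| ≤ C → |deriv F s| ≤ L) (e : Fin N) (j : ℕ) :
    Continuous (phiH e j α U) := by
  rw [continuous_iff_continuousAt]
  intro x
  rcases eq_or_ne x 0 with rfl | hx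
  · obtain ⟨A, hA, h⟩ := exists_HH_bound e j
    have h0 : phiH e j α U 0 = 0 := by
      rw [phiH, norm_zero, Phi_zero hα, zero_div, zero_mul]
    rw [ContinuousAt, h0]
    refine squeeze_zero_norm (a := fun x : 𝔼 => A * (L * C * ‖x‖ ^ (1 + α / 2))) (fun x => ?_) ?_
    · refine (abs_phiH_le hA h x).trans (mul_le_mul_of_nonneg_left ?_ hA)
      rcases eq_or_ne x 0 with rfl | hx
      · rw [norm_zero, Phi_zero hα, zero_rpow (by positivity)]; simp
      · exact H.abs_Phi_le hN hF hF0 hα hL (norm_pos_iff.2 hx)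
    · have : Continuous fun x : 𝔼 => A * (L * C * ‖x‖ ^ (1 + α / 2)) :=
        continuous_const.mul (continuous_const.mul (continuous_norm_rpow (by positivity)))
      have h1 := this.tendsto 0
      rwa [norm_zero, zero_rpow (by positivity), mul_zero, mul_zero] at h1
  · have hn := norm_pos_iff.2 hx
    refine ContinuousAt.mul (ContinuousAt.div ?_ (continuous_norm.pow j).continuousAt
      (pow_pos hn j).ne') (HH_continuous e j).continuousAt
    exact ContinuousAt.comp (f := fun x : 𝔼 => ‖x‖) (H.hasDerivAt_Phi hN hn).continuousAt
      continuous_norm.continuousAt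

lemma exists_phiH_bound (hα : 0 < α) {D : ℝ} (hD : 0 ≤ D)
    (h : ∀ r > 0, |Phi e α U r| ≤ D * exp (-(2 * r))) (j : ℕ) :
    ∃ C, ∀ x, |phiH e j α U x| ≤ C * rho 2 x := by
  obtain ⟨A, hA, h'⟩ := exists_HH_bound e j
  refine ⟨A * (D * exp 2), fun x => (abs_phiH_le hA h' x).trans ?_⟩
  rw [mul_assoc, mul_assoc]
  refine mul_le_mul_of_nonneg_left ?_ hA
  have h1 : exp (-(2 * ‖x‖)) ≤ exp 2 * rho 2 x := by
    rw [rho, ← exp_add]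
    refine exp_le_exp.2 ?_
    have : √(1 + ‖x‖ ^ 2) ≤ 1 + ‖x‖ := by
      rw [Real.sqrt_le_left (by positivity)]
      nlinarith [norm_nonneg x]
    linarith
  have h2 := mul_le_mul_of_nonneg_left h1 hD
  rcases eq_or_ne x 0 with rfl | hx
  · rw [norm_zero, Phi_zero hα, abs_zero]
    have := rho_pos 2 (0:𝔼)
    positivity
  · exact (h _ (norm_pos_iff.2 hx)).trans h2

end RadSol

lemma mem_symm_of_rho_mul {S : Set 𝔼} {f : 𝔼 → ℝ} {z : 𝔼 →ᵇ ℝ} (hz : ∀ x, f x = rho 1 x * z x)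
    (h : ∀ x y, (∀ s ∈ S, inner ℝ s x = inner ℝ s y) → ‖x‖ = ‖y‖ → f x = f y) : z ∈ symm S :=
  fun x y h1 h2 => by
    have h3 := h x y h1 h2
    rw [hz, hz, rho_eq_of_norm_eq h2] at h3
    exact mul_left_cancel₀ (rho_pos 1 y).ne' h3

lemma inner_single (e : Fin N) (x : 𝔼) : inner ℝ (single e (1:ℝ)) x = x e := by
  rw [EuclideanSpace.inner_single_left]; simp

lemma phiH_eq_of {j : ℕ} {x y : 𝔼} (h1 : x e = y e) (h2 : ‖x‖ = ‖y‖) :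
    phiH e j α U x = phiH e j α U y := by
  rw [phiH, phiH, h2, HH_eq_of e j h1 h2]

lemma exists_md_rho_bound (e : Fin N) (j : ℕ) : ∃ A > 0, ∀ (z : 𝔼 →ᵇ ℝ), ∀ r > 0,
    |md e j (fun x => rho 1 x * z x) r| ≤ A * ‖z‖ * exp (-r) := by
  obtain ⟨A, hA, h⟩ := exists_md_bound e j
  refine ⟨A, hA, fun z r hr => ?_⟩
  rw [mul_assoc]
  refine h _ r _ fun x hx => ?_
  rw [abs_of_pos hr] at hx
  rw [abs_mul, abs_of_pos (rho_pos 1 x), mul_comm, ← hx]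
  have h1 := rho_le_exp zero_le_one x
  rw [one_mul] at h1
  exact mul_le_mul (z.norm_coe_le_norm x) h1 (rho_pos 1 x).le (norm_nonneg z)

/-- The linear functional given by the weighted integral of the `j`-th mode against `P`. -/
lemma exists_ell (e : Fin N) (j : ℕ) {P : ℝ → ℝ} (hP : Dec P) (hc : ContinuousOn P (Ioi 0)) {b : ℝ}
    (hb : -1 < b) : ∃ ell : (𝔼 →ᵇ ℝ) →L[ℝ] ℝ, ∀ z : 𝔼 →ᵇ ℝ,
      ell z = ∫ r in Ioi (0:ℝ), r ^ b * (md e j (fun x => rho 1 x * z x) r * P r) := by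
  obtain ⟨A, hA, hle⟩ := exists_md_rho_bound e j
  have hle' : ∀ (z : 𝔼 →ᵇ ℝ), ∀ r > 0, |md e j (fun x => rho 1 x * z x) r| ≤ A * ‖z‖ :=
    fun z r hr => (hle z r hr).trans (mul_le_of_le_one_right (by positivity)
      (by rw [exp_le_one_iff]; linarith))
  have hI : ∀ z : 𝔼 →ᵇ ℝ, IntegrableOn
      (fun r => r ^ b * (md e j (fun x => rho 1 x * z x) r * P r)) (Ioi 0) := fun z =>
    (hP.bdd_mul (hle' z)).integrableOn
      ((continuous_md e j (continuous_rho_mul z)).continuousOn.mul hc) hb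
  have hP1 : IntegrableOn (fun r => r ^ b * |P r|) (Ioi 0) :=
    (hP.of_le (M := 1) (z := fun r => |P r|) fun t _ => by rw [abs_abs, one_mul]).integrableOn
      hc.abs hb
  refine ⟨LinearMap.mkContinuous
    { toFun := fun z => ∫ r in Ioi (0:ℝ), r ^ b * (md e j (fun x => rho 1 x * z x) r * P r)
      map_add' := fun z w => ?_
      map_smul' := fun c z => ?_ } (A * ∫ r in Ioi (0:ℝ), r ^ b * |P r|) fun z => ?_, fun z => rfl⟩
  · rw [← integral_add (hI z) (hI w)]
    refine setIntegral_congr_fun measurableSet_Ioi fun r _ => ?_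
    have : (fun x => rho 1 x * (z + w) x) = fun x => rho 1 x * z x + rho 1 x * w x := by
      funext x; rw [BoundedContinuousFunction.add_apply, mul_add]
    simp only [this]
    rw [md_add e j (continuous_rho_mul z) (continuous_rho_mul w)]
    ring
  · rw [RingHom.id_apply, smul_eq_mul, ← integral_const_mul]
    refine setIntegral_congr_fun measurableSet_Ioi fun r _ => ?_
    have : (fun x => rho 1 x * (c • z) x) = fun x => c * (rho 1 x * z x) := by
      funext x; rw [BoundedContinuousFunction.smul_apply, smul_eq_mul]; ring
    simp only [this]
    rw [md_const_mul]
    ring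
  · refine (norm_integral_le_integral_norm _).trans ?_
    have : ∫ r in Ioi (0:ℝ), (A * ‖z‖) * (r ^ b * |P r|) =
        A * (∫ r in Ioi (0:ℝ), r ^ b * |P r|) * ‖z‖ := by
      rw [integral_const_mul]; ring
    rw [← this]
    refine setIntegral_mono_on (hI z).norm (hP1.const_mul _) measurableSet_Ioi fun r hr => ?_
    have hr0 := rpow_nonneg (le_of_lt hr) b
    rw [norm_eq_abs, abs_mul, abs_mul, abs_of_nonneg hr0]
    have := mul_le_mul_of_nonneg_left (mul_le_mul_of_nonneg_right (hle' z r hr) (abs_nonneg (P r)))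
      hr0
    linarith

lemma ell_eq_zero_of_radial (hN : 2 ≤ N) {e : Fin N} {j : ℕ} (hj : 1 ≤ j) {P : ℝ → ℝ} {b : ℝ}
    {z : 𝔼 →ᵇ ℝ} (hz : z ∈ symm (∅ : Set 𝔼)) :
    ∫ r in Ioi (0:ℝ), r ^ b * (md e j (fun x => rho 1 x * z x) r * P r) = 0 := by
  refine setIntegral_eq_zero_of_forall_eq_zero fun r hr => ?_
  have := md_radial hN e hj (v := fun x => rho 1 x * z x) (r := r)
    (c := rho 1 (r • (single e 1 : 𝔼)) * z (r • (single e 1 : 𝔼)))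
    (le_of_lt hr) fun x hx => by
      have h1 : ‖x‖ = ‖r • (single e 1 : 𝔼)‖ := by
        rw [norm_smul_single (le_of_lt hr), hx]
      rw [rho_eq_of_norm_eq h1, hz x _ (by simp) h1]
  simp only [this, zero_mul, mul_zero]

/-- Polynomial factors are absorbed by half of the exponential decay. -/
lemma exists_rpow_mul_exp_bound (hα : 0 < α) : ∃ K ≥ 0, ∀ r ≥ (0:ℝ),
    r ^ α * exp (-r) ≤ K * exp (-(r / 2)) := by
  refine ⟨(α / (1 / 2)) ^ α, rpow_nonneg (by positivity) _, fun r hr => ?_⟩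
  have h1 := rpow_le_exp hr hα (show (0:ℝ) < 1 / 2 by norm_num)
  have h2 : exp (1 / 2 * r) * exp (-r) = exp (-(r / 2)) := by
    rw [← exp_add]; ring_nf
  rw [← h2, ← mul_assoc]
  exact mul_le_mul_of_nonneg_right h1 (exp_pos _).le

lemma exp_neg_le_half {r : ℝ} (hr : 0 ≤ r) : exp (-r) ≤ exp (-(r / 2)) :=
  exp_le_exp.2 (by linarith)

namespace RadSol

lemma dec_qq_Phi (H : RadSol F α C U) (hN : 2 ≤ N) (hF : ContDiff ℝ 1 F) (hF0 : F 0 = 0)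
    (hα : 0 < α) (hL : ∀ s, |s| ≤ C → |deriv F s| ≤ L) (m : ℝ) :
    Dec fun r => (m * r ^ α + 8) * Phi e α U r := by
  have h1 := H.dec_Phi (e := e) hN hF hF0 hα hL
  exact (((h1.rpow_mul hα.le).const_mul m).add (h1.const_mul 8)).congr fun r _ => by ring

lemma continuousOn_qq_Phi (H : RadSol F α C U) (hN : 2 ≤ N) (hα : 0 < α) (m : ℝ) :
    ContinuousOn (fun r => (m * r ^ α + 8) * Phi e α U r) (Ioi 0) :=
  (((continuous_const.mul (continuous_rpow_const hα.le)).add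
    continuous_const).continuousOn).mul (H.continuousOn_Phi hN)

lemma integral_qq_Phi_pos (H : RadSol F α C U) (hN : 3 ≤ N) (hF : ContDiff ℝ 1 F) (hF0 : F 0 = 0)
    (hα : 0 < α) {m : ℝ} (hm : 0 < m) {x : 𝔼} (hx : x ≠ 0) (hU : U x ≠ 0) :
    0 < ∫ r in Ioi (0:ℝ), r ^ ((N:ℝ) - 1) *
      (Phi e α U r * ((m * r ^ α + 8) * Phi e α U r)) := by
  have hN2 : 2 ≤ N := by omega
  have hNr : (3:ℝ) ≤ N := by exact_mod_cast hN
  obtain ⟨L, hL0, hL⟩ := exists_deriv_bound hF C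
  obtain ⟨r₀, hr₀, h₀⟩ := H.exists_Phi_ne_zero (e := e) hN2 hF hF0 hα hL hx hU
  have d1 := H.dec_Phi (e := e) hN2 hF hF0 hα hL
  have d2 := H.dec_qq_Phi (e := e) hN2 hF hF0 hα hL m
  have hc := (H.continuousOn_Phi (e := e) hN2).mul (H.continuousOn_qq_Phi (e := e) hN2 hα m)
  refine setIntegral_rpow_mul_pos hc (fun t ht => ?_) hr₀ ?_ ((d1.mul d2).integrableOn hc
    (by linarith))
  · have : 0 ≤ m * t ^ α + 8 := by have := rpow_nonneg (le_of_lt ht) α; positivity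
    have h2 := mul_nonneg this (mul_self_nonneg (Phi e α U t))
    linarith
  · have : 0 < m * r₀ ^ α + 8 := by have := rpow_nonneg (le_of_lt hr₀) α; positivity
    exact mul_ne_zero h₀ (mul_ne_zero this.ne' h₀)

lemma md_linear (H : RadSol F α C U) (hN : 2 ≤ N) (hF : ContDiff ℝ 1 F) (hF0 : F 0 = 0)
    (hα : 0 < α) (hL : ∀ s, |s| ≤ C → |deriv F s| ≤ L) {w : 𝔼 → ℝ} (hw : Continuous w) (m c : ℝ)
    (j : ℕ) {r : ℝ} (hr : 0 < r) :
    md e j (fun x => ‖x‖ ^ α * deriv F (U x) * w x - c * (qq m α x * phiH e j α U x)) r =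
      r ^ α * deriv F (prof e U r) * md e j w r -
        c * (sqH e j * ((m * r ^ α + 8) * Phi e α U r)) := by
  have c1 : Continuous fun x : 𝔼 => ‖x‖ ^ α * deriv F (U x) := (continuous_norm_rpow hα.le).mul
    ((hF.continuous_deriv le_rfl).comp H.continuous)
  have c2 : Continuous fun x : 𝔼 => -c * qq m α x := continuous_const.mul (continuous_qq m hα.le)
  have h1 := md_add e j (v := fun x => ‖x‖ ^ α * deriv F (U x) * w x)
    (w := fun x => -c * qq m α x * phiH e j α U x) (c1.mul hw)
    (c2.mul (H.continuous_phiH hN hF hF0 hα hL e j)) r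
  rw [md_radial_mul (c := r ^ α * deriv F (prof e U r)) e j hr.le
    (fun x hx => by rw [H.prof_eq (e := e) hr.le hx, hx]),
    md_radial_mul (c := -c * (m * r ^ α + 8)) e j hr.le (fun x hx => by rw [qq, hx]),
    md_phiH e j α U hr] at h1
  have : (fun x => ‖x‖ ^ α * deriv F (U x) * w x - c * (qq m α x * phiH e j α U x)) =
    fun x => ‖x‖ ^ α * deriv F (U x) * w x + -c * qq m α x * phiH e j α U x := by
    funext x; ring
  rw [this, h1]
  ring

/-- The forcing coefficient of a solution of the forced linearized equation vanishes. -/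
lemma coeff_eq_zero (H : RadSol F α C U) (hN : 3 ≤ N) (hF : ContDiff ℝ 1 F) (hF0 : F 0 = 0)
    (hα : 0 < α) {x : 𝔼} (hx : x ≠ 0) (hU : U x ≠ 0) {m : ℝ} (hm : 0 < m) {w : 𝔼 → ℝ} {c B : ℝ}
    {j : ℕ} (hj : (j:ℝ) * (j + N - 2) = (N - 1 + α / 2) * (1 + α / 2))
    (Hw : LSol w (fun x => ‖x‖ ^ α * deriv F (U x) * w x - c * (qq m α x * phiH e j α U x)))
    (hw : ∀ x, |w x| ≤ B * exp (-(‖x‖ / 2)))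
    (hh : ∀ x, |‖x‖ ^ α * deriv F (U x) * w x - c * (qq m α x * phiH e j α U x)| ≤
      B * exp (-(‖x‖ / 2))) : c = 0 := by
  have hN2 : 2 ≤ N := by omega
  obtain ⟨L, hL0, hL⟩ := exists_deriv_bound hF C
  have h1 := H.wronskian (e := e) hN hF hF0 hα Hw hw hh j
  rw [hj, sub_self, zero_mul] at h1
  have h2 : ∫ r in Ioi (0:ℝ), r ^ ((N:ℝ) - 1) * ((md e j (fun x => ‖x‖ ^ α * deriv F (U x) * w x -
      c * (qq m α x * phiH e j α U x)) r - r ^ α * deriv F (prof e U r) * md e j w r) *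
      Phi e α U r) = -(c * sqH e j) * ∫ r in Ioi (0:ℝ), r ^ ((N:ℝ) - 1) *
      (Phi e α U r * ((m * r ^ α + 8) * Phi e α U r)) := by
    rw [← integral_const_mul]
    refine setIntegral_congr_fun measurableSet_Ioi fun r hr => ?_
    rw [H.md_linear hN2 hF hF0 hα hL Hw.continuous m c j hr]
    ring
  rw [h2] at h1
  have h3 := H.integral_qq_Phi_pos (e := e) hN hF hF0 hα hm hx hU
  have h4 := sqH_pos hN2 e j
  rcases mul_eq_zero.1 h1 with h | h
  · have := (mul_eq_zero.1 (neg_eq_zero.1 h)).resolve_right h4.ne'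
    exact this
  · exact absurd h h3.ne'

/-- A mode of a solution of the linearized equation that is proportional to `Phi` vanishes unless
the angular eigenvalue is the one of `Phi`. -/
lemma proportional_eq_zero (H : RadSol F α C U) (hN : 2 ≤ N) (hF : ContDiff ℝ 1 F) {y y1 : ℝ → ℝ}
    {μ c r₀ : ℝ} (hr₀ : 0 < r₀) (h₀ : Phi e α U r₀ ≠ 0)
    (hy : ∀ r > (0:ℝ), HasDerivAt y (y1 r) r)
    (hy1 : ∀ r > (0:ℝ), HasDerivAt y1 (-((N - 1) / r * y1 r) -
      (r ^ α * deriv F (prof e U r) - μ / r ^ 2) * y r) r)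
    (h : ∀ r > (0:ℝ), y r = c * Phi e α U r)
    (hμ : μ ≠ (N - 1 + α / 2) * (1 + α / 2)) : c = 0 := by
  have e1 : ∀ r > (0:ℝ), y1 r = c * Phi1 e F α U r := fun r hr => by
    refine (hy r hr).unique (((H.hasDerivAt_Phi (e := e) hN hr).const_mul c).congr_of_eventuallyEq ?_)
    filter_upwards [Ioi_mem_nhds hr] with s hs using h s hs
  have e2 := (hy1 r₀ hr₀).unique (((H.hasDerivAt_Phi1 (e := e) hN hF hr₀).const_mul
    c).congr_of_eventuallyEq (by filter_upwards [Ioi_mem_nhds hr₀] with s hs using e1 s hs))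
  rw [h r₀ hr₀, e1 r₀ hr₀] at e2
  have e3 : (μ - (N - 1 + α / 2) * (1 + α / 2)) * (c * (Phi e α U r₀ / r₀ ^ 2)) = 0 := by
    linear_combination e2
  have e4 := (mul_eq_zero.1 e3).resolve_left (sub_ne_zero.2 hμ)
  exact (mul_eq_zero.1 e4).resolve_right (div_ne_zero h₀ (by positivity))

end RadSol

lemma angular_eigenvalue_ne {i j : ℕ} (hN : 2 ≤ N) (hj : 1 ≤ j) (hji : j ≠ i + 1) :
    (j:ℝ) * (j + N - 2) ≠ (N - 1 + 2 * (i:ℝ) / 2) * (1 + 2 * (i:ℝ) / 2) := by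
  intro h
  have hNr : (2:ℝ) ≤ N := by exact_mod_cast hN
  have hjr : (1:ℝ) ≤ j := by exact_mod_cast hj
  have hi : (0:ℝ) ≤ i := Nat.cast_nonneg i
  have h1 : ((j:ℝ) - (i + 1)) * (j + i + 1 + N - 2) = 0 := by linear_combination h
  rcases mul_eq_zero.1 h1 with h2 | h2
  · exact hji (by exact_mod_cast (sub_eq_zero.1 h2))
  · linarith

lemma RadSol.eq_zero_of_linearized (H : RadSol F α C U) (hN : 3 ≤ N) (hF : ContDiff ℝ 1 F)
    (hF0 : F 0 = 0) {i : ℕ} (hi : 0 < i) (hα : α = 2 * i)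
    {x₀ : 𝔼} (hx₀ : x₀ ≠ 0) (hU : U x₀ ≠ 0)
    (hV : ContinuousOn V (Ioi 0)) {b : ℝ} (hb : b = 1 + i)
    (hVp : ∀ r > (0:ℝ), prof e U r = V (r ^ b / b))
    (hnd : RadNondeg (kk N α) fun t => deriv F (V t))
    (hmi : MorseIndexOne (kk N α) fun t => deriv F (V t)) {w : 𝔼 → ℝ} {B : ℝ}
    (Hw : LSol w (fun x => ‖x‖ ^ α * deriv F (U x) * w x))
    (hw : ∀ x, |w x| ≤ B * exp (-(‖x‖ / 2)))
    (hh : ∀ x, |‖x‖ ^ α * deriv F (U x) * w x| ≤ B * exp (-(‖x‖ / 2)))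
    (hsym : ∀ x y : 𝔼, x e = y e → ‖x‖ = ‖y‖ → w x = w y)
    (hell : ∫ r in Ioi (0:ℝ), r ^ ((N:ℝ) - 1 - 2) * (md e (i + 1) w r * Phi e α U r) = 0)
    (x : 𝔼) : w x = 0 := by
  have hN2 : 2 ≤ N := by omega
  have hNr : (3:ℝ) ≤ N := by exact_mod_cast hN
  have hir : (0:ℝ) < i := by exact_mod_cast hi
  have hα0 : 0 < α := by rw [hα]; positivity
  have hb0 : 0 < b := by rw [hb]; positivity
  obtain ⟨L, hL0, hL⟩ := exists_deriv_bound hF C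
  have hw1 := Hw.contDiff_one
  set A : ℝ → ℝ := fun t => deriv F (V t) with hA
  have hAc : ContinuousOn A (Ioi 0) := (hF.continuous_deriv le_rfl).comp_continuousOn hV
  have hVr : ∀ t > (0:ℝ), V t = prof e U (rt b t) := fun t ht => by
    rw [hVp _ (rt_pos hb0 ht), rt_rpow hb0 ht, mul_div_cancel_left₀ _ hb0.ne']
  have hAM : ∀ t > (0:ℝ), |A t| ≤ L := fun t ht => by
    refine hL _ ?_
    rw [hVr t ht]
    exact H.abs_prof_le' (rt_pos hb0 ht).le
  have hk : ((N:ℝ) - 1 - 1 + b) / b = kk N α := by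
    rw [kk, hb, hα, div_eq_div_iff (by positivity) (by positivity)]
    ring
  have hk1 : 1 < kk N α := by
    rw [← hk, lt_div_iff₀ hb0]
    linarith
  have hα2 : 2 * b - 2 = α := by rw [hb, hα]; ring
  have hAr : ∀ r > (0:ℝ), deriv F (prof e U r) = A (r ^ b / b) := fun r hr => by
    rw [hA, hVp r hr]
  have hy : ∀ j, ∀ r > (0:ℝ), HasDerivAt (md e j w) (mdd e j w r) r :=
    fun j r _ => hasDerivAt_md e j hw1 r
  have hy1 : ∀ j : ℕ, ∀ r > (0:ℝ), HasDerivAt (mdd e j w) (-((N - 1) / r * mdd e j w r) -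
      (r ^ α * deriv F (prof e U r) - j * (j + N - 2) / r ^ 2) * md e j w r) r := fun j r hr => by
    refine (Hw.hasDerivAt_mdd hN2 e j hr).congr_deriv ?_
    rw [md_radial_mul (c := r ^ α * deriv F (prof e U r)) e j hr.le
      (fun x hx => by rw [H.prof_eq (e := e) hr.le hx, hx])]
    ring
  have hy1' : ∀ j : ℕ, ∀ r > (0:ℝ), HasDerivAt (mdd e j w) (-((N - 1) / r * mdd e j w r) -
      (r ^ (2 * b - 2) * A (r ^ b / b) - j * (j + N - 2) / r ^ 2) * md e j w r) r :=
    fun j r hr => by rw [hα2, ← hAr r hr]; exact hy1 j r hr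
  have dy : ∀ j, Dec (md e j w) := fun j => dec_md e j hw
  have dy1 : ∀ j, Dec fun r => r * mdd e j w r := fun j => Hw.dec_mdd e j hw hh
  have hW0 : ∀ j, (∀ t > (0:ℝ), md e j w (rt b t) = 0) → ∀ r > (0:ℝ), md e j w r = 0 := by
    intro j h r hr
    have := h (r ^ b / b) (div_pos (rpow_pos_of_pos hr b) hb0)
    rwa [rt_apply_rpow hb0 hr] at this
  have hmode : ∀ j, ∀ r > (0:ℝ), md e j w r = 0 := by
    intro j
    rcases Nat.eq_zero_or_pos j with rfl | hj
    · refine hW0 0 (eq_zero_of_radNondeg hk1 hAc hnd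
        (fun t ht => (hasDerivAt_comp_rt hb0 (hy 0) (hy1' 0) ht).1)
        (fun t ht => ?_) ((dy 0).comp_rt hb0) (Dec.comp_rt_deriv (dy1 0) hb0))
      refine (hasDerivAt_comp_rt hb0 (hy 0) (hy1' 0) ht).2.congr_deriv ?_
      rw [hk]
      simp
    · have hP : ∀ r > (0:ℝ), HasDerivAt (Phi e α U) (Phi1 e F α U r) r :=
        fun r hr => H.hasDerivAt_Phi hN2 hr
      have hP1 : ∀ r > (0:ℝ), HasDerivAt (Phi1 e F α U) (-((N - 1) / r * Phi1 e F α U r) -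
          (r ^ (2 * b - 2) * A (r ^ b / b) - (N - 1 + α / 2) * (1 + α / 2) / r ^ 2) *
          Phi e α U r) r := fun r hr => by
        rw [hα2, ← hAr r hr]
        exact H.hasDerivAt_Phi1 hN2 hF hr
      have hjr : (1:ℝ) ≤ j := by exact_mod_cast hj
      have hν : 0 < (j:ℝ) * (j + N - 2) / b ^ 2 :=
        div_pos (mul_pos (by linarith) (by linarith)) (by positivity)
      have hκ : 0 < (N - 1 + α / 2) * (1 + α / 2) / b ^ 2 :=
        div_pos (mul_pos (by linarith) (by linarith)) (by positivity)
      obtain ⟨c₁, c₂, hc, hcc⟩ := dependent_of_morseIndexOne hk1 hAc hAM hmi hν hκ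
        (fun t ht => (hasDerivAt_comp_rt hb0 (hy j) (hy1' j) ht).1)
        (fun t ht => by
          have := (hasDerivAt_comp_rt hb0 (hy j) (hy1' j) ht).2
          rwa [hk] at this)
        (fun t ht => (hasDerivAt_comp_rt hb0 hP hP1 ht).1)
        (fun t ht => by
          have := (hasDerivAt_comp_rt hb0 hP hP1 ht).2
          rwa [hk] at this)
        ((dy j).comp_rt hb0) (Dec.comp_rt_deriv (dy1 j) hb0)
        ((H.dec_Phi hN2 hF hF0 hα0 hL).comp_rt hb0)
        (Dec.comp_rt_deriv (H.dec_Phi1 hN2 hF hF0 hα0 hL) hb0)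
      have hcc' : ∀ r > (0:ℝ), c₁ * md e j w r + c₂ * Phi e α U r = 0 := fun r hr => by
        have := hcc (r ^ b / b) (div_pos (rpow_pos_of_pos hr b) hb0)
        rwa [rt_apply_rpow hb0 hr] at this
      obtain ⟨r₀, hr₀, h₀⟩ := H.exists_Phi_ne_zero (e := e) hN2 hF hF0 hα0 hL hx₀ hU
      have hc₁ : c₁ ≠ 0 := fun h => by
        have h1 := hcc' r₀ hr₀
        rw [h, zero_mul, zero_add] at h1
        exact hc ⟨h, (mul_eq_zero.1 h1).resolve_right h₀⟩
      have hprop : ∀ r > (0:ℝ), md e j w r = -(c₂ / c₁) * Phi e α U r := fun r hr => by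
        field_simp
        linear_combination hcc' r hr
      have hc0 : -(c₂ / c₁) = 0 := by
        by_cases hji : j = i + 1
        · subst hji
          have h2 : ∫ r in Ioi (0:ℝ), r ^ ((N:ℝ) - 1 - 2) * (md e (i + 1) w r * Phi e α U r) =
              -(c₂ / c₁) * ∫ r in Ioi (0:ℝ), r ^ ((N:ℝ) - 1 - 2) *
                (Phi e α U r * Phi e α U r) := by
            rw [← integral_const_mul]
            refine setIntegral_congr_fun measurableSet_Ioi fun r hr => ?_
            rw [hprop r hr]
            ring
          rw [hell] at h2
          have d1 := H.dec_Phi (e := e) hN2 hF hF0 hα0 hL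
          have cΦ := H.continuousOn_Phi (e := e) hN2
          have h3 : 0 < ∫ r in Ioi (0:ℝ), r ^ ((N:ℝ) - 1 - 2) * (Phi e α U r * Phi e α U r) :=
            setIntegral_rpow_mul_pos (cΦ.mul cΦ) (fun t _ => mul_self_nonneg _) hr₀
              (mul_ne_zero h₀ h₀) ((d1.mul d1).integrableOn (cΦ.mul cΦ) (by linarith))
          exact (mul_eq_zero.1 h2.symm).resolve_right h3.ne'
        · refine H.proportional_eq_zero hN2 hF hr₀ h₀ (hy j) (hy1 j) hprop ?_
          rw [hα]
          exact angular_eigenvalue_ne hN2 hj hji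
      intro r hr
      rw [hprop r hr, hc0, zero_mul]
  have hne : ∀ y : 𝔼, y ≠ 0 → w y = 0 := fun y hy' =>
    eq_zero_of_md_eq_zero hN2 e Hw.continuous hsym (norm_nonneg y)
      (fun j => hmode j _ (norm_pos_iff.2 hy')) y rfl
  rcases eq_or_ne x 0 with rfl | hx
  · have h1 : Tendsto w (𝓝[≠] (0:𝔼)) (𝓝 (w 0)) :=
      (Hw.continuous.tendsto 0).mono_left nhdsWithin_le_nhds
    have h2 : Tendsto w (𝓝[≠] (0:𝔼)) (𝓝 0) := tendsto_const_nhds.congr' (by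
      filter_upwards [self_mem_nhdsWithin] with y hy' using (hne y hy').symm)
    have : Nontrivial 𝔼 := ⟨x₀, 0, hx₀⟩
    have : (𝓝[≠] (0:𝔼)).NeBot := Module.punctured_nhds_neBot ℝ 𝔼 0
    exact tendsto_nhds_unique h1 h2
  · exact hne x hx

lemma lSol_of_profile (hi : 0 < i) (hF : Continuous F)
    (hVc : ContinuousOn V (Ici 0)) (hV : ContDiffOn ℝ 2 V (Ioi 0))
    (hode : ∀ t > (0:ℝ), -(deriv (deriv V) t) - kk N (2 * i) / t * deriv V t = F (V t))
    (hV0 : Tendsto (deriv V) (𝓝[>] 0) (𝓝 0)) (hU : ∀ x, U x = V (‖x‖ ^ (1 + i : ℝ) / (1 + i))) :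
    LSol U (fun x => ‖x‖ ^ (2 * i : ℝ) * F (U x)) := by
  have hir : (1:ℝ) ≤ i := by exact_mod_cast hi
  have hkk : kk N (2 * i) = (N - 2 + (1 + i : ℝ)) / (1 + i) := by
    rw [kk, div_eq_div_iff (by positivity) (by positivity)]; ring
  have h := lSol_sqProf (N := N) (b := 1 + i) (by linarith) hF hVc hV (by rwa [hkk] at hode) hV0
  have hUe : ∀ x : 𝔼, sqProf V (1 + i) (‖x‖ ^ 2) = U x := fun x => by
    rw [hU, sqProf, ← rpow_natCast, ← Real.rpow_mul (norm_nonneg x)]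
    congr 3; push_cast; ring
  simp only [hUe] at h
  convert h using 2 with x
  rw [← mul_assoc]
  congr 1
  rcases eq_or_ne x 0 with rfl | hx
  · rw [norm_zero, zero_rpow (by positivity)]; simp
  · have hx' := norm_pos_iff.2 hx
    rw [← rpow_natCast, ← Real.rpow_mul (norm_nonneg x), ← rpow_add hx']
    congr 1; push_cast; ring

lemma tendsto_of_profile (hVt : Tendsto V atTop (𝓝 0))
    (hU : ∀ x, U x = V (‖x‖ ^ (1 + i : ℝ) / (1 + i))) : Tendsto U (cocompact 𝔼) (𝓝 0) := by
  have h : Tendsto (fun x : 𝔼 => ‖x‖ ^ (1 + i : ℝ) / (1 + i)) (cocompact 𝔼) atTop :=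
    ((tendsto_rpow_atTop (by positivity : (0:ℝ) < 1 + i)).comp
      tendsto_norm_cocompact_atTop).atTop_div_const (by positivity)
  exact (hVt.comp h).congr fun x => (hU x).symm

lemma nonneg_of_profile (hVc : ContinuousOn V (Ici 0)) (hpos : ∀ t > (0:ℝ), 0 < V t)
    (hU : ∀ x, U x = V (‖x‖ ^ (1 + i : ℝ) / (1 + i))) (x : 𝔼) : 0 ≤ U x := by
  rw [hU]
  have h0 : 0 ≤ ‖x‖ ^ (1 + i : ℝ) / (1 + i) := by positivity
  have hc : closure (Ioi (0:ℝ)) = Ici 0 := closure_Ioi 0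
  have hmem : ‖x‖ ^ (1 + i : ℝ) / (1 + i) ∈ closure (Ioi (0:ℝ)) := hc ▸ h0
  have := (hVc _ h0).mono Ioi_subset_Ici_self
  exact isClosed_Ici.closure_subset
    (this.mem_closure hmem fun t ht => (hpos t ht).le)

lemma abs_rho_mul_le_exp (z : 𝔼 →ᵇ ℝ) (x : 𝔼) : |rho 1 x * z x| ≤ ‖z‖ * exp (-‖x‖) := by
  rw [abs_mul, abs_of_pos (rho_pos 1 x), mul_comm]
  have h1 := rho_le_exp zero_le_one x
  rw [one_mul] at h1
  exact mul_le_mul (by simpa using z.norm_coe_le_norm x) h1 (rho_pos 1 x).le (norm_nonneg z)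

lemma exists_abs_rhs_le {α : ℝ} (hα : 0 < α) (hm : 0 < m) (zf : 𝔼 →ᵇ ℝ) {A : ℝ} (hA : 0 ≤ A) (c : ℝ) :
    ∃ B, A ≤ B ∧ ∀ g : 𝔼 → ℝ, (∀ x, |g x| ≤ A * exp (-‖x‖)) →
      ∀ x, |‖x‖ ^ α * g x - c * (qq m α x * (rho 1 x * zf x))| ≤ B * exp (-(‖x‖ / 2)) := by
  obtain ⟨K, hK, h⟩ := exists_rpow_mul_exp_bound hα
  refine ⟨A + (K * A + |c| * ((m * K + 8) * ‖zf‖)), le_add_of_nonneg_right (by positivity),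
    fun g hg x => ?_⟩
  have h1 := h ‖x‖ (norm_nonneg x)
  have h2 := exp_neg_le_half (norm_nonneg x)
  have h3 := abs_rho_mul_le_exp zf x
  have hr := rpow_nonneg (norm_nonneg x) α
  have hE := (exp_pos (-(‖x‖ / 2))).le
  have e1 : |‖x‖ ^ α * g x| ≤ K * A * exp (-(‖x‖ / 2)) := by
    rw [abs_mul, abs_of_nonneg hr]
    calc _ ≤ ‖x‖ ^ α * (A * exp (-‖x‖)) := mul_le_mul_of_nonneg_left (hg x) hr
      _ = A * (‖x‖ ^ α * exp (-‖x‖)) := by ring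
      _ ≤ A * (K * exp (-(‖x‖ / 2))) := mul_le_mul_of_nonneg_left h1 hA
      _ = _ := by ring
  have e2 : |c * (qq m α x * (rho 1 x * zf x))| ≤
      |c| * ((m * K + 8) * ‖zf‖) * exp (-(‖x‖ / 2)) := by
    have hq : 0 ≤ qq m α x := by have := qq_ge hm α x; linarith
    rw [abs_mul, abs_mul (qq m α x), abs_of_nonneg hq, mul_assoc |c|]
    refine mul_le_mul_of_nonneg_left ?_ (abs_nonneg c)
    calc _ ≤ qq m α x * (‖zf‖ * exp (-‖x‖)) := mul_le_mul_of_nonneg_left h3 hq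
      _ = (m * (‖x‖ ^ α * exp (-‖x‖)) + 8 * exp (-‖x‖)) * ‖zf‖ := by rw [qq]; ring
      _ ≤ (m * (K * exp (-(‖x‖ / 2))) + 8 * exp (-(‖x‖ / 2))) * ‖zf‖ := by gcongr
      _ = _ := by ring
  have := abs_sub (‖x‖ ^ α * g x) (c * (qq m α x * (rho 1 x * zf x)))
  have h0 := mul_nonneg hA hE
  linarith

lemma exists_setup (hN : 3 ≤ N) (hi : 0 < i) (hm : 0 < m) (hF : ContDiff ℝ 1 F) (hF0 : F 0 = 0)
    (hF1 : deriv F 0 = -m)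
    (hVc : ContinuousOn V (Ici 0)) (hV : ContDiffOn ℝ 2 V (Ioi 0)) (hpos : ∀ t > (0:ℝ), 0 < V t)
    (hode : ∀ t > (0:ℝ), -(deriv (deriv V) t) - kk N (2 * i) / t * deriv V t = F (V t))
    (hV0 : Tendsto (deriv V) (𝓝[>] 0) (𝓝 0)) (hVt : Tendsto V atTop (𝓝 0))
    (hnd : RadNondeg (kk N (2 * i)) fun t => deriv F (V t))
    (hmi : MorseIndexOne (kk N (2 * i)) fun t => deriv F (V t)) (e : Fin N)
    (hU : ∀ x, U x = V (‖x‖ ^ (1 + i : ℝ) / (1 + i))) :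
    ∃ (C : ℝ) (zu zf : 𝔼 →ᵇ ℝ) (ell : (𝔼 →ᵇ ℝ) →L[ℝ] ℝ), RadSol F (2 * i) C U ∧
      (∀ x, U x = rho 1 x * zu x) ∧ zu ∈ symm ∅ ∧ zf ∈ symm {single e 1} ∧
      Tendsto zf (cocompact 𝔼) (𝓝 0) ∧ (∀ x, phiH e (i + 1) (2 * i) U x = rho 1 x * zf x) ∧
      (∀ z : 𝔼 →ᵇ ℝ, ell z = ∫ r in Ioi (0:ℝ), r ^ ((N:ℝ) - 1 - 2) *
        (md e (i + 1) (fun x => rho 1 x * z x) r * Phi e (2 * i) U r)) ∧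
      ∀ z ∈ symm {single e 1},
        TT (fun s => F s + m * s) m ell zf zu (2 * i) z = z → z = 0 := by
  have hN2 : 2 ≤ N := by omega
  have hN1 : 1 ≤ N := by omega
  have hNr : (3:ℝ) ≤ N := by exact_mod_cast hN
  have hir : (0:ℝ) < i := by exact_mod_cast hi
  have hα : (0:ℝ) < 2 * i := by positivity
  have hsol := lSol_of_profile hi hF.continuous hVc hV hode hV0 hU
  have hdec : ∀ c : ℝ, 0 ≤ c → ∃ C, 0 ≤ C ∧ ∀ x, |U x| ≤ C * rho c x := fun c hc =>
    hsol.exists_abs_le_rho hN1 hα hm hF hF0 hF1 (nonneg_of_profile hVc hpos hU)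
      (tendsto_of_profile hVt hU) hc
  have hrad : ∀ x y, ‖x‖ = ‖y‖ → U x = U y := fun x y h => by rw [hU, hU, h]
  obtain ⟨C, hC, h1⟩ := hdec 1 zero_le_one
  obtain ⟨C₂, hC2, h2⟩ := hdec 2 zero_le_two
  obtain ⟨C₃, hC3, h3⟩ := hdec 3 zero_le_three
  have H : RadSol F (2 * i) C U := ⟨hsol, hrad, fun x => (h1 x).trans
    (mul_le_mul_of_nonneg_left (by simpa using rho_le_exp zero_le_one x) hC)⟩
  obtain ⟨L, hL0, hL⟩ := exists_deriv_bound hF C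
  obtain ⟨hzu, -⟩ := exists_eq_rho_mul hsol.continuous h2
  set zu := mkB fun y => U y / rho 1 y
  obtain ⟨D, hD, hPhi⟩ := H.exists_abs_Phi_le_exp (e := e) hN2 hF hF0 hα hL fun x => (h3 x).trans
    (mul_le_mul_of_nonneg_left (rho_le_exp zero_le_three x) hC3)
  obtain ⟨C', hC'⟩ := RadSol.exists_phiH_bound hα hD hPhi (i + 1)
  obtain ⟨hzf, hzf0⟩ := exists_eq_rho_mul (H.continuous_phiH hN2 hF hF0 hα hL e (i + 1)) hC'
  set zf := mkB fun y => phiH e (i + 1) (2 * i) U y / rho 1 y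
  obtain ⟨ell, hell⟩ := exists_ell e (i + 1) (H.dec_Phi (e := e) hN2 hF hF0 hα hL)
    (H.continuousOn_Phi hN2) (b := (N:ℝ) - 1 - 2) (by linarith)
  refine ⟨C, zu, zf, ell, H, hzu, mem_symm_of_rho_mul hzu fun x y _ => hrad x y,
    mem_symm_of_rho_mul hzf fun x y h => phiH_eq_of ?_, hzf0, hzf, hell, fun z hz hTT => ?_⟩
  · simpa [inner_single] using h
  have hG : ContDiff ℝ 1 fun s => F s + m * s := hF.add (contDiff_const.mul contDiff_id)
  have hGd : ∀ s, deriv (fun s => F s + m * s) s - m = deriv F s := fun s => by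
    have h4 := ((hF.differentiable (by norm_num)).differentiableAt (x := s)).hasDerivAt.add
      ((hasDerivAt_id s).const_mul m)
    rw [show deriv (fun s => F s + m * s) s = _ from h4.deriv]; ring
  have hw := TT_eq_imp hN1 hG hm hα hTT
  simp only [hGd, ← hzu] at hw
  have hb : ∀ x, |deriv F (U x) * (rho 1 x * z x)| ≤ L * ‖z‖ * exp (-‖x‖) := fun x => by
    rw [abs_mul, mul_assoc]
    refine mul_le_mul (hL _ ((h1 x).trans (mul_le_of_le_one_right hC (rho_le_one zero_le_one x))))
      (abs_rho_mul_le_exp z x) (abs_nonneg _) hL0.le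
  obtain ⟨B, hAB, hB⟩ := exists_abs_rhs_le hα hm zf (A := L * ‖z‖ + ‖z‖) (by positivity) (ell z)
  have hb2 : ∀ x, |deriv F (U x) * (rho 1 x * z x)| ≤ (L * ‖z‖ + ‖z‖) * exp (-‖x‖) :=
    fun x => (hb x).trans (by have := norm_nonneg z; gcongr; linarith)
  have hBz : ∀ x, |rho 1 x * z x| ≤ B * exp (-(‖x‖ / 2)) := fun x => by
    have h5 : ‖z‖ ≤ B := (le_add_of_nonneg_left (by positivity)).trans hAB
    exact (abs_rho_mul_le_exp z x).trans (mul_le_mul h5 (exp_neg_le_half (norm_nonneg x))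
      (exp_pos _).le ((norm_nonneg z).trans h5))
  have hBh := hB _ hb2
  have hassoc : ∀ x : 𝔼, ‖x‖ ^ (2 * i : ℝ) * (deriv F (U x) * (rho 1 x * z x)) =
      ‖x‖ ^ (2 * i : ℝ) * deriv F (U x) * (rho 1 x * z x) := fun x => (mul_assoc _ _ _).symm
  simp only [hassoc, ← hzf] at hBh
  simp only [← hzf] at hw
  have hx₀ : (single e 1 : 𝔼) ≠ 0 := by
    rw [← norm_ne_zero_iff, PiLp.norm_single]; simp
  have hU₀ : U (single e 1 : 𝔼) ≠ 0 := by
    rw [hU, PiLp.norm_single]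
    exact (hpos _ (by simp only [norm_one, one_rpow]; positivity)).ne'
  have hc : ell z = 0 := H.coeff_eq_zero hN hF hF0 hα hx₀ hU₀ hm (by push_cast; ring) hw hBz hBh
  rw [hc] at hw hBh
  simp only [zero_mul, sub_zero] at hw hBh
  have := H.eq_zero_of_linearized (e := e) hN hF hF0 hi rfl hx₀ hU₀ hV.continuousOn (b := 1 + i) rfl
    (fun r hr => by rw [prof, hU, norm_smul_single (le_of_lt hr)]) hnd hmi hw hBz hBh
    (fun x y h h' => by
      rw [hz x y (by simpa [inner_single] using h) h', rho_eq_of_norm_eq h']) (by rw [← hell, hc])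
  ext x
  exact (mul_eq_zero.1 (this x)).resolve_left (rho_pos 1 x).ne'

/-- The solutions of the augmented problem near a nondegenerate one form a continuous family. -/
lemma exists_branch (hN : 1 ≤ N) (hG : ContDiff ℝ 1 G) (h0 : G 0 = 0) (h1 : deriv G 0 = 0)
    (hm : 0 < m) (hα : 0 < α) {S : Set 𝔼} (hzf : Tendsto zf (cocompact 𝔼) (𝓝 0))
    (hzfS : zf ∈ symm S) (hzu : zu ∈ symm ∅) (hfix : PP G m ell zf zu α 0 zu = zu)
    (hell : ∀ z ∈ symm (∅ : Set 𝔼), ell z = 0)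
    (hker : ∀ z ∈ symm S, TT G m ell zf zu α z = z → z = 0) :
    ∃ K > (0:ℝ), ∀ r > (0:ℝ), ∃ a > (0:ℝ), ∃ s₀ > (0:ℝ), ∃ Z : ℝ → ℝ → 𝔼 →ᵇ ℝ,
      Z α 0 = zu ∧ ∀ β s, |β - α| ≤ a → |s| ≤ s₀ → Z β s ∈ symm S ∧ ‖Z β s - zu‖ ≤ r ∧
        PP G m ell zf zu β s (Z β s) = Z β s ∧ Z β 0 ∈ symm ∅ ∧ ‖Z β s - Z β 0‖ ≤ K * |s| ∧
        ContinuousWithinAt (fun γ => Z γ s) (closedBall α a) β := by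
  have hsub : symm (∅ : Set 𝔼) ≤ symm S := symm_mono (empty_subset S)
  have hzuS := hsub hzu
  obtain ⟨⟨C, hC, hb⟩, hS⟩ := exists_bound_of_injOn
    (TT_isCompactOperator (ell := ell) (zf := zf) (zu := zu) hN hG h1 hm hα) (symm S)
    (isClosed_symm S) (fun y hy => TT_mem_symm hN hG hm hα hzfS hzuS hy) hker
  have hT0 : ∀ y ∈ symm (∅ : Set 𝔼), TT G m ell zf zu α y ∈ symm (∅ : Set 𝔼) := fun y hy => by
    have h2 : TT G m ell zf zu α y = KK m α (bet G m α zu * y) - ell y • KK m α zf := rfl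
    rw [h2, hell y hy, zero_smul, sub_zero]
    exact KK_mem_symm hN hm hα (mul_mem_symm (bet_mem_symm hG hm hα hzu) hy)
  obtain ⟨-, hS0⟩ := exists_bound_of_injOn
    (TT_isCompactOperator (ell := ell) (zf := zf) (zu := zu) hN hG h1 hm hα) (symm ∅)
    (isClosed_symm ∅) hT0 fun y hy => hker y (hsub hy)
  obtain ⟨r₀, hr₀, a₁, ha₁, hnear⟩ := PP_near (ell := ell) (zu := zu) hN hG h0 h1 hm hα hzf
    (show 0 < 1 / (2 * C) by positivity)
  refine ⟨2 * C * (2 * ‖zf‖) + 1, by positivity, fun r hr => ?_⟩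
  set r' := min r r₀ with hr'
  have hr'0 : 0 < r' := lt_min hr hr₀
  have hball : closedBall zu r' ⊆ closedBall zu r₀ :=
    closedBall_subset_closedBall (min_le_right _ _)
  obtain ⟨a₂, ha₂, hc⟩ := Metric.continuousAt_iff.1
    (continuousAt_PP (ell := ell) (zu := zu) hN hG h0 h1 hm hα hzf 0 zu) (r' / (4 * C))
    (by positivity)
  set a := min a₁ (min (a₂ / 2) (α / 2)) with ha
  have ha0 : 0 < a := by positivity
  set s₀ := r' / (4 * C) / (2 * ‖zf‖ + 1) with hs₀
  have hs₀0 : 0 < s₀ := by positivity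
  have hpos : ∀ β, |β - α| ≤ a → 0 < β := fun β hβ => by
    have h2 := (hβ.trans (min_le_right _ _)).trans (min_le_right _ _)
    linarith [(abs_le.1 h2).1]
  have hst : ∀ β s, |β - α| ≤ a → |s| ≤ s₀ → ‖PP G m ell zf zu β s zu - zu‖ ≤ r' / (2 * C) := by
    intro β s hβ hs
    have h2 := (hβ.trans (min_le_right _ _)).trans (min_le_left _ _)
    have h3 := hc (x := β) (by rw [Real.dist_eq]; linarith)
    rw [hfix, dist_eq_norm] at h3
    have h4 : ‖PP G m ell zf zu β s zu - PP G m ell zf zu β 0 zu‖ ≤ r' / (4 * C) := by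
      rw [PP_sub_PP, sub_zero, norm_smul, norm_eq_abs]
      calc _ ≤ s₀ * (2 * ‖zf‖ + 1) := mul_le_mul hs
            ((norm_KK_le hN hm (hpos β hβ) zf).trans (by linarith)) (norm_nonneg _) hs₀0.le
        _ = _ := by rw [hs₀]; field_simp
    calc _ ≤ _ := norm_sub_le_norm_sub_add_norm_sub _ (PP G m ell zf zu β 0 zu) _
      _ ≤ r' / (4 * C) + r' / (4 * C) := add_le_add h4 h3.le
      _ = _ := by field_simp; norm_num
  have hnear' : ∀ β, |β - α| ≤ a → ∀ s : ℝ, ∀ z ∈ closedBall zu r',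
      ∀ z' ∈ closedBall zu r',
      ‖PP G m ell zf zu β s z - PP G m ell zf zu β s z' - TT G m ell zf zu α (z - z')‖ ≤
        1 / (2 * C) * ‖z - z'‖ := fun β hβ s z hz z' hz' =>
    hnear β (hβ.trans (min_le_left _ _)) s z (hball hz) z' (hball hz')
  have hex : ∀ β s, |β - α| ≤ a → |s| ≤ s₀ → ∃ z ∈ symm S, z ∈ closedBall zu r' ∧
      PP G m ell zf zu β s z = z := fun β s hβ hs =>
    exists_fixed_of_near (isClosed_symm S) hC hb hS
      (fun y hy => PP_mem_symm hN hG h0 hm (hpos β hβ) s hzfS hy) hzuS hr'0 (hnear' β hβ s)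
      (hst β s hβ hs)
  have hex0 : ∀ β, |β - α| ≤ a → ∃ z ∈ symm (∅ : Set 𝔼), z ∈ closedBall zu r' ∧
      PP G m ell zf zu β 0 z = z := fun β hβ =>
    exists_fixed_of_near (isClosed_symm ∅) hC (fun y hy => hb y (hsub hy)) hS0
      (fun y hy => by
        have h2 : PP G m ell zf zu β 0 y = KK m β (hh G m β y + (0 - ell (y - zu)) • zf) := rfl
        rw [h2, hell _ (Submodule.sub_mem _ hy hzu), sub_zero, zero_smul, add_zero]
        exact KK_mem_symm hN hm (hpos β hβ) (hh_mem_symm hG h0 hm (hpos β hβ) hy)) hzu hr'0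
      (hnear' β hβ 0) (hst β 0 hβ (by simpa using hs₀0.le))
  choose! Z hZS hZb hZ using hex
  have huniq : ∀ β, |β - α| ≤ a → ∀ s, |s| ≤ s₀ → ∀ z ∈ symm S, z ∈ closedBall zu r' →
      ‖Z β s - z‖ ≤ 2 * C * ‖z - PP G m ell zf zu β s z‖ := fun β hβ s hs z hz hzb => by
    have := norm_sub_le_of_near hC (hb _ (Submodule.sub_mem _ (hZS β s hβ hs) hz))
      (hnear' β hβ s _ (hZb β s hβ hs) z hzb)
    rwa [hZ β s hβ hs, sub_self, zero_sub, norm_neg] at this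
  have hu := huniq α (by simpa using ha0.le) 0 (by simpa using hs₀0.le) zu hzuS
    (mem_closedBall_self hr'0.le)
  rw [hfix, sub_self, norm_zero, mul_zero] at hu
  refine ⟨a, ha0, s₀, hs₀0, Z, sub_eq_zero.1 (norm_le_zero_iff.1 hu), fun β s hβ hs => ⟨hZS β s hβ hs, ?_, hZ β s hβ hs, ?_, ?_, ?_⟩⟩
  · have := hZb β s hβ hs
    rw [mem_closedBall_iff_norm] at this
    exact this.trans (min_le_left _ _)
  · obtain ⟨z, hz, hzb, hzf⟩ := hex0 β hβ
    have := huniq β hβ 0 (by simpa using hs₀0.le) z (hsub hz) hzb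
    rw [hzf, sub_self, norm_zero, mul_zero] at this
    rwa [sub_eq_zero.1 (norm_le_zero_iff.1 this)]
  · have hs0 : |(0:ℝ)| ≤ s₀ := by simpa using hs₀0.le
    have h2 := huniq β hβ s hs _ (hZS β 0 hβ hs0) (hZb β 0 hβ hs0)
    nth_rewrite 2 [← hZ β 0 hβ hs0] at h2
    rw [PP_sub_PP, zero_sub, norm_smul, norm_neg, norm_eq_abs] at h2
    have h3 := norm_KK_le hN hm (hpos β hβ) zf
    calc _ ≤ _ := h2
      _ ≤ 2 * C * (|s| * (2 * ‖zf‖)) := by gcongr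
      _ ≤ _ := by nlinarith [abs_nonneg s]
  · have h2 : Tendsto (fun γ => 2 * C * ‖Z β s - PP G m ell zf zu γ s (Z β s)‖)
        (𝓝[closedBall α a] β) (𝓝 0) := by
      have h3 := (continuousAt_PP (ell := ell) (zu := zu) hN hG h0 h1 hm (hpos β hβ) hzf s
        (Z β s)).tendsto.mono_left (nhdsWithin_le_nhds (s := closedBall α a))
      rw [hZ β s hβ hs] at h3
      have h4 := ((tendsto_const_nhds (x := Z β s)).sub h3).norm.const_mul (2 * C)
      rwa [sub_self, norm_zero, mul_zero] at h4
    refine tendsto_iff_norm_sub_tendsto_zero.2 (squeeze_zero' (Eventually.of_forall fun _ =>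
      norm_nonneg _) ?_ h2)
    filter_upwards [self_mem_nhdsWithin] with γ hγ
    rw [mem_closedBall, Real.dist_eq] at hγ
    exact huniq γ hγ s hs _ (hZS β s hβ hs) (hZb β s hβ hs)

/-- The Wronskian identity for a forced linearized equation with a small remainder. -/
lemma RadSol.exists_forced_wronskian (H : RadSol F β C U) (H₀ : RadSol F α C₀ U₀) (hN : 3 ≤ N)
    (hF : ContDiff ℝ 1 F) (hF0 : F 0 = 0) (hα : 0 < α) (hβ : 0 < β) (e : Fin N) (m : ℝ) (j : ℕ) :
    ∃ M ≥ 0, ∀ (w R : 𝔼 → ℝ) (c τ B : ℝ), Continuous R → 0 ≤ τ →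
      (∀ x, |R x| ≤ τ * exp (-(‖x‖ / 2))) →
      LSol w (fun x => ‖x‖ ^ β * (deriv F (U x) * w x + R x) + c * (qq m β x * phiH e j α U₀ x)) →
      (∀ x, |w x| ≤ B * exp (-(‖x‖ / 2))) →
      (∀ x, |‖x‖ ^ β * (deriv F (U x) * w x + R x) + c * (qq m β x * phiH e j α U₀ x)| ≤
        B * exp (-(‖x‖ / 2))) →
      |c * (sqH e j * ∫ r in Ioi (0:ℝ), r ^ ((N:ℝ) - 1) *
          (Phi e α U₀ r * ((m * r ^ β + 8) * Phi e β U r))) -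
        (j * (j + N - 2) - (N - 1 + β / 2) * (1 + β / 2)) *
          ∫ r in Ioi (0:ℝ), r ^ ((N:ℝ) - 1 - 2) * (md e j w r * Phi e β U r)| ≤ M * τ := by
  have hN2 : 2 ≤ N := by omega
  have hNr : (3:ℝ) ≤ N := by exact_mod_cast hN
  obtain ⟨L, hL0, hL⟩ := exists_deriv_bound hF C
  obtain ⟨L₀, -, hL₀⟩ := exists_deriv_bound hF C₀
  obtain ⟨A, hA, hmd⟩ := exists_md_bound (N := N) e j
  have dΦ := H.dec_Phi (e := e) hN2 hF hF0 hβ hL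
  have cΦ := H.continuousOn_Phi (e := e) hN2
  have dq := H.dec_qq_Phi (e := e) hN2 hF hF0 hβ hL m
  have cq := H.continuousOn_qq_Phi (e := e) hN2 hβ m
  have dΦ₀ := H₀.dec_Phi (e := e) hN2 hF hF0 hα hL₀
  have cΦ₀ := H₀.continuousOn_Phi (e := e) hN2
  have dr : Dec fun r => r ^ β * Phi e β U r := dΦ.rpow_mul hβ.le
  have cr : ContinuousOn (fun r => r ^ β * Phi e β U r) (Ioi 0) :=
    (continuous_rpow_const hβ.le).continuousOn.mul cΦ
  have da : Dec fun r => |r ^ β * Phi e β U r| := dr.of_le (M := 1) fun t _ => by simp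
  have ia := da.integrableOn cr.abs (b := (N:ℝ) - 1) (by linarith)
  refine ⟨A * ∫ r in Ioi (0:ℝ), r ^ ((N:ℝ) - 1) * |r ^ β * Phi e β U r|, ?_, ?_⟩
  · exact mul_nonneg hA.le (setIntegral_nonneg measurableSet_Ioi fun r hr =>
      mul_nonneg (rpow_nonneg (le_of_lt hr) _) (abs_nonneg _))
  intro w R c τ B hR hτ hRb Hw hw hh
  have h1 := H.wronskian (e := e) hN hF hF0 hβ Hw hw hh j
  have c1 : Continuous fun x : 𝔼 => ‖x‖ ^ β * deriv F (U x) := (continuous_norm_rpow hβ.le).mul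
    ((hF.continuous_deriv le_rfl).comp H.continuous)
  have c2 : Continuous fun x : 𝔼 => c * qq m β x := continuous_const.mul (continuous_qq m hβ.le)
  have hm : ∀ r > (0:ℝ), md e j (fun x => ‖x‖ ^ β * (deriv F (U x) * w x + R x) +
      c * (qq m β x * phiH e j α U₀ x)) r = r ^ β * deriv F (prof e U r) * md e j w r +
      r ^ β * md e j R r + c * (sqH e j * ((m * r ^ β + 8) * Phi e α U₀ r)) := fun r hr => by
    have e0 : (fun x => ‖x‖ ^ β * (deriv F (U x) * w x + R x) + c * (qq m β x * phiH e j α U₀ x)) =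
        fun x => (‖x‖ ^ β * deriv F (U x) * w x + ‖x‖ ^ β * R x) +
          c * qq m β x * phiH e j α U₀ x := by funext x; ring
    have k1 := (c1.mul Hw.continuous)
    have k2 := (continuous_norm_rpow (N := N) hβ.le).mul hR
    rw [e0, md_add e j (v := fun x => ‖x‖ ^ β * deriv F (U x) * w x + ‖x‖ ^ β * R x)
      (w := fun x => c * qq m β x * phiH e j α U₀ x) (k1.add k2)
      (c2.mul (H₀.continuous_phiH hN2 hF hF0 hα hL₀ e j)) r,
      md_add e j (v := fun x => ‖x‖ ^ β * deriv F (U x) * w x) (w := fun x => ‖x‖ ^ β * R x) k1 k2 r,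
      md_radial_mul (c := r ^ β * deriv F (prof e U r)) e j hr.le
      (fun x hx => by rw [H.prof_eq (e := e) hr.le hx, hx]),
      md_radial_mul (c := r ^ β) e j hr.le (fun x hx => by rw [hx]),
      md_radial_mul (c := c * (m * r ^ β + 8)) e j hr.le (fun x hx => by rw [qq, hx]),
      md_phiH e j α U₀ hr]
    ring
  have i1 := (((dΦ₀.mul dq).integrableOn (cΦ₀.mul cq) (b := (N:ℝ) - 1)
    (by linarith))).const_mul (c * sqH e j)
  have dR := dec_md e j hRb
  have i2 := (dR.mul dr).integrableOn ((continuous_md e j hR).continuousOn.mul cr)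
    (b := (N:ℝ) - 1) (by linarith)
  have h2 : ∫ r in Ioi (0:ℝ), r ^ ((N:ℝ) - 1) * ((md e j (fun x => ‖x‖ ^ β *
      (deriv F (U x) * w x + R x) + c * (qq m β x * phiH e j α U₀ x)) r -
      r ^ β * deriv F (prof e U r) * md e j w r) * Phi e β U r) =
      c * (sqH e j * ∫ r in Ioi (0:ℝ), r ^ ((N:ℝ) - 1) *
          (Phi e α U₀ r * ((m * r ^ β + 8) * Phi e β U r))) +
      ∫ r in Ioi (0:ℝ), r ^ ((N:ℝ) - 1) * (md e j R r * (r ^ β * Phi e β U r)) := by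
    rw [← mul_assoc, ← integral_const_mul, ← integral_add i1 i2]
    refine setIntegral_congr_fun measurableSet_Ioi fun r hr => ?_
    simp only [hm r hr]
    ring
  have h3 : |∫ r in Ioi (0:ℝ), r ^ ((N:ℝ) - 1) * (md e j R r * (r ^ β * Phi e β U r))| ≤
      (A * ∫ r in Ioi (0:ℝ), r ^ ((N:ℝ) - 1) * |r ^ β * Phi e β U r|) * τ := by
    have h4 : (A * ∫ r in Ioi (0:ℝ), r ^ ((N:ℝ) - 1) * |r ^ β * Phi e β U r|) * τ =
        ∫ r in Ioi (0:ℝ), A * τ * (r ^ ((N:ℝ) - 1) * |r ^ β * Phi e β U r|) := by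
      rw [integral_const_mul]; ring
    rw [h4]
    refine (norm_integral_le_integral_norm _).trans (setIntegral_mono_on i2.norm
      (ia.const_mul _) measurableSet_Ioi fun r hr => ?_)
    have hr0 : 0 < r := hr
    have h5 : |md e j R r| ≤ A * τ := hmd R r τ fun x _ => (hRb x).trans
      (mul_le_of_le_one_right hτ (by rw [exp_le_one_iff]; have := norm_nonneg x; linarith))
    have h6 := rpow_nonneg hr0.le ((N:ℝ) - 1)
    rw [norm_eq_abs, abs_mul, abs_of_nonneg h6, abs_mul]
    calc _ ≤ r ^ ((N:ℝ) - 1) * (A * τ * |r ^ β * Phi e β U r|) := by gcongr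
      _ = _ := by ring
  rw [h2] at h1
  rw [← h1, ← abs_neg]
  convert h3 using 2
  ring

lemma tendsto_coupling {U : ℝ → 𝔼 → ℝ} (hN : 3 ≤ N) (hF : ContDiff ℝ 1 F) (hF0 : F 0 = 0)
    (hα : 0 < α) (hm : 0 < m) (H : ∀ᶠ β in 𝓝 α, RadSol F β C (U β))
    (hlim : ∀ x, Tendsto (fun β => U β x) (𝓝 α) (𝓝 (U α x))) (e : Fin N) :
    Tendsto (fun β => ∫ r in Ioi (0:ℝ), r ^ ((N:ℝ) - 1) *
      (Phi e α (U α) r * ((m * r ^ β + 8) * Phi e β (U β) r))) (𝓝 α)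
      (𝓝 (∫ r in Ioi (0:ℝ), r ^ ((N:ℝ) - 1) *
        (Phi e α (U α) r * ((m * r ^ α + 8) * Phi e α (U α) r)))) ∧
    Tendsto (fun β => ∫ r in Ioi (0:ℝ), r ^ ((N:ℝ) - 1 - 2) *
      (exp (-(r / 2)) * |Phi e β (U β) r - Phi e α (U α) r|)) (𝓝 α) (𝓝 0) := by
  have hN2 : 2 ≤ N := by omega
  have hNr : (3:ℝ) ≤ N := by exact_mod_cast hN
  obtain ⟨L, hL0, hL⟩ := exists_deriv_bound hF C
  have Hα := H.self_of_nhds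
  have hC := Hα.C_nonneg
  have hev : ∀ᶠ β in 𝓝 α, 0 < β ∧ β < 2 * α :=
    (eventually_gt_nhds hα).and (eventually_lt_nhds (by linarith))
  have hΦ : ∀ r > (0:ℝ), Tendsto (fun β => Phi e β (U β) r) (𝓝 α) (𝓝 (Phi e α (U α) r)) :=
    fun r hr => tendsto_Phi hN2 hF hF0 hα hL H hlim hr
  have hb : ∀ β, 0 < β → β < 2 * α → RadSol F β C (U β) → ∀ r > (0:ℝ),
      |Phi e β (U β) r| ≤ L * C * (1 + r ^ (3 * α + 1)) := fun β h1 h2 h3 r hr =>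
    (h3.abs_Phi_le hN2 hF hF0 h1 hL hr).trans (mul_le_mul_of_nonneg_left
      (rpow_le_one_add_of_le hr (by positivity) (by linarith)) (by positivity))
  constructor
  · refine tendsto_integral_dec (k := 3 * α + 1) (B := (m + 8) * (L * C))
      (p := fun β r => (m * r ^ β + 8) * Phi e β (U β) r) (by linarith) (by positivity)
      (Hα.dec_Phi hN2 hF hF0 hα hL) (Hα.continuousOn_Phi hN2) ?_ fun r hr => ?_
    · filter_upwards [H, hev] with β h1 h2
      refine ⟨h1.continuousOn_qq_Phi hN2 h2.1 m, fun r hr => ?_⟩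
      have hr' := rpow_nonneg (le_of_lt hr) β
      rw [abs_mul, abs_of_nonneg (by positivity : 0 ≤ m * r ^ β + 8)]
      have e1 := h1.abs_Phi_le (e := e) hN2 hF hF0 h2.1 hL hr
      have e2 : r ^ β * r ^ (1 + β / 2) ≤ 1 + r ^ (3 * α + 1) := by
        rw [← rpow_add hr]
        exact rpow_le_one_add_of_le hr (by linarith [h2.1]) (by linarith [h2.2])
      have e3 : r ^ (1 + β / 2) ≤ 1 + r ^ (3 * α + 1) :=
        rpow_le_one_add_of_le hr (by linarith [h2.1]) (by linarith [h2.2])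
      calc _ ≤ (m * r ^ β + 8) * (L * C * r ^ (1 + β / 2)) := by gcongr
        _ = L * C * (m * (r ^ β * r ^ (1 + β / 2)) + 8 * r ^ (1 + β / 2)) := by ring
        _ ≤ L * C * (m * (1 + r ^ (3 * α + 1)) + 8 * (1 + r ^ (3 * α + 1))) := by gcongr
        _ = _ := by ring
    · refine Tendsto.mul (Tendsto.add_const _ (Tendsto.const_mul _ ?_)) (hΦ r hr)
      exact (continuousAt_const_rpow (ne_of_gt hr)).tendsto
  · have := tendsto_integral_dec (k := 3 * α + 1) (B := 2 * (L * C)) (b := (N:ℝ) - 1 - 2) (α := α)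
      (p := fun β r => |Phi e β (U β) r - Phi e α (U α) r|) (by linarith) (by positivity)
      dec_exp (by fun_prop) (by
        filter_upwards [H, hev] with β h1 h2
        refine ⟨((h1.continuousOn_Phi hN2).sub (Hα.continuousOn_Phi hN2)).abs, fun r hr => ?_⟩
        rw [abs_abs]
        have e1 := hb β h2.1 h2.2 h1 r hr
        have e2 := hb α hα (by linarith) Hα r hr
        exact (abs_sub _ _).trans (by linarith)) fun r hr =>
        ((hΦ r hr).sub_const _).abs
    simpa using this

lemma exists_remainder_bound (hF : ContDiff ℝ 1 F) (C : ℝ) {τ : ℝ} (hτ : 0 < τ) :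
    ∃ δ > (0:ℝ), ∀ s t, |t| ≤ C → |s - t| ≤ δ →
      |F s - F t - deriv F t * (s - t)| ≤ τ * |s - t| := by
  have hu := (isCompact_Icc (a := -(C + 1)) (b := C + 1)).uniformContinuousOn_of_continuous
    (hF.continuous_deriv le_rfl).continuousOn
  obtain ⟨δ, hδ, h⟩ := Metric.uniformContinuousOn_iff.1 hu τ hτ
  refine ⟨min (δ / 2) 1, by positivity, fun s t ht hst => abs_sub_sub_le hF fun σ hσ => ?_⟩
  have h1 : |σ - t| ≤ |s - t| := abs_sub_left_of_mem_uIcc (uIcc_comm s t ▸ hσ)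
  have h2 := h1.trans hst
  have h3 := abs_le.1 (h2.trans (min_le_right _ _))
  have h4 := abs_le.1 ht
  have := h σ ⟨by linarith, by linarith⟩ t ⟨by linarith, by linarith⟩ (by
    rw [Real.dist_eq]; linarith [h2.trans (min_le_left _ _)])
  exact (Real.dist_eq _ _ ▸ this).le

/-- The sign of the forcing coefficient of a perturbed solution. -/
lemma RadSol.exists_forcing_sign (H : RadSol F β C U) (H₀ : RadSol F α C₀ U₀) (hN : 3 ≤ N)
    (hF : ContDiff ℝ 1 F) (hF0 : F 0 = 0) (hα : 0 < α) (hβ : 0 < β) (hm : 0 < m) {j : ℕ}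
    {zf z₀ : 𝔼 →ᵇ ℝ} {ell : (𝔼 →ᵇ ℝ) →L[ℝ] ℝ} {A K κ : ℝ}
    (hA : 0 < A) (hK : 0 < K) (hU : ∀ x, U x = rho 1 x * z₀ x)
    (hzf : ∀ x, phiH e j α U₀ x = rho 1 x * zf x)
    (hell : ∀ z : 𝔼 →ᵇ ℝ, ell z = ∫ r in Ioi (0:ℝ), r ^ ((N:ℝ) - 1 - 2) *
        (md e j (fun x => rho 1 x * z x) r * Phi e α U₀ r))
    (hmd : ∀ z : 𝔼 →ᵇ ℝ, ∀ r > 0, |md e j (fun x => rho 1 x * z x) r| ≤ A * ‖z‖ * exp (-r))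
    (hκ : κ = j * (j + N - 2) - (N - 1 + β / 2) * (1 + β / 2)) (hκ0 : κ ≠ 0)
    (hD : 0 < sqH e j * (∫ r in Ioi (0:ℝ), r ^ ((N:ℝ) - 1) *
      (Phi e α U₀ r * ((m * r ^ β + 8) * Phi e β U r))) + κ)
    (hη : A * K * (∫ r in Ioi (0:ℝ), r ^ ((N:ℝ) - 1 - 2) *
      (exp (-(r / 2)) * |Phi e β U r - Phi e α U₀ r|)) ≤ 1 / 4) :
    ∃ s₁ > (0:ℝ), ∀ s, 0 < s → s ≤ s₁ → ∀ (z : 𝔼 →ᵇ ℝ) (c : ℝ), ‖z - z₀‖ ≤ K * s →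
      ell (z - z₀) = s - c → LSol (fun x => rho 1 x * z x) (fun x =>
        ‖x‖ ^ β * F (rho 1 x * z x) + c * (qq m β x * (rho 1 x * zf x))) → 0 < κ * c := by
  have hN2 : 2 ≤ N := by omega
  have hNr : (3:ℝ) ≤ N := by exact_mod_cast hN
  obtain ⟨L, hL0, hL⟩ := exists_deriv_bound hF C
  obtain ⟨L₀, -, hL₀⟩ := exists_deriv_bound hF C₀
  have dΦ := H.dec_Phi (e := e) hN2 hF hF0 hβ hL
  have cΦ := H.continuousOn_Phi (e := e) hN2
  have dΦ₀ := H₀.dec_Phi (e := e) hN2 hF hF0 hα hL₀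
  have cΦ₀ := H₀.continuousOn_Phi (e := e) hN2
  obtain ⟨M, hM, hW⟩ := H.exists_forced_wronskian H₀ hN hF hF0 hα hβ e m j
  set τ := |κ| / (4 * (M + 1) * K) with hτ
  have hκa : 0 < |κ| := abs_pos.2 hκ0
  have hτ0 : 0 < τ := by positivity
  obtain ⟨δ, hδ, hrem⟩ := exists_remainder_bound hF C hτ0
  refine ⟨δ / K, by positivity, fun s hs0 hs z c hz hc Hz => ?_⟩
  set w : 𝔼 → ℝ := fun x => rho 1 x * (z - z₀) x with hw
  have hwe : ∀ x, rho 1 x * z x - U x = w x := fun x => by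
    rw [hU, hw]; simp only [BoundedContinuousFunction.sub_apply]; ring
  set R : 𝔼 → ℝ := fun x => F (rho 1 x * z x) - F (U x) - deriv F (U x) * w x with hR
  have hwb : ∀ x, |w x| ≤ K * s * exp (-‖x‖) := fun x =>
    (abs_rho_mul_le_exp _ x).trans (by gcongr)
  have hUC : ∀ x, |U x| ≤ C := fun x => (H.le x).trans
    (mul_le_of_le_one_right H.C_nonneg (by rw [exp_le_one_iff]; linarith [norm_nonneg x]))
  have hRb : ∀ x, |R x| ≤ τ * |w x| := fun x => by
    have hd : |w x| ≤ δ := by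
      refine (abs_rho_mul_le _ x).trans (hz.trans ?_)
      rw [le_div_iff₀ hK] at hs; linarith
    have := hrem (rho 1 x * z x) (U x) (hUC x) (by rwa [hwe])
    rwa [hwe] at this
  have hRb2 : ∀ x, |R x| ≤ τ * (K * s) * exp (-‖x‖) := fun x => (hRb x).trans (by
    rw [mul_assoc τ]; exact mul_le_mul_of_nonneg_left (hwb x) hτ0.le)
  have hcw : Continuous w := continuous_rho_mul _
  have hFd := hF.continuous_deriv le_rfl
  have hcR : Continuous R := ((hF.continuous.comp (continuous_rho_mul z)).sub
    (hF.continuous.comp H.continuous)).sub ((hFd.comp H.continuous).mul hcw)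
  have Hw : LSol w (fun x => ‖x‖ ^ β * (deriv F (U x) * w x + R x) +
      c * (qq m β x * phiH e j α U₀ x)) := by
    convert Hz.sub H.sol using 1
    · funext x; exact (hwe x).symm
    · funext x; rw [hzf, hR]; ring
  have hg : ∀ x, |deriv F (U x) * w x + R x| ≤ (L + τ) * (K * s) * exp (-‖x‖) := fun x => by
    have h1 : |deriv F (U x) * w x| ≤ L * (K * s * exp (-‖x‖)) := by
      rw [abs_mul]; exact mul_le_mul (hL _ (hUC x)) (hwb x) (abs_nonneg _) hL0.le
    have := abs_add_le (deriv F (U x) * w x) (R x)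
    linarith [hRb2 x]
  obtain ⟨B, hAB, hB⟩ := exists_abs_rhs_le hβ hm zf (A := (L + τ + 1) * (K * s))
    (by positivity) (-c)
  have hB1 := hB _ fun x => (hg x).trans
    (mul_le_mul_of_nonneg_right (mul_le_mul_of_nonneg_right (by linarith) (by positivity))
      (exp_pos _).le)
  have hKB : K * s ≤ B := le_trans (by
    have : 0 < K * s := by positivity
    nlinarith) hAB
  have key := hW w R c (τ * (K * s)) B hcR (by positivity)
    (fun x => (hRb2 x).trans (by gcongr; linarith [norm_nonneg x])) Hw
    (fun x => (hwb x).trans (mul_le_mul hKB (exp_neg_le_half (norm_nonneg x))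
      (exp_pos _).le ((by positivity : 0 ≤ K * s).trans hKB)))
    fun x => by have := hB1 x; rwa [neg_mul, sub_neg_eq_add, ← hzf] at this
  rw [← hκ] at key
  have hb : (-1:ℝ) < (N:ℝ) - 1 - 2 := by linarith
  have dw : Dec (md e j w) := dec_md e j fun x => (hwb x).trans
    (mul_le_mul_of_nonneg_left (exp_neg_le_half (norm_nonneg x)) (by positivity))
  have cw := (continuous_md e j hcw).continuousOn (s := Ioi (0:ℝ))
  have i1 := (dw.mul dΦ).integrableOn (cw.mul cΦ) hb
  have i0 := (dw.mul dΦ₀).integrableOn (cw.mul cΦ₀) hb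
  set X := ∫ r in Ioi (0:ℝ), r ^ ((N:ℝ) - 1 - 2) * (md e j w r * Phi e β U r) with hX
  set η := ∫ r in Ioi (0:ℝ), r ^ ((N:ℝ) - 1 - 2) *
      (exp (-(r / 2)) * |Phi e β U r - Phi e α U₀ r|) with hηd
  have dd : Dec fun r => Phi e β U r - Phi e α U₀ r :=
    (dΦ.add (dΦ₀.const_mul (-1))).congr fun t _ => by ring
  have i2 := (dec_exp.mul (dd.of_le (M := 1) (z := fun r => |Phi e β U r - Phi e α U₀ r|)
    fun t _ => by simp)).integrableOn ((by fun_prop : Continuous fun r : ℝ =>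
      exp (-(r / 2))).continuousOn.mul (cΦ.sub cΦ₀).abs) hb
  have hXe : |X - (s - c)| ≤ s / 4 := by
    rw [← hc, hell, hX, ← integral_sub i1 i0]
    have h1 : s / 4 ≥ ∫ r in Ioi (0:ℝ), A * (K * s) * (r ^ ((N:ℝ) - 1 - 2) *
        (exp (-(r / 2)) * |Phi e β U r - Phi e α U₀ r|)) := by
      rw [integral_const_mul, ← hηd]; nlinarith
    refine le_trans ((norm_integral_le_integral_norm _).trans (setIntegral_mono_on
      (i1.sub i0).norm (i2.const_mul _) measurableSet_Ioi fun r hr => ?_)) h1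
    have hr0 : 0 < r := hr
    rw [Pi.sub_apply, ← mul_sub, ← mul_sub, norm_eq_abs, abs_mul, abs_mul,
      abs_of_nonneg (rpow_nonneg hr0.le _)]
    have h2 := hmd (z - z₀) r hr
    have h3 : |md e j w r| ≤ A * (K * s) * exp (-(r / 2)) := h2.trans
      (mul_le_mul (mul_le_mul_of_nonneg_left hz hA.le) (exp_neg_le_half hr0.le)
        (exp_pos _).le (by positivity))
    calc _ ≤ r ^ ((N:ℝ) - 1 - 2) * (A * (K * s) * exp (-(r / 2)) *
          |Phi e β U r - Phi e α U₀ r|) := mul_le_mul_of_nonneg_left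
            (mul_le_mul_of_nonneg_right h3 (abs_nonneg _)) (rpow_nonneg hr0.le _)
      _ = _ := by ring
  have hMτ : M * (τ * (K * s)) ≤ |κ| * s / 4 := by
    have h1 : (M + 1) * (τ * (K * s)) = |κ| * s / 4 := by rw [hτ]; field_simp
    have h2 : 0 ≤ τ * (K * s) := by positivity
    linarith
  set D := ∫ r in Ioi (0:ℝ), r ^ ((N:ℝ) - 1) *
      (Phi e α U₀ r * ((m * r ^ β + 8) * Phi e β U r))
  have h1 : |c * (sqH e j * D) - κ * (s - c)| ≤ |κ| * s / 2 := by
    have h2 : |κ * (X - (s - c))| ≤ |κ| * (s / 4) := by rw [abs_mul]; gcongr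
    have h3 := abs_add_le (c * (sqH e j * D) - κ * X) (κ * (X - (s - c)))
    have h4 : c * (sqH e j * D) - κ * (s - c) =
      c * (sqH e j * D) - κ * X + κ * (X - (s - c)) := by ring
    rw [h4]; linarith
  have h2 : |κ * (c * (sqH e j * D) - κ * (s - c))| ≤ |κ| * (|κ| * s / 2) := by
    rw [abs_mul]; gcongr
  have h3 := (abs_le.1 h2).1
  have h4 : |κ| * |κ| = κ * κ := abs_mul_abs_self κ
  have h5 : 0 < κ * κ := h4 ▸ mul_pos hκa hκa
  have h6 : 0 < κ * c * (sqH e j * D + κ) := by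
    have h7 : |κ| * (|κ| * s / 2) = κ * κ * s / 2 := by rw [← h4]; ring
    have h8 : 0 < κ * κ * s := mul_pos h5 hs0
    rw [h7] at h3
    nlinarith
  exact (pos_iff_pos_of_mul_pos h6).2 hD

/-- Nonradial solutions bifurcate from the radial one. -/
lemma exists_bifurcation (hN : 3 ≤ N) (hi : 0 < i) (hm : 0 < m) (hF : ContDiff ℝ 1 F)
    (hF0 : F 0 = 0) (hF1 : deriv F 0 = -m) {zu zf : 𝔼 →ᵇ ℝ} {ell : (𝔼 →ᵇ ℝ) →L[ℝ] ℝ}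
    (H : RadSol F (2 * i) C U) (hU : ∀ x, U x = rho 1 x * zu x) (hzu : zu ∈ symm (∅ : Set 𝔼))
    (hzfS : zf ∈ symm ({single e 1} : Set 𝔼))
    (hzf0 : Tendsto zf (cocompact 𝔼) (𝓝 0))
    (hzf : ∀ x, phiH e (i + 1) (2 * i) U x = rho 1 x * zf x)
    (hell : ∀ z : 𝔼 →ᵇ ℝ, ell z = ∫ r in Ioi (0:ℝ), r ^ ((N:ℝ) - 1 - 2) *
        (md e (i + 1) (fun x => rho 1 x * z x) r * Phi e (2 * i) U r))
    (hker : ∀ z ∈ symm ({single e 1} : Set 𝔼),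
      TT (fun s => F s + m * s) m ell zf zu (2 * i) z = z → z = 0)
    {x₀ : 𝔼} (hx₀ : x₀ ≠ 0) (hUx₀ : U x₀ ≠ 0) {r : ℝ} (hr : 0 < r) {a : ℝ} (ha : 0 < a) :
    ∃ β : ℝ, |β - 2 * i| < a ∧ 0 < β ∧ ∃ z ∈ symm ({single e 1} : Set 𝔼),
      ‖z - zu‖ ≤ r ∧ z ∉ symm (∅ : Set 𝔼) ∧
      LSol (fun x => rho 1 x * z x) (fun x => ‖x‖ ^ β * F (rho 1 x * z x)) := by
  have hN1 : 1 ≤ N := by omega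
  have hN2 : 2 ≤ N := by omega
  have hir : (0:ℝ) < i := by exact_mod_cast hi
  have hNr : (3:ℝ) ≤ N := by exact_mod_cast hN
  set α : ℝ := 2 * i with hαdef
  have hα : 0 < α := by positivity
  set G : ℝ → ℝ := fun s => F s + m * s with hGdef
  have hG : ContDiff ℝ 1 G := by fun_prop
  have h0 : G 0 = 0 := by simp [hGdef, hF0]
  have h1 : deriv G 0 = 0 := by
    have : HasDerivAt G (deriv F 0 + m) 0 :=
      ((hF.differentiable one_ne_zero 0).hasDerivAt).add
        (by simpa using (hasDerivAt_id (0:ℝ)).const_mul m)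
    rw [this.deriv, hF1]; ring
  have hrad : ∀ z ∈ symm (∅ : Set 𝔼), ell z = 0 := fun z hz => by
    rw [hell]; exact ell_eq_zero_of_radial hN2 (by omega) hz
  have hPP : ∀ {β : ℝ}, 0 < β → ∀ s z, PP G m ell zf zu β s z = z →
      LSol (fun x => rho 1 x * z x) (fun x => ‖x‖ ^ β * F (rho 1 x * z x) +
        (s - ell (z - zu)) * (qq m β x * (rho 1 x * zf x))) := fun hβ s z hz => by
    have := (KK_hh_eq_iff hN1 hG h0 hm hβ (s - ell (z - zu)) z).1 hz
    simpa only [hGdef, add_sub_cancel_right] using this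
  have hfix : PP G m ell zf zu α 0 zu = zu := by
    refine (KK_hh_eq_iff hN1 hG h0 hm hα (0 - ell (zu - zu)) zu).2 ?_
    have hs := H.sol
    rw [show U = fun x => rho 1 x * zu x from funext hU] at hs
    simpa only [hGdef, add_sub_cancel_right, sub_self, map_zero, zero_mul, add_zero] using hs
  obtain ⟨K, hK, hbr⟩ := exists_branch hN1 hG h0 h1 hm hα hzf0 hzfS hzu hfix hrad hker
  obtain ⟨a₁, ha₁, s₀, hs₀, Z, hZ0, hZ⟩ := hbr r hr
  set W : ℝ → 𝔼 → ℝ := fun β x => rho 1 x * Z β 0 x with hW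
  have hWα : W α = U := by funext x; rw [hW, hU]; simp only [hZ0]
  have hell0 : ∀ β, |β - α| ≤ a₁ → ell (Z β 0 - zu) = 0 := fun β hβ =>
    hrad _ (Submodule.sub_mem _ (hZ β 0 hβ (by simpa using hs₀.le)).2.2.2.1 hzu)
  have hWsol : ∀ β, 0 < β → |β - α| ≤ a₁ → RadSol F β (‖zu‖ + r) (W β) := fun β hβ0 hβ => by
    obtain ⟨-, h2, h3, h4, -⟩ := hZ β 0 hβ (by simpa using hs₀.le)
    refine ⟨?_, fun x y hxy => ?_, fun x => ?_⟩
    · have := hPP hβ0 0 _ h3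
      rw [hell0 β hβ] at this
      simpa only [sub_self, zero_mul, add_zero] using this
    · simp only [hW]
      rw [rho_eq_of_norm_eq hxy, h4 x y (by simp) hxy]
    · refine (abs_rho_mul_le_exp _ x).trans (mul_le_mul_of_nonneg_right ?_ (exp_pos _).le)
      have := norm_add_le zu (Z β 0 - zu)
      rw [add_sub_cancel] at this
      linarith
  have hnear : ∀ᶠ β in 𝓝 α, |β - α| ≤ a₁ := by
    filter_upwards [Metric.closedBall_mem_nhds α ha₁] with β hβ
    rwa [mem_closedBall, Real.dist_eq] at hβ
  have hcoup := tendsto_coupling (U := W) hN hF hF0 hα hm (C := ‖zu‖ + r) (by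
    filter_upwards [hnear, eventually_gt_nhds hα] with β h2 h3 using hWsol β h3 h2)
    (fun x => by
      have h2 := (hZ α 0 (by simpa using ha₁.le) (by simpa using hs₀.le)).2.2.2.2.2
      have h3 : Tendsto (fun γ => Z γ 0) (𝓝 α) (𝓝 (Z α 0)) :=
        (h2.continuousAt (Metric.closedBall_mem_nhds α ha₁))
      exact (((continuous_eval_const (F := 𝔼 →ᵇ ℝ) x).tendsto _).comp h3).const_mul _) e
  rw [hWα] at hcoup
  obtain ⟨A, hA, hmd⟩ := exists_md_rho_bound e (i + 1)
  set κ : ℝ → ℝ := fun β => ((i + 1 : ℕ):ℝ) * ((i + 1 : ℕ) + N - 2) -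
    (N - 1 + β / 2) * (1 + β / 2) with hκ
  have hκα : κ α = 0 := by simp only [hκ, hαdef]; push_cast; ring
  have hκc : Continuous κ := by fun_prop
  have hpos := mul_pos (sqH_pos hN2 e (i + 1)) (H.integral_qq_Phi_pos (e := e) hN hF hF0 hα hm hx₀ hUx₀)
  have hev1 := ((hcoup.1.const_mul (sqH e (i + 1))).add (hκc.tendsto α)).eventually_const_lt
    (show (0:ℝ) < _ by rwa [hκα, add_zero])
  have hev2 := (hcoup.2.const_mul (A * K)).eventually_le_const
    (show A * K * 0 < 1 / 4 by norm_num)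
  obtain ⟨b, hb, hball⟩ := Metric.eventually_nhds_iff.1 (hev1.and (hev2.and
    (hnear.and (eventually_gt_nhds hα))))
  set d := min (a / 2) (b / 2) with hd
  have hd0 : 0 < d := by positivity
  have hda : d < a := lt_of_le_of_lt (min_le_left _ _) (by linarith)
  have hdb : d < b := lt_of_le_of_lt (min_le_right _ _) (by linarith)
  have hin : ∀ β, |β - α| ≤ d → _ := fun β hβ => hball (y := β) (by
    rw [Real.dist_eq]; linarith)
  have hsign : ∀ β, |β - α| ≤ d → κ β ≠ 0 → ∃ s₁ > 0, ∀ s, 0 < s → s ≤ s₁ → s ≤ s₀ →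
      0 < κ β * (s - ell (Z β s - zu)) := fun β hβ hne => by
    obtain ⟨h2, h3, h4, h5⟩ := hin β hβ
    obtain ⟨s₁, hs₁, h6⟩ := (hWsol β h5 h4).exists_forcing_sign H hN hF hF0 hα h5 hm hA hK
      (fun x => rfl) hzf hell hmd rfl hne h2 h3
    refine ⟨s₁, hs₁, fun s hs hs2 hs3 => ?_⟩
    obtain ⟨-, -, h7, -, h8, -⟩ := hZ β s h4 (by rwa [abs_of_pos hs])
    rw [abs_of_pos hs] at h8
    refine h6 s hs hs2 (Z β s) _ h8 ?_ (hPP h5 s _ h7)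
    have h9 := hell0 β h4
    rw [map_sub] at h9 ⊢
    rw [map_sub]; linarith
  have hm1 : |α - d - α| ≤ d := by rw [show α - d - α = -d by ring, abs_neg, abs_of_pos hd0]
  have hp1 : |α + d - α| ≤ d := by rw [add_sub_cancel_left, abs_of_pos hd0]
  have hκm : 0 < κ (α - d) := by
    have h2 := (hin _ hm1).2.2.2
    have h3 : κ (α - d) = κ α + d / 2 * (N + α - d / 2) := by simp only [hκ]; ring
    rw [h3, hκα, zero_add]
    exact mul_pos (by positivity) (by linarith)
  have hκp : κ (α + d) < 0 := by
    have h3 : κ (α + d) = κ α - d / 2 * (N + α + d / 2) := by simp only [hκ]; ring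
    rw [h3, hκα, zero_sub, neg_lt_zero]
    positivity
  obtain ⟨s₁, hs₁, hsm⟩ := hsign _ hm1 hκm.ne'
  obtain ⟨s₂, hs₂, hsp⟩ := hsign _ hp1 hκp.ne
  obtain ⟨s, hs, hle⟩ : ∃ s > 0, s ≤ min s₀ (min s₁ s₂) :=
    ⟨_, lt_min hs₀ (lt_min hs₁ hs₂), le_rfl⟩
  obtain ⟨hle0, hle1, hle2⟩ := (le_min_iff.1 hle).imp_right le_min_iff.1
  have hm2 := (pos_iff_pos_of_mul_pos (hsm s hs hle1 hle0)).1 hκm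
  have hp2 := (neg_iff_neg_of_mul_pos (hsp s hs hle2 hle0)).1 hκp
  have hIcc : ∀ β ∈ Icc (α - d) (α + d), |β - α| ≤ d := fun β hβ =>
    abs_le.2 ⟨by linarith [hβ.1], by linarith [hβ.2]⟩
  have hcont : ContinuousOn (fun β => s - ell (Z β s - zu)) (Icc (α - d) (α + d)) := fun β hβ => by
    have h2 := (hZ β s (hin β (hIcc β hβ)).2.2.1 (by rwa [abs_of_pos hs])).2.2.2.2.2
    have h3 : ContinuousWithinAt (fun γ => Z γ s) (Icc (α - d) (α + d)) β :=
      h2.mono fun γ hγ => by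
        rw [mem_closedBall, Real.dist_eq]; exact (hin γ (hIcc γ hγ)).2.2.1
    exact continuousWithinAt_const.sub (ell.continuous.continuousAt.comp_continuousWithinAt
      (h3.sub continuousWithinAt_const))
  obtain ⟨β, hβ, h2⟩ := intermediate_value_Icc' (by linarith) hcont
    (show (0:ℝ) ∈ Icc _ _ from ⟨hp2.le, hm2.le⟩)
  obtain ⟨-, -, hβ1, hβ0⟩ := hin β (hIcc β hβ)
  obtain ⟨h3, h4, h5, -⟩ := hZ β s hβ1 (by rwa [abs_of_pos hs])
  refine ⟨β, (hIcc β hβ).trans_lt hda, hβ0, Z β s, h3, h4, fun h6 => ?_, ?_⟩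
  · have := hrad _ (Submodule.sub_mem _ h6 hzu)
    simp only [this] at h2
    linarith
  · have := hPP hβ0 s _ h5
    simp only at h2
    rw [h2] at this
    simpa only [zero_mul, add_zero] using this

lemma contDiff_gauss (A : ℝ) : ContDiff ℝ 2 fun y : 𝔼 => exp (A * ‖y‖ ^ 2) :=
  contDiff_exp.comp (contDiff_const.mul (contDiff_normSq.of_le le_top))

lemma lap_gauss (A : ℝ) (x : 𝔼) : lap (fun y : 𝔼 => exp (A * ‖y‖ ^ 2)) x =
    (4 * A ^ 2 * ‖x‖ ^ 2 + 2 * N * A) * exp (A * ‖x‖ ^ 2) := by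
  have h : ∀ c s : ℝ, HasDerivAt (fun s => c * exp (A * s)) (c * A * exp (A * s)) s :=
    fun c s => ((((hasDerivAt_id s).const_mul A).exp).const_mul c).congr_deriv (by simp; ring)
  have h1 : deriv (fun s => exp (A * s)) = fun s => A * exp (A * s) := by
    funext s; simpa using (h 1 s).deriv
  rw [lap_comp_normSq (g := fun s => exp (A * s)) (by fun_prop), h1, (h A _).deriv]
  ring

/-- Comparison with a strict subsolution on a ball. -/
lemma LSol.ge_sub_ball {h ψ : 𝔼 → ℝ} {R : ℝ} (H : LSol v h) (hψ : ContDiff ℝ 2 ψ)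
    (hb : ∀ x, ‖x‖ = R → ψ x ≤ v x) (hs : ∀ x, ‖x‖ < R → v x < ψ x → -lap ψ x < h x) {x : 𝔼}
    (hx : ‖x‖ ≤ R) : ψ x ≤ v x := by
  by_contra! hcon
  obtain ⟨y, hy, hmin⟩ := (isCompact_closedBall (0:𝔼) R).exists_isMinOn ⟨x, by simpa using hx⟩
    (H.continuous.sub hψ.continuous).continuousOn
  have h1 : v y - ψ y ≤ v x - ψ x := hmin (by simpa using hx)
  have hy2 : ‖y‖ < R := lt_of_le_of_ne (by simpa using hy) fun h => by
    linarith [hb y h]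
  refine (hs y hy2 (by linarith)).not_ge (H.ge_of_isMin hψ ?_)
  filter_upwards [(isOpen_lt continuous_norm continuous_const).mem_nhds hy2] with z hz
  exact hmin (by simpa using le_of_lt hz)

/-- A radial solution that is positive away from the origin is positive at the origin. -/
lemma RadSol.pos_zero (H : RadSol F α C U) (hN : 1 ≤ N) (hF : ContDiff ℝ 1 F) (hF0 : F 0 = 0)
    (hα : 0 ≤ α) (hU : ∀ x, 0 ≤ U x) {μ : ℝ} (hμ : 0 < μ) (h1 : ∀ x, ‖x‖ = 1 → U x = μ) :
    0 < U 0 := by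
  obtain ⟨L, hL0, hL⟩ := exists_deriv_bound hF C
  have hNr : (1:ℝ) ≤ N := by exact_mod_cast hN
  have hUC : ∀ x, |U x| ≤ C := fun x => (H.le x).trans
    (mul_le_of_le_one_right H.C_nonneg (by rw [exp_le_one_iff]; linarith [norm_nonneg x]))
  set M := μ * exp (-L) with hM
  have hM0 : 0 < M := by positivity
  have := H.sol.ge_sub_ball (ψ := fun x => M * exp (L * ‖x‖ ^ 2)) (R := 1) (x := 0)
    (contDiff_const.mul (contDiff_gauss L)) (fun x hx => ?_) (fun x hx hlt => ?_) (by simp)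
  · exact lt_of_lt_of_le (by positivity) this
  · rw [h1 x hx, hM, hx, mul_assoc, ← exp_add]; simp
  · rw [lap_const_mul _ (contDiff_gauss L).contDiffAt, lap_gauss]
    have h2 := abs_le_mul_of_deriv_bound hF hF0 (s := U x) fun t ht => hL t (ht.trans (hUC x))
    rw [abs_of_nonneg (hU x)] at h2
    have h3 : ‖x‖ ^ α ≤ 1 := rpow_le_one (norm_nonneg x) hx.le hα
    have h4 : |‖x‖ ^ α * F (U x)| ≤ L * U x := by
      rw [abs_mul, abs_of_nonneg (rpow_nonneg (norm_nonneg x) _)]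
      exact (mul_le_of_le_one_left (abs_nonneg _) h3).trans h2
    have h5 := (abs_le.1 h4).1
    have h6 : L ≤ 4 * L ^ 2 * ‖x‖ ^ 2 + 2 * N * L := by nlinarith [sq_nonneg (L * ‖x‖)]
    have h7 := mul_le_mul_of_nonneg_right h6
      (show 0 ≤ M * exp (L * ‖x‖ ^ 2) by positivity)
    have h8 := mul_lt_mul_of_pos_left hlt hL0
    linarith

/-- A decaying solution that is positive on a ball and small outside of it is positive. -/
lemma LSol.pos (H : LSol v fun x => ‖x‖ ^ β * F (v x)) (hN : 1 ≤ N) (hβ : 0 ≤ β) (hm : 0 < m)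
    {δ μ R : ℝ} (hFδ : ∀ s, |s| ≤ δ → |F s + m * s| ≤ m / 2 * |s|) (hR : 0 < R) (hμ : 0 < μ)
    (hin : ∀ x, ‖x‖ ≤ R → μ ≤ v x) (hout : ∀ x, R < ‖x‖ → |v x| ≤ δ)
    (hlim : Tendsto v (cocompact 𝔼) (𝓝 0)) (x : 𝔼) : 0 < v x := by
  have hNr : (1:ℝ) ≤ N := by exact_mod_cast hN
  have hnn : ∀ x, 0 ≤ v x := by
    by_contra! hcon
    obtain ⟨x, hx⟩ := hcon
    obtain ⟨y, hy⟩ := H.continuous.exists_forall_le' x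
      ((hlim.eventually_const_lt hx).mono fun z hz => hz.le)
    have hy0 := (hy x).trans_lt hx
    have hyR : R < ‖y‖ := by
      by_contra! h
      linarith [hin y h]
    have h1 := H.ge_of_isMin (ψ := fun _ => 0) contDiff_const (x₀ := y)
      (Eventually.of_forall fun z => by simpa using hy z)
    rw [lap_const] at h1
    have h2 := (abs_le.1 (hFδ _ (hout y hyR))).1
    rw [abs_of_neg hy0] at h2
    have h3 : 0 < F (v y) := by nlinarith
    have h4 := mul_pos (rpow_pos_of_pos (hR.trans hyR) β) h3
    linarith
  rcases le_or_gt ‖x‖ R with hx | hx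
  · exact hμ.trans_le (hin x hx)
  set S := ‖x‖ + 1 with hS
  have hS0 : 0 < S := by positivity
  set c := S ^ β * (2 * m) with hc
  have hc0 : 0 < c := by positivity
  set A := N / R ^ 2 + c with hA
  have hA0 : 0 < A := by positivity
  have hAR : N ≤ A * R ^ 2 := by rw [hA, add_mul, div_mul_cancel₀ _ (by positivity)]; nlinarith
  have hAc : c ≤ A := by rw [hA]; linarith [show 0 ≤ N / R ^ 2 by positivity]
  set B := exp (-A * S ^ 2) with hB
  have hlow := H.ge_sub_ball (ψ := fun y => μ * (exp (-A * ‖y‖ ^ 2) - B)) (R := S) (x := x)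
    (contDiff_const.mul ((contDiff_gauss _).sub contDiff_const)) (fun y hy => ?_)
    (fun y hy hlt => ?_) (by linarith)
  · refine lt_of_lt_of_le (mul_pos hμ (sub_pos.2 (Real.exp_lt_exp.2 ?_))) hlow
    have : ‖x‖ ^ 2 < S ^ 2 := by nlinarith [norm_nonneg x]
    nlinarith
  · rw [hy, hB, sub_self, mul_zero]; exact hnn y
  · rw [lap_const_mul _ ((contDiff_gauss _).sub contDiff_const).contDiffAt,
      lap_sub (contDiff_gauss _).contDiffAt contDiffAt_const, lap_gauss, lap_const, sub_zero]
    set E := exp (-A * ‖y‖ ^ 2) with hE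
    have hE0 : 0 < E := exp_pos _
    have hyR : R < ‖y‖ := by
      by_contra! h
      have h1 := hin y h
      have h2 : E ≤ 1 := exp_le_one_iff.2 (by nlinarith [sq_nonneg ‖y‖])
      have h3 : 0 < B := exp_pos _
      nlinarith
    have h2 := (abs_le.1 (hFδ _ (hout y hyR))).1
    rw [abs_of_nonneg (hnn y)] at h2
    have h3 : -(2 * m * v y) ≤ F (v y) := by nlinarith [mul_nonneg hm.le (hnn y)]
    have h4 : ‖y‖ ^ β ≤ S ^ β := rpow_le_rpow (norm_nonneg y) hy.le hβ
    have h5 : -(c * v y) ≤ ‖y‖ ^ β * F (v y) := by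
      have h6 := mul_le_mul_of_nonneg_left h3 (rpow_nonneg (norm_nonneg y) β)
      have h7 := mul_le_mul_of_nonneg_right h4 (mul_nonneg (mul_nonneg zero_le_two hm.le) (hnn y))
      rw [hc]; linarith
    have h8 : R ^ 2 ≤ ‖y‖ ^ 2 := by gcongr
    have h9 : c ≤ 4 * (-A) ^ 2 * ‖y‖ ^ 2 + 2 * N * -A := by
      have h10 := mul_le_mul_of_nonneg_left h8 (sq_nonneg A)
      have h11 := mul_le_mul_of_nonneg_left hAR hA0.le
      nlinarith
    have h12 := mul_le_mul_of_nonneg_right h9 (show 0 ≤ μ * E by positivity)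
    have h13 := mul_lt_mul_of_pos_left hlt hc0
    have h14 : 0 < c * (μ * B) := mul_pos hc0 (mul_pos hμ (exp_pos _))
    linarith

lemma integrable_exp_neg_norm : Integrable fun x : 𝔼 => exp (-‖x‖) := by
  have h := (integrable_one_add_norm (E := 𝔼) (μ := volume) (r := N + 1) (by simp)).const_mul
    (((N + 1 : ℝ) / 1) ^ (N + 1 : ℝ) * exp 1)
  refine h.mono' (by fun_prop) (Eventually.of_forall fun x => ?_)
  have h1 := rpow_le_exp (r := 1 + ‖x‖) (s := N + 1) (c := 1) (by positivity) (by positivity) one_pos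
  have h2 : 0 < (1 + ‖x‖) ^ (N + 1 : ℝ) := by positivity
  rw [norm_of_nonneg (exp_pos _).le, rpow_neg (by positivity), ← div_eq_mul_inv,
    le_div_iff₀ h2]
  refine (mul_le_mul_of_nonneg_left h1 (exp_pos _).le).trans_eq ?_
  rw [one_mul, exp_add, Real.exp_neg]
  field_simp

/-- Closeness of solutions implies closeness of their gradients. -/
lemma RadSol.exists_grad_close (H : RadSol F α C U) (hF : ContDiff ℝ 1 F) (hF0 : F 0 = 0)
    (hα : 2 ≤ α) : ∃ Q ≥ (0:ℝ), ∀ β v r, |β - α| ≤ 1 → 0 ≤ r → r ≤ 1 →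
      LSol v (fun x => ‖x‖ ^ β * F (v x)) → (∀ x, |v x - U x| ≤ r * exp (-‖x‖)) →
      √(∫ x, ‖fderiv ℝ v x - fderiv ℝ U x‖ ^ 2) ≤ Q * (r + |β - α|) := by
  obtain ⟨L, hL0, hL⟩ := exists_deriv_bound hF (C + 1)
  obtain ⟨K, hK, hexp⟩ := exists_rpow_mul_exp_bound (show 0 < 2 * α + 1 by linarith)
  have hC := H.C_nonneg
  set P := 1 + L * (1 + C) * (2 + K) with hP
  have hP0 : 0 < P := by positivity
  refine ⟨(N + 1) * exp (1 / 2) * P * √(∫ x : 𝔼, exp (-‖x‖)), by positivity,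
    fun β v r hβ hr0 hr1 hv hvU => ?_⟩
  obtain ⟨hβ1, hβ2⟩ := abs_le.1 hβ
  set t := r + |β - α| with ht
  have ht0 : 0 ≤ t := by positivity
  have hUC : ∀ x, |U x| ≤ C := fun x => (H.le x).trans
    (mul_le_of_le_one_right hC (by rw [exp_le_one_iff]; linarith [norm_nonneg x]))
  have he1 : ∀ x : 𝔼, exp (-‖x‖) ≤ 1 := fun x => by
    rw [exp_le_one_iff]; linarith [norm_nonneg x]
  have hvC : ∀ x, |v x| ≤ C + 1 := fun x => by
    have h1 := abs_add_le (U x) (v x - U x)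
    rw [add_sub_cancel] at h1
    have h2 := mul_le_mul hr1 (he1 x) (exp_pos _).le zero_le_one
    linarith [hUC x, hvU x]
  have hrhs : ∀ x, |‖x‖ ^ β * F (v x) - ‖x‖ ^ α * F (U x)| ≤ P * t * exp (-(‖x‖ / 2)) :=
    fun x => by
    have hp : ∀ y, 0 ≤ y → y ≤ 2 * α + 1 → ‖x‖ ^ y ≤ 1 + ‖x‖ ^ (2 * α + 1) := fun y h0 hy => by
      rcases (norm_nonneg x).eq_or_lt with h | h
      · rw [← h]
        linarith [Real.zero_rpow_le_one y, rpow_nonneg (le_refl (0:ℝ)) (2 * α + 1)]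
      · exact rpow_le_one_add_of_le h h0 hy
    have h1 : |F (v x) - F (U x)| ≤ L * (r * exp (-‖x‖)) := by
      have := abs_sub_sub_le hF (a := v x) (b := U x) (c := 0) (L := L) fun s hs => by
        rw [sub_zero]
        have h3 := abs_le.1 (hvC x)
        have h4 := abs_le.1 (hUC x)
        refine hL s (abs_le.2 ?_)
        rcases mem_uIcc.1 hs with h5 | h5 <;> constructor <;> linarith [h5.1, h5.2]
      rw [zero_mul, sub_zero] at this
      exact this.trans (mul_le_mul_of_nonneg_left (hvU x) hL0.le)
    have h2 : |F (U x)| ≤ L * (C * exp (-‖x‖)) :=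
      (abs_le_mul_of_deriv_bound hF hF0 fun s hs => hL s (by linarith [hUC x])).trans
        (mul_le_mul_of_nonneg_left (H.le x) hL0.le)
    have h3 : |‖x‖ ^ β - ‖x‖ ^ α| ≤ |β - α| * (2 + ‖x‖ ^ (2 * α + 1)) := by
      have h4 := abs_rpow_sub_le (norm_nonneg x) one_pos (show 1 ≤ β by linarith)
        (show 1 ≤ α by linarith)
      rw [← Real.rpow_add_of_nonneg (norm_nonneg x) (by linarith) (by linarith), div_one] at h4
      refine h4.trans (mul_le_mul_of_nonneg_left ?_ (abs_nonneg _))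
      linarith [hp (β + α) (by linarith) (by linarith)]
    have h5 : ‖x‖ ^ β ≤ 2 + ‖x‖ ^ (2 * α + 1) := by
      linarith [hp β (by linarith) (by linarith)]
    have h6 : (2 + ‖x‖ ^ (2 * α + 1)) * exp (-‖x‖) ≤ (2 + K) * exp (-(‖x‖ / 2)) := by
      have := hexp _ (norm_nonneg x)
      linarith [exp_neg_le_half (norm_nonneg x)]
    have h7 : 0 ≤ ‖x‖ ^ β := rpow_nonneg (norm_nonneg x) _
    have h8 : 0 ≤ ‖x‖ ^ (2 * α + 1) := rpow_nonneg (norm_nonneg x) _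
    calc |‖x‖ ^ β * F (v x) - ‖x‖ ^ α * F (U x)|
        = |‖x‖ ^ β * (F (v x) - F (U x)) + (‖x‖ ^ β - ‖x‖ ^ α) * F (U x)| := by ring_nf
      _ ≤ ‖x‖ ^ β * |F (v x) - F (U x)| + |‖x‖ ^ β - ‖x‖ ^ α| * |F (U x)| := by
        rw [← abs_of_nonneg h7, ← abs_mul, abs_of_nonneg h7, ← abs_mul]; exact abs_add_le _ _
      _ ≤ (2 + ‖x‖ ^ (2 * α + 1)) * (L * (r * exp (-‖x‖))) +
          |β - α| * (2 + ‖x‖ ^ (2 * α + 1)) * (L * (C * exp (-‖x‖))) := by gcongr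
      _ = L * (r + |β - α| * C) * ((2 + ‖x‖ ^ (2 * α + 1)) * exp (-‖x‖)) := by ring
      _ ≤ L * (t * (1 + C)) * ((2 + K) * exp (-(‖x‖ / 2))) := by
        refine mul_le_mul (mul_le_mul_of_nonneg_left ?_ hL0.le) h6 (by positivity) (by positivity)
        rw [ht]; nlinarith [abs_nonneg (β - α)]
      _ = (P - 1) * t * exp (-(‖x‖ / 2)) := by rw [hP]; ring
      _ ≤ _ := by gcongr; linarith
  have hd : ∀ x, |v x - U x| ≤ P * t * exp (-(‖x‖ / 2)) := fun x =>
    (hvU x).trans (mul_le_mul (by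
      have h1 : r ≤ t := by linarith [abs_nonneg (β - α)]
      have h2 : 1 ≤ P := by rw [hP]; linarith [show 0 ≤ L * (1 + C) * (2 + K) by positivity]
      nlinarith) (exp_neg_le_half (norm_nonneg x)) (exp_pos _).le (by positivity))
  have hgrad := (hv.sub H.sol).norm_fderiv_le_exp hd hrhs
  have hsq : ∀ x, ‖fderiv ℝ v x - fderiv ℝ U x‖ ^ 2 ≤
      ((N + 1) * exp (1 / 2) * (P * t)) ^ 2 * exp (-‖x‖) := fun x => by
    have h1 := hgrad x
    rw [fderiv_fun_sub (hv.contDiff_one.differentiable one_ne_zero x)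
      (H.sol.contDiff_one.differentiable one_ne_zero x)] at h1
    refine (pow_le_pow_left₀ (norm_nonneg _) h1 2).trans_eq ?_
    rw [mul_pow, ← Real.exp_nat_mul]
    congr 2; push_cast; ring
  have hint : ∫ x, ‖fderiv ℝ v x - fderiv ℝ U x‖ ^ 2 ≤
      ((N + 1) * exp (1 / 2) * (P * t)) ^ 2 * ∫ x : 𝔼, exp (-‖x‖) := by
    rw [← integral_const_mul]
    exact integral_mono_of_nonneg (Eventually.of_forall fun x => sq_nonneg _)
      (integrable_exp_neg_norm.const_mul _) (Eventually.of_forall hsq)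
  refine (Real.sqrt_le_sqrt hint).trans_eq ?_
  rw [Real.sqrt_mul (sq_nonneg _), sqrt_sq (by positivity)]
  ring

lemma exists_norm_bound_of_tendsto {U : 𝔼 → ℝ} (h : Tendsto U (cocompact 𝔼) (𝓝 0)) {δ : ℝ}
    (hδ : 0 < δ) : ∃ R > 0, ∀ x, R < ‖x‖ → |U x| ≤ δ := by
  have h1 : ∀ᶠ x in cocompact 𝔼, |U x| ≤ δ := by
    have := h.abs
    rw [abs_zero] at this
    exact this.eventually_le_const hδ
  rw [← Metric.cobounded_eq_cocompact, ← comap_norm_atTop] at h1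
  obtain ⟨R, hR⟩ := (eventually_comap.1 h1).exists_forall_of_atTop
  exact ⟨max R 1, by positivity, fun x hx => hR _ ((le_max_left _ _).trans hx.le) x rfl⟩

/-- Nonradial solutions accumulate at the radial solution `U` for the exponent `2 * i`. -/
lemma exists_nonradial_near (hN : 3 ≤ N) {m : ℝ} (hm : 0 < m) {F : ℝ → ℝ} (hF : ContDiff ℝ 1 F)
    (hF0 : F 0 = 0) (hF1 : deriv F 0 = -m) {V : ℝ → ℝ} {i : ℕ} (hi : 0 < i)
    (hVc : ContinuousOn V (Ici 0)) (hV : ContDiffOn ℝ 2 V (Ioi 0)) (hpos : ∀ t > (0:ℝ), 0 < V t)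
    (hode : ∀ t > (0:ℝ), -(deriv (deriv V) t) - kk N (2 * i) / t * deriv V t = F (V t))
    (hV0 : Tendsto (deriv V) (𝓝[>] 0) (𝓝 0)) (hVt : Tendsto V atTop (𝓝 0))
    (hnd : RadNondeg (kk N (2 * i)) fun t => deriv F (V t))
    (hmi : MorseIndexOne (kk N (2 * i)) fun t => deriv F (V t)) (e : Fin N) {U : 𝔼 → ℝ}
    (hU : ∀ x, U x = V (‖x‖ ^ (1 + i : ℝ) / (1 + i))) {ε : ℝ} (hε : 0 < ε) :
    ∃ α : ℝ, |α - 2 * i| < ε ∧ ∃ v : 𝔼 → ℝ, (∀ x, 0 < v x) ∧ ContDiff ℝ 2 v ∧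
      (∀ x, -lap v x = ‖x‖ ^ α * F (v x)) ∧ Tendsto v (cocompact 𝔼) (𝓝 0) ∧
      (∀ x y, x e = y e → ‖x‖ = ‖y‖ → v x = v y) ∧ (∃ x y, ‖x‖ = ‖y‖ ∧ v x ≠ v y) ∧
      √(∫ x, ‖fderiv ℝ v x - fderiv ℝ U x‖ ^ 2) < ε ∧
      ∀ x, exp ‖x‖ * |v x - U x| < ε := by
  have hN1 : 1 ≤ N := by omega
  have hir : (1:ℝ) ≤ i := by exact_mod_cast hi
  obtain ⟨C, zu, zf, ell, H, hzu, hzuS, hzfS, hzf0, hzf, hell, hker⟩ :=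
    exists_setup hN hi hm hF hF0 hF1 hVc hV hpos hode hV0 hVt hnd hmi e hU
  have hUpos : ∀ x, 0 < U x := fun x => by
    rcases eq_or_ne x 0 with rfl | hx
    · refine H.pos_zero hN1 hF hF0 (by positivity) (nonneg_of_profile hVc hpos hU)
        (hpos (1 / (1 + i)) (by positivity)) fun x hx => ?_
      rw [hU, hx, one_rpow]
    · have := norm_pos_iff.2 hx
      rw [hU]
      exact hpos _ (by positivity)
  have hx₀ : (single e 1 : 𝔼) ≠ 0 := by
    rw [← norm_ne_zero_iff, PiLp.norm_single]; simp
  obtain ⟨δ, hδ, hFδ⟩ := exists_remainder_bound hF 0 (half_pos hm)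
  have hFδ' : ∀ s, |s| ≤ δ → |F s + m * s| ≤ m / 2 * |s| := fun s hs => by
    simpa [hF0, hF1] using hFδ s 0 (by simp) (by simpa using hs)
  obtain ⟨R, hR, hUR⟩ := exists_norm_bound_of_tendsto (tendsto_of_profile hVt hU) (half_pos hδ)
  obtain ⟨x₁, -, hmin⟩ := (isCompact_closedBall (0:𝔼) R).exists_isMinOn
    ⟨0, by simpa using hR.le⟩ H.continuous.continuousOn
  obtain ⟨Q, hQ, hgrad⟩ := H.exists_grad_close hF hF0 (by linarith)
  have hμ := half_pos (hUpos x₁)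
  set μ := U x₁ / 2 with hμdef
  set t := ε / (4 * (Q + 1)) with ht
  have ht0 : 0 < t := by positivity
  set r := min (min μ (δ / 2)) (min (min 1 (ε / 2)) t) with hrdef
  set a := min (min ε 1) t with hadef
  have hr0 : 0 < r := by positivity
  have hrμ : r ≤ μ := (min_le_left _ _).trans (min_le_left _ _)
  have hrδ : r ≤ δ / 2 := (min_le_left _ _).trans (min_le_right _ _)
  have hr1 : r ≤ 1 := (min_le_right _ _).trans ((min_le_left _ _).trans (min_le_left _ _))
  have hrε : r ≤ ε / 2 := (min_le_right _ _).trans ((min_le_left _ _).trans (min_le_right _ _))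
  have hrt : r ≤ t := (min_le_right _ _).trans (min_le_right _ _)
  obtain ⟨β, hβ, -, z, hz, hzr, hzn, hL⟩ := exists_bifurcation hN hi hm hF hF0 hF1 H hzu hzuS hzfS
    hzf0 hzf hell hker hx₀ (hUpos _).ne' hr0 (a := a) (by positivity)
  have hβε : |β - 2 * i| < ε := hβ.trans_le ((min_le_left _ _).trans (min_le_left _ _))
  have hβ1 : |β - 2 * i| < 1 := hβ.trans_le ((min_le_left _ _).trans (min_le_right _ _))
  have hβt : |β - 2 * i| < t := hβ.trans_le (min_le_right _ _)
  have hβ2 : 1 < β := by linarith [(abs_lt.1 hβ1).1]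
  set v : 𝔼 → ℝ := fun x => rho 1 x * z x with hv
  have hd : ∀ x, |v x - U x| ≤ r * exp (-‖x‖) := fun x => by
    have h1 := abs_rho_mul_le_exp (z - zu) x
    rw [BoundedContinuousFunction.sub_apply, mul_sub, ← hzu] at h1
    exact h1.trans (mul_le_mul_of_nonneg_right hzr (exp_pos _).le)
  have hd' : ∀ x, |v x - U x| ≤ r := fun x => (hd x).trans
    (mul_le_of_le_one_right hr0.le (by rw [exp_le_one_iff]; linarith [norm_nonneg x]))
  have hC2 : ContDiff ℝ 2 v := hL.contDiff_two
    ((contDiff_norm_rpow hβ2).mul (hF.comp hL.contDiff_one))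
  refine ⟨β, hβε, v, fun x => ?_, hC2, fun x => hL.lap_eq hC2 x, tendsto_rho_mul z,
    fun x y h1 h2 => ?_, ?_, ?_, fun x => ?_⟩
  · refine hL.pos hN1 (by linarith) hm hFδ' hR hμ (fun x hx => ?_) (fun x hx => ?_)
      (tendsto_rho_mul z) x
    · have h1 : U x₁ ≤ U x := hmin (by simpa using hx)
      linarith [(abs_le.1 (hd' x)).1]
    · have h1 := abs_add_le (U x) (v x - U x)
      rw [add_sub_cancel] at h1
      linarith [hUR x hx, hd' x]
  · simp only [hv]
    rw [hz x y (by simpa [inner_single] using h1) h2, rho_eq_of_norm_eq h2]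
  · simp only [mem_symm] at hzn
    push Not at hzn
    obtain ⟨x, y, -, h1, h2⟩ := hzn
    refine ⟨x, y, h1, fun h => h2 (mul_left_cancel₀ (rho_pos 1 x).ne' ?_)⟩
    simpa only [hv, rho_eq_of_norm_eq (c := 1) h1] using h
  · have h2 := hgrad β v r hβ1.le hr0.le hr1 hL hd
    have h3 : Q * (r + |β - 2 * i|) ≤ Q * (2 * t) := by gcongr; linarith
    have h4 : (Q + 1) * (4 * t) = ε := by rw [ht]; field_simp
    linarith [mul_nonneg hQ ht0.le]
  · have h1 := mul_le_mul_of_nonneg_left (hd x) (exp_pos ‖x‖).le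
    rw [mul_left_comm, ← exp_add, add_neg_cancel, exp_zero, mul_one] at h1
    linarith

end Henon

theorem stmt15 (N : ℕ) (hN : 3 ≤ N) (m : ℝ) (hm : 0 < m)
    (F : ℝ → ℝ) (hF : ContDiff ℝ 1 F) (hF0 : F 0 = 0) (hF'0 : deriv F 0 = -m)
    (I : Set ℝ) (hIopen : IsOpen I) (hIsub : I ⊆ Ioi 0) (hIconn : I.OrdConnected)
    (V : ℝ → ℝ → ℝ)
    (hsol : ∀ α ∈ I,
      ContinuousOn (V α) (Ici 0) ∧ ContDiffOn ℝ 2 (V α) (Ioi 0) ∧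
      (∀ t > (0:ℝ), 0 < V α t) ∧
      (∀ t > (0:ℝ), -(deriv (deriv (V α)) t) - kk N α / t * deriv (V α) t = F (V α t)) ∧
      Tendsto (deriv (V α)) (𝓝[>] 0) (𝓝 0) ∧ Tendsto (V α) atTop (𝓝 0) ∧
      RadNondeg (kk N α) (fun t => deriv F (V α t)) ∧
      MorseIndexOne (kk N α) (fun t => deriv F (V α t)))
    (i : ℕ) (hi : 0 < i) (hαi : (2 * i : ℝ) ∈ I) :
    ∀ ε > (0:ℝ), ∃ α ∈ I, |α - 2 * i| < ε ∧
      ∃ v : EuclideanSpace ℝ (Fin N) → ℝ,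
        (∀ x, 0 < v x) ∧ Continuous v ∧ ContDiffOn ℝ 2 v {x | x ≠ 0} ∧
        (∀ x : EuclideanSpace ℝ (Fin N), x ≠ 0 → -(lap v x) = ‖x‖ ^ α * F (v x)) ∧
        Tendsto v (comap (fun x => ‖x‖) atTop) (𝓝 0) ∧
        -- v is O(N-1)-invariant: it depends only on the last coordinate and the norm
        (∀ x y : EuclideanSpace ℝ (Fin N),
          x (⟨N - 1, by omega⟩ : Fin N) = y (⟨N - 1, by omega⟩ : Fin N) →
          ‖x‖ = ‖y‖ → v x = v y) ∧
        -- v is nonradial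
        (∃ x y : EuclideanSpace ℝ (Fin N), ‖x‖ = ‖y‖ ∧ v x ≠ v y) ∧
        -- closeness to the radial solution u_{α_i} in the norm of X
        Real.sqrt (∫ x : EuclideanSpace ℝ (Fin N),
            ‖fderiv ℝ v x - fderiv ℝ
              (fun y : EuclideanSpace ℝ (Fin N) =>
                V (2 * i) (2 / (2 + 2 * (i:ℝ)) * ‖y‖ ^ ((2 + 2 * (i:ℝ)) / 2))) x‖ ^ 2) < ε ∧
        ∀ x : EuclideanSpace ℝ (Fin N),
          Real.exp ‖x‖ *
            |v x - V (2 * i) (2 / (2 + 2 * (i:ℝ)) * ‖x‖ ^ ((2 + 2 * (i:ℝ)) / 2))| < ε := by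
  intro ε hε
  obtain ⟨hVc, hV, hpos, hode, hV0, hVt, hnd, hmi⟩ := hsol _ hαi
  obtain ⟨ρ, hρ, hball⟩ := Metric.isOpen_iff.1 hIopen _ hαi
  have hu : (fun y : EuclideanSpace ℝ (Fin N) =>
      V (2 * i) (2 / (2 + 2 * (i:ℝ)) * ‖y‖ ^ ((2 + 2 * (i:ℝ)) / 2))) =
      fun y => V (2 * i) (‖y‖ ^ (1 + i : ℝ) / (1 + i)) := by
    funext y
    rw [show (2 + 2 * (i:ℝ)) / 2 = 1 + i by ring]
    congr 1
    field_simp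
  obtain ⟨α, hα, v, h1, h2, h3, h4, h5, h6, h7, h8⟩ :=
    Henon.exists_nonradial_near hN hm hF hF0 hF'0 hi hVc hV hpos hode hV0 hVt hnd hmi
      ⟨N - 1, by omega⟩ (fun _ => rfl) (lt_min hε hρ)
  refine ⟨α, hball (by simpa [Real.dist_eq] using hα.trans_le (min_le_right _ _)),
    hα.trans_le (min_le_left _ _), v, h1, h2.continuous, h2.contDiffOn, fun x _ => h3 x, ?_,
    h5, h6, ?_, fun x => ?_⟩
  · rwa [show (fun x : EuclideanSpace ℝ (Fin N) => ‖x‖) = norm from rfl, comap_norm_atTop,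
      Metric.cobounded_eq_cocompact]
  · rw [hu]
    exact h7.trans_le (min_le_left _ _)
  · rw [congrFun hu x]
    exact (h8 x).trans_le (min_le_left _ _)
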